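/- (Catlin) Let Ω be a bounded pseudoconvex domain with smooth boundary in ℂ^n, p ∈ Ω, and β₁,…,β_n positive numbers. Assume there exist a function φ ∈ C³(Ω̄) and positive constants M, C̃, C_α such that: (1) |φ(z)| ≤ M for z ∈ Ω; (2) φ is plurisubharmonic in Ω; (3) the polydisc P = P(p,β) = {z ∈ ℂ^n : |z_j − p_j| < β_j, 1 ≤ j ≤ n} is contained in Ω; (4) Σ_{j,k=1}^n ∂²φ(z)/∂z_j∂z̄_k · X_j X̄_k ≥ C̃ Σ_{j=1}^n |X_j|²/β_j² for all z ∈ P and X ∈ ℂ^n; and (5) for every multi-index α with |α| ≤ 3 and every z ∈ P, |D^α φ(z)| ≤ C_α ∏_{j=1}^n β_j^{−α_j}, where D^α denotes any derivative of order α_j in the variables z_j, z̄_j for each j. Then there exists a positive constant C, depending only on M, C̃ and the C_α, such that C^{−1} Σ_{j=1}^n |X_j|²/β_j² ≤ g_Ω(p;X) ≤ C Σ_{j=1}^n |X_j|²/β_j² for all X ∈ ℂ^n. -/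

import Mathlib

open MeasureTheory Complex Topology Filter Set

noncomputable section

/-! ### Wirtinger derivatives and complex Hessians on ℂⁿ -/

/-- The Wirtinger derivative `∂u/∂z_j` of a function `u : ℂⁿ → ℂ` at `z`. -/
def wder (n : ℕ) (j : Fin n) (u : (Fin n → ℂ) → ℂ) (z : Fin n → ℂ) : ℂ :=
  (1 / 2) * (fderiv ℝ u z (Pi.single j 1) - Complex.I * fderiv ℝ u z (Pi.single j Complex.I))

/-- The conjugate Wirtinger derivative `∂u/∂z̄_j` of a function `u : ℂⁿ → ℂ` at `z`. -/
def wderBar (n : ℕ) (j : Fin n) (u : (Fin n → ℂ) → ℂ) (z : Fin n → ℂ) : ℂ :=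
  (1 / 2) * (fderiv ℝ u z (Pi.single j 1) + Complex.I * fderiv ℝ u z (Pi.single j Complex.I))

/-- The complex Hessian `∂²φ/∂z_j∂z̄_k` of a real-valued function `φ` at `z`. -/
def cHess (n : ℕ) (φ : (Fin n → ℂ) → ℝ) (z : Fin n → ℂ) (j k : Fin n) : ℂ :=
  wderBar n k (fun w => wder n j (fun v => (φ v : ℂ)) w) z

/-- The (real part of the) Hermitian form `Σ_{j,k} H_{jk} X_j conj (Y_k)`. -/
def hermForm (n : ℕ) (H : Fin n → Fin n → ℂ) (X Y : Fin n → ℂ) : ℝ :=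
  (∑ j, ∑ k, H j k * X j * starRingEnd ℂ (Y k)).re

/-! ### The Bergman space, Bergman kernel, minimum integrals -/

/-- Membership in the Bergman space `A²(Ω)`: holomorphic and square-integrable on `Ω`. -/
def InBergman (n : ℕ) (Ω : Set (Fin n → ℂ)) (f : (Fin n → ℂ) → ℂ) : Prop :=
  DifferentiableOn ℂ f Ω ∧ IntegrableOn (fun z => ‖f z‖ ^ 2) Ω

/-- The squared `L²(Ω)`-norm `∫_Ω |f|²`. -/
def l2sq (n : ℕ) (Ω : Set (Fin n → ℂ)) (f : (Fin n → ℂ) → ℂ) : ℝ :=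
  ∫ z in Ω, ‖f z‖ ^ 2

/-- The holomorphic directional derivative `Σ_i X_i ∂f/∂z_i(p)`. -/
def holDeriv (n : ℕ) (f : (Fin n → ℂ) → ℂ) (p X : Fin n → ℂ) : ℂ :=
  ∑ i, X i * fderiv ℂ f p (Pi.single i 1)

/-- The second-order holomorphic derivative `Σ_{j,k} X_j Y_k ∂²f/∂z_j∂z_k(p)`. -/
def holDeriv2 (n : ℕ) (f : (Fin n → ℂ) → ℂ) (p X Y : Fin n → ℂ) : ℂ :=
  ∑ j, ∑ k, X j * Y k * fderiv ℂ (fun z => fderiv ℂ f z (Pi.single k 1)) p (Pi.single j 1)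

/-- Bergman's minimum integral `I⁰_Ω(p)`. -/
def I0 (n : ℕ) (Ω : Set (Fin n → ℂ)) (p : Fin n → ℂ) : ℝ :=
  sInf {r | ∃ f, InBergman n Ω f ∧ f p = 1 ∧ r = l2sq n Ω f}

/-- Bergman's minimum integral `I¹_Ω(p; X)`. -/
def I1 (n : ℕ) (Ω : Set (Fin n → ℂ)) (p X : Fin n → ℂ) : ℝ :=
  sInf {r | ∃ f, InBergman n Ω f ∧ f p = 0 ∧ holDeriv n f p X = 1 ∧ r = l2sq n Ω f}

/-- Bergman's minimum integral `I²_Ω(p; X, Y)`. -/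
def I2 (n : ℕ) (Ω : Set (Fin n → ℂ)) (p X Y : Fin n → ℂ) : ℝ :=
  sInf {r | ∃ f, InBergman n Ω f ∧ f p = 0 ∧ fderiv ℂ f p = 0 ∧
    holDeriv2 n f p X Y = 1 ∧ r = l2sq n Ω f}

/-- The Bergman kernel on the diagonal,
`K_Ω(p, p̄) = sup {|f(p)|² : f ∈ A²(Ω), ‖f‖_{L²(Ω)} ≤ 1}`. -/
def bergmanKernel (n : ℕ) (Ω : Set (Fin n → ℂ)) (p : Fin n → ℂ) : ℝ :=
  sSup {r | ∃ f, InBergman n Ω f ∧ l2sq n Ω f ≤ 1 ∧ r = ‖f p‖ ^ 2}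

/-- The components `g_{jk̄}(z) = ∂² log K_Ω(z,z̄)/∂z_j∂z̄_k` of the Bergman metric. -/
def bergMetricMat (n : ℕ) (Ω : Set (Fin n → ℂ)) (z : Fin n → ℂ) (j k : Fin n) : ℂ :=
  cHess n (fun w => Real.log (bergmanKernel n Ω w)) z j k

/-- The Bergman metric `g_Ω(z; X) = Σ_{j,k} g_{jk̄}(z) X_j X̄_k`. -/
def bergMetric (n : ℕ) (Ω : Set (Fin n → ℂ)) (z X : Fin n → ℂ) : ℝ :=
  hermForm n (bergMetricMat n Ω z) X X

/-- The inverse matrix `(g^{νμ̄})` of the Bergman metric. -/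
def bergMetricInv (n : ℕ) (Ω : Set (Fin n → ℂ)) (z : Fin n → ℂ) : Matrix (Fin n) (Fin n) ℂ :=
  (Matrix.of (bergMetricMat n Ω z))⁻¹

/-- The curvature tensor of the Bergman metric,
`R_{h̄jkl̄} = −∂²g_{jh̄}/∂z_k∂z̄_l + g^{νμ̄} (∂g_{jμ̄}/∂z_k)(∂g_{νh̄}/∂z̄_l)`. -/
def bergCurvTensor (n : ℕ) (Ω : Set (Fin n → ℂ)) (z : Fin n → ℂ) (h j k l : Fin n) : ℂ :=
  - wderBar n l (fun w => wder n k (fun v => bergMetricMat n Ω v j h) w) z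
  + ∑ ν, ∑ μ, bergMetricInv n Ω z ν μ *
      wder n k (fun v => bergMetricMat n Ω v j μ) z *
      wderBar n l (fun v => bergMetricMat n Ω v ν h) z

/-- The bisectional curvature of the Bergman metric,
`B_Ω(z;X,Y) = R_{h̄jkl̄} X̄_h X_j Y_k Ȳ_l / (g(z;X) g(z;Y))`. -/
def bisecCurv (n : ℕ) (Ω : Set (Fin n → ℂ)) (z X Y : Fin n → ℂ) : ℝ :=
  (∑ h, ∑ j, ∑ k, ∑ l, bergCurvTensor n Ω z h j k l *
      starRingEnd ℂ (X h) * X j * Y k * starRingEnd ℂ (Y l)).re /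
    (bergMetric n Ω z X * bergMetric n Ω z Y)

/-- The holomorphic sectional curvature `H_Ω(z;X) = B_Ω(z;X,X)`. -/
def holSecCurv (n : ℕ) (Ω : Set (Fin n → ℂ)) (z X : Fin n → ℂ) : ℝ := bisecCurv n Ω z X X

/-- The Ricci curvature `Ric_Ω(z;X) = Σ_j B_Ω(z;E^j,X)` (standard basis). -/
def ricciCurv (n : ℕ) (Ω : Set (Fin n → ℂ)) (z X : Fin n → ℂ) : ℝ :=
  ∑ j, bisecCurv n Ω z (Pi.single j 1) X

/-! ### Plurisubharmonicity and pseudoconvexity -/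

/-- `u` is plurisubharmonic on `Ω`: upper semicontinuous and satisfying the sub-mean value
inequality on circles in complex lines contained in `Ω`. -/
def PSHOn (n : ℕ) (u : (Fin n → ℂ) → ℝ) (Ω : Set (Fin n → ℂ)) : Prop :=
  UpperSemicontinuousOn u Ω ∧
  ∀ z ∈ Ω, ∀ w : Fin n → ℂ, ∀ r : ℝ, 0 < r →
    (∀ t : ℂ, ‖t‖ ≤ r → z + t • w ∈ Ω) →
    u z ≤ (1 / (2 * Real.pi)) *
      ∫ θ in (0:ℝ)..(2 * Real.pi), u (z + ((r : ℂ) * Complex.exp ((θ : ℂ) * Complex.I)) • w)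

/-- A `C²` function `φ` is plurisubharmonic on `Ω` iff its complex Hessian is
positive semidefinite at every point of `Ω`. -/
def PSHOnC2 (n : ℕ) (φ : (Fin n → ℂ) → ℝ) (Ω : Set (Fin n → ℂ)) : Prop :=
  ∀ z ∈ Ω, ∀ X : Fin n → ℂ, 0 ≤ hermForm n (cHess n φ z) X X

/-- `Ω` is pseudoconvex: it admits a continuous plurisubharmonic exhaustion function. -/
def PseudoconvexExh (n : ℕ) (Ω : Set (Fin n → ℂ)) : Prop :=
  ∃ u : (Fin n → ℂ) → ℝ, ContinuousOn u Ω ∧ PSHOn n u Ω ∧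
    ∀ c : ℝ, ∃ K : Set (Fin n → ℂ), IsCompact K ∧ K ⊆ Ω ∧ {z ∈ Ω | u z ≤ c} ⊆ K

/-! ### Smooth boundary, Levi form, Levi rank -/

/-- `ρ` is a (global) smooth defining function for the domain `Ω`. -/
def IsDefining (n : ℕ) (Ω : Set (Fin n → ℂ)) (ρ : (Fin n → ℂ) → ℝ) : Prop :=
  ContDiff ℝ (⊤ : ℕ∞) ρ ∧ (∀ z ∈ Ω, ρ z < 0) ∧ (∀ z ∈ frontier Ω, ρ z = 0) ∧
    ∀ z ∈ frontier Ω, fderiv ℝ ρ z ≠ 0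

/-- The coefficient `∂ρ/∂z_j(q)` of `∂ρ` (for a real-valued `ρ`). -/
def dzCoef (n : ℕ) (ρ : (Fin n → ℂ) → ℝ) (q : Fin n → ℂ) (j : Fin n) : ℂ :=
  wder n j (fun v => (ρ v : ℂ)) q

/-- The ℂ-linear map `X ↦ Σ_j ∂ρ/∂z_j(q) X_j`. -/
def cTangentMap (n : ℕ) (ρ : (Fin n → ℂ) → ℝ) (q : Fin n → ℂ) : (Fin n → ℂ) →ₗ[ℂ] ℂ :=
  ∑ j, dzCoef n ρ q j • (LinearMap.proj j : (Fin n → ℂ) →ₗ[ℂ] ℂ)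

/-- The complex tangent space `T^{1,0}_q(∂Ω) = {X : Σ_j ∂ρ/∂z_j(q) X_j = 0}`. -/
def cTangent (n : ℕ) (ρ : (Fin n → ℂ) → ℝ) (q : Fin n → ℂ) : Submodule ℂ (Fin n → ℂ) :=
  LinearMap.ker (cTangentMap n ρ q)

/-- The Levi form of `ρ` at `q` is positive semidefinite on the complex tangent space. -/
def LeviPSDAt (n : ℕ) (ρ : (Fin n → ℂ) → ℝ) (q : Fin n → ℂ) : Prop :=
  ∀ X ∈ cTangent n ρ q, 0 ≤ hermForm n (cHess n ρ q) X X

/-- The ℂ-linear map `X ↦ Σ_{j,k} ρ_{jk̄}(q) X_j conj (Y_k)` (Levi pairing against `Y`). -/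
def leviPairMap (n : ℕ) (ρ : (Fin n → ℂ) → ℝ) (q Y : Fin n → ℂ) : (Fin n → ℂ) →ₗ[ℂ] ℂ :=
  ∑ j, (∑ k, cHess n ρ q j k * starRingEnd ℂ (Y k)) • (LinearMap.proj j : (Fin n → ℂ) →ₗ[ℂ] ℂ)

/-- The kernel of the Levi form of `ρ` at `q`, as a Hermitian form on `T^{1,0}_q(∂Ω)`. -/
def leviKernel (n : ℕ) (ρ : (Fin n → ℂ) → ℝ) (q : Fin n → ℂ) : Submodule ℂ (Fin n → ℂ) :=
  cTangent n ρ q ⊓ ⨅ Y ∈ cTangent n ρ q, LinearMap.ker (leviPairMap n ρ q Y)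

/-- The Levi form of `ρ` at `q`, as a Hermitian form on `T^{1,0}_q(∂Ω)`, has rank `l`. -/
def LeviRankAt (n : ℕ) (ρ : (Fin n → ℂ) → ℝ) (q : Fin n → ℂ) (l : ℕ) : Prop :=
  Module.finrank ℂ ↥(cTangent n ρ q) - Module.finrank ℂ ↥(leviKernel n ρ q) = l

/-! ### Test functions, polydiscs, Euclidean norms, biholomorphisms -/

/-- A smooth test function compactly supported in `Ω`. -/
def IsTestFun (n : ℕ) (ψ : (Fin n → ℂ) → ℂ) (Ω : Set (Fin n → ℂ)) : Prop :=
  ContDiff ℝ (⊤ : ℕ∞) ψ ∧ HasCompactSupport ψ ∧ tsupport ψ ⊆ Ω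

/-- The polydisc `P(c, β) = {z : |z_j − c_j| < β_j for all j}`. -/
def polydisc (n : ℕ) (c : Fin n → ℂ) (β : Fin n → ℝ) : Set (Fin n → ℂ) :=
  {z | ∀ j, ‖z j - c j‖ < β j}

/-- The Euclidean norm of the components of `ζ` indexed by `s`. -/
def eucNormOn (n : ℕ) (s : Finset (Fin n)) (ζ : Fin n → ℂ) : ℝ :=
  Real.sqrt (∑ j ∈ s, ‖ζ j‖ ^ 2)

/-- The Euclidean ball of radius `r` centered at the origin in ℂⁿ. -/
def eball (n : ℕ) (r : ℝ) : Set (Fin n → ℂ) :=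
  {ζ | eucNormOn n Finset.univ ζ < r}

/-- `f` is a biholomorphism from `A` onto `B`. -/
def Biholo (n : ℕ) (f : (Fin n → ℂ) → (Fin n → ℂ)) (A B : Set (Fin n → ℂ)) : Prop :=
  DifferentiableOn ℂ f A ∧ Set.BijOn f A B ∧
    ∃ g, DifferentiableOn ℂ g B ∧ ∀ z ∈ A, g (f z) = z

/-- The determinant of the complex Jacobian of `f` at `p`. -/
def cJacDet (n : ℕ) (f : (Fin n → ℂ) → (Fin n → ℂ)) (p : Fin n → ℂ) : ℂ :=
  LinearMap.det ((fderiv ℂ f p).toLinearMap)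

/-! ### Mixed derivatives `D^α` in the variables `z_j`, `z̄_j` -/

/-- The multi-index `α : Fin n → ℕ` recording how many of the directions `ι i` hit slot `j`. -/
def multiIdxOf (n : ℕ) {m : ℕ} (ι : Fin m → Fin n) : Fin n → ℕ :=
  fun j => (Finset.univ.filter fun i => ι i = j).card

/-- All mixed derivatives `D^α φ` of total order `≤ mmax`, where in each slot `j` one may
differentiate in the real directions underlying `z_j` and `z̄_j` (i.e. `e_j` and `i·e_j`),
are bounded on `P` by `bound α`. -/
def MixedDerivBound (n : ℕ) (φ : (Fin n → ℂ) → ℝ) (P : Set (Fin n → ℂ))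
    (mmax : ℕ) (bound : (Fin n → ℕ) → ℝ) : Prop :=
  ∀ m : ℕ, m ≤ mmax → ∀ ι : Fin m → Fin n, ∀ ε : Fin m → ℂ,
    (∀ i, ε i = 1 ∨ ε i = Complex.I) → ∀ z ∈ P,
      ‖iteratedFDeriv ℝ m φ z (fun i => Pi.single (ι i) (ε i))‖ ≤ bound (multiIdxOf n ι)

/-- All mixed derivatives `D^α φ` (of any order) are bounded on `P` by `bound α`. -/
def MixedDerivBoundAll (n : ℕ) (φ : (Fin n → ℂ) → ℝ) (P : Set (Fin n → ℂ))
    (bound : (Fin n → ℕ) → ℝ) : Prop :=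
  ∀ m : ℕ, ∀ ι : Fin m → Fin n, ∀ ε : Fin m → ℂ,
    (∀ i, ε i = 1 ∨ ε i = Complex.I) → ∀ z ∈ P,
      ‖iteratedFDeriv ℝ m φ z (fun i => Pi.single (ι i) (ε i))‖ ≤ bound (multiIdxOf n ι)

/-! ### Fu's centering maps and normal forms (constant Levi rank `l`) -/

/-- Lean indices `1,…,l`, i.e. the coordinates `ζ_2,…,ζ_{l+1}` (the block `ζ'`). -/
def primIdx (n l : ℕ) : Finset (Fin n) := Finset.univ.filter fun j => 1 ≤ j.val ∧ j.val ≤ l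

/-- Lean indices `l+1,…,n−1`, i.e. the coordinates `ζ_{l+2},…,ζ_n` (the block `ζ''`). -/
def dprimIdx (n l : ℕ) : Finset (Fin n) := Finset.univ.filter fun j => l + 1 ≤ j.val

/-- Lean indices `1,…,n−l−1`, i.e. the coordinates `ζ_2,…,ζ_{n−l}`. -/
def midIdx (n l : ℕ) : Finset (Fin n) :=
  Finset.univ.filter fun j => 1 ≤ j.val ∧ j.val ≤ n - l - 1

/-- Lean indices `n−l,…,n−1`, i.e. the coordinates `ζ_{n−l+1},…,ζ_n`. -/
def tailIdx (n l : ℕ) : Finset (Fin n) := Finset.univ.filter fun j => n - l ≤ j.val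

/-- `ρ` is a smooth local defining function for the real hypersurface `S` near `0`
(on the Euclidean ball of radius `ε`). -/
def IsLocalDefining (n : ℕ) (S : Set (Fin n → ℂ)) (ρ : (Fin n → ℂ) → ℝ) (ε : ℝ) : Prop :=
  ContDiffOn ℝ (⊤ : ℕ∞) ρ (eball n ε) ∧
    S ∩ eball n ε = {ζ ∈ eball n ε | ρ ζ = 0} ∧
    ∀ ζ ∈ S ∩ eball n ε, fderiv ℝ ρ ζ ≠ 0

/-- `ρ(ζ) = Re ζ₁ + Σ_{j=2}^{l+1} λ_j |ζ_j|² + O(|ζ'|²·|ζ''| + |ζ'|³ + |Im ζ₁|·|ζ|)` near `0`. -/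
def NormalForm (n l : ℕ) [NeZero n] (lam : Fin n → ℝ) (ρ : (Fin n → ℂ) → ℝ) (ε : ℝ) : Prop :=
  ∃ C > (0:ℝ), ∀ ζ ∈ eball n ε,
    |ρ ζ - ((ζ 0).re + ∑ j ∈ primIdx n l, lam j * ‖ζ j‖ ^ 2)| ≤
      C * ((eucNormOn n (primIdx n l) ζ) ^ 2 * eucNormOn n (dprimIdx n l) ζ +
        (eucNormOn n (primIdx n l) ζ) ^ 3 + |(ζ 0).im| * eucNormOn n Finset.univ ζ)

/-- Fu's centering data near a boundary point: for each `q ∈ U ∩ ∂Ω`, `Φ q` is a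
biholomorphism of `U` onto the unit ball with `Φ q q = 0`, depending smoothly on `q`,
such that `Φ q (U ∩ ∂Ω)` has, near `0`, a defining function `ρloc q` in normal form with
positive coefficients `lam q j` (for `j` in the block `ζ'`) depending smoothly on `q`. -/
def CenteringData (n l : ℕ) [NeZero n] (Ω U : Set (Fin n → ℂ))
    (Φ : (Fin n → ℂ) → (Fin n → ℂ) → (Fin n → ℂ))
    (lam : (Fin n → ℂ) → Fin n → ℝ)
    (ρloc : (Fin n → ℂ) → (Fin n → ℂ) → ℝ) (ε : ℝ) : Prop :=
  ContDiffOn ℝ (⊤ : ℕ∞) (fun pq : (Fin n → ℂ) × (Fin n → ℂ) => Φ pq.1 pq.2)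
      ((U ∩ frontier Ω) ×ˢ U) ∧
  (∀ j : Fin n, ContDiffOn ℝ (⊤ : ℕ∞) (fun q => lam q j) (U ∩ frontier Ω)) ∧
  ∀ q ∈ U ∩ frontier Ω,
    Φ q q = 0 ∧ Biholo n (Φ q) U (eball n 1) ∧
    (∀ j ∈ primIdx n l, 0 < lam q j) ∧
    IsLocalDefining n (Φ q '' (U ∩ frontier Ω)) (ρloc q) ε ∧
    NormalForm n l (lam q) (ρloc q) ε

/-- Fu's polydisc-type region
`P_{δ,a} = {ζ : |ζ₁| < aδ, |ζ_j| < aδ^{1/2} (2 ≤ j ≤ n−l), |ζ_k| < a (n−l+1 ≤ k ≤ n)}`. -/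
def PdaSet (n l : ℕ) [NeZero n] (δ a : ℝ) : Set (Fin n → ℂ) :=
  {ζ | ‖ζ 0‖ < a * δ ∧ (∀ j ∈ midIdx n l, ‖ζ j‖ < a * Real.sqrt δ) ∧
    ∀ j ∈ tailIdx n l, ‖ζ j‖ < a}

/-! ### Finite type in the sense of D'Angelo -/

/-- `h` vanishes to order at least `k` at `0`. -/
def vanishGe (E : Type*) [Norm E] (h : ℂ → E) (k : ℕ) : Prop :=
  ∃ C > (0:ℝ), ∃ ε > (0:ℝ), ∀ t : ℂ, ‖t‖ < ε → ‖h t‖ ≤ C * ‖t‖ ^ k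

/-- The vanishing order of `h` at `0`, as an extended natural number. -/
def vOrder (E : Type*) [Norm E] (h : ℂ → E) : ℕ∞ :=
  sSup ((fun k : ℕ => (k : ℕ∞)) '' {k | vanishGe E h k})

/-- `z₀ ∈ ∂Ω` is a point of finite type in the sense of D'Angelo (w.r.t. the defining
function `ρ`): the order of contact of `∂Ω` with nonconstant holomorphic curves through
`z₀` is uniformly bounded. -/
def FiniteTypeAt (n : ℕ) (ρ : (Fin n → ℂ) → ℝ) (z₀ : Fin n → ℂ) : Prop :=
  ∃ T : ℕ, ∀ γ : ℂ → (Fin n → ℂ), AnalyticAt ℂ γ 0 → γ 0 = z₀ →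
    ¬ (∀ᶠ t in 𝓝 (0:ℂ), γ t = z₀) →
    vOrder ℝ (fun t => ρ (γ t)) ≤ (T : ℕ∞) * vOrder (Fin n → ℂ) (fun t => γ t - z₀)

end

open scoped ContDiff

/-! ### Wirtinger calculus -/

section Wirtinger

variable {n : ℕ}

theorem wder_congr {j : Fin n} {u w : (Fin n → ℂ) → ℂ} {z : Fin n → ℂ} (h : u =ᶠ[𝓝 z] w) :
    wder n j u z = wder n j w z := by
  simp only [wder, h.fderiv_eq]

theorem wderBar_congr {j : Fin n} {u w : (Fin n → ℂ) → ℂ} {z : Fin n → ℂ} (h : u =ᶠ[𝓝 z] w) :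
    wderBar n j u z = wderBar n j w z := by
  simp only [wderBar, h.fderiv_eq]

theorem wder_eq_zero {j : Fin n} {u : (Fin n → ℂ) → ℂ} {z : Fin n → ℂ} (h : u =ᶠ[𝓝 z] 0) :
    wder n j u z = 0 := by
  rw [wder_congr h]; simp [wder]

theorem wderBar_eq_zero {j : Fin n} {u : (Fin n → ℂ) → ℂ} {z : Fin n → ℂ} (h : u =ᶠ[𝓝 z] 0) :
    wderBar n j u z = 0 := by
  rw [wderBar_congr h]; simp [wderBar]

theorem wder_mul {j : Fin n} {u w : (Fin n → ℂ) → ℂ} {z : Fin n → ℂ}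
    (hu : DifferentiableAt ℝ u z) (hw : DifferentiableAt ℝ w z) :
    wder n j (fun x => u x * w x) z = wder n j u z * w z + u z * wder n j w z := by
  simp only [wder, fderiv_fun_mul hu hw]
  simp
  ring

theorem wderBar_mul {j : Fin n} {u w : (Fin n → ℂ) → ℂ} {z : Fin n → ℂ}
    (hu : DifferentiableAt ℝ u z) (hw : DifferentiableAt ℝ w z) :
    wderBar n j (fun x => u x * w x) z = wderBar n j u z * w z + u z * wderBar n j w z := by
  simp only [wderBar, fderiv_fun_mul hu hw]
  simp
  ring

theorem wderBar_add {j : Fin n} {u w : (Fin n → ℂ) → ℂ} {z : Fin n → ℂ}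
    (hu : DifferentiableAt ℝ u z) (hw : DifferentiableAt ℝ w z) :
    wderBar n j (fun x => u x + w x) z = wderBar n j u z + wderBar n j w z := by
  simp only [wderBar, fderiv_fun_add hu hw]
  simp
  ring

theorem wderBar_sub {j : Fin n} {u w : (Fin n → ℂ) → ℂ} {z : Fin n → ℂ}
    (hu : DifferentiableAt ℝ u z) (hw : DifferentiableAt ℝ w z) :
    wderBar n j (fun x => u x - w x) z = wderBar n j u z - wderBar n j w z := by
  simp only [wderBar, fderiv_fun_sub hu hw]
  simp
  ring

theorem wderBar_const_mul {j : Fin n} {u : (Fin n → ℂ) → ℂ} {z : Fin n → ℂ} (c : ℂ)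
    (hu : DifferentiableAt ℝ u z) :
    wderBar n j (fun x => c * u x) z = c * wderBar n j u z := by
  simp only [wderBar, fderiv_const_mul hu]
  simp
  ring

theorem wder_conj (j : Fin n) (u : (Fin n → ℂ) → ℂ) (z : Fin n → ℂ) :
    wder n j (fun x => starRingEnd ℂ (u x)) z = starRingEnd ℂ (wderBar n j u z) := by
  have h : fderiv ℝ (fun x => starRingEnd ℂ (u x)) z =
      (conjCLE : ℂ →L[ℝ] ℂ).comp (fderiv ℝ u z) := by
    have := conjCLE.comp_fderiv (f := u) (x := z)
    simpa [Function.comp_def] using this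
  simp only [wder, wderBar, h]
  simp [Complex.conj_ofNat]
  ring

theorem wderBar_conj (j : Fin n) (u : (Fin n → ℂ) → ℂ) (z : Fin n → ℂ) :
    wderBar n j (fun x => starRingEnd ℂ (u x)) z = starRingEnd ℂ (wder n j u z) := by
  have := wder_conj j (fun x => starRingEnd ℂ (u x)) z
  simp only [RingHomCompTriple.comp_apply, RingHom.id_apply] at this
  rw [this, Complex.conj_conj]

theorem ContDiff.wder {k m : WithTop ℕ∞} {u : (Fin n → ℂ) → ℂ} (j : Fin n) (hu : ContDiff ℝ k u)
    (h : m + 1 ≤ k) : ContDiff ℝ m (wder n j u) := by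
  unfold _root_.wder
  have := hu.fderiv_right h
  fun_prop

theorem ContDiff.wderBar {k m : WithTop ℕ∞} {u : (Fin n → ℂ) → ℂ} (j : Fin n)
    (hu : ContDiff ℝ k u) (h : m + 1 ≤ k) : ContDiff ℝ m (wderBar n j u) := by
  unfold _root_.wderBar
  have := hu.fderiv_right h
  fun_prop

theorem HasCompactSupport.wder {u : (Fin n → ℂ) → ℂ} (j : Fin n) (hu : HasCompactSupport u) :
    HasCompactSupport (wder n j u) := by
  refine HasCompactSupport.of_support_subset_isCompact hu ?_
  intro z hz
  by_contra hc
  exact hz (wder_eq_zero (notMem_tsupport_iff_eventuallyEq.1 hc))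

theorem HasCompactSupport.wderBar {u : (Fin n → ℂ) → ℂ} (j : Fin n) (hu : HasCompactSupport u) :
    HasCompactSupport (wderBar n j u) := by
  refine HasCompactSupport.of_support_subset_isCompact hu ?_
  intro z hz
  by_contra hc
  exact hz (wderBar_eq_zero (notMem_tsupport_iff_eventuallyEq.1 hc))

theorem integral_mul_fderiv_apply {u w : (Fin n → ℂ) → ℂ} (hu : ContDiff ℝ 1 u)
    (hw : ContDiff ℝ 1 w) (hc : HasCompactSupport w) (v : Fin n → ℂ) :
    ∫ z, u z * fderiv ℝ w z v = - ∫ z, fderiv ℝ u z v * w z := by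
  have hu' : Continuous fun z => fderiv ℝ u z v := by
    have := hu.continuous_fderiv (by simp); fun_prop
  have hw' : Continuous fun z => fderiv ℝ w z v := by
    have := hw.continuous_fderiv (by simp); fun_prop
  have hc' : HasCompactSupport fun z => fderiv ℝ w z v := by
    refine HasCompactSupport.of_support_subset_isCompact hc ?_
    intro z hz
    by_contra hcc
    apply hz
    have := (notMem_tsupport_iff_eventuallyEq.1 hcc).fderiv_eq (𝕜 := ℝ)
    simp [this]
  apply integral_mul_fderiv_eq_neg_fderiv_mul_of_integrable
  · exact (hu'.mul hw.continuous).integrable_of_hasCompactSupport hc.mul_left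
  · exact (hu.continuous.mul hw').integrable_of_hasCompactSupport hc'.mul_left
  · exact (hu.continuous.mul hw.continuous).integrable_of_hasCompactSupport hc.mul_left
  · exact fun x _ => (hu.differentiable (by simp)).differentiableAt
  · exact fun x _ => (hw.differentiable (by simp)).differentiableAt

theorem integrable_mul_fderiv_apply {u w : (Fin n → ℂ) → ℂ} (hu : Continuous u)
    (hw : ContDiff ℝ 1 w) (hc : HasCompactSupport w) (v : Fin n → ℂ) :
    Integrable fun z => u z * fderiv ℝ w z v := by
  have hw' : Continuous fun z => fderiv ℝ w z v := by
    have := hw.continuous_fderiv (by simp); fun_prop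
  have hc' : HasCompactSupport fun z => fderiv ℝ w z v := by
    refine HasCompactSupport.of_support_subset_isCompact hc ?_
    intro z hz
    by_contra hcc
    apply hz
    have := (notMem_tsupport_iff_eventuallyEq.1 hcc).fderiv_eq (𝕜 := ℝ)
    simp [this]
  exact (hu.mul hw').integrable_of_hasCompactSupport hc'.mul_left

theorem integrable_fderiv_apply_mul {u w : (Fin n → ℂ) → ℂ} (hu : ContDiff ℝ 1 u)
    (hw : Continuous w) (hc : HasCompactSupport w) (v : Fin n → ℂ) :
    Integrable fun z => fderiv ℝ u z v * w z := by
  have hu' : Continuous fun z => fderiv ℝ u z v := by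
    have := hu.continuous_fderiv (by simp); fun_prop
  exact (hu'.mul hw).integrable_of_hasCompactSupport hc.mul_left

theorem integral_mul_wder {u w : (Fin n → ℂ) → ℂ} (hu : ContDiff ℝ 1 u)
    (hw : ContDiff ℝ 1 w) (hc : HasCompactSupport w) (j : Fin n) :
    ∫ z, u z * wder n j w z = - ∫ z, wder n j u z * w z := by
  have e1 : (fun z => u z * wder n j w z) = fun z =>
      (1 / 2) * (u z * fderiv ℝ w z (Pi.single j 1)) -
        (I / 2) * (u z * fderiv ℝ w z (Pi.single j I)) := by
    ext z; simp only [wder]; ring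
  have e2 : (fun z => wder n j u z * w z) = fun z =>
      (1 / 2) * (fderiv ℝ u z (Pi.single j 1) * w z) -
        (I / 2) * (fderiv ℝ u z (Pi.single j I) * w z) := by
    ext z; simp only [wder]; ring
  rw [e1, e2, integral_sub, integral_sub]
  · simp only [integral_const_mul, integral_mul_fderiv_apply hu hw hc]
    ring
  · exact (integrable_fderiv_apply_mul hu hw.continuous hc _).const_mul _
  · exact (integrable_fderiv_apply_mul hu hw.continuous hc _).const_mul _
  · exact (integrable_mul_fderiv_apply hu.continuous hw hc _).const_mul _
  · exact (integrable_mul_fderiv_apply hu.continuous hw hc _).const_mul _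

theorem integral_mul_wderBar {u w : (Fin n → ℂ) → ℂ} (hu : ContDiff ℝ 1 u)
    (hw : ContDiff ℝ 1 w) (hc : HasCompactSupport w) (j : Fin n) :
    ∫ z, u z * wderBar n j w z = - ∫ z, wderBar n j u z * w z := by
  have e1 : (fun z => u z * wderBar n j w z) = fun z =>
      (1 / 2) * (u z * fderiv ℝ w z (Pi.single j 1)) +
        (I / 2) * (u z * fderiv ℝ w z (Pi.single j I)) := by
    ext z; simp only [wderBar]; ring
  have e2 : (fun z => wderBar n j u z * w z) = fun z =>
      (1 / 2) * (fderiv ℝ u z (Pi.single j 1) * w z) +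
        (I / 2) * (fderiv ℝ u z (Pi.single j I) * w z) := by
    ext z; simp only [wderBar]; ring
  rw [e1, e2, integral_add, integral_add]
  · simp only [integral_const_mul, integral_mul_fderiv_apply hu hw hc]
    ring
  · exact (integrable_fderiv_apply_mul hu hw.continuous hc _).const_mul _
  · exact (integrable_fderiv_apply_mul hu hw.continuous hc _).const_mul _
  · exact (integrable_mul_fderiv_apply hu.continuous hw hc _).const_mul _
  · exact (integrable_mul_fderiv_apply hu.continuous hw hc _).const_mul _

theorem fderiv_wder {u : (Fin n → ℂ) → ℂ} {z : Fin n → ℂ}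
    (hu : DifferentiableAt ℝ (fderiv ℝ u) z) (j : Fin n) (v : Fin n → ℂ) :
    fderiv ℝ (wder n j u) z v = (1 / 2) * (fderiv ℝ (fderiv ℝ u) z v (Pi.single j 1) -
      I * fderiv ℝ (fderiv ℝ u) z v (Pi.single j I)) := by
  have h : ∀ x : Fin n → ℂ, HasFDerivAt (fun w => fderiv ℝ u w x)
      ((fderiv ℝ (fderiv ℝ u) z).flip x) z := fun x => by
    have := hu.hasFDerivAt.clm_apply (hasFDerivAt_const x z)
    simpa using this
  have := (((h (Pi.single j 1)).sub ((h (Pi.single j I)).const_mul I)).const_mul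
    (1 / 2 : ℂ)).fderiv
  unfold wder
  simp only [Pi.sub_def] at this
  rw [this]
  simp

theorem fderiv_wderBar {u : (Fin n → ℂ) → ℂ} {z : Fin n → ℂ}
    (hu : DifferentiableAt ℝ (fderiv ℝ u) z) (j : Fin n) (v : Fin n → ℂ) :
    fderiv ℝ (wderBar n j u) z v = (1 / 2) * (fderiv ℝ (fderiv ℝ u) z v (Pi.single j 1) +
      I * fderiv ℝ (fderiv ℝ u) z v (Pi.single j I)) := by
  have h : ∀ x : Fin n → ℂ, HasFDerivAt (fun w => fderiv ℝ u w x)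
      ((fderiv ℝ (fderiv ℝ u) z).flip x) z := fun x => by
    have := hu.hasFDerivAt.clm_apply (hasFDerivAt_const x z)
    simpa using this
  have := (((h (Pi.single j 1)).add ((h (Pi.single j I)).const_mul I)).const_mul
    (1 / 2 : ℂ)).fderiv
  unfold wderBar
  simp only [Pi.add_def] at this
  rw [this]
  simp
  ring

theorem ContDiffAt.differentiableAt_fderiv_of_two {F : Type*} [NormedAddCommGroup F]
    [NormedSpace ℝ F] {u : (Fin n → ℂ) → F}
    {z : Fin n → ℂ} (hu : ContDiffAt ℝ 2 u z) : DifferentiableAt ℝ (fderiv ℝ u) z :=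
  (hu.fderiv_right (m := 1) (by norm_num)).differentiableAt (by simp)

theorem wderBar_wder_comm {u : (Fin n → ℂ) → ℂ} {z : Fin n → ℂ} (hu : ContDiffAt ℝ 2 u z)
    (j k : Fin n) : wderBar n j (wder n k u) z = wder n k (wderBar n j u) z := by
  have hs := hu.isSymmSndFDerivAt (by simp)
  have hd := hu.differentiableAt_fderiv_of_two
  conv_lhs => unfold wderBar
  conv_rhs => unfold wder
  simp only [fderiv_wder hd, fderiv_wderBar hd]
  rw [hs (Pi.single j 1) (Pi.single k 1), hs (Pi.single j 1) (Pi.single k I),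
    hs (Pi.single j I) (Pi.single k 1), hs (Pi.single j I) (Pi.single k I)]
  ring

theorem wderBar_wderBar_comm {u : (Fin n → ℂ) → ℂ} {z : Fin n → ℂ} (hu : ContDiffAt ℝ 2 u z)
    (j k : Fin n) : wderBar n j (wderBar n k u) z = wderBar n k (wderBar n j u) z := by
  have hs := hu.isSymmSndFDerivAt (by simp)
  have hd := hu.differentiableAt_fderiv_of_two
  change (1 / 2) * (fderiv ℝ (wderBar n k u) z (Pi.single j 1) +
    I * fderiv ℝ (wderBar n k u) z (Pi.single j I)) = (1 / 2) *
    (fderiv ℝ (wderBar n j u) z (Pi.single k 1) + I * fderiv ℝ (wderBar n j u) z (Pi.single k I))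
  simp only [fderiv_wderBar hd]
  rw [hs (Pi.single j 1) (Pi.single k 1), hs (Pi.single j 1) (Pi.single k I),
    hs (Pi.single j I) (Pi.single k 1), hs (Pi.single j I) (Pi.single k I)]
  ring

theorem fderiv_ofReal_comp {φ : (Fin n → ℂ) → ℝ} {z : Fin n → ℂ} (h : DifferentiableAt ℝ φ z)
    (v : Fin n → ℂ) : fderiv ℝ (fun x => (φ x : ℂ)) z v = (fderiv ℝ φ z v : ℂ) := by
  have : HasFDerivAt (fun x => (φ x : ℂ)) (ofRealCLM.comp (fderiv ℝ φ z)) z :=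
    ofRealCLM.hasFDerivAt.comp z h.hasFDerivAt
  rw [this.fderiv]; rfl

end Wirtinger

/-! ### The Levi form of a function -/

section Levi

variable {n : ℕ}

/-- The Levi form of `φ` at `z` in the direction `X`, expressed by real second derivatives. -/
noncomputable def leviForm (φ : (Fin n → ℂ) → ℝ) (z X : Fin n → ℂ) : ℝ :=
  (1 / 4) * (fderiv ℝ (fderiv ℝ φ) z X X + fderiv ℝ (fderiv ℝ φ) z (I • X) (I • X))

/-- The value `Σ_j ∂φ/∂z_j X_j`, expressed by real first derivatives. -/
noncomputable def dPairing (φ : (Fin n → ℂ) → ℝ) (z X : Fin n → ℂ) : ℂ :=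
  (1 / 2) * ((fderiv ℝ φ z X : ℂ) - I * (fderiv ℝ φ z (I • X) : ℂ))

theorem normSq_dPairing (φ : (Fin n → ℂ) → ℝ) (z X : Fin n → ℂ) :
    ‖dPairing φ z X‖ ^ 2 = (1 / 4) * (fderiv ℝ φ z X ^ 2 + fderiv ℝ φ z (I • X) ^ 2) := by
  rw [← Complex.normSq_eq_norm_sq, Complex.normSq_apply]
  simp [dPairing]
  ring

theorem eq_sum_re_im (X : Fin n → ℂ) : X = ∑ j, ((X j).re • (Pi.single j (1 : ℂ) : Fin n → ℂ) +
    (X j).im • (Pi.single j I : Fin n → ℂ)) := by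
  ext i
  simp only [Finset.sum_apply, Pi.add_apply, Pi.smul_apply, Pi.single_apply, Complex.real_smul]
  rw [Finset.sum_eq_single i]
  · simp [Complex.re_add_im]
  · intro b _ hb; simp [hb.symm]
  · simp

theorem I_smul_eq_sum_re_im (X : Fin n → ℂ) :
    I • X = ∑ j, ((X j).re • (Pi.single j I : Fin n → ℂ) -
    (X j).im • (Pi.single j 1 : Fin n → ℂ)) := by
  rw [eq_sum_re_im (I • X)]
  refine Finset.sum_congr rfl fun j _ => ?_
  simp [sub_eq_add_neg, add_comm]

theorem wder_ofReal {φ : (Fin n → ℂ) → ℝ} {z : Fin n → ℂ} (h : DifferentiableAt ℝ φ z)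
    (j : Fin n) : wder n j (fun v => (φ v : ℂ)) z = (1 / 2) *
      ((fderiv ℝ φ z (Pi.single j 1) : ℂ) - I * (fderiv ℝ φ z (Pi.single j I) : ℂ)) := by
  simp only [wder, fderiv_ofReal_comp h]

theorem sum_wder_ofReal_mul {φ : (Fin n → ℂ) → ℝ} {z : Fin n → ℂ} (h : DifferentiableAt ℝ φ z)
    (X : Fin n → ℂ) : ∑ j, wder n j (fun v => (φ v : ℂ)) z * X j = dPairing φ z X := by
  simp only [wder_ofReal h, dPairing]
  rw [I_smul_eq_sum_re_im X]
  conv_rhs => rw [eq_sum_re_im X]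
  simp only [map_sum, map_add, map_sub, map_smul, smul_eq_mul, ofReal_sum, ofReal_add, ofReal_sub,
    ofReal_mul, Finset.mul_sum, ← Finset.sum_sub_distrib]
  simp only [Finset.sum_apply, Pi.add_apply, Pi.smul_apply, Pi.single_apply, Complex.real_smul,
    mul_ite, mul_one, mul_zero, Finset.sum_add_distrib, Finset.sum_ite_eq, Finset.mem_univ, if_true]
  refine Finset.sum_congr rfl fun j _ => ?_
  apply Complex.ext <;> simp <;> ring

theorem cHess_eq {φ : (Fin n → ℂ) → ℝ} {z : Fin n → ℂ} (h : ContDiffAt ℝ 2 φ z) (j k : Fin n) :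
    cHess n φ z j k = (1 / 4) * ((fderiv ℝ (fderiv ℝ φ) z (Pi.single k 1) (Pi.single j 1) : ℂ)
      - I * (fderiv ℝ (fderiv ℝ φ) z (Pi.single k 1) (Pi.single j I) : ℂ)
      + I * (fderiv ℝ (fderiv ℝ φ) z (Pi.single k I) (Pi.single j 1) : ℂ)
      + (fderiv ℝ (fderiv ℝ φ) z (Pi.single k I) (Pi.single j I) : ℂ)) := by
  have hd := h.differentiableAt_fderiv_of_two
  have hev : (fun w => wder n j (fun v => (φ v : ℂ)) w) =ᶠ[𝓝 z] fun w => (1 / 2) *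
      ((fderiv ℝ φ w (Pi.single j 1) : ℂ) - I * (fderiv ℝ φ w (Pi.single j I) : ℂ)) := by
    have := h.eventually (by simp)
    filter_upwards [this] with w hw
    exact wder_ofReal (hw.differentiableAt (by simp)) j
  have h1 : ∀ x : Fin n → ℂ, HasFDerivAt (fun w => fderiv ℝ φ w x)
      ((fderiv ℝ (fderiv ℝ φ) z).flip x) z := fun x => by
    have := hd.hasFDerivAt.clm_apply (hasFDerivAt_const x z)
    simpa using this
  have h2 : ∀ x : Fin n → ℂ, HasFDerivAt (fun w => (fderiv ℝ φ w x : ℂ))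
      (ofRealCLM.comp ((fderiv ℝ (fderiv ℝ φ) z).flip x)) z := fun x =>
    ofRealCLM.hasFDerivAt.comp z (h1 x)
  unfold cHess
  rw [wderBar_congr hev]
  have h3 := (((h2 (Pi.single j 1)).sub ((h2 (Pi.single j I)).const_mul I)).const_mul
    (1 / 2 : ℂ)).fderiv
  simp only [Pi.sub_def] at h3
  unfold wderBar
  rw [h3]
  simp
  ring_nf
  simp
  ring

theorem hermForm_cHess {φ : (Fin n → ℂ) → ℝ} {z : Fin n → ℂ} (h : ContDiffAt ℝ 2 φ z)
    (X : Fin n → ℂ) : hermForm n (cHess n φ z) X X = leviForm φ z X := by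
  have hs := h.isSymmSndFDerivAt (by simp)
  unfold hermForm leviForm
  simp only [cHess_eq h]
  set B := fderiv ℝ (fderiv ℝ φ) z
  have e1 : B X X = ∑ k, ∑ j, ((X k).re * (X j).re * B (Pi.single k 1) (Pi.single j 1)
      + (X k).re * (X j).im * B (Pi.single k 1) (Pi.single j I)
      + (X k).im * (X j).re * B (Pi.single k I) (Pi.single j 1)
      + (X k).im * (X j).im * B (Pi.single k I) (Pi.single j I)) := by
    conv_lhs => rw [eq_sum_re_im X]
    simp only [map_sum, map_add, map_smul, smul_eq_mul, FunLike.coe_sum, Finset.sum_apply,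
      add_apply, smul_apply]
    refine Eq.trans ?_ Finset.sum_comm
    refine Finset.sum_congr rfl fun k _ => ?_
    rw [Finset.mul_sum, Finset.mul_sum, ← Finset.sum_add_distrib]
    refine Finset.sum_congr rfl fun j _ => ?_
    ring
  have e2 : B (I • X) (I • X) = ∑ k, ∑ j, ((X k).re * (X j).re * B (Pi.single k I) (Pi.single j I)
      - (X k).re * (X j).im * B (Pi.single k I) (Pi.single j 1)
      - (X k).im * (X j).re * B (Pi.single k 1) (Pi.single j I)
      + (X k).im * (X j).im * B (Pi.single k 1) (Pi.single j 1)) := by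
    rw [I_smul_eq_sum_re_im X]
    simp only [map_sum, map_sub, map_smul, smul_eq_mul, FunLike.coe_sum, Finset.sum_apply,
      sub_apply, smul_apply]
    refine Eq.trans ?_ Finset.sum_comm
    refine Finset.sum_congr rfl fun k _ => ?_
    rw [Finset.mul_sum, Finset.mul_sum, ← Finset.sum_sub_distrib]
    refine Finset.sum_congr rfl fun j _ => ?_
    ring
  rw [e1, e2, Finset.sum_comm, ← Finset.sum_add_distrib, Finset.mul_sum, Complex.re_sum]
  refine Finset.sum_congr rfl fun k _ => ?_
  rw [← Finset.sum_add_distrib, Finset.mul_sum, Complex.re_sum]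
  refine Finset.sum_congr rfl fun j _ => ?_
  simp
  ring

theorem leviForm_congr {φ ψ : (Fin n → ℂ) → ℝ} {z : Fin n → ℂ} (h : φ =ᶠ[𝓝 z] ψ)
    (X : Fin n → ℂ) : leviForm φ z X = leviForm ψ z X := by
  unfold leviForm
  rw [h.fderiv.fderiv_eq]

theorem fderiv_fderiv_add {φ ψ : (Fin n → ℂ) → ℝ} {z : Fin n → ℂ} (h : ContDiffAt ℝ 2 φ z)
    (h' : ContDiffAt ℝ 2 ψ z) : fderiv ℝ (fderiv ℝ (fun x => φ x + ψ x)) z =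
      fderiv ℝ (fderiv ℝ φ) z + fderiv ℝ (fderiv ℝ ψ) z := by
  have hev : fderiv ℝ (fun x => φ x + ψ x) =ᶠ[𝓝 z] fun w => fderiv ℝ φ w + fderiv ℝ ψ w := by
    filter_upwards [h.eventually (by simp), h'.eventually (by simp)] with w hw hw'
    exact fderiv_fun_add (hw.differentiableAt (by simp)) (hw'.differentiableAt (by simp))
  rw [hev.fderiv_eq]
  exact fderiv_fun_add h.differentiableAt_fderiv_of_two h'.differentiableAt_fderiv_of_two

theorem leviForm_add {φ ψ : (Fin n → ℂ) → ℝ} {z : Fin n → ℂ} (h : ContDiffAt ℝ 2 φ z)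
    (h' : ContDiffAt ℝ 2 ψ z) (X : Fin n → ℂ) :
    leviForm (fun x => φ x + ψ x) z X = leviForm φ z X + leviForm ψ z X := by
  simp only [leviForm, fderiv_fderiv_add h h']
  simp
  ring

/-- Second derivative of a composition with a function of one real variable. -/
theorem fderiv_fderiv_comp {θ θ' : ℝ → ℝ} {θ'' : ℝ} {φ : (Fin n → ℂ) → ℝ} {z : Fin n → ℂ}
    (h : ContDiffAt ℝ 2 φ z) (hθ : ∀ᶠ t in 𝓝 (φ z), HasDerivAt θ (θ' t) t)
    (hθ' : HasDerivAt θ' θ'' (φ z)) (X : Fin n → ℂ) :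
    fderiv ℝ (fderiv ℝ (fun x => θ (φ x))) z X X =
      θ' (φ z) * fderiv ℝ (fderiv ℝ φ) z X X + θ'' * (fderiv ℝ φ z X) ^ 2 := by
  have hev : fderiv ℝ (fun x => θ (φ x)) =ᶠ[𝓝 z] fun w => θ' (φ w) • fderiv ℝ φ w := by
    filter_upwards [h.eventually (by simp), h.continuousAt.eventually hθ] with w hw hw'
    have := hw'.comp_hasFDerivAt w (hw.differentiableAt (by simp)).hasFDerivAt
    exact this.fderiv
  rw [hev.fderiv_eq]
  have hd := h.differentiableAt_fderiv_of_two
  have hc := hθ'.comp_hasFDerivAt z (h.differentiableAt (by simp)).hasFDerivAt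
  have := (HasFDerivAt.smul hc hd.hasFDerivAt).fderiv
  simp only [Function.comp_def] at this
  rw [show (fun w => θ' (φ w) • fderiv ℝ φ w) = ((fun x => θ' (φ x)) • fderiv ℝ φ) from rfl, this]
  simp
  ring

theorem fderiv_comp_real {θ : ℝ → ℝ} {θ' : ℝ} {φ : (Fin n → ℂ) → ℝ} {z : Fin n → ℂ}
    (h : DifferentiableAt ℝ φ z) (hθ : HasDerivAt θ θ' (φ z)) :
    fderiv ℝ (fun x => θ (φ x)) z = θ' • fderiv ℝ φ z :=
  (hθ.comp_hasFDerivAt z h.hasFDerivAt).fderiv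

theorem leviForm_comp {θ θ' : ℝ → ℝ} {θ'' : ℝ} {φ : (Fin n → ℂ) → ℝ} {z : Fin n → ℂ}
    (h : ContDiffAt ℝ 2 φ z) (hθ : ∀ᶠ t in 𝓝 (φ z), HasDerivAt θ (θ' t) t)
    (hθ' : HasDerivAt θ' θ'' (φ z)) (X : Fin n → ℂ) :
    leviForm (fun x => θ (φ x)) z X =
      θ' (φ z) * leviForm φ z X + θ'' * ‖dPairing φ z X‖ ^ 2 := by
  simp only [leviForm, fderiv_fderiv_comp h hθ hθ', normSq_dPairing]
  ring

end Levi

/-! ### The weighted a priori inequality -/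

section BasicInequality

variable {n : ℕ}

/-- The formal adjoint (up to sign) of `∂/∂z̄_j` with respect to the weight `e^{-φ}`. -/
noncomputable def wAdj (φ : (Fin n → ℂ) → ℝ) (j : Fin n) (a : (Fin n → ℂ) → ℂ)
    (z : Fin n → ℂ) : ℂ :=
  wder n j a z - wder n j (fun v => (φ v : ℂ)) z * a z

theorem contDiff_wAdj {φ : (Fin n → ℂ) → ℝ} (hφ : ContDiff ℝ 2 φ) (j : Fin n)
    {a : (Fin n → ℂ) → ℂ} (ha : ContDiff ℝ 2 a) : ContDiff ℝ 1 (wAdj φ j a) := by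
  have h1 : ContDiff ℝ 2 (fun v => (φ v : ℂ)) := ofRealCLM.contDiff.comp hφ
  exact (ha.wder j (by norm_num)).sub ((h1.wder j (by norm_num)).mul (ha.of_le (by norm_num)))

theorem continuous_wAdj {φ : (Fin n → ℂ) → ℝ} (hφ : ContDiff ℝ 1 φ) (j : Fin n)
    {a : (Fin n → ℂ) → ℂ} (ha : ContDiff ℝ 1 a) : Continuous (wAdj φ j a) := by
  have h1 : ContDiff ℝ 1 (fun v => (φ v : ℂ)) := ofRealCLM.contDiff.comp hφ
  exact (ha.wder (m := 0) j (by norm_num)).continuous.sub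
    ((h1.wder (m := 0) j (by norm_num)).continuous.mul ha.continuous)

theorem wder_exp_neg {φ : (Fin n → ℂ) → ℝ} {z : Fin n → ℂ} (hφ : DifferentiableAt ℝ φ z)
    (j : Fin n) : wder n j (fun v => (Real.exp (-φ v) : ℂ)) z =
      - (Real.exp (-φ z) : ℂ) * wder n j (fun v => (φ v : ℂ)) z := by
  have h : fderiv ℝ (fun v => Real.exp (-φ v)) z = (-Real.exp (-φ z)) • fderiv ℝ φ z := by
    have := (hφ.hasFDerivAt.neg.exp).fderiv
    simp only [Pi.neg_apply] at this
    rw [this]; ext v; simp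
  have h1 : DifferentiableAt ℝ (fun v => Real.exp (-φ v)) z := hφ.neg.exp
  rw [wder_ofReal h1, wder_ofReal hφ, h]
  simp
  ring

theorem wder_exp_neg_mul {φ : (Fin n → ℂ) → ℝ} {z : Fin n → ℂ} (hφ : DifferentiableAt ℝ φ z)
    {a : (Fin n → ℂ) → ℂ} (ha : DifferentiableAt ℝ a z) (j : Fin n) :
    wder n j (fun v => (Real.exp (-φ v) : ℂ) * a v) z = (Real.exp (-φ z) : ℂ) * wAdj φ j a z := by
  have h1 : DifferentiableAt ℝ (fun v => (Real.exp (-φ v) : ℂ)) z :=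
    ofRealCLM.differentiableAt.comp z hφ.neg.exp
  rw [wder_mul h1 ha, wder_exp_neg hφ, wAdj]
  ring

theorem wderBar_wAdj {φ : (Fin n → ℂ) → ℝ} (hφ : ContDiff ℝ 2 φ) {b : (Fin n → ℂ) → ℂ}
    (hb : ContDiff ℝ 2 b) (j k : Fin n) (z : Fin n → ℂ) :
    wderBar n j (wAdj φ k b) z = wAdj φ k (wderBar n j b) z - cHess n φ z k j * b z := by
  have h1 : ContDiff ℝ 2 (fun v => (φ v : ℂ)) := ofRealCLM.contDiff.comp hφ
  have h2 : ContDiff ℝ 1 (wder n k (fun v => (φ v : ℂ))) := h1.wder k (by norm_num)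
  have h3 : ContDiff ℝ 1 (wder n k b) := hb.wder k (by norm_num)
  have h4 : ContDiff ℝ 1 b := hb.of_le (by norm_num)
  have d2 := h2.differentiable (by simp) z
  have d3 := h3.differentiable (by simp) z
  have d4 := h4.differentiable (by simp) z
  unfold wAdj
  rw [wderBar_sub d3 (by exact d2.mul d4), wderBar_mul d2 d4, wderBar_wder_comm hb.contDiffAt]
  simp only [cHess]
  ring

theorem integral_wAdj_mul_conj {φ : (Fin n → ℂ) → ℝ} (hφ : ContDiff ℝ 1 φ)
    {a b : (Fin n → ℂ) → ℂ} (ha : ContDiff ℝ 1 a) (hb : ContDiff ℝ 1 b)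
    (hc : HasCompactSupport b) (j : Fin n) :
    ∫ z, (Real.exp (-φ z) : ℂ) * wAdj φ j a z * starRingEnd ℂ (b z) =
      - ∫ z, (Real.exp (-φ z) : ℂ) * a z * starRingEnd ℂ (wderBar n j b z) := by
  have hE : ContDiff ℝ 1 (fun v => (Real.exp (-φ v) : ℂ)) :=
    ofRealCLM.contDiff.comp hφ.neg.exp
  have hcb : ContDiff ℝ 1 (fun z => starRingEnd ℂ (b z)) := conjCLE.contDiff.comp hb
  have := integral_mul_wder (hE.mul ha) hcb (hc.comp_left (map_zero _)) j
  simp only [wder_conj] at this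
  rw [this, neg_neg]
  congr 1; ext z
  rw [wder_exp_neg_mul (hφ.differentiable (by simp) z) (ha.differentiable (by simp) z)]

theorem integral_mul_conj_wAdj {φ : (Fin n → ℂ) → ℝ} (hφ : ContDiff ℝ 1 φ)
    {a b : (Fin n → ℂ) → ℂ} (ha : ContDiff ℝ 1 a) (hb : ContDiff ℝ 1 b)
    (hc : HasCompactSupport b) (j : Fin n) :
    ∫ z, (Real.exp (-φ z) : ℂ) * a z * starRingEnd ℂ (wAdj φ j b z) =
      - ∫ z, (Real.exp (-φ z) : ℂ) * wderBar n j a z * starRingEnd ℂ (b z) := by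
  have hE : ContDiff ℝ 1 (fun v => (Real.exp (-φ v) : ℂ)) :=
    ofRealCLM.contDiff.comp hφ.neg.exp
  have hcb : ContDiff ℝ 1 (fun z => starRingEnd ℂ ((Real.exp (-φ z) : ℂ) * b z)) :=
    conjCLE.contDiff.comp (hE.mul hb)
  have := integral_mul_wderBar ha hcb ((hc.mul_left).comp_left (map_zero _)) j
  simp only [wderBar_conj] at this
  have e : ∀ z, (Real.exp (-φ z) : ℂ) * a z * starRingEnd ℂ (wAdj φ j b z) = a z *
      starRingEnd ℂ (wder n j (fun z => (Real.exp (-φ z) : ℂ) * b z) z) := fun z => by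
    rw [wder_exp_neg_mul (hφ.differentiable (by simp) z) (hb.differentiable (by simp) z), map_mul,
      conj_ofReal]
    ring
  simp only [e]
  rw [this]
  congr 2; ext z
  rw [map_mul, conj_ofReal]
  ring

theorem integral_wAdj_mul_conj_wAdj {φ : (Fin n → ℂ) → ℝ} (hφ : ContDiff ℝ 2 φ)
    {a b : (Fin n → ℂ) → ℂ} (ha : ContDiff ℝ 2 a) (hb : ContDiff ℝ 2 b)
    (hc : HasCompactSupport b) (j k : Fin n) :
    ∫ z, (Real.exp (-φ z) : ℂ) * wAdj φ j a z * starRingEnd ℂ (wAdj φ k b z) =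
      (∫ z, (Real.exp (-φ z) : ℂ) * wderBar n k a z * starRingEnd ℂ (wderBar n j b z)) +
      ∫ z, (Real.exp (-φ z) : ℂ) * a z * starRingEnd ℂ (cHess n φ z k j * b z) := by
  have hφ1 : ContDiff ℝ 1 φ := hφ.of_le (by norm_num)
  have ha1 : ContDiff ℝ 1 a := ha.of_le (by norm_num)
  have hb1 : ContDiff ℝ 1 b := hb.of_le (by norm_num)
  have hbb : ContDiff ℝ 1 (wderBar n j b) := hb.wderBar j (by norm_num)
  have hcw : HasCompactSupport (wAdj φ k b) := (hc.wder k).sub hc.mul_left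
  have hcb := hc.wderBar j
  have hH : Continuous fun z => cHess n φ z k j := by
    have h1 : ContDiff ℝ 2 (fun v => (φ v : ℂ)) := ofRealCLM.contDiff.comp hφ
    exact ((h1.wder (m := 1) k (by norm_num)).wderBar (m := 0) j (by norm_num)).continuous
  have hE : Continuous fun z => (Real.exp (-φ z) : ℂ) := by
    have := hφ.continuous; fun_prop
  rw [integral_wAdj_mul_conj hφ1 ha1 (contDiff_wAdj hφ k hb) hcw j]
  simp only [wderBar_wAdj hφ hb, map_sub, mul_sub]
  rw [integral_sub, integral_mul_conj_wAdj hφ1 ha1 hbb hcb]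
  · ring
  · refine Continuous.integrable_of_hasCompactSupport ?_ ?_
    · exact (hE.mul ha.continuous).mul (continuous_conj.comp (continuous_wAdj hφ1 k hbb))
    · have : HasCompactSupport (wAdj φ k (wderBar n j b)) := (hcb.wder k).sub hcb.mul_left
      exact (this.comp_left (map_zero _)).mul_left
  · refine Continuous.integrable_of_hasCompactSupport ?_ ?_
    · exact (hE.mul ha.continuous).mul (continuous_conj.comp (hH.mul hb.continuous))
    · exact ((hc.mul_left).comp_left (map_zero _)).mul_left

theorem neg_normSq_sub_le_two_re_mul_conj (x y : ℂ) :
    -(1 / 2) * ‖x - y‖ ^ 2 ≤ (x * starRingEnd ℂ y).re := by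
  rw [← Complex.normSq_eq_norm_sq, Complex.normSq_apply]
  simp
  nlinarith [sq_nonneg x.re, sq_nonneg y.re, sq_nonneg x.im, sq_nonneg y.im,
    sq_nonneg (x.re + y.re), sq_nonneg (x.im + y.im)]

/-- The Morrey–Kohn–Hörmander inequality with weight `e^{-φ}` on all of `ℂⁿ`. -/
theorem integral_leviForm_le {φ : (Fin n → ℂ) → ℝ} (hφ : ContDiff ℝ 2 φ)
    {α : Fin n → (Fin n → ℂ) → ℂ} (hα : ∀ j, ContDiff ℝ 2 (α j))
    (hc : ∀ j, HasCompactSupport (α j)) :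
    ∫ z, leviForm φ z (fun j => α j z) * Real.exp (-φ z) ≤
      (∫ z, ‖∑ j, wAdj φ j (α j) z‖ ^ 2 * Real.exp (-φ z)) +
      (1 / 2) * ∫ z, (∑ j, ∑ k, ‖wderBar n j (α k) z - wderBar n k (α j) z‖ ^ 2) *
        Real.exp (-φ z) := by
  have hφ1 : ContDiff ℝ 1 φ := hφ.of_le (by norm_num)
  have hα1 : ∀ j, ContDiff ℝ 1 (α j) := fun j => (hα j).of_le (by norm_num)
  have hE : Continuous fun z => (Real.exp (-φ z) : ℂ) := by
    have := hφ.continuous; fun_prop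
  have hH : ∀ j k, Continuous fun z => cHess n φ z k j := fun j k => by
    have h1 : ContDiff ℝ 2 (fun v => (φ v : ℂ)) := ofRealCLM.contDiff.comp hφ
    exact ((h1.wder (m := 1) k (by norm_num)).wderBar (m := 0) j (by norm_num)).continuous
  have hd : ∀ j k, Continuous (wderBar n j (α k)) := fun j k =>
    ((hα1 k).wderBar (m := 0) j (by norm_num)).continuous
  have hcw : ∀ j, HasCompactSupport (wAdj φ j (α j)) := fun j => ((hc j).wder j).sub (hc j).mul_left
  have I1 : ∀ j k, Integrable fun z => (Real.exp (-φ z) : ℂ) * wAdj φ j (α j) z *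
      starRingEnd ℂ (wAdj φ k (α k) z) := fun j k => by
    refine Continuous.integrable_of_hasCompactSupport ?_ ?_
    · exact (hE.mul (continuous_wAdj hφ1 j (hα1 j))).mul
        (continuous_conj.comp (continuous_wAdj hφ1 k (hα1 k)))
    · exact ((hcw k).comp_left (map_zero _)).mul_left
  have I2 : ∀ j k, Integrable fun z => (Real.exp (-φ z) : ℂ) * wderBar n k (α j) z *
      starRingEnd ℂ (wderBar n j (α k) z) := fun j k => by
    refine Continuous.integrable_of_hasCompactSupport ?_ ?_
    · exact (hE.mul (hd k j)).mul (continuous_conj.comp (hd j k))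
    · exact (((hc k).wderBar j).comp_left (map_zero _)).mul_left
  have I3 : ∀ j k, Integrable fun z => (Real.exp (-φ z) : ℂ) * α j z *
      starRingEnd ℂ (cHess n φ z k j * α k z) := fun j k => by
    refine Continuous.integrable_of_hasCompactSupport ?_ ?_
    · exact (hE.mul (hα j).continuous).mul (continuous_conj.comp ((hH j k).mul (hα k).continuous))
    · exact (((hc k).mul_left).comp_left (map_zero _)).mul_left
  have key : (∑ j, ∑ k, ∫ z, (Real.exp (-φ z) : ℂ) * wAdj φ j (α j) z *
      starRingEnd ℂ (wAdj φ k (α k) z)) = (∑ j, ∑ k, ∫ z, (Real.exp (-φ z) : ℂ) *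
      wderBar n k (α j) z * starRingEnd ℂ (wderBar n j (α k) z)) +
      ∑ j, ∑ k, ∫ z, (Real.exp (-φ z) : ℂ) * α j z *
        starRingEnd ℂ (cHess n φ z k j * α k z) := by
    simp only [integral_wAdj_mul_conj_wAdj hφ (hα _) (hα _) (hc _), Finset.sum_add_distrib]
  have hsum : ∀ f : Fin n → Fin n → (Fin n → ℂ) → ℂ, (∀ j k, Integrable (f j k)) →
      (∑ j, ∑ k, ∫ z, f j k z).re = ∫ z, (∑ j, ∑ k, f j k z).re := by
    intro f hf
    have h1 : Integrable fun z => ∑ j, ∑ k, f j k z :=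
      integrable_finsetSum _ fun j _ => integrable_finsetSum _ fun k _ => hf j k
    have := integral_re h1
    simp only [RCLike.re_to_complex] at this
    rw [this, integral_finsetSum _ fun j _ => integrable_finsetSum _ fun k _ => hf j k]
    congr 2; ext j
    rw [integral_finsetSum _ fun k _ => hf j k]
  have key' := congrArg Complex.re key
  rw [add_re, hsum _ I1, hsum _ I2, hsum _ I3] at key'
  have J2 : Integrable fun z => (∑ j, ∑ k, (Real.exp (-φ z) : ℂ) * wderBar n k (α j) z *
      starRingEnd ℂ (wderBar n j (α k) z)).re :=
    (integrable_finsetSum _ fun j _ => integrable_finsetSum _ fun k _ => I2 j k).re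
  have e1 : ∀ z, (∑ j, ∑ k, (Real.exp (-φ z) : ℂ) * wAdj φ j (α j) z *
      starRingEnd ℂ (wAdj φ k (α k) z)).re =
      ‖∑ j, wAdj φ j (α j) z‖ ^ 2 * Real.exp (-φ z) := fun z => by
    have : ∑ j, ∑ k, (Real.exp (-φ z) : ℂ) * wAdj φ j (α j) z *
      starRingEnd ℂ (wAdj φ k (α k) z) =
      (Real.exp (-φ z) : ℂ) * ((∑ j, wAdj φ j (α j) z) *
        starRingEnd ℂ (∑ j, wAdj φ j (α j) z)) := by
      rw [map_sum, Finset.sum_mul_sum, Finset.mul_sum]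
      refine Finset.sum_congr rfl fun j _ => ?_
      rw [Finset.mul_sum]
      refine Finset.sum_congr rfl fun k _ => ?_
      ring
    rw [this, Complex.mul_conj, Complex.normSq_eq_norm_sq, ← ofReal_mul, ofReal_re, mul_comm]
  have e3 : ∀ z, (∑ j, ∑ k, (Real.exp (-φ z) : ℂ) * α j z *
        starRingEnd ℂ (cHess n φ z k j * α k z)).re =
      leviForm φ z (fun j => α j z) * Real.exp (-φ z) := fun z => by
    rw [← hermForm_cHess hφ.contDiffAt, hermForm, Finset.sum_comm]
    have : ∑ k, ∑ j, (Real.exp (-φ z) : ℂ) * α j z *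
        starRingEnd ℂ (cHess n φ z k j * α k z) = (Real.exp (-φ z) : ℂ) *
        starRingEnd ℂ (∑ j, ∑ k, cHess n φ z j k * α j z * starRingEnd ℂ (α k z)) := by
      simp only [map_sum, Finset.mul_sum, map_mul, conj_conj]
      refine Finset.sum_congr rfl fun j _ => Finset.sum_congr rfl fun k _ => ?_
      ring
    rw [this, re_ofReal_mul, conj_re, mul_comm]
  simp only [e1, e3] at key'
  rw [key', ← integral_const_mul]
  have J4 : Integrable fun z => (1 / 2) * ((∑ j, ∑ k,
      ‖wderBar n j (α k) z - wderBar n k (α j) z‖ ^ 2) * Real.exp (-φ z)) := by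
    have hEr : Continuous fun z => Real.exp (-φ z) := by
      have := hφ.continuous; fun_prop
    refine Integrable.const_mul ?_ _
    simp only [Finset.sum_mul]
    refine integrable_finsetSum _ fun j _ => integrable_finsetSum _ fun k _ => ?_
    refine Continuous.integrable_of_hasCompactSupport ?_ ?_
    · exact ((((hd j k).sub (hd k j)).norm).pow 2).mul hEr
    · refine HasCompactSupport.mul_right ?_
      have : HasCompactSupport fun z => wderBar n j (α k) z - wderBar n k (α j) z :=
        ((hc k).wderBar j).sub ((hc j).wderBar k)
      exact this.comp_left (g := fun x : ℂ => ‖x‖ ^ 2) (by simp)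
  have : 0 ≤ (∫ z, (∑ j, ∑ k, (Real.exp (-φ z) : ℂ) * wderBar n k (α j) z *
      starRingEnd ℂ (wderBar n j (α k) z)).re) + ∫ z, (1 / 2) * ((∑ j, ∑ k,
      ‖wderBar n j (α k) z - wderBar n k (α j) z‖ ^ 2) * Real.exp (-φ z)) := by
    rw [← integral_add J2 J4]
    refine integral_nonneg fun z => ?_
    simp only [Pi.zero_apply]
    rw [Complex.re_sum, Finset.sum_mul, Finset.mul_sum, ← Finset.sum_add_distrib]
    refine Finset.sum_nonneg fun j _ => ?_
    rw [Complex.re_sum, Finset.sum_mul, Finset.mul_sum, ← Finset.sum_add_distrib]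
    refine Finset.sum_nonneg fun k _ => ?_
    rw [mul_assoc, re_ofReal_mul]
    have := neg_normSq_sub_le_two_re_mul_conj (wderBar n k (α j) z) (wderBar n j (α k) z)
    rw [norm_sub_rev] at this
    nlinarith [Real.exp_pos (-φ z)]
  linarith

end BasicInequality

/-! ### Circularly symmetric mollifiers -/

section Mollifier

variable {n : ℕ}

/-- The squared Euclidean norm `Σ_j |z_j|²`. -/
noncomputable def nsq (z : Fin n → ℂ) : ℝ := ∑ j, ‖z j‖ ^ 2

theorem contDiff_nsq {k : WithTop ℕ∞} : ContDiff ℝ k (nsq (n := n)) := by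
  unfold nsq
  refine ContDiff.sum fun j _ => ?_
  exact (contDiff_norm_sq ℝ).comp (contDiff_apply ℝ ℂ j)

theorem norm_apply_sq_le_nsq (z : Fin n → ℂ) (j : Fin n) : ‖z j‖ ^ 2 ≤ nsq z :=
  Finset.single_le_sum (f := fun j => ‖z j‖ ^ 2) (fun _ _ => by positivity) (Finset.mem_univ j)

/-- `ρ` is a smooth nonnegative function of integral one, supported in the closed ball of
radius `r` and invariant under multiplication by complex numbers of modulus one. -/
structure IsMollifier (r : ℝ) (ρ : (Fin n → ℂ) → ℝ) : Prop where
  contDiff : ContDiff ℝ ∞ ρ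
  nonneg : ∀ z, 0 ≤ ρ z
  eq_zero : ∀ z, r ≤ ‖z‖ → ρ z = 0
  integral : ∫ z, ρ z = 1
  circular : ∀ (c : ℂ) (z : Fin n → ℂ), ‖c‖ = 1 → ρ (c • z) = ρ z

theorem hasCompactSupport_of_eq_zero_of_le_norm {F : Type*} [NormedAddCommGroup F] {r : ℝ}
    {f : (Fin n → ℂ) → F} (h : ∀ z, r ≤ ‖z‖ → f z = 0) : HasCompactSupport f := by
  refine HasCompactSupport.of_support_subset_isCompact (isCompact_closedBall 0 r) ?_
  intro z hz
  by_contra hc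
  exact hz (h z (by simpa using (not_le.mp (fun h' => hc (by simpa using h'))).le))

theorem exists_isMollifier {r : ℝ} (hr : 0 < r) : ∃ ρ : (Fin n → ℂ) → ℝ, IsMollifier r ρ := by
  set R : (Fin n → ℂ) → ℝ := fun z => Real.smoothTransition (1 - nsq z / r ^ 2) with hR
  have hRc : ContDiff ℝ ∞ R :=
    Real.smoothTransition.contDiff.comp (contDiff_const.sub (contDiff_nsq.div_const _))
  have hR0 : ∀ z, 0 ≤ R z := fun z => Real.smoothTransition.nonneg _
  have hcirc : ∀ (c : ℂ) (z : Fin n → ℂ), ‖c‖ = 1 → R (c • z) = R z := by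
    intro c z hc
    simp [hR, nsq, hc]
  rcases Nat.eq_zero_or_pos n with hn | hn
  · subst hn
    refine ⟨fun _ => 1, contDiff_const, by simp, fun z hz => ?_, ?_, by simp⟩
    · rw [Subsingleton.elim z 0, norm_zero] at hz; linarith
    · simp only [integral_const, smul_eq_mul, mul_one, measureReal_def]
      have : (univ : Set (Fin 0 → ℂ)) = Set.pi univ (fun _ => univ) := by simp
      rw [this, volume_pi_pi]; simp
  · have hz : ∀ z, r ≤ ‖z‖ → R z = 0 := by
      intro z hz
      refine Real.smoothTransition.zero_of_nonpos ?_
      have : ∃ j, r ≤ ‖z j‖ := by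
        by_contra hcon
        push Not at hcon
        have := (pi_norm_lt_iff hr).2 hcon
        linarith
      obtain ⟨j, hj⟩ := this
      have h2 := norm_apply_sq_le_nsq z j
      have h3 : r ^ 2 ≤ nsq z := (pow_le_pow_left₀ hr.le hj 2).trans h2
      have := (one_le_div (by positivity)).2 h3
      linarith
    have hcs := hasCompactSupport_of_eq_zero_of_le_norm hz
    have hpos : 0 < ∫ z, R z := by
      refine integral_pos_of_integrable_nonneg_nonzero (x := 0) hRc.continuous
        (hRc.continuous.integrable_of_hasCompactSupport hcs) hR0 ?_
      simp [hR, nsq]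
    clear_value R
    refine ⟨fun z => (∫ z, R z)⁻¹ * R z, contDiff_const.mul hRc, fun z => ?_, fun z h => ?_, ?_, ?_⟩
    · exact mul_nonneg (inv_nonneg.2 hpos.le) (hR0 z)
    · rw [hz z h, mul_zero]
    · rw [integral_const_mul, inv_mul_cancel₀ hpos.ne']
    · intro c z hc; simp only [hcirc c z hc]

namespace IsMollifier

variable {r : ℝ} {ρ : (Fin n → ℂ) → ℝ}

theorem hasCompactSupport (h : IsMollifier r ρ) : HasCompactSupport ρ :=
  hasCompactSupport_of_eq_zero_of_le_norm h.eq_zero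

theorem integrable (h : IsMollifier r ρ) : Integrable ρ :=
  h.contDiff.continuous.integrable_of_hasCompactSupport h.hasCompactSupport

theorem neg (h : IsMollifier r ρ) (z : Fin n → ℂ) : ρ (-z) = ρ z := by
  have := h.circular (-1) z (by simp)
  simpa using this

end IsMollifier

theorem measurePreserving_smul_of_norm_eq_one {c : ℂ} (hc : ‖c‖ = 1) :
    MeasurePreserving (fun z : Fin n → ℂ => c • z) := by
  have h1 : MeasurePreserving (fun z : ℂ => c * z) := by
    have := (rotation ⟨c, by simp [Submonoid.unitSphere, hc]⟩).measurePreserving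
    exact this
  exact volume_preserving_pi (f := fun _ : Fin n => fun z : ℂ => c * z) fun _ => h1

theorem integral_smul_of_norm_eq_one {F : Type*} [NormedAddCommGroup F] [NormedSpace ℝ F]
    {c : ℂ} (hc : ‖c‖ = 1) (f : (Fin n → ℂ) → F) : ∫ z, f (c • z) = ∫ z, f z := by
  have hc0 : c ≠ 0 := by rintro rfl; simp at hc
  exact (measurePreserving_smul_of_norm_eq_one hc).integral_comp
    (Homeomorph.smulOfNeZero c hc0).measurableEmbedding f

/-- The mean value property of holomorphic functions with respect to circular mollifiers. -/
theorem IsMollifier.integral_mul_eq {r : ℝ} {ρ : (Fin n → ℂ) → ℝ} (h : IsMollifier r ρ)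
    {Ω : Set (Fin n → ℂ)} (hΩ : IsOpen Ω) {f : (Fin n → ℂ) → ℂ} (hf : DifferentiableOn ℂ f Ω)
    {z : Fin n → ℂ} (hz : Metric.closedBall z r ⊆ Ω) :
    ∫ w, f w * ρ (z - w) = f z := by
  have hcont : ContinuousOn f (Metric.closedBall z r) := hf.continuousOn.mono hz
  have e1 : ∫ w, f w * ρ (z - w) = ∫ w, f (z + w) * ρ w := by
    rw [← integral_add_left_eq_self _ z]
    simp [h.neg]
  have e2 : ∀ θ : ℝ, ∫ w, f (z + w) * ρ w = ∫ w, f (z + circleMap 0 1 θ • w) * ρ w := by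
    intro θ
    have hn : ‖circleMap 0 1 θ‖ = 1 := by simp
    rw [← integral_smul_of_norm_eq_one hn]
    simp only [h.circular _ _ hn]
  have hmean : ∀ w : Fin n → ℂ, ‖w‖ ≤ r →
      Real.circleAverage (fun t : ℂ => f (z + t • w)) 0 1 = f z := by
    intro w hw
    have hmem : ∀ t ∈ Metric.closedBall (0 : ℂ) 1, z + t • w ∈ Metric.closedBall z r := by
      intro t ht
      have ht' : ‖t‖ ≤ 1 := by simpa using ht
      simp only [Metric.mem_closedBall, dist_eq_norm, add_sub_cancel_left, norm_smul]
      calc ‖t‖ * ‖w‖ ≤ 1 * ‖w‖ := by gcongr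
        _ ≤ r := by linarith
    have := circleAverage_of_differentiable_on_off_countable (f := fun t : ℂ => f (z + t • w))
      (c := 0) (R := 1) (s := ∅) countable_empty ?_ ?_
    · rw [this]; simp
    · refine hcont.comp (by fun_prop) ?_
      intro t ht; exact hmem t (by simpa using ht)
    · intro t ht
      have ht' : t ∈ Metric.closedBall (0 : ℂ) 1 := by
        have := ht.1; simp at this ⊢; exact this.le
      have hd : DifferentiableAt ℂ f (z + t • w) :=
        hf.differentiableAt (hΩ.mem_nhds (hz (hmem t ht')))
      exact DifferentiableAt.comp t (g := f) (f := fun t : ℂ => z + t • w) hd (by fun_prop)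
  rw [e1]
  have hcl : ∀ θ (w : Fin n → ℂ), ‖w‖ ≤ r →
      z + circleMap 0 1 θ • w ∈ Metric.closedBall z r := by
    intro θ w hw
    simp only [Metric.mem_closedBall, dist_eq_norm, add_sub_cancel_left, norm_smul]
    simpa using hw
  have hjoint : IntegrableOn (Function.uncurry fun (θ : ℝ) (w : Fin n → ℂ) =>
      f (z + circleMap 0 1 θ • w) * ρ w) (Icc 0 (2 * Real.pi) ×ˢ Metric.closedBall 0 r)
      (volume.prod volume) := by
    refine ContinuousOn.integrableOn_compact (isCompact_Icc.prod (isCompact_closedBall _ _)) ?_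
    refine ContinuousOn.mul ?_ ?_
    · refine hcont.comp ?_ ?_
      · fun_prop
      · rintro ⟨θ, w⟩ ⟨_, hw⟩
        exact hcl θ w (by simpa using hw)
    · have := h.contDiff.continuous
      fun_prop
  have hset : ∀ F : (Fin n → ℂ) → ℂ, ∫ w, F w * ρ w =
      ∫ w in Metric.closedBall 0 r, F w * ρ w := by
    intro F
    rw [setIntegral_eq_integral_of_forall_compl_eq_zero]
    intro w hw
    have : r ≤ ‖w‖ := by simp at hw; exact hw.le
    rw [h.eq_zero w this]; simp
  have hpi : (0 : ℝ) < 2 * Real.pi := by positivity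
  have e3 : (2 * Real.pi) • ∫ w, f (z + w) * ρ w =
      ∫ θ in (0 : ℝ)..(2 * Real.pi), ∫ w in Metric.closedBall 0 r,
        f (z + circleMap 0 1 θ • w) * ρ w := by
    simp only [← hset, ← e2]
    simp
  have e4 : ∫ θ in (0 : ℝ)..(2 * Real.pi), ∫ w in Metric.closedBall 0 r,
        f (z + circleMap 0 1 θ • w) * ρ w = ∫ w in Metric.closedBall 0 r,
        ∫ θ in (0 : ℝ)..(2 * Real.pi), f (z + circleMap 0 1 θ • w) * ρ w := by
    simp only [intervalIntegral.integral_of_le hpi.le]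
    refine integral_integral_swap ?_
    have := hjoint.mono_set (Set.prod_mono (Ioc_subset_Icc_self (a := 0) (b := 2 * Real.pi))
      (Subset.refl (Metric.closedBall (0 : Fin n → ℂ) r)))
    rwa [IntegrableOn, ← Measure.prod_restrict] at this
  have e5 : ∫ w in Metric.closedBall 0 r,
        ∫ θ in (0 : ℝ)..(2 * Real.pi), f (z + circleMap 0 1 θ • w) * ρ w =
      ∫ w in Metric.closedBall 0 r, (2 * Real.pi) * f z * ρ w := by
    refine setIntegral_congr_fun Metric.isClosed_closedBall.measurableSet ?_
    intro w hw
    have h1 := hmean w (by simpa using hw)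
    simp only [intervalIntegral.integral_mul_const]
    rw [Real.circleAverage, inv_smul_eq_iff₀ hpi.ne'] at h1
    rw [h1]; simp
  rw [e4, e5, ← hset (fun _ => 2 * Real.pi * f z), integral_const_mul,
    integral_complex_ofReal, h.integral] at e3
  have hpi' : ((2 * Real.pi : ℝ) : ℂ) ≠ 0 := by exact_mod_cast hpi.ne'
  rw [Complex.real_smul] at e3
  apply mul_left_cancel₀ hpi'
  rw [e3]; simp

end Mollifier

/-! ### Convolutions and convergence in `L²` -/

section LTwo

variable {α : Type*} [MeasurableSpace α] {μ : Measure α}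

/-- Convergence of a sequence of functions in `L²`. -/
structure LTwoTendsto (μ : Measure α) (F : ℕ → α → ℂ) (f : α → ℂ) : Prop where
  memLp : ∀ m, MemLp (F m) 2 μ
  memLp_lim : MemLp f 2 μ
  tendsto : Tendsto (fun m => eLpNorm (F m - f) 2 μ) atTop (𝓝 0)

namespace LTwoTendsto

variable {F G : ℕ → α → ℂ} {f g : α → ℂ}

theorem const (hf : MemLp f 2 μ) : LTwoTendsto μ (fun _ => f) f :=
  ⟨fun _ => hf, hf, by simp⟩

theorem add (hF : LTwoTendsto μ F f) (hG : LTwoTendsto μ G g) :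
    LTwoTendsto μ (fun m x => F m x + G m x) (fun x => f x + g x) := by
  refine ⟨fun m => (hF.memLp m).add (hG.memLp m), hF.memLp_lim.add hG.memLp_lim, ?_⟩
  have h := hF.tendsto.add hG.tendsto
  rw [add_zero] at h
  refine tendsto_of_tendsto_of_tendsto_of_le_of_le tendsto_const_nhds h (fun _ => zero_le) ?_
  intro m
  have : (fun x => F m x + G m x) - (fun x => f x + g x) = (F m - f) + (G m - g) := by
    ext x; simp; ring
  simp only [this]
  exact eLpNorm_add_le ((hF.memLp m).sub hF.memLp_lim).1 ((hG.memLp m).sub hG.memLp_lim).1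
    (by norm_num)

theorem sum {ι : Type*} {s : Finset ι} {F : ι → ℕ → α → ℂ} {f : ι → α → ℂ}
    (h : ∀ i ∈ s, LTwoTendsto μ (F i) (f i)) :
    LTwoTendsto μ (fun m x => ∑ i ∈ s, F i m x) (fun x => ∑ i ∈ s, f i x) := by
  classical
  induction s using Finset.induction_on with
  | empty => simpa using const (μ := μ) (f := fun _ : α => (0 : ℂ)) MemLp.zero
  | insert a s ha ih =>
    simp only [Finset.sum_insert ha]
    exact (h a (by simp)).add (ih fun i hi => h i (by simp [hi]))

theorem bdd_mul {c : α → ℂ} {C : ℝ} (hc : AEStronglyMeasurable c μ) (hC : ∀ x, ‖c x‖ ≤ C)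
    (hF : LTwoTendsto μ F f) :
    LTwoTendsto μ (fun m x => c x * F m x) (fun x => c x * f x) := by
  have hm : ∀ {u : α → ℂ}, MemLp u 2 μ → MemLp (fun x => c x * u x) 2 μ := by
    intro u hu
    exact MemLp.of_le_mul hu (hc.mul hu.1)
      (Eventually.of_forall fun x => by rw [norm_mul]; gcongr; exact hC x : ∀ᵐ x ∂μ, ‖c x * u x‖ ≤ C * ‖u x‖)
  refine ⟨fun m => hm (hF.memLp m), hm hF.memLp_lim, ?_⟩
  have h := ENNReal.Tendsto.const_mul (a := ENNReal.ofReal C) hF.tendsto (Or.inr ENNReal.ofReal_ne_top)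
  rw [mul_zero] at h
  refine tendsto_of_tendsto_of_tendsto_of_le_of_le tendsto_const_nhds h (fun _ => zero_le) ?_
  intro m
  refine eLpNorm_le_mul_eLpNorm_of_ae_le_mul (Eventually.of_forall fun x => ?_) 2
  simp only [Pi.sub_apply]
  rw [← mul_sub, norm_mul]
  gcongr
  exact hC x

theorem neg (hF : LTwoTendsto μ F f) : LTwoTendsto μ (fun m x => - F m x) (fun x => - f x) := by
  have := bdd_mul (c := fun _ => -1) (C := 1) aestronglyMeasurable_const (by simp) hF
  simpa using this

theorem sub (hF : LTwoTendsto μ F f) (hG : LTwoTendsto μ G g) :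
    LTwoTendsto μ (fun m x => F m x - G m x) (fun x => f x - g x) := by
  simpa [sub_eq_add_neg] using hF.add hG.neg

theorem integral_mul_conj (hF : LTwoTendsto μ F f) (hG : LTwoTendsto μ G g) :
    Tendsto (fun m => ∫ x, F m x * starRingEnd ℂ (G m x) ∂μ) atTop
      (𝓝 (∫ x, f x * starRingEnd ℂ (g x) ∂μ)) := by
  have hl : ∀ {F : ℕ → α → ℂ} {f : α → ℂ} (h : LTwoTendsto μ F f),
      Tendsto (fun m => (h.memLp m).toLp (F m)) atTop (𝓝 (h.memLp_lim.toLp f)) := by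
    intro F f h
    rw [Lp.tendsto_Lp_iff_tendsto_eLpNorm'' _ h.memLp _ h.memLp_lim]
    exact h.tendsto
  have hi : ∀ {u v : α → ℂ} (hu : MemLp u 2 μ) (hv : MemLp v 2 μ),
      inner ℂ (hv.toLp v) (hu.toLp u) = ∫ x, u x * starRingEnd ℂ (v x) ∂μ := by
    intro u v hu hv
    rw [L2.inner_def]
    refine integral_congr_ae ?_
    filter_upwards [hu.coeFn_toLp, hv.coeFn_toLp] with x h1 h2
    rw [h1, h2, RCLike.inner_apply]
  have := (hl hG).inner (𝕜 := ℂ) (hl hF)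
  simpa only [hi] using this

theorem integral_norm_sq (hF : LTwoTendsto μ F f) :
    Tendsto (fun m => ∫ x, ‖F m x‖ ^ 2 ∂μ) atTop (𝓝 (∫ x, ‖f x‖ ^ 2 ∂μ)) := by
  have h := (hF.integral_mul_conj hF)
  simp only [Complex.mul_conj, Complex.normSq_eq_norm_sq] at h
  have h2 := (continuous_re.tendsto _).comp h
  simpa only [Function.comp_def, integral_complex_ofReal, ofReal_re] using h2

end LTwoTendsto

end LTwo

section Convolution

variable {n : ℕ}

/-- The convolution of two complex-valued functions on `ℂⁿ`. -/
noncomputable def mconv (F ρ : (Fin n → ℂ) → ℂ) (z : Fin n → ℂ) : ℂ := ∫ w, F w * ρ (z - w)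

theorem mconv_eq (F ρ : (Fin n → ℂ) → ℂ) :
    mconv F ρ = convolution F ρ (ContinuousLinearMap.mul ℝ ℂ) volume := rfl

theorem integrable_mconv {F ρ : (Fin n → ℂ) → ℂ} (hF : LocallyIntegrable F)
    (hρ : Continuous ρ) (hc : HasCompactSupport ρ) (z : Fin n → ℂ) :
    Integrable fun w => F w * ρ (z - w) :=
  hc.convolutionExists_right (ContinuousLinearMap.mul ℝ ℂ) hF hρ z

theorem contDiff_mconv {F ρ : (Fin n → ℂ) → ℂ} {k : ℕ∞} (hF : LocallyIntegrable F)
    (hρ : ContDiff ℝ k ρ) (hc : HasCompactSupport ρ) : ContDiff ℝ k (mconv F ρ) := by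
  rw [mconv_eq]
  exact hc.contDiff_convolution_right _ hF hρ

theorem fderiv_mconv {F ρ : (Fin n → ℂ) → ℂ} (hF : LocallyIntegrable F)
    (hρ : ContDiff ℝ 1 ρ) (hc : HasCompactSupport ρ) (z v : Fin n → ℂ) :
    fderiv ℝ (mconv F ρ) z v = mconv F (fun w => fderiv ℝ ρ w v) z := by
  rw [mconv_eq]
  rw [(hc.hasFDerivAt_convolution_right (ContinuousLinearMap.mul ℝ ℂ) hF hρ z).fderiv]
  rw [convolution_precompR_apply _ hF (hc.fderiv (𝕜 := ℝ)) (hρ.continuous_fderiv (by simp))]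
  rfl

theorem wder_mconv {F ρ : (Fin n → ℂ) → ℂ} (hF : LocallyIntegrable F)
    (hρ : ContDiff ℝ 1 ρ) (hc : HasCompactSupport ρ) (j : Fin n) (z : Fin n → ℂ) :
    wder n j (mconv F ρ) z = mconv F (wder n j ρ) z := by
  have hi : ∀ v : Fin n → ℂ, Integrable fun w => F w * fderiv ℝ ρ (z - w) v := fun v => by
    refine integrable_mconv (ρ := fun w => fderiv ℝ ρ w v) hF ?_ (hc.fderiv_apply (𝕜 := ℝ) v) z
    have := hρ.continuous_fderiv (by simp); fun_prop
  unfold wder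
  rw [fderiv_mconv hF hρ hc, fderiv_mconv hF hρ hc]
  unfold mconv
  rw [← integral_const_mul, ← integral_sub (hi _) ((hi _).const_mul _), ← integral_const_mul]
  congr 1; ext w; ring

theorem wderBar_mconv {F ρ : (Fin n → ℂ) → ℂ} (hF : LocallyIntegrable F)
    (hρ : ContDiff ℝ 1 ρ) (hc : HasCompactSupport ρ) (j : Fin n) (z : Fin n → ℂ) :
    wderBar n j (mconv F ρ) z = mconv F (wderBar n j ρ) z := by
  have hi : ∀ v : Fin n → ℂ, Integrable fun w => F w * fderiv ℝ ρ (z - w) v := fun v => by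
    refine integrable_mconv (ρ := fun w => fderiv ℝ ρ w v) hF ?_ (hc.fderiv_apply (𝕜 := ℝ) v) z
    have := hρ.continuous_fderiv (by simp); fun_prop
  unfold wderBar
  rw [fderiv_mconv hF hρ hc, fderiv_mconv hF hρ hc]
  unfold mconv
  rw [← integral_const_mul, ← integral_add (hi _) ((hi _).const_mul _), ← integral_const_mul]
  congr 1; ext w; ring

theorem fderiv_mirror {ρ : (Fin n → ℂ) → ℂ} (z w : Fin n → ℂ) :
    fderiv ℝ (fun w => ρ (z - w)) w = - fderiv ℝ ρ (z - w) := by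
  have h := (ContinuousLinearEquiv.neg ℝ (M := Fin n → ℂ)).comp_right_fderiv
    (f := fun y => ρ (y + z)) (x := w)
  rw [fderiv_comp_add_right] at h
  have e : (fun w => ρ (z - w)) = (fun y => ρ (y + z)) ∘ (ContinuousLinearEquiv.neg ℝ) := by
    ext w; simp [neg_add_eq_sub]
  rw [e, h]
  ext v
  simp [neg_add_eq_sub]

theorem wder_comp_const_sub {ρ : (Fin n → ℂ) → ℂ} (j : Fin n) (z w : Fin n → ℂ) :
    wder n j (fun w => ρ (z - w)) w = - wder n j ρ (z - w) := by
  simp only [wder, fderiv_mirror]; simp; ring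

theorem wderBar_comp_const_sub {ρ : (Fin n → ℂ) → ℂ} (j : Fin n) (z w : Fin n → ℂ) :
    wderBar n j (fun w => ρ (z - w)) w = - wderBar n j ρ (z - w) := by
  simp only [wderBar, fderiv_mirror]; simp; ring

theorem mconv_eq_zero {F : (Fin n → ℂ) → ℂ} {ρ : (Fin n → ℂ) → ℝ} {r : ℝ} (h : IsMollifier r ρ)
    {z : Fin n → ℂ} (hF : ∀ w, ‖z - w‖ < r → F w = 0) : mconv F (fun w => (ρ w : ℂ)) z = 0 := by
  unfold mconv
  rw [← integral_zero (Fin n → ℂ) ℂ]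
  congr 1; ext w
  by_cases hw : ‖z - w‖ < r
  · simp [hF w hw]
  · simp [h.eq_zero _ (not_lt.1 hw)]

theorem IsMollifier.ofReal_contDiff {ρ : (Fin n → ℂ) → ℝ} {r : ℝ} (h : IsMollifier r ρ) :
    ContDiff ℝ ∞ (fun w => (ρ w : ℂ)) := ofRealCLM.contDiff.comp h.contDiff

theorem IsMollifier.ofReal_hasCompactSupport {ρ : (Fin n → ℂ) → ℝ} {r : ℝ}
    (h : IsMollifier r ρ) : HasCompactSupport (fun w => (ρ w : ℂ)) :=
  h.hasCompactSupport.comp_left (g := ((↑) : ℝ → ℂ)) ofReal_zero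

theorem IsMollifier.lintegral {ρ : (Fin n → ℂ) → ℝ} {r : ℝ} (h : IsMollifier r ρ) :
    ∫⁻ w, ENNReal.ofReal (ρ w) = 1 := by
  rw [← ofReal_integral_eq_lintegral_ofReal h.integrable (Eventually.of_forall h.nonneg),
    h.integral, ENNReal.ofReal_one]

theorem enorm_mconv_sq_le {F : (Fin n → ℂ) → ℂ} {ρ : (Fin n → ℂ) → ℝ} {r : ℝ}
    (h : IsMollifier r ρ) (hF : AEStronglyMeasurable F) (z : Fin n → ℂ) :
    ‖mconv F (fun w => (ρ w : ℂ)) z‖ₑ ^ (2 : ℝ) ≤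
      ∫⁻ w, ‖F w‖ₑ ^ (2 : ℝ) * ENNReal.ofReal (ρ (z - w)) := by
  have hρ := h.contDiff.continuous
  set s : (Fin n → ℂ) → ENNReal := fun w => ENNReal.ofReal (Real.sqrt (ρ (z - w))) with hs
  have hsm : Measurable s := by
    refine ENNReal.measurable_ofReal.comp (Continuous.measurable ?_)
    fun_prop
  have hs2 : ∀ w, s w ^ (2 : ℝ) = ENNReal.ofReal (ρ (z - w)) := fun w => by
    simp only [hs]
    rw [ENNReal.ofReal_rpow_of_nonneg (Real.sqrt_nonneg _) (by norm_num), Real.rpow_two,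
      Real.sq_sqrt (h.nonneg _)]
  have hsint : ∫⁻ w, s w ^ (2 : ℝ) = 1 := by
    simp only [hs2]
    rw [lintegral_sub_left_eq_self (fun w => ENNReal.ofReal (ρ w)) z, h.lintegral]
  have h1 : ‖mconv F (fun w => (ρ w : ℂ)) z‖ₑ ≤ ∫⁻ w, ((fun w => ‖F w‖ₑ * s w) * s) w := by
    refine (enorm_integral_le_lintegral_enorm _).trans (lintegral_mono fun w => ?_)
    simp only [enorm_mul, Pi.mul_apply]
    rw [mul_assoc]
    gcongr
    rw [← pow_two, ← ENNReal.rpow_two, hs2, ← ofReal_norm, Complex.norm_real,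
      Real.norm_of_nonneg (h.nonneg _)]
  have h2 := ENNReal.lintegral_mul_le_Lp_mul_Lq volume Real.HolderConjugate.two_two
    (hF.enorm.mul hsm.aemeasurable) hsm.aemeasurable (f := fun w => ‖F w‖ₑ * s w) (g := s)
  rw [hsint, ENNReal.one_rpow, mul_one] at h2
  calc _ ≤ ((∫⁻ w, (‖F w‖ₑ * s w) ^ (2 : ℝ)) ^ (1 / 2 : ℝ)) ^ (2 : ℝ) := by
        gcongr; exact h1.trans h2
    _ = ∫⁻ w, (‖F w‖ₑ * s w) ^ (2 : ℝ) := by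
        rw [← ENNReal.rpow_mul]; norm_num
    _ = _ := by
        congr 1; ext w
        rw [ENNReal.mul_rpow_of_nonneg _ _ (by norm_num), hs2]

theorem eLpNorm_mconv_le {F : (Fin n → ℂ) → ℂ} {ρ : (Fin n → ℂ) → ℝ} {r : ℝ}
    (h : IsMollifier r ρ) (hF : AEStronglyMeasurable F) :
    eLpNorm (mconv F (fun w => (ρ w : ℂ))) 2 volume ≤ eLpNorm F 2 volume := by
  rw [eLpNorm_eq_lintegral_rpow_enorm_toReal (by norm_num) (by norm_num),
    eLpNorm_eq_lintegral_rpow_enorm_toReal (by norm_num) (by norm_num)]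
  simp only [ENNReal.toReal_ofNat]
  refine ENNReal.rpow_le_rpow ?_ (by norm_num)
  calc _ ≤ ∫⁻ z, ∫⁻ w, ‖F w‖ₑ ^ (2 : ℝ) * ENNReal.ofReal (ρ (z - w)) :=
        lintegral_mono fun z => enorm_mconv_sq_le h hF z
    _ = ∫⁻ w, ∫⁻ z, ‖F w‖ₑ ^ (2 : ℝ) * ENNReal.ofReal (ρ (z - w)) := by
        refine lintegral_lintegral_swap ?_
        refine AEMeasurable.mul ?_ ?_
        · exact (hF.enorm.pow_const _).comp_snd
        · refine (ENNReal.measurable_ofReal.comp ?_).aemeasurable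
          have := h.contDiff.continuous
          exact Continuous.measurable (by fun_prop)
    _ = _ := by
        congr 1; ext w
        rw [lintegral_const_mul', lintegral_sub_right_eq_self (fun z => ENNReal.ofReal (ρ z)) w,
          h.lintegral, mul_one]
        exact ENNReal.rpow_ne_top_of_nonneg (by norm_num) enorm_ne_top

theorem memLp_mconv {F : (Fin n → ℂ) → ℂ} {ρ : (Fin n → ℂ) → ℝ} {r : ℝ}
    (h : IsMollifier r ρ) (hF : MemLp F 2) : MemLp (mconv F (fun w => (ρ w : ℂ))) 2 := by
  refine ⟨?_, (eLpNorm_mconv_le h hF.1).trans_lt hF.2⟩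
  exact (contDiff_mconv (k := 0) (hF.locallyIntegrable (by norm_num))
    (h.ofReal_contDiff.of_le (by simp)) h.ofReal_hasCompactSupport).continuous.aestronglyMeasurable

theorem mconv_sub_self_le {G : (Fin n → ℂ) → ℂ} (hG : Continuous G) {ρ : (Fin n → ℂ) → ℝ} {r ε : ℝ}
    (h : IsMollifier r ρ) {z : Fin n → ℂ} (hε : ∀ w, ‖z - w‖ < r → ‖G w - G z‖ ≤ ε) :
    ‖mconv G (fun w => (ρ w : ℂ)) z - G z‖ ≤ ε := by
  have hi : Integrable fun w => (ρ (z - w) : ℂ) := by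
    have := h.integrable.comp_sub_left z
    exact this.ofReal
  have h1 : ∫ w, ρ (z - w) = 1 := by rw [integral_sub_left_eq_self ρ _ z, h.integral]
  have e : mconv G (fun w => (ρ w : ℂ)) z - G z = ∫ w, (G w - G z) * ρ (z - w) := by
    simp only [sub_mul]
    rw [integral_sub (integrable_mconv hG.locallyIntegrable h.ofReal_contDiff.continuous
      h.ofReal_hasCompactSupport z) (hi.const_mul _), integral_const_mul, integral_complex_ofReal, h1]
    simp [mconv]
  rw [e]
  calc _ ≤ ∫ w, ε * ρ (z - w) := by
        refine norm_integral_le_of_norm_le ((h.integrable.comp_sub_left z).const_mul _) ?_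
        refine Eventually.of_forall fun w => ?_
        rw [norm_mul, Complex.norm_real, Real.norm_of_nonneg (h.nonneg _)]
        by_cases hw : ‖z - w‖ < r
        · exact mul_le_mul_of_nonneg_right (hε w hw) (h.nonneg _)
        · simp [h.eq_zero _ (not_lt.1 hw)]
    _ = ε := by rw [integral_const_mul, h1, mul_one]

theorem mconv_sub {F G ρ : (Fin n → ℂ) → ℂ} (hF : LocallyIntegrable F) (hG : LocallyIntegrable G)
    (hρ : Continuous ρ) (hc : HasCompactSupport ρ) : mconv (F - G) ρ = mconv F ρ - mconv G ρ := by
  ext z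
  simp only [mconv, Pi.sub_apply, sub_mul]
  exact integral_sub (integrable_mconv hF hρ hc z) (integrable_mconv hG hρ hc z)

theorem tendsto_mconv_of_continuous {G : (Fin n → ℂ) → ℂ} (hG : Continuous G)
    (hc : HasCompactSupport G) {ρ : ℕ → (Fin n → ℂ) → ℝ} {r : ℕ → ℝ}
    (h : ∀ m, IsMollifier (r m) (ρ m)) (hr : Tendsto r atTop (𝓝 0)) :
    Tendsto (fun m => eLpNorm (mconv G (fun w => (ρ m w : ℂ)) - G) 2 volume) atTop (𝓝 0) := by
  obtain ⟨R, hR⟩ := hc.isCompact.isBounded.subset_closedBall 0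
  set K := Metric.closedBall (0 : Fin n → ℂ) (R + 1)
  have hKm : MeasurableSet K := Metric.isClosed_closedBall.measurableSet
  have hKf : volume K ≠ ⊤ := (isCompact_closedBall _ _).measure_ne_top
  have huc := hG.uniformContinuous_of_tendsto_cocompact
    (show Tendsto G (cocompact _) (𝓝 0) from hc.is_zero_at_infty)
  set A := volume K ^ (1 / (2 : ENNReal).toReal) with hA
  have hAt : A ≠ ⊤ := ENNReal.rpow_ne_top_of_nonneg (by simp) hKf
  have main : ∀ ε : ℝ, 0 < ε → ∀ᶠ m in atTop,
      eLpNorm (mconv G (fun w => (ρ m w : ℂ)) - G) 2 volume ≤ A * ENNReal.ofReal ε := by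
    intro ε hε
    obtain ⟨δ, hδ, hd⟩ := Metric.uniformContinuous_iff.1 huc ε hε
    filter_upwards [hr.eventually (gt_mem_nhds (lt_min hδ one_pos))] with m hm
    have hz : ∀ z ∉ K, (mconv G (fun w => (ρ m w : ℂ)) - G) z = 0 := by
      intro z hz
      have hz' : R + 1 < ‖z‖ := by simpa [K] using hz
      have hG0 : ∀ w, R < ‖w‖ → G w = 0 := by
        intro w hw
        by_contra hne
        have := hR (subset_tsupport G hne)
        simp at this; linarith
      rw [Pi.sub_apply, hG0 z (by linarith), mconv_eq_zero (h m), sub_zero]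
      intro w hw
      refine hG0 w ?_
      have := norm_sub_norm_le z w
      have := hm.trans_le (min_le_right _ _)
      linarith
    have hb : ∀ z, ‖(mconv G (fun w => (ρ m w : ℂ)) - G) z‖ ≤ ε := by
      intro z
      refine mconv_sub_self_le hG (h m) fun w hw => ?_
      rw [← dist_eq_norm]
      refine (hd ?_).le
      rw [dist_comm, dist_eq_norm]
      exact hw.trans (hm.trans_le (min_le_left _ _))
    have hres : eLpNorm (mconv G (fun w => (ρ m w : ℂ)) - G) 2 volume =
        eLpNorm (mconv G (fun w => (ρ m w : ℂ)) - G) 2 (volume.restrict K) := by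
      rw [← eLpNorm_indicator_eq_eLpNorm_restrict hKm]
      congr 1
      ext z
      by_cases hzK : z ∈ K
      · simp [hzK]
      · simp only [hzK, not_false_eq_true, Set.indicator_of_notMem, hz z hzK]
    rw [hres]
    refine (eLpNorm_le_of_ae_bound (Eventually.of_forall hb)).trans ?_
    simp [hA]
  rw [ENNReal.tendsto_nhds_zero]
  intro ε hε
  by_cases hεt : ε = ⊤
  · simp [hεt]
  · have hA1 : A.toReal + 1 > 0 := by positivity
    have hεp : 0 < ε.toReal := ENNReal.toReal_pos hε.ne' hεt
    filter_upwards [main (ε.toReal / (A.toReal + 1)) (by positivity)] with m hm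
    refine hm.trans ?_
    rw [← ENNReal.ofReal_toReal hAt, ← ENNReal.ofReal_mul (by positivity)]
    refine (ENNReal.ofReal_le_ofReal ?_).trans (ENNReal.ofReal_toReal hεt).le
    rw [ENNReal.toReal_ofReal (by positivity), mul_div_assoc', div_le_iff₀ hA1]
    nlinarith

theorem lTwoTendsto_mconv {F : (Fin n → ℂ) → ℂ} (hF : MemLp F 2)
    {ρ : ℕ → (Fin n → ℂ) → ℝ} {r : ℕ → ℝ}
    (h : ∀ m, IsMollifier (r m) (ρ m)) (hr : Tendsto r atTop (𝓝 0)) :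
    LTwoTendsto volume (fun m => mconv F (fun w => (ρ m w : ℂ))) F := by
  refine ⟨fun m => memLp_mconv (h m) hF, hF, ?_⟩
  rw [ENNReal.tendsto_nhds_zero]
  intro ε hε
  have hε3 : ε / 3 ≠ 0 := (ENNReal.div_pos hε.ne' (by norm_num)).ne'
  obtain ⟨G, hGc, hGε, hG, hGm⟩ := hF.exists_hasCompactSupport_eLpNorm_sub_le (by norm_num) hε3
  filter_upwards [(ENNReal.tendsto_nhds_zero.1 (tendsto_mconv_of_continuous hG hGc h hr)) _
    (pos_iff_ne_zero.2 hε3)] with m hm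
  have e : mconv F (fun w => (ρ m w : ℂ)) - F = mconv (F - G) (fun w => (ρ m w : ℂ)) +
      (mconv G (fun w => (ρ m w : ℂ)) - G) - (F - G) := by
    rw [mconv_sub (hF.locallyIntegrable (by norm_num)) hG.locallyIntegrable
      (h m).ofReal_contDiff.continuous (h m).ofReal_hasCompactSupport]
    abel
  have m1 := (memLp_mconv (h m) (hF.sub hGm)).1
  have m2 := ((memLp_mconv (h m) hGm).sub hGm).1
  rw [e]
  calc _ ≤ eLpNorm (mconv (F - G) (fun w => (ρ m w : ℂ)) +
        (mconv G (fun w => (ρ m w : ℂ)) - G)) 2 volume + eLpNorm (F - G) 2 volume :=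
        eLpNorm_sub_le (m1.add m2) (hF.sub hGm).1 (by norm_num)
    _ ≤ (eLpNorm (mconv (F - G) (fun w => (ρ m w : ℂ))) 2 volume +
        eLpNorm (mconv G (fun w => (ρ m w : ℂ)) - G) 2 volume) + eLpNorm (F - G) 2 volume := by
        gcongr; exact eLpNorm_add_le m1 m2 (by norm_num)
    _ ≤ (ε / 3 + ε / 3) + ε / 3 := by
        gcongr
        exact (eLpNorm_mconv_le (h m) (hF.sub hGm).1).trans hGε
    _ = ε := ENNReal.add_thirds ε

end Convolution

/-! ### Holomorphic functions and Weyl's lemma -/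

section Weyl

variable {n : ℕ}

theorem differentiableAt_of_wderBar_eq_zero {u : (Fin n → ℂ) → ℂ} {z : Fin n → ℂ}
    (hu : DifferentiableAt ℝ u z) (h : ∀ j, wderBar n j u z = 0) : DifferentiableAt ℂ u z := by
  set L := fderiv ℝ u z with hL
  have hj : ∀ j, L (Pi.single j I) = I * L (Pi.single j 1) := by
    intro j
    have h1 := h j
    simp only [wderBar, mul_eq_zero, ← hL] at h1
    have h2 := h1.resolve_left (by norm_num)
    linear_combination (-I) * h2 + L (Pi.single j I) * I_mul_I
  have hI : ∀ X, L (I • X) = I * L X := by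
    intro X
    rw [I_smul_eq_sum_re_im]
    conv_rhs => rw [eq_sum_re_im X]
    simp only [map_sum, map_sub, map_add, map_smul, hj, Finset.mul_sum, Complex.real_smul]
    refine Finset.sum_congr rfl fun j _ => ?_
    linear_combination (-(X j).im * L (Pi.single j 1)) * I_mul_I
  let L' : (Fin n → ℂ) →L[ℂ] ℂ :=
    { toFun := L
      map_add' := L.map_add
      map_smul' := by
        intro c X
        have : c • X = c.re • X + c.im • (I • X) := by
          ext i
          simp only [Pi.add_apply, Pi.smul_apply, smul_eq_mul, Complex.real_smul]
          conv_lhs => rw [← re_add_im c]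
          ring
        rw [this, map_add, map_smul, map_smul, hI]
        simp only [Complex.real_smul, smul_eq_mul, RingHom.id_apply]
        conv_rhs => rw [← re_add_im c]
        ring
      cont := L.cont }
  exact (hasFDerivAt_of_restrictScalars ℝ (f' := L') hu.hasFDerivAt (by ext; rfl)).differentiableAt

theorem wderBar_eq_zero_of_differentiableAt {u : (Fin n → ℂ) → ℂ} {z : Fin n → ℂ}
    (hu : DifferentiableAt ℂ u z) (j : Fin n) : wderBar n j u z = 0 := by
  have h := hu.fderiv_restrictScalars ℝ
  have e : (Pi.single j I : Fin n → ℂ) = I • Pi.single j 1 := by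
    rw [← Pi.single_smul]; simp
  simp only [wderBar, h, e]
  simp only [ContinuousLinearMap.coe_restrictScalars', map_smul, smul_eq_mul]
  linear_combination (1 / 2 * (fderiv ℂ u z) (Pi.single j 1)) * I_mul_I

/-- `F` is weakly holomorphic on `Ω`. -/
def WeaklyHolomorphic (n : ℕ) (Ω : Set (Fin n → ℂ)) (F : (Fin n → ℂ) → ℂ) : Prop :=
  ∀ (j : Fin n) (η : (Fin n → ℂ) → ℂ), ContDiff ℝ 2 η → HasCompactSupport η → tsupport η ⊆ Ω →
    ∫ z, F z * wderBar n j η z = 0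

theorem tsupport_mirror_subset {ρ : (Fin n → ℂ) → ℝ} {r : ℝ} (h : IsMollifier r ρ)
    (z : Fin n → ℂ) : tsupport (fun w => (ρ (z - w) : ℂ)) ⊆ Metric.closedBall z r := by
  refine closure_minimal (fun w hw => ?_) Metric.isClosed_closedBall
  by_contra hne
  refine hw ?_
  rw [Metric.mem_closedBall, dist_comm, dist_eq_norm, not_le] at hne
  simp [h.eq_zero _ hne.le]

theorem IsMollifier.contDiff_mirror {ρ : (Fin n → ℂ) → ℝ} {r : ℝ} (h : IsMollifier r ρ)
    (z : Fin n → ℂ) : ContDiff ℝ ∞ (fun w => (ρ (z - w) : ℂ)) :=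
  h.ofReal_contDiff.comp (contDiff_const.sub contDiff_id)

theorem IsMollifier.hasCompactSupport_mirror {ρ : (Fin n → ℂ) → ℝ} {r : ℝ} (h : IsMollifier r ρ)
    (z : Fin n → ℂ) : HasCompactSupport (fun w => (ρ (z - w) : ℂ)) :=
  (isCompact_closedBall z r).of_isClosed_subset (isClosed_tsupport _) (tsupport_mirror_subset h z)

theorem memLp_mirror {ρ : (Fin n → ℂ) → ℝ} {r : ℝ} (h : IsMollifier r ρ) (z : Fin n → ℂ) :
    MemLp (fun w => (ρ (z - w) : ℂ)) 2 :=
  (h.contDiff_mirror z).continuous.memLp_of_hasCompactSupport (h.hasCompactSupport_mirror z)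

theorem differentiableAt_mconv {Ω : Set (Fin n → ℂ)} {F : (Fin n → ℂ) → ℂ} (hF : MemLp F 2)
    (hw : WeaklyHolomorphic n Ω F) {ρ : (Fin n → ℂ) → ℝ} {r : ℝ} (h : IsMollifier r ρ)
    {z : Fin n → ℂ} (hz : Metric.closedBall z r ⊆ Ω) :
    DifferentiableAt ℂ (mconv F (fun w => (ρ w : ℂ))) z := by
  have hl : LocallyIntegrable F := hF.locallyIntegrable (by norm_num)
  have h1 : ContDiff ℝ 1 (fun w => (ρ w : ℂ)) := h.ofReal_contDiff.of_le (mod_cast le_top)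
  refine differentiableAt_of_wderBar_eq_zero
    ((contDiff_mconv (k := 1) hl h1 h.ofReal_hasCompactSupport).differentiable (by simp) z)
    fun j => ?_
  rw [wderBar_mconv hl h1 h.ofReal_hasCompactSupport]
  have := hw j (fun w => (ρ (z - w) : ℂ)) ((h.contDiff_mirror z).of_le (WithTop.coe_le_coe.2 (le_top (a := (2 : ℕ∞)))))
    (h.hasCompactSupport_mirror z) ((tsupport_mirror_subset h z).trans hz)
  have e : ∀ w, wderBar n j (fun w => (ρ (z - w) : ℂ)) w =
      - wderBar n j (fun w => (ρ w : ℂ)) (z - w) :=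
    wderBar_comp_const_sub (ρ := fun w => (ρ w : ℂ)) j z
  simp only [e, mul_neg, integral_neg,
    neg_eq_zero] at this
  exact this

theorem tendsto_mconv_mconv {Ω : Set (Fin n → ℂ)} {F : (Fin n → ℂ) → ℂ} (hF : MemLp F 2)
    (hw : WeaklyHolomorphic n Ω F) {ρ : ℕ → (Fin n → ℂ) → ℝ} {r : ℕ → ℝ}
    (h : ∀ m, IsMollifier (r m) (ρ m)) (hr : Tendsto r atTop (𝓝 0))
    {σ : (Fin n → ℂ) → ℝ} {R : ℝ} (hR : 0 < R) (hσ : IsMollifier R σ) {z : Fin n → ℂ}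
    (hz : Metric.ball z (3 * R) ⊆ Ω) :
    Tendsto (fun m => mconv F (fun w => (ρ m w : ℂ)) z) atTop
      (𝓝 (mconv F (fun w => (σ w : ℂ)) z)) := by
  have h1 := (lTwoTendsto_mconv hF h hr).integral_mul_conj (LTwoTendsto.const (memLp_mirror hσ z))
  simp only [conj_ofReal] at h1
  refine h1.congr' ?_
  filter_upwards [hr.eventually (gt_mem_nhds hR)] with m hm
  refine hσ.integral_mul_eq (Ω := Metric.ball z (2 * R)) Metric.isOpen_ball ?_ ?_
  · intro w hw'
    refine (differentiableAt_mconv hF hw (h m) (Subset.trans ?_ hz)).differentiableWithinAt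
    refine Metric.closedBall_subset_ball' ?_
    have := Metric.mem_ball.1 hw'
    linarith
  · exact Metric.closedBall_subset_ball (by linarith)

/-- **Weyl's lemma** for the Cauchy–Riemann equations in `L²`. -/
theorem WeaklyHolomorphic.exists_differentiableOn {Ω : Set (Fin n → ℂ)} (hΩ : IsOpen Ω)
    {F : (Fin n → ℂ) → ℂ} (hF : MemLp F 2) (hw : WeaklyHolomorphic n Ω F) :
    ∃ f : (Fin n → ℂ) → ℂ, DifferentiableOn ℂ f Ω ∧ f =ᵐ[volume.restrict Ω] F := by
  have hr : Tendsto (fun m : ℕ => 1 / ((m : ℝ) + 1)) atTop (𝓝 0) :=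
    tendsto_one_div_add_atTop_nhds_zero_nat
  choose ρ hρ using fun m : ℕ => exists_isMollifier (n := n) (r := 1 / ((m : ℝ) + 1)) (by positivity)
  have hloc : ∀ z₀ ∈ Ω, ∃ R > 0, ∃ g : (Fin n → ℂ) → ℂ, DifferentiableOn ℂ g (Metric.ball z₀ R) ∧
      ∀ z ∈ Metric.ball z₀ R, Tendsto (fun m => mconv F (fun w => (ρ m w : ℂ)) z) atTop (𝓝 (g z)) := by
    intro z₀ hz₀
    obtain ⟨ε, hε, hb⟩ := Metric.isOpen_iff.1 hΩ z₀ hz₀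
    have hR : 0 < ε / 4 := by positivity
    obtain ⟨σ, hσ⟩ := exists_isMollifier (n := n) hR
    have hsub : ∀ z ∈ Metric.ball z₀ (ε / 4), Metric.ball z (3 * (ε / 4)) ⊆ Ω := by
      intro z hz
      refine (Metric.ball_subset_ball' ?_).trans hb
      have := Metric.mem_ball.1 hz
      linarith
    refine ⟨ε / 4, hR, mconv F (fun w => (σ w : ℂ)), fun z hz => ?_, fun z hz => ?_⟩
    · refine (differentiableAt_mconv hF hw hσ ?_).differentiableWithinAt
      exact (Metric.closedBall_subset_ball (by linarith)).trans (hsub z hz)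
    · exact tendsto_mconv_mconv hF hw hρ hr hR hσ (hsub z hz)
  set f : (Fin n → ℂ) → ℂ := fun z => limUnder atTop (fun m => mconv F (fun w => (ρ m w : ℂ)) z)
    with hf
  have hlim : ∀ z ∈ Ω, Tendsto (fun m => mconv F (fun w => (ρ m w : ℂ)) z) atTop (𝓝 (f z)) := by
    intro z hz
    obtain ⟨R, hR, g, -, hg⟩ := hloc z hz
    exact tendsto_nhds_limUnder ⟨_, hg z (Metric.mem_ball_self hR)⟩
  refine ⟨f, fun z hz => ?_, ?_⟩
  · obtain ⟨R, hR, g, hg, hg'⟩ := hloc z hz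
    refine DifferentiableAt.differentiableWithinAt ?_
    refine ((hg z (Metric.mem_ball_self hR)).differentiableAt
      (Metric.ball_mem_nhds z hR)).congr_of_eventuallyEq ?_
    filter_upwards [Metric.ball_mem_nhds z hR] with w hw'
    exact (hg' w hw').limUnder_eq
  · have hL := lTwoTendsto_mconv hF hρ hr
    have hm := tendstoInMeasure_of_tendsto_eLpNorm (p := 2) (by norm_num) (fun m => (hL.memLp m).1)
      hF.1 hL.tendsto
    obtain ⟨ns, hns, hae⟩ := hm.exists_seq_tendsto_ae
    refine (ae_restrict_iff' hΩ.measurableSet).2 ?_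
    filter_upwards [hae] with z hz hzΩ
    exact tendsto_nhds_unique ((hlim z hzΩ).comp hns.tendsto_atTop) hz

end Weyl

/-! ### The basic inequality for square-integrable forms with weak derivatives -/

section BasicWeak

variable {n : ℕ}

theorem exists_cutoff {K Ω : Set (Fin n → ℂ)} (hK : IsCompact K) (hΩ : IsOpen Ω) (hKΩ : K ⊆ Ω) :
    ∃ χ : (Fin n → ℂ) → ℝ, ContDiff ℝ ∞ χ ∧ HasCompactSupport χ ∧ tsupport χ ⊆ Ω ∧
      (∀ z ∈ K, χ =ᶠ[𝓝 z] fun _ => 1) ∧ ∀ z, 0 ≤ χ z ∧ χ z ≤ 1 := by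
  obtain ⟨L, hL, hKL, hLΩ⟩ := exists_compact_between hK hΩ hKΩ
  obtain ⟨f, h1, h0, h01⟩ := exists_contMDiffMap_one_nhds_of_subset_interior
    (n := ⊤) (modelWithCornersSelf ℝ (Fin n → ℂ)) hK.isClosed hKL
  have hts : tsupport f ⊆ L := closure_minimal (fun z hz => by
    by_contra hn
    exact hz (h0 z hn)) hL.isClosed
  refine ⟨f, f.contMDiff.contDiff, hL.of_isClosed_subset (isClosed_tsupport _) hts,
    hts.trans hLΩ, fun z hz => ?_, fun z => h01 z⟩
  exact h1.filter_mono (nhds_le_nhdsSet hz)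

theorem contDiff_of_eq_zero_off {F : Type*} [NormedAddCommGroup F] [NormedSpace ℝ F]
    {K Ω : Set (Fin n → ℂ)} (hK : IsClosed K) (hKΩ : K ⊆ Ω)
    {k : WithTop ℕ∞} {g : (Fin n → ℂ) → F} (hg : ∀ z ∈ Ω, ContDiffAt ℝ k g z)
    (h0 : ∀ z, z ∉ K → g z = 0) : ContDiff ℝ k g := by
  rw [contDiff_iff_contDiffAt]
  intro z
  by_cases hz : z ∈ K
  · exact hg z (hKΩ hz)
  · refine (contDiffAt_const (c := (0 : F))).congr_of_eventuallyEq ?_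
    filter_upwards [hK.isOpen_compl.mem_nhds hz] with w hw
    exact h0 w hw

theorem exists_norm_le_of_hasCompactSupport {g : (Fin n → ℂ) → ℂ} (hg : Continuous g)
    (hc : HasCompactSupport g) : ∃ C, ∀ z, ‖g z‖ ≤ C := by
  obtain ⟨C, hC⟩ := hc.exists_bound_of_continuous hg
  exact ⟨C, hC⟩

theorem hasCompactSupport_mconv {F : (Fin n → ℂ) → ℂ} {K : Set (Fin n → ℂ)} (hK : IsCompact K)
    (hF : ∀ z, z ∉ K → F z = 0) {ρ : (Fin n → ℂ) → ℝ} {r : ℝ} (h : IsMollifier r ρ) :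
    HasCompactSupport (mconv F (fun w => (ρ w : ℂ))) := by
  obtain ⟨R, hR⟩ := hK.isBounded.subset_closedBall 0
  refine hasCompactSupport_of_eq_zero_of_le_norm (r := R + r + 1) fun z hz => ?_
  refine mconv_eq_zero h fun w hw => hF w fun hwK => ?_
  have := hR hwK
  simp only [Metric.mem_closedBall, dist_zero_right] at this
  have := norm_sub_norm_le z w
  linarith

theorem mconv_congr_weak {m : ℕ} {F : Fin m → (Fin n → ℂ) → ℂ} {k : (Fin n → ℂ) → ℂ}
    {D : Fin m → ((Fin n → ℂ) → ℂ) → (Fin n → ℂ) → ℂ} {ρ : (Fin n → ℂ) → ℝ} {r : ℝ}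
    (h : IsMollifier r ρ)
    (hD : ∀ j z w, D j (fun w => (ρ (z - w) : ℂ)) w = - D j (fun w => (ρ w : ℂ)) (z - w))
    (hi : ∀ j z, Integrable fun w => F j w * D j (fun w => (ρ w : ℂ)) (z - w))
    (hk : ∀ η, ContDiff ℝ ∞ η → HasCompactSupport η →
      ∫ z, ∑ j, F j z * D j η z = - ∫ z, k z * η z) (z : Fin n → ℂ) :
    ∑ j, mconv (F j) (D j (fun w => (ρ w : ℂ))) z = mconv k (fun w => (ρ w : ℂ)) z := by
  have := hk _ (h.contDiff_mirror z) (h.hasCompactSupport_mirror z)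
  simp only [hD, mul_neg, Finset.sum_neg_distrib, integral_neg, neg_inj] at this
  unfold mconv
  rw [← this, integral_finsetSum _ fun j _ => hi j z]

theorem integral_leviForm_le_of_weak_of_hasCompactSupport {φ : (Fin n → ℂ) → ℝ}
    (hφ : ContDiff ℝ 2 φ) (hφc : HasCompactSupport φ) {K : Set (Fin n → ℂ)} (hK : IsCompact K)
    {f : Fin n → (Fin n → ℂ) → ℂ} {k : (Fin n → ℂ) → ℂ} {W : Fin n → Fin n → (Fin n → ℂ) → ℂ}
    (hf : ∀ j, MemLp (f j) 2) (hk : MemLp k 2) (hW : ∀ j l, MemLp (W j l) 2)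
    (hf0 : ∀ j z, z ∉ K → f j z = 0)
    (hdiv : ∀ η, ContDiff ℝ ∞ η → HasCompactSupport η →
      ∫ z, ∑ j, f j z * wder n j η z = - ∫ z, k z * η z)
    (hcurl : ∀ j l η, ContDiff ℝ ∞ η → HasCompactSupport η →
      ∫ z, (f l z * wderBar n j η z - f j z * wderBar n l η z) = - ∫ z, W j l z * η z) :
    ∫ z, leviForm φ z (fun j => f j z) * Real.exp (-φ z) ≤
      (∫ z, ‖k z - ∑ j, wder n j (fun v => (φ v : ℂ)) z * f j z‖ ^ 2 * Real.exp (-φ z)) +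
      (1 / 2) * ∫ z, (∑ j, ∑ l, ‖W j l z‖ ^ 2) * Real.exp (-φ z) := by
  have hφ2 : ContDiff ℝ 2 (fun v => (φ v : ℂ)) := ofRealCLM.contDiff.comp hφ
  have hφc2 : HasCompactSupport (fun v => (φ v : ℂ)) :=
    hφc.comp_left (g := ((↑) : ℝ → ℂ)) ofReal_zero
  have hr : Tendsto (fun m : ℕ => 1 / ((m : ℝ) + 1)) atTop (𝓝 0) :=
    tendsto_one_div_add_atTop_nhds_zero_nat
  choose ρ hρ using fun m : ℕ => exists_isMollifier (n := n) (r := 1 / ((m : ℝ) + 1)) (by positivity)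
  set ρc : ℕ → (Fin n → ℂ) → ℂ := fun m w => (ρ m w : ℂ) with hρc
  have hρ1 : ∀ m, ContDiff ℝ 1 (ρc m) := fun m => (hρ m).ofReal_contDiff.of_le (mod_cast le_top)
  have hρs : ∀ m, HasCompactSupport (ρc m) := fun m => (hρ m).ofReal_hasCompactSupport
  have hl : ∀ j, LocallyIntegrable (f j) := fun j => (hf j).locallyIntegrable (by norm_num)
  set F : ℕ → Fin n → (Fin n → ℂ) → ℂ := fun m j => mconv (f j) (ρc m) with hF
  have hFsm : ∀ m j, ContDiff ℝ 2 (F m j) := fun m j =>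
    contDiff_mconv (k := 2) (hl j)
      ((hρ m).ofReal_contDiff.of_le (WithTop.coe_le_coe.2 (le_top (a := (2 : ℕ∞))))) (hρs m)
  have hFc : ∀ m j, HasCompactSupport (F m j) := fun m j =>
    hasCompactSupport_mconv hK (hf0 j) (hρ m)
  have hdivF : ∀ m z, ∑ j, wder n j (F m j) z = mconv k (ρc m) z := by
    intro m z
    simp only [hF, wder_mconv (hl _) (hρ1 m) (hρs m)]
    refine mconv_congr_weak (D := fun j => wder n j) (hρ m)
      (fun j z w => wder_comp_const_sub (ρ := ρc m) j z w) (fun j z => ?_) hdiv z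
    exact integrable_mconv (hl j) ((hρ1 m).wder (m := 0) j (by norm_num)).continuous
      ((hρs m).wder j) z
  have hcurlF : ∀ m j l z, wderBar n j (F m l) z - wderBar n l (F m j) z =
      mconv (W j l) (ρc m) z := by
    intro m j l z
    simp only [hF, wderBar_mconv (hl _) (hρ1 m) (hρs m)]
    have h := mconv_congr_weak (m := 2) (F := ![f l, fun z => - f j z])
      (D := ![wderBar n j, wderBar n l]) (k := W j l) (hρ m) ?_ ?_ ?_ z
    · simp only [Fin.sum_univ_two, Matrix.cons_val_zero, Matrix.cons_val_one] at h
      rw [← h]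
      simp [mconv, integral_neg, sub_eq_add_neg, hρc]
    · intro i z w
      fin_cases i
      · exact wderBar_comp_const_sub (ρ := ρc m) j z w
      · exact wderBar_comp_const_sub (ρ := ρc m) l z w
    · intro i z
      have hInt : ∀ i l, Integrable fun w => f i w * wderBar n l (ρc m) (z - w) := fun i l =>
        integrable_mconv (hl i) ((hρ1 m).wderBar (m := 0) l (by norm_num)).continuous
          ((hρs m).wderBar l) z
      fin_cases i
      · exact hInt l j
      · simpa using (hInt j l).neg
    · intro η hη hηc
      simpa [Fin.sum_univ_two, sub_eq_add_neg] using hcurl j l η hη hηc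
  have hLF : ∀ j, LTwoTendsto volume (fun m => F m j) (f j) := fun j =>
    lTwoTendsto_mconv (hf j) hρ hr
  have hLk : LTwoTendsto volume (fun m => mconv k (ρc m)) k := lTwoTendsto_mconv hk hρ hr
  have hLW : ∀ j l, LTwoTendsto volume (fun m => mconv (W j l) (ρc m)) (W j l) := fun j l =>
    lTwoTendsto_mconv (hW j l) hρ hr
  set e : (Fin n → ℂ) → ℂ := fun z => (Real.exp (-φ z / 2) : ℂ) with he
  have hec : Continuous e := by have := hφ.continuous; fun_prop
  obtain ⟨B, hB⟩ := exists_norm_le_of_hasCompactSupport hφ2.continuous hφc2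
  have heB : ∀ z, ‖e z‖ ≤ Real.exp (B / 2) := by
    intro z
    have := hB z
    simp only [he, Complex.norm_real, Real.norm_eq_abs, Real.abs_exp] at this ⊢
    have := neg_abs_le (φ z)
    exact Real.exp_le_exp.2 (by linarith)
  have he2 : ∀ z (x : ℂ), ‖e z * x‖ ^ 2 = ‖x‖ ^ 2 * Real.exp (-φ z) := by
    intro z x
    simp only [he, norm_mul, Complex.norm_real, Real.norm_eq_abs, Real.abs_exp, mul_pow]
    rw [← Real.exp_nat_mul, mul_comm]
    congr 2; push_cast; ring
  have ineq : ∀ m, _ := fun m => integral_leviForm_le hφ (hFsm m) (hFc m)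
  have lim1 : Tendsto (fun m => ∫ z, leviForm φ z (fun j => F m j z) * Real.exp (-φ z)) atTop
      (𝓝 (∫ z, leviForm φ z (fun j => f j z) * Real.exp (-φ z))) := by
    have hH : ∀ j k, Continuous fun z => cHess n φ z j k := fun j k =>
      ((hφ2.wder (m := 1) j (by norm_num)).wderBar (m := 0) k (by norm_num)).continuous
    set c : Fin n → Fin n → (Fin n → ℂ) → ℂ := fun j k z => cHess n φ z j k * Real.exp (-φ z) with hcd
    have hcc : ∀ j k, Continuous (c j k) := fun j k => by
      have := hH j k
      have := hφ.continuous
      fun_prop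
    have hcb : ∀ j k, ∃ C, ∀ z, ‖c j k z‖ ≤ C := fun j k =>
      exists_norm_le_of_hasCompactSupport (hcc j k) (((hφc2.wder j).wderBar k).mul_right)
    choose C hC using hcb
    have hInt : ∀ {u v : (Fin n → ℂ) → ℂ}, MemLp u 2 → MemLp v 2 →
        Integrable fun z => u z * starRingEnd ℂ (v z) := fun hu hv => hu.integrable_mul hv.star
    have hs : ∀ G : Fin n → (Fin n → ℂ) → ℂ, (∀ j, MemLp (G j) 2) →
        (∀ j k, MemLp (fun z => c j k z * G j z) 2) →
        ∫ z, leviForm φ z (fun j => G j z) * Real.exp (-φ z) =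
          (∑ j, ∑ k, ∫ z, (c j k z * G j z) * starRingEnd ℂ (G k z)).re := by
      intro G hG hcG
      have hi : ∀ j k, Integrable fun z => (c j k z * G j z) * starRingEnd ℂ (G k z) :=
        fun j k => hInt (hcG j k) (hG k)
      rw [← Finset.sum_congr rfl fun j _ => integral_finsetSum _ fun l _ => hi j l,
        ← integral_finsetSum _ fun j _ => integrable_finsetSum _ fun l _ => hi j l]
      have hre := reCLM.integral_comp_comm (integrable_finsetSum (Finset.univ : Finset (Fin n))
        fun j _ => integrable_finsetSum (Finset.univ : Finset (Fin n)) fun l _ => hi j l)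
      simp only [reCLM_apply] at hre
      rw [← hre]
      refine integral_congr_ae (Eventually.of_forall fun z => ?_)
      simp only
      rw [← hermForm_cHess hφ.contDiffAt, hermForm, ← re_mul_ofReal, Finset.sum_mul]
      simp only [Finset.sum_mul, hcd]
      congr 1
      refine Finset.sum_congr rfl fun j _ => Finset.sum_congr rfl fun k _ => ?_
      ring
    have hcG : ∀ j k, _ := fun j k =>
      (hLF j).bdd_mul (hcc j k).aestronglyMeasurable (hC j k)
    rw [hs f hf fun j k => (hcG j k).memLp_lim]
    simp only [hs _ (fun j => (hLF j).memLp _) fun j k => (hcG j k).memLp _]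
    refine (continuous_re.tendsto _).comp ?_
    exact tendsto_finsetSum _ fun j _ => tendsto_finsetSum _ fun l _ =>
      (hcG j l).integral_mul_conj (hLF l)
  have lim2 : Tendsto (fun m => ∫ z, ‖∑ j, wAdj φ j (F m j) z‖ ^ 2 * Real.exp (-φ z)) atTop
      (𝓝 (∫ z, ‖k z - ∑ j, wder n j (fun v => (φ v : ℂ)) z * f j z‖ ^ 2 * Real.exp (-φ z))) := by
    have hdb : ∀ j, ∃ C, ∀ z, ‖wder n j (fun v => (φ v : ℂ)) z‖ ≤ C := fun j =>
      exists_norm_le_of_hasCompactSupport (hφ2.wder (m := 1) j (by norm_num)).continuous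
        (hφc2.wder j)
    choose C hC using hdb
    have h := ((hLk.sub (LTwoTendsto.sum (s := Finset.univ) fun j _ => (hLF j).bdd_mul
      (hφ2.wder (m := 1) j (by norm_num)).continuous.aestronglyMeasurable (hC j))).bdd_mul
      hec.aestronglyMeasurable heB).integral_norm_sq
    simp only [he2] at h
    simpa only [wAdj, Finset.sum_sub_distrib, hdivF] using h
  have lim3 : Tendsto (fun m => ∫ z, (∑ j, ∑ l, ‖wderBar n j (F m l) z - wderBar n l (F m j) z‖ ^ 2) *
      Real.exp (-φ z)) atTop (𝓝 (∫ z, (∑ j, ∑ l, ‖W j l z‖ ^ 2) * Real.exp (-φ z))) := by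
    have h1 : ∀ j l, _ := fun j l => (hLW j l).bdd_mul hec.aestronglyMeasurable heB
    have hs : ∀ G : Fin n → Fin n → (Fin n → ℂ) → ℂ, (∀ j l, MemLp (fun z => e z * G j l z) 2) →
        ∫ z, (∑ j, ∑ l, ‖G j l z‖ ^ 2) * Real.exp (-φ z) = ∑ j, ∑ l, ∫ z, ‖e z * G j l z‖ ^ 2 := by
      intro G hG
      have hi : ∀ j l, Integrable fun z => ‖e z * G j l z‖ ^ 2 := fun j l =>
        (memLp_two_iff_integrable_sq_norm (hG j l).1).1 (hG j l)
      rw [← Finset.sum_congr rfl fun j _ => integral_finsetSum _ fun l _ => hi j l,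
        ← integral_finsetSum _ fun j _ => integrable_finsetSum _ fun l _ => hi j l]
      simp only [he2, Finset.sum_mul]
    simp only [hcurlF]
    rw [hs W fun j l => (h1 j l).memLp_lim]
    simp only [hs _ fun j l => (h1 j l).memLp _]
    exact tendsto_finsetSum _ fun j _ => tendsto_finsetSum _ fun l _ => (h1 j l).integral_norm_sq
  exact le_of_tendsto_of_tendsto' lim1 (lim2.add (lim3.const_mul _)) ineq

theorem integral_leviForm_le_of_weak {Ω K : Set (Fin n → ℂ)} (hΩ : IsOpen Ω) (hK : IsCompact K)
    (hKΩ : K ⊆ Ω) {φ : (Fin n → ℂ) → ℝ} (hφ : ∀ z ∈ Ω, ContDiffAt ℝ 2 φ z)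
    {f : Fin n → (Fin n → ℂ) → ℂ} {k : (Fin n → ℂ) → ℂ} {W : Fin n → Fin n → (Fin n → ℂ) → ℂ}
    (hf : ∀ j, MemLp (f j) 2) (hk : MemLp k 2) (hW : ∀ j l, MemLp (W j l) 2)
    (hf0 : ∀ j z, z ∉ K → f j z = 0) (hk0 : ∀ z, z ∉ K → k z = 0)
    (hW0 : ∀ j l z, z ∉ K → W j l z = 0)
    (hdiv : ∀ η, ContDiff ℝ ∞ η → HasCompactSupport η →
      ∫ z, ∑ j, f j z * wder n j η z = - ∫ z, k z * η z)
    (hcurl : ∀ j l η, ContDiff ℝ ∞ η → HasCompactSupport η →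
      ∫ z, (f l z * wderBar n j η z - f j z * wderBar n l η z) = - ∫ z, W j l z * η z) :
    ∫ z, leviForm φ z (fun j => f j z) * Real.exp (-φ z) ≤
      (∫ z, ‖k z - ∑ j, wder n j (fun v => (φ v : ℂ)) z * f j z‖ ^ 2 * Real.exp (-φ z)) +
      (1 / 2) * ∫ z, (∑ j, ∑ l, ‖W j l z‖ ^ 2) * Real.exp (-φ z) := by
  obtain ⟨χ, hχ, hχc, hχΩ, hχ1, -⟩ := exists_cutoff hK hΩ hKΩ
  have hs : ContDiff ℝ 2 fun z => χ z * φ z := by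
    refine contDiff_of_eq_zero_off (isClosed_tsupport χ) hχΩ (fun z hz => ?_) fun z hz => ?_
    · exact (hχ.contDiffAt.of_le (WithTop.coe_le_coe.2 (le_top (a := (2 : ℕ∞))))).mul (hφ z hz)
    · simp [image_eq_zero_of_notMem_tsupport hz]
  have key := integral_leviForm_le_of_weak_of_hasCompactSupport hs hχc.mul_right hK hf hk hW hf0
    hdiv hcurl
  have hev : ∀ z ∈ K, (fun z => χ z * φ z) =ᶠ[𝓝 z] φ := by
    intro z hz
    filter_upwards [hχ1 z hz] with w hw
    rw [hw, one_mul]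
  have hevc : ∀ z ∈ K, (fun z => ((χ z * φ z : ℝ) : ℂ)) =ᶠ[𝓝 z] fun z => (φ z : ℂ) := by
    intro z hz
    filter_upwards [hev z hz] with w hw
    rw [hw]
  have hv : ∀ z ∈ K, χ z * φ z = φ z := fun z hz => (hev z hz).self_of_nhds
  convert key using 3
  · rename_i z
    by_cases hz : z ∈ K
    · rw [leviForm_congr (hev z hz), hv z hz]
    · simp [hf0 _ z hz, leviForm, show (fun _ : Fin n => (0 : ℂ)) = 0 from rfl]
  · ext z
    by_cases hz : z ∈ K
    · simp only [wder_congr (hevc z hz), hv z hz]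
    · simp [hf0 _ z hz, hk0 z hz]
  · congr 1
    ext z
    by_cases hz : z ∈ K
    · rw [hv z hz]
    · simp [hW0 _ _ z hz]

end BasicWeak

/-! ### Orthogonal projection onto the weakly `∂̄`-closed forms -/

section Projection

variable {n : ℕ}

theorem exists_inner_eq_of_orthogonal {H ι : Type*} [NormedAddCommGroup H]
    [InnerProductSpace ℂ H] [CompleteSpace H] (w : ι → H) (a : H) :
    ∃ a' : H, (∀ i, inner ℂ (w i) a' = 0) ∧
      ∀ b : H, (∀ i, inner ℂ (w i) b = 0) → inner ℂ a' b = inner ℂ a b := by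
  let U := (Submodule.span ℂ (range w)).topologicalClosure
  have hU : ∀ b : H, (∀ i, inner ℂ (w i) b = 0) → b ∈ Uᗮ := by
    intro b hb
    rw [Submodule.orthogonal_closure, Submodule.mem_orthogonal]
    intro u hu
    refine Submodule.span_induction (p := fun u _ => inner ℂ u b = 0) ?_ ?_ ?_ ?_ hu
    · rintro _ ⟨i, rfl⟩
      exact hb i
    · simp
    · intro x y _ _ hx hy
      rw [inner_add_left, hx, hy, add_zero]
    · intro c x _ hx
      rw [inner_smul_left, hx, mul_zero]
  obtain ⟨a0, ha0, a1, ha1, rfl⟩ := U.exists_add_mem_mem_orthogonal a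
  refine ⟨a1, fun i => (Submodule.mem_orthogonal U a1).1 ha1 _
    (Submodule.le_topologicalClosure _ (Submodule.subset_span ⟨i, rfl⟩)), fun b hb => ?_⟩
  rw [inner_add_left, (Submodule.mem_orthogonal U b).1 (hU b hb) a0 ha0, zero_add]

theorem inner_toLp_pi {b w : Fin n → (Fin n → ℂ) → ℂ} (hb : ∀ k, MemLp (b k) 2)
    (hw : ∀ k, MemLp (w k) 2) :
    inner ℂ (WithLp.toLp 2 fun k => (hw k).toLp (w k) : PiLp 2 fun _ : Fin n =>
      Lp ℂ 2 (volume : Measure (Fin n → ℂ))) (WithLp.toLp 2 fun k => (hb k).toLp (b k)) =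
      ∑ k, ∫ z, b k z * starRingEnd ℂ (w k z) := by
  rw [PiLp.inner_apply]
  refine Finset.sum_congr rfl fun k _ => ?_
  rw [L2.inner_def]
  refine integral_congr_ae ?_
  filter_upwards [(hb k).coeFn_toLp, (hw k).coeFn_toLp] with z h1 h2
  simp only [h1, h2, RCLike.inner_apply]

theorem exists_orthogonal_projection {ι : Type*} {w : ι → Fin n → (Fin n → ℂ) → ℂ}
    (hw : ∀ i k, MemLp (w i k) 2) {a : Fin n → (Fin n → ℂ) → ℂ} (ha : ∀ k, MemLp (a k) 2) :
    ∃ a' : Fin n → (Fin n → ℂ) → ℂ, (∀ k, MemLp (a' k) 2) ∧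
      (∀ i, ∑ k, ∫ z, a' k z * starRingEnd ℂ (w i k z) = 0) ∧
      ∀ b : Fin n → (Fin n → ℂ) → ℂ, (∀ k, MemLp (b k) 2) →
        (∀ i, ∑ k, ∫ z, b k z * starRingEnd ℂ (w i k z) = 0) →
        ∑ k, ∫ z, b k z * starRingEnd ℂ (a' k z) = ∑ k, ∫ z, b k z * starRingEnd ℂ (a k z) := by
  have hL : ∀ (a1 : PiLp 2 fun _ : Fin n => Lp ℂ 2 (volume : Measure (Fin n → ℂ))) k,
    MemLp (a1 k : (Fin n → ℂ) → ℂ) 2 := fun a1 k => Lp.memLp (a1 k)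
  obtain ⟨a1, h1, h2⟩ := exists_inner_eq_of_orthogonal (fun i => (WithLp.toLp 2 fun k =>
    (hw i k).toLp (w i k) : PiLp 2 fun _ : Fin n => Lp ℂ 2 (volume : Measure (Fin n → ℂ))))
    (WithLp.toLp 2 fun k => (ha k).toLp (a k))
  have e1 : (WithLp.toLp 2 fun k => (hL a1 k).toLp (a1 k : (Fin n → ℂ) → ℂ)) = a1 := by
    ext1 k
    exact Lp.toLp_coeFn (a1 k) (hL a1 k)
  refine ⟨fun k => a1 k, hL a1, fun i => ?_, fun b hb h => ?_⟩
  · rw [← inner_toLp_pi (hL a1) (hw i), e1]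
    exact h1 i
  · rw [← inner_toLp_pi hb (hL a1), ← inner_toLp_pi hb ha, e1]
    exact h2 _ fun i => by rw [inner_toLp_pi hb (hw i), h i]

/-- For compactly supported `γ`, the part of the weighted form dual to `γ` which is weakly
`∂̄`-closed. -/
theorem exists_closed_dual {Ω : Set (Fin n → ℂ)}
    {φ : (Fin n → ℂ) → ℝ} (hφ : ∀ z ∈ Ω, ContDiffAt ℝ 1 φ z) {γ : Fin n → (Fin n → ℂ) → ℂ}
    (hγ : ∀ k, ContDiff ℝ 1 (γ k)) (hγc : ∀ k, HasCompactSupport (γ k))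
    (hγΩ : ∀ k, tsupport (γ k) ⊆ Ω) :
    ∃ a : Fin n → (Fin n → ℂ) → ℂ, (∀ k, MemLp (a k) 2) ∧
      (∀ j k η, ContDiff ℝ 2 η → HasCompactSupport η → tsupport η ⊆ Ω →
        ∫ z, Real.exp (φ z / 2) * (a k z * wderBar n j η z - a j z * wderBar n k η z) = 0) ∧
      (∀ v : Fin n → (Fin n → ℂ) → ℂ, (∀ k, Continuous (v k)) → (∀ k, HasCompactSupport (v k)) →
        (∀ k, tsupport (v k) ⊆ Ω) →
        (∀ j k η, ContDiff ℝ 2 η → HasCompactSupport η → tsupport η ⊆ Ω →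
          ∫ z, (v k z * wderBar n j η z - v j z * wderBar n k η z) = 0) →
        ∑ k, ∫ z, v k z * starRingEnd ℂ (a k z) * Real.exp (-(φ z / 2)) =
          ∑ k, ∫ z, v k z * γ k z) ∧
      (∀ y : (Fin n → ℂ) → ℂ, ContDiff ℝ 1 y → HasCompactSupport y → tsupport y ⊆ Ω →
        ∑ k, ∫ z, Real.exp (φ z / 2) *
          ((wder n k y z + wder n k (fun v => (φ v : ℂ)) z * y z) * a k z) =
          - ∫ z, Real.exp (φ z) * y z * starRingEnd ℂ (∑ k, wderBar n k (γ k) z)) := by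
  have hE : ∀ (c : ℝ) {g : (Fin n → ℂ) → ℂ} {k : WithTop ℕ∞}, k ≤ 1 → ContDiff ℝ k g →
      tsupport g ⊆ Ω → ContDiff ℝ k fun z => ((Real.exp (c * φ z) : ℝ) : ℂ) * g z := by
    intro c g k hk hg hgΩ
    refine contDiff_of_eq_zero_off (isClosed_tsupport g) hgΩ (fun z hz => ?_) fun z hz => ?_
    · have h1 : ContDiffAt ℝ k (fun z => Real.exp (c * φ z)) z :=
        (contDiffAt_const.mul ((hφ z hz).of_le hk)).exp
      exact (ofRealCLM.contDiff.contDiffAt.comp z h1).mul hg.contDiffAt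
    · simp [image_eq_zero_of_notMem_tsupport hz]
  have hEc : ∀ (c : ℝ) {g : (Fin n → ℂ) → ℂ}, Continuous g → HasCompactSupport g →
      tsupport g ⊆ Ω → Continuous (fun z => ((Real.exp (c * φ z) : ℝ) : ℂ) * g z) ∧
        MemLp (fun z => ((Real.exp (c * φ z) : ℝ) : ℂ) * g z) 2 := by
    intro c g hg hgc hgΩ
    have h := (hE c zero_le_one (contDiff_zero.2 hg) hgΩ).continuous
    exact ⟨h, h.memLp_of_hasCompactSupport hgc.mul_left⟩
  have tsb : ∀ (k : Fin n) (η : (Fin n → ℂ) → ℂ), tsupport (wderBar n k η) ⊆ tsupport η := by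
    intro k η
    refine closure_minimal (fun z hz => ?_) (isClosed_tsupport η)
    by_contra hc
    exact hz (wderBar_eq_zero (notMem_tsupport_iff_eventuallyEq.1 hc))
  let ι := {t : Fin n × Fin n × ((Fin n → ℂ) → ℂ) //
    ContDiff ℝ 2 t.2.2 ∧ HasCompactSupport t.2.2 ∧ tsupport t.2.2 ⊆ Ω}
  let w : ι → Fin n → (Fin n → ℂ) → ℂ := fun t k z =>
    (if k = t.1.2.1 then ((Real.exp (1 / 2 * φ z) : ℝ) : ℂ) *
      starRingEnd ℂ (wderBar n t.1.1 t.1.2.2 z) else 0) -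
    (if k = t.1.1 then ((Real.exp (1 / 2 * φ z) : ℝ) : ℂ) *
      starRingEnd ℂ (wderBar n t.1.2.1 t.1.2.2 z) else 0)
  have hw0 : ∀ j (η : (Fin n → ℂ) → ℂ), ContDiff ℝ 2 η → HasCompactSupport η → tsupport η ⊆ Ω →
      MemLp (fun z => ((Real.exp (1 / 2 * φ z) : ℝ) : ℂ) * starRingEnd ℂ (wderBar n j η z)) 2 := by
    intro j η h1 h2 h3
    have hs : HasCompactSupport fun z => starRingEnd ℂ (wderBar n j η z) :=
      (h2.wderBar j).comp_left (g := starRingEnd ℂ) (map_zero _)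
    refine (hEc (1 / 2) (continuous_conj.comp (h1.wderBar (m := 1) j (by norm_num)).continuous) hs ?_).2
    refine (closure_mono ?_).trans ((tsb j η).trans h3)
    intro z hz hc
    exact hz (by simp [hc])
  have hw : ∀ i k, MemLp (w i k) 2 := by
    intro t k
    obtain ⟨⟨j, l, η⟩, h1, h2, h3⟩ := t
    refine MemLp.sub ?_ ?_
    · by_cases h : k = l
      · simpa only [h, if_true] using hw0 j η h1 h2 h3
      · simp only [h, if_false]; exact MemLp.zero
    · by_cases h : k = j
      · simpa only [h, if_true] using hw0 l η h1 h2 h3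
      · simp only [h, if_false]; exact MemLp.zero
  have hwsum : ∀ (b : Fin n → (Fin n → ℂ) → ℂ), (∀ k, MemLp (b k) 2) → ∀ i : ι,
      ∑ k, ∫ z, b k z * starRingEnd ℂ (w i k z) = ∫ z, Real.exp (1 / 2 * φ z) *
        (b i.1.2.1 z * wderBar n i.1.1 i.1.2.2 z - b i.1.1 z * wderBar n i.1.2.1 i.1.2.2 z) := by
    intro b hb i
    have hi : ∀ k, Integrable fun z => b k z * starRingEnd ℂ (w i k z) := fun k =>
      (hb k).integrable_mul (hw i k).star
    rw [← integral_finsetSum _ fun k _ => hi k]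
    refine integral_congr_ae (Eventually.of_forall fun z => ?_)
    simp only [w, map_sub, mul_sub, Finset.sum_sub_distrib, apply_ite (starRingEnd ℂ), map_mul,
      conj_ofReal, Complex.conj_conj, map_zero, mul_ite, mul_zero, Finset.sum_ite_eq',
      Finset.mem_univ, if_true]
    ring
  have hcγ : ∀ k, MemLp (fun z => ((Real.exp (1 / 2 * φ z) : ℝ) : ℂ) * starRingEnd ℂ (γ k z)) 2 := by
    intro k
    refine (hEc (1 / 2) (continuous_conj.comp (hγ k).continuous)
      ((hγc k).comp_left (g := starRingEnd ℂ) (map_zero _)) ?_).2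
    refine (closure_mono ?_).trans (hγΩ k)
    intro z hz hc
    exact hz (by simp [hc])
  obtain ⟨a, ha, haw, hab⟩ := exists_orthogonal_projection hw hcγ
  have hii : ∀ v : Fin n → (Fin n → ℂ) → ℂ, (∀ k, Continuous (v k)) →
        (∀ k, HasCompactSupport (v k)) → (∀ k, tsupport (v k) ⊆ Ω) →
        (∀ j k η, ContDiff ℝ 2 η → HasCompactSupport η → tsupport η ⊆ Ω →
          ∫ z, (v k z * wderBar n j η z - v j z * wderBar n k η z) = 0) →
        ∑ k, ∫ z, v k z * starRingEnd ℂ (a k z) * Real.exp (-(φ z / 2)) =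
          ∑ k, ∫ z, v k z * γ k z := by
    intro v hv hvc hvΩ hcl
    have hb : ∀ k, MemLp (fun z => ((Real.exp (-(1 / 2) * φ z) : ℝ) : ℂ) * v k z) 2 :=
      fun k => (hEc (-(1 / 2)) (hv k) (hvc k) (hvΩ k)).2
    have hee : ∀ x : ℝ, ((Real.exp (1 / 2 * x) : ℝ) : ℂ) * ((Real.exp (-(1 / 2) * x) : ℝ) : ℂ) = 1 := by
      intro x
      rw [← ofReal_mul, ← Real.exp_add]; simp
    have := hab _ hb fun i => by
      rw [hwsum _ hb i, ← hcl i.1.1 i.1.2.1 i.1.2.2 i.2.1 i.2.2.1 i.2.2.2]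
      congr 1; ext z
      linear_combination (v i.1.2.1 z * wderBar n i.1.1 i.1.2.2 z -
        v i.1.1 z * wderBar n i.1.2.1 i.1.2.2 z) * hee (φ z)
    convert this using 3
    · ext z
      rw [show -(φ z / 2) = -(1 / 2) * φ z by ring]; ring
    · ext z
      rw [map_mul, conj_ofReal, Complex.conj_conj]
      linear_combination -(v _ z * γ _ z) * hee (φ z)
  refine ⟨a, ha, fun j k η h1 h2 h3 => ?_, hii, fun y hy hyc hyΩ => ?_⟩
  · have := haw ⟨(j, k, η), h1, h2, h3⟩
    rw [hwsum a ha] at this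
    rw [← this]
    congr 1; ext z
    rw [show φ z / 2 = 1 / 2 * φ z by ring]
  · have hu1 := hE 1 le_rfl hy hyΩ
    have hu : ContDiff ℝ 1 fun z => starRingEnd ℂ (((Real.exp (1 * φ z) : ℝ) : ℂ) * y z) :=
      conjCLE.contDiff.comp hu1
    set u : (Fin n → ℂ) → ℂ := fun z => starRingEnd ℂ (((Real.exp (1 * φ z) : ℝ) : ℂ) * y z) with hudef
    have huy : tsupport u ⊆ tsupport y := by
      refine closure_mono fun z hz hc => hz ?_
      simp [u, hc]
    have huc : HasCompactSupport u := hyc.of_isClosed_subset (isClosed_tsupport _) huy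
    have hdu : ∀ k z, wderBar n k u z = starRingEnd ℂ (Real.exp (φ z) *
        (wder n k y z + wder n k (fun v => (φ v : ℂ)) z * y z)) := by
      intro k z
      rw [hudef, wderBar_conj]
      congr 1
      by_cases hz : z ∈ Ω
      · have hd := (hφ z hz).differentiableAt (by norm_num)
        have h1 : wder n k (fun v => ((Real.exp (1 * φ v) : ℝ) : ℂ)) z =
            Real.exp (φ z) * wder n k (fun v => (φ v : ℂ)) z := by
          have := wder_exp_neg (φ := fun v => -φ v) hd.neg k
          simp only [neg_neg] at this
          simp only [one_mul]
          rw [this]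
          have h2 : wder n k (fun v => ((-φ v : ℝ) : ℂ)) z = - wder n k (fun v => (φ v : ℂ)) z := by
            rw [wder_ofReal hd, wder_ofReal (φ := fun v => -φ v) hd.neg, fderiv_fun_neg]
            simp only [neg_apply, ofReal_neg]
            ring
          rw [h2]; ring
        have he : DifferentiableAt ℝ (fun v => ((Real.exp (1 * φ v) : ℝ) : ℂ)) z :=
          ofRealCLM.differentiableAt.comp z ((hd.const_mul 1).exp)
        rw [wder_mul he (hy.differentiable (by norm_num) z), h1]
        simp only [one_mul]; ring
      · have hz' : z ∉ tsupport y := fun h => hz (hyΩ h)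
        have e0 := notMem_tsupport_iff_eventuallyEq.1 hz'
        rw [wder_eq_zero e0, e0.self_of_nhds, wder_eq_zero]
        · simp
        · filter_upwards [e0] with x hx
          simp [hx]
    have := hii (fun k => wderBar n k u) (fun k => (hu.wderBar (m := 0) k (by norm_num)).continuous)
      (fun k => huc.wderBar k) (fun k => (tsb k u).trans (huy.trans hyΩ)) (by
        intro j k η h1 h2 h3
        have hd : ∀ l, ContDiff ℝ 1 (wderBar n l η) := fun l => h1.wderBar l (by norm_num)
        have hi : ∀ l m, Integrable fun z => wderBar n l u z * wderBar n m η z := fun l m =>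
          (((hu.wderBar (m := 0) l (by norm_num)).continuous).mul
            (hd m).continuous).integrable_of_hasCompactSupport (h2.wderBar m).mul_left
        have hp : ∀ l m, ∫ z, wderBar n l u z * wderBar n m η z =
            - ∫ z, u z * wderBar n l (wderBar n m η) z := by
          intro l m
          rw [integral_mul_wderBar hu (hd m) (h2.wderBar m), neg_neg]
        rw [integral_sub (hi _ _) (hi _ _), hp, hp]
        simp only [wderBar_wderBar_comm h1.contDiffAt j k, sub_self])
    have h3 : ∑ k, ∫ z, wderBar n k u z * γ k z = - ∫ z, u z * ∑ k, wderBar n k (γ k) z := by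
      have hcd : ∀ k, Continuous (wderBar n k (γ k)) := fun k =>
        ((hγ k).wderBar (m := 0) k (by norm_num)).continuous
      have hi : ∀ k, Integrable fun z => u z * wderBar n k (γ k) z := fun k =>
        (hu.continuous.mul (hcd k)).integrable_of_hasCompactSupport ((hγc k).wderBar k).mul_left
      simp only [Finset.mul_sum]
      rw [integral_finsetSum _ fun k _ => hi k, ← Finset.sum_neg_distrib]
      refine Finset.sum_congr rfl fun k _ => ?_
      rw [integral_mul_wderBar hu (hγ k) (hγc k), neg_neg]
    rw [h3] at this
    have h4 := congrArg (starRingEnd ℂ) this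
    rw [map_neg, ← integral_conj, map_sum] at h4
    simp only [← integral_conj] at h4
    refine Eq.trans (Finset.sum_congr rfl fun k _ => integral_congr_ae
      (Eventually.of_forall fun z => ?_)) (h4.trans (congrArg Neg.neg (integral_congr_ae
      (Eventually.of_forall fun z => ?_))))
    · beta_reduce
      have hee : ((Real.exp (φ z) : ℝ) : ℂ) * ((Real.exp (-(φ z / 2)) : ℝ) : ℂ) = (Real.exp (φ z / 2) : ℝ) := by
        rw [← ofReal_mul, ← Real.exp_add]; ring_nf
      rw [hdu]
      simp only [map_mul, conj_ofReal, Complex.conj_conj]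
      rw [← hee]
      ring
    · simp only [u, map_mul, conj_ofReal, Complex.conj_conj, one_mul]

end Projection

/-! ### Auxiliary one-variable functions and integrability of the Levi form -/

section Weights

variable {n : ℕ}

theorem hasDerivAt_max_zero_pow (k : ℕ) (τ : ℝ) :
    HasDerivAt (fun τ : ℝ => max τ 0 ^ (k + 2)) ((k + 2) * max τ 0 ^ (k + 1)) τ := by
  have hne : ∀ y : ℝ, y ≠ 0 →
      HasDerivAt (fun τ : ℝ => max τ 0 ^ (k + 2)) ((k + 2) * max y 0 ^ (k + 1)) y := by
    intro y hy
    rcases lt_or_gt_of_ne hy with h | h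
    · rw [max_eq_right h.le, zero_pow (by omega), mul_zero]
      refine (hasDerivAt_const y (0 : ℝ)).congr_of_eventuallyEq ?_
      filter_upwards [gt_mem_nhds h] with x hx
      rw [max_eq_right hx.le, zero_pow (by omega)]
    · rw [max_eq_left h.le]
      have := hasDerivAt_pow (k + 2) y
      refine HasDerivAt.congr_of_eventuallyEq (f := fun x => x ^ (k + 2)) (by simpa using this) ?_
      filter_upwards [lt_mem_nhds h] with x hx
      rw [max_eq_left hx.le]
  by_cases h : τ = 0
  · subst h
    exact hasDerivAt_of_hasDerivAt_of_ne (g := fun y : ℝ => (k + 2) * max y 0 ^ (k + 1)) hne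
      (by fun_prop) (by fun_prop)
  · exact hne τ h

theorem contDiff_max_zero_pow (k : ℕ) : ContDiff ℝ k fun τ : ℝ => max τ 0 ^ (k + 1) := by
  induction k with
  | zero => exact contDiff_zero.2 (by fun_prop)
  | succ k ih =>
    rw [Nat.cast_succ, contDiff_succ_iff_deriv]
    refine ⟨fun τ => (hasDerivAt_max_zero_pow k τ).differentiableAt, by simp, ?_⟩
    rw [funext fun τ => (hasDerivAt_max_zero_pow k τ).deriv]
    exact contDiff_const.mul ih

/-- A smooth decreasing cutoff on the line. -/
theorem exists_real_cutoff : ∃ (h : ℝ → ℝ) (B : ℝ), ContDiff ℝ ∞ h ∧ (∀ τ ≤ 0, h τ = 1) ∧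
    (∀ τ, 1 ≤ τ → h τ = 0) ∧ (∀ τ < 0, deriv h τ = 0) ∧ ∀ τ, |deriv h τ| ≤ B := by
  have hs : ContDiff ℝ ∞ fun τ : ℝ => Real.smoothTransition (1 - τ) :=
    Real.smoothTransition.contDiff.comp (by fun_prop)
  have h1 : ∀ τ : ℝ, τ ≤ 0 → Real.smoothTransition (1 - τ) = 1 := fun τ h =>
    Real.smoothTransition.one_of_one_le (by linarith)
  have h0 : ∀ τ : ℝ, 1 ≤ τ → Real.smoothTransition (1 - τ) = 0 := fun τ h =>
    Real.smoothTransition.zero_of_nonpos (by linarith)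
  have hd1 : ∀ τ : ℝ, τ < 0 → deriv (fun τ : ℝ => Real.smoothTransition (1 - τ)) τ = 0 := by
    intro τ hτ
    have : (fun τ : ℝ => Real.smoothTransition (1 - τ)) =ᶠ[𝓝 τ] fun _ => 1 := by
      filter_upwards [gt_mem_nhds hτ] with x hx using h1 x hx.le
    rw [this.deriv_eq, deriv_const]
  have hd0 : ∀ τ : ℝ, 1 < τ → deriv (fun τ : ℝ => Real.smoothTransition (1 - τ)) τ = 0 := by
    intro τ hτ
    have : (fun τ : ℝ => Real.smoothTransition (1 - τ)) =ᶠ[𝓝 τ] fun _ => 0 := by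
      filter_upwards [lt_mem_nhds hτ] with x hx using h0 x hx.le
    rw [this.deriv_eq, deriv_const]
  have hc : Continuous (deriv fun τ : ℝ => Real.smoothTransition (1 - τ)) :=
    hs.continuous_deriv (mod_cast le_top)
  obtain ⟨B, hB⟩ := (isCompact_Icc (a := (0 : ℝ)) (b := 1)).exists_bound_of_continuousOn hc.continuousOn
  refine ⟨_, max B 0, hs, h1, h0, hd1, fun τ => ?_⟩
  by_cases h : τ ∈ Icc (0 : ℝ) 1
  · exact (hB τ h).trans (le_max_left _ _)
  · rw [mem_Icc, not_and_or, not_le, not_le] at h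
    rcases h with h | h
    · rw [hd1 τ h, abs_zero]; exact le_max_right _ _
    · rw [hd0 τ h, abs_zero]; exact le_max_right _ _

theorem leviForm_ofReal_mul (φ : (Fin n → ℂ) → ℝ) (z : Fin n → ℂ) (c : ℝ) (X : Fin n → ℂ) :
    leviForm φ z (fun j => (c : ℂ) * X j) = c ^ 2 * leviForm φ z X := by
  have h : (fun j => (c : ℂ) * X j) = c • X := by ext j; simp
  have h2 : I • (c • X) = c • (I • X) := smul_comm _ _ _
  rw [h]
  simp only [leviForm, h2, map_smul, smul_apply, smul_eq_mul]
  ring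

theorem MeasureTheory.MemLp.continuous_mul {c u : (Fin n → ℂ) → ℂ} (hu : MemLp u 2) (hc : Continuous c)
    (hcc : HasCompactSupport c) : MemLp (fun z => c z * u z) 2 := by
  obtain ⟨C, hC⟩ := exists_norm_le_of_hasCompactSupport hc hcc
  refine MemLp.of_le_mul (c := C) hu (hc.aestronglyMeasurable.mul hu.1)
    (Eventually.of_forall fun z => ?_)
  rw [norm_mul]
  exact mul_le_mul_of_nonneg_right (hC z) (norm_nonneg _)

theorem integrable_norm_sq_mul {c : (Fin n → ℂ) → ℝ} {u : (Fin n → ℂ) → ℂ} (hu : MemLp u 2)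
    (hc : Continuous c) (hcc : HasCompactSupport c) : Integrable fun z => ‖u z‖ ^ 2 * c z := by
  obtain ⟨C, hC⟩ := hcc.exists_bound_of_continuous hc
  have := ((memLp_two_iff_integrable_sq_norm hu.1).1 hu).bdd_mul hc.aestronglyMeasurable
    (Eventually.of_forall hC)
  simpa only [mul_comm] using this

/-- A continuous function on an open set agrees on a compact subset with a continuous compactly
supported function. -/
theorem exists_continuous_eqOn {Ω K : Set (Fin n → ℂ)} (hΩ : IsOpen Ω) (hK : IsCompact K)
    (hKΩ : K ⊆ Ω) {g : (Fin n → ℂ) → ℝ} (hg : ContinuousOn g Ω) :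
    ∃ c : (Fin n → ℂ) → ℝ, Continuous c ∧ HasCompactSupport c ∧ EqOn c g K := by
  obtain ⟨χ, hχ, hχc, hχΩ, hχ1, -⟩ := exists_cutoff hK hΩ hKΩ
  refine ⟨fun z => χ z * g z, ?_, hχc.mul_right, fun z hz => ?_⟩
  · rw [continuous_iff_continuousAt]
    intro z
    by_cases hz : z ∈ tsupport χ
    · exact hχ.continuous.continuousAt.mul (hg.continuousAt (hΩ.mem_nhds (hχΩ hz)))
    · refine (continuousAt_const (y := (0 : ℝ))).congr ?_
      filter_upwards [notMem_tsupport_iff_eventuallyEq.1 hz] with w hw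
      simp [hw]
  · change χ z * g z = g z
    rw [(hχ1 z hz).self_of_nhds, one_mul]

theorem integrable_norm_sq_mul_of_eq_zero {Ω K : Set (Fin n → ℂ)} (hΩ : IsOpen Ω)
    (hK : IsCompact K) (hKΩ : K ⊆ Ω) {g : (Fin n → ℂ) → ℝ} (hg : ContinuousOn g Ω)
    {u : (Fin n → ℂ) → ℂ} (hu : MemLp u 2) (h0 : ∀ z, z ∉ K → u z = 0) :
    Integrable fun z => ‖u z‖ ^ 2 * g z := by
  obtain ⟨c, hc, hcc, hcg⟩ := exists_continuous_eqOn hΩ hK hKΩ hg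
  refine (integrable_norm_sq_mul hu hc hcc).congr (Eventually.of_forall fun z => ?_)
  by_cases hz : z ∈ K
  · simp only [hcg hz]
  · simp [h0 z hz]

theorem integrable_leviForm_mul {Ω K : Set (Fin n → ℂ)} (hΩ : IsOpen Ω) (hK : IsCompact K)
    (hKΩ : K ⊆ Ω) {φ g : (Fin n → ℂ) → ℝ} (hφ : ∀ z ∈ Ω, ContDiffAt ℝ 2 φ z)
    (hg : ContinuousOn g Ω) {f : Fin n → (Fin n → ℂ) → ℂ} (hf : ∀ j, MemLp (f j) 2)
    (hf0 : ∀ j z, z ∉ K → f j z = 0) :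
    Integrable fun z => leviForm φ z (fun j => f j z) * g z := by
  obtain ⟨χ, hχ, hχc, hχΩ, hχ1, -⟩ := exists_cutoff hK hΩ hKΩ
  obtain ⟨c, hc, hcc, hcg⟩ := exists_continuous_eqOn hΩ hK hKΩ hg
  have hs : ContDiff ℝ 2 fun z => χ z * φ z := by
    refine contDiff_of_eq_zero_off (isClosed_tsupport χ) hχΩ (fun z hz => ?_) fun z hz => ?_
    · exact (hχ.contDiffAt.of_le (WithTop.coe_le_coe.2 (le_top (a := (2 : ℕ∞))))).mul (hφ z hz)
    · simp [image_eq_zero_of_notMem_tsupport hz]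
  have hs2 : ContDiff ℝ 2 fun z => ((χ z * φ z : ℝ) : ℂ) := ofRealCLM.contDiff.comp hs
  have hH : ∀ j k, Continuous fun z => cHess n (fun z => χ z * φ z) z j k * (c z : ℂ) := fun j k =>
    (((hs2.wder (m := 1) j (by norm_num)).wderBar (m := 0) k (by norm_num)).continuous).mul
      (continuous_ofReal.comp hc)
  have hi : ∀ j k, Integrable fun z => (cHess n (fun z => χ z * φ z) z j k * (c z : ℂ) * f j z) *
      starRingEnd ℂ (f k z) := fun j k =>
    ((hf j).continuous_mul (hH j k)
      ((hcc.comp_left (g := ((↑) : ℝ → ℂ)) ofReal_zero).mul_left)).integrable_mul (hf k).star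
  have h1 : Integrable fun z => ∑ j, ∑ k, (cHess n (fun z => χ z * φ z) z j k * (c z : ℂ) * f j z) *
      starRingEnd ℂ (f k z) :=
    integrable_finsetSum _ fun j _ => integrable_finsetSum _ fun k _ => hi j k
  refine (h1.re).congr (Eventually.of_forall fun z => ?_)
  by_cases hz : z ∈ K
  · have hev : (fun z => χ z * φ z) =ᶠ[𝓝 z] φ := by
      filter_upwards [hχ1 z hz] with w hw
      rw [hw, one_mul]
    simp only
    rw [← hcg hz, ← leviForm_congr hev, ← hermForm_cHess hs.contDiffAt, hermForm, ← re_mul_ofReal,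
      Finset.sum_mul]
    simp only [Finset.sum_mul]
    change re _ = re _
    congr 1
    refine Finset.sum_congr rfl fun j _ => Finset.sum_congr rfl fun k _ => ?_
    ring
  · simp [hf0 _ z hz, leviForm, show (fun _ : Fin n => (0 : ℂ)) = 0 from rfl]

/-- The pointwise comparison behind the weighted a priori estimate. -/
theorem norm_sub_sq_mul_le {m x E H L w : ℝ} (hx : 0 ≤ x) (hH : 0 ≤ H) (hL : 0 ≤ L) (hw : 0 ≤ w)
    (p ℓ : ℂ) :
    ‖p - (m * E * (2 * x) : ℝ) * ℓ‖ ^ 2 * w ≤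
      (m * E) ^ 2 * (H + (4 * x ^ 3 * L + 12 * x ^ 2 * ‖ℓ‖ ^ 2)) * w + 2 * ‖p‖ ^ 2 * w := by
  rw [← add_mul]
  refine mul_le_mul_of_nonneg_right ?_ hw
  have h1 : ‖p - (m * E * (2 * x) : ℝ) * ℓ‖ ≤ ‖p‖ + |m * E * (2 * x)| * ‖ℓ‖ := by
    refine (norm_sub_le _ _).trans_eq ?_
    rw [norm_mul, norm_real, Real.norm_eq_abs]
  have h2 : ‖p - (m * E * (2 * x) : ℝ) * ℓ‖ ^ 2 ≤ 2 * ‖p‖ ^ 2 + 2 * (|m * E * (2 * x)| * ‖ℓ‖) ^ 2 := by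
    have := pow_le_pow_left₀ (norm_nonneg _) h1 2
    nlinarith [sq_nonneg (‖p‖ - |m * E * (2 * x)| * ‖ℓ‖)]
  rw [mul_pow, sq_abs] at h2
  have h3 : 0 ≤ (m * E) ^ 2 * H := by positivity
  have h4 : 0 ≤ (m * E) ^ 2 * (x ^ 3 * L) := by positivity
  have h5 : 0 ≤ (m * E) ^ 2 * (x ^ 2 * ‖ℓ‖ ^ 2) := by positivity
  nlinarith

end Weights

/-! ### The basic inequality for cut-off closed forms -/

section CutoffForm

variable {n : ℕ}

theorem hasCompactSupport_of_eq_zero_off {F : Type*} [Zero F] {K : Set (Fin n → ℂ)}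
    (hK : IsCompact K) {c : (Fin n → ℂ) → F} (h0 : ∀ z, z ∉ K → c z = 0) : HasCompactSupport c :=
  HasCompactSupport.intro hK h0

theorem tsupport_subset_of_eq_zero_off {F : Type*} [Zero F] {K : Set (Fin n → ℂ)}
    (hK : IsClosed K) {c : (Fin n → ℂ) → F} (h0 : ∀ z, z ∉ K → c z = 0) : tsupport c ⊆ K :=
  closure_minimal (fun z hz => by_contra fun hc => hz (h0 z hc)) hK

theorem continuous_mul_of_eq_zero_off {Ω K : Set (Fin n → ℂ)} (hΩ : IsOpen Ω) (hK : IsCompact K)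
    (hKΩ : K ⊆ Ω) {c : (Fin n → ℂ) → ℂ} (hc : Continuous c) (h0 : ∀ z, z ∉ K → c z = 0)
    {g : (Fin n → ℂ) → ℝ} (hg : ContinuousOn g Ω) : Continuous fun z => c z * (g z : ℂ) := by
  obtain ⟨d, hd, -, hdg⟩ := exists_continuous_eqOn hΩ hK hKΩ hg
  have : (fun z => c z * (g z : ℂ)) = fun z => c z * (d z : ℂ) := by
    ext z
    by_cases hz : z ∈ K
    · rw [hdg hz]
    · simp [h0 z hz]
  rw [this]
  exact hc.mul (continuous_ofReal.comp hd)

theorem continuous_mul_wder_of_eq_zero_off {Ω K : Set (Fin n → ℂ)} (hΩ : IsOpen Ω)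
    (hK : IsCompact K) (hKΩ : K ⊆ Ω) {c : (Fin n → ℂ) → ℂ} (hc : Continuous c)
    (h0 : ∀ z, z ∉ K → c z = 0) {g : (Fin n → ℂ) → ℝ} (hg : ∀ z ∈ Ω, ContDiffAt ℝ 1 g z)
    (j : Fin n) : Continuous fun z => c z * wder n j (fun v => (g v : ℂ)) z := by
  obtain ⟨χ, hχ, hχc, hχΩ, hχ1, -⟩ := exists_cutoff hK hΩ hKΩ
  have hs : ContDiff ℝ 1 fun z => χ z * g z := by
    refine contDiff_of_eq_zero_off (isClosed_tsupport χ) hχΩ (fun z hz => ?_) fun z hz => ?_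
    · exact (hχ.contDiffAt.of_le (mod_cast le_top)).mul (hg z hz)
    · simp [image_eq_zero_of_notMem_tsupport hz]
  have hs2 : ContDiff ℝ 1 fun z => ((χ z * g z : ℝ) : ℂ) := ofRealCLM.contDiff.comp hs
  have : (fun z => c z * wder n j (fun v => (g v : ℂ)) z) =
      fun z => c z * wder n j (fun v => ((χ v * g v : ℝ) : ℂ)) z := by
    ext z
    by_cases hz : z ∈ K
    · congr 1
      refine wder_congr ?_
      filter_upwards [hχ1 z hz] with w hw
      rw [hw, one_mul]
    · simp [h0 z hz]
  rw [this]
  exact hc.mul (hs2.wder (m := 0) j (by norm_num)).continuous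

theorem integral_leviForm_cutoff_le {Ω K : Set (Fin n → ℂ)} (hΩ : IsOpen Ω) (hK : IsCompact K)
    (hKΩ : K ⊆ Ω) {φ φ' m : (Fin n → ℂ) → ℝ} (hφ : ∀ z ∈ Ω, ContDiffAt ℝ 2 φ z)
    (hφ' : ∀ z ∈ Ω, ContDiffAt ℝ 1 φ' z) (hm : ContDiff ℝ 2 m) (hm0 : ∀ z, z ∉ K → m z = 0)
    {D : (Fin n → ℂ) → ℂ} (hD : Continuous D) {a : Fin n → (Fin n → ℂ) → ℂ}
    (ha : ∀ k, MemLp (a k) 2)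
    (hcl : ∀ j k η, ContDiff ℝ 2 η → HasCompactSupport η → tsupport η ⊆ Ω →
        ∫ z, Real.exp (φ' z / 2) * (a k z * wderBar n j η z - a j z * wderBar n k η z) = 0)
    (hadj : ∀ y : (Fin n → ℂ) → ℂ, ContDiff ℝ 1 y → HasCompactSupport y → tsupport y ⊆ Ω →
        ∑ k, ∫ z, Real.exp (φ' z / 2) *
          ((wder n k y z + wder n k (fun v => (φ' v : ℂ)) z * y z) * a k z) =
          - ∫ z, Real.exp (φ' z) * y z * starRingEnd ℂ (D z)) :
    let f : Fin n → (Fin n → ℂ) → ℂ := fun j z => ((m z * Real.exp (φ' z / 2) : ℝ) : ℂ) * a j z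
    let k : (Fin n → ℂ) → ℂ := fun z =>
      ∑ j, wder n j (fun v => (m v : ℂ)) z * (Real.exp (φ' z / 2) : ℝ) * a j z +
      ∑ j, wder n j (fun v => (φ' v : ℂ)) z * f j z +
      ((m z * Real.exp (φ' z) : ℝ) : ℂ) * starRingEnd ℂ (D z)
    let W : Fin n → Fin n → (Fin n → ℂ) → ℂ := fun j l z =>
      wderBar n j (fun v => (m v : ℂ)) z * (Real.exp (φ' z / 2) : ℝ) * a l z -
      wderBar n l (fun v => (m v : ℂ)) z * (Real.exp (φ' z / 2) : ℝ) * a j z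
    (Integrable fun z => leviForm φ z (fun j => f j z) * Real.exp (-φ z)) ∧
    (Integrable fun z => ‖k z - ∑ j, wder n j (fun v => (φ v : ℂ)) z * f j z‖ ^ 2 *
      Real.exp (-φ z)) ∧
    (Integrable fun z => (∑ j, ∑ l, ‖W j l z‖ ^ 2) * Real.exp (-φ z)) ∧
    ∫ z, leviForm φ z (fun j => f j z) * Real.exp (-φ z) ≤
      (∫ z, ‖k z - ∑ j, wder n j (fun v => (φ v : ℂ)) z * f j z‖ ^ 2 * Real.exp (-φ z)) +
      (1 / 2) * ∫ z, (∑ j, ∑ l, ‖W j l z‖ ^ 2) * Real.exp (-φ z) := by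
  intro f k W
  have hcφ' : ContinuousOn φ' Ω := fun z hz => (hφ' z hz).continuousAt.continuousWithinAt
  have hcφ : ContinuousOn φ Ω := fun z hz => (hφ z hz).continuousAt.continuousWithinAt
  have hcE : ContinuousOn (fun z => Real.exp (φ' z / 2)) Ω := (hcφ'.div_const 2).rexp
  have hcm : ContDiff ℝ 2 fun v => (m v : ℂ) := ofRealCLM.contDiff.comp hm
  have hcm0 : ∀ z, z ∉ K → (m z : ℂ) = 0 := fun z hz => by simp [hm0 z hz]
  have hev0 : ∀ z, z ∉ K → (fun v => (m v : ℂ)) =ᶠ[𝓝 z] fun _ => 0 := fun z hz => by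
    filter_upwards [hK.isClosed.isOpen_compl.mem_nhds hz] with w hw using hcm0 w hw
  have hd0 : ∀ j z, z ∉ K → wder n j (fun v => (m v : ℂ)) z = 0 := fun j z hz =>
    wder_eq_zero (hev0 z hz)
  have hdb0 : ∀ j z, z ∉ K → wderBar n j (fun v => (m v : ℂ)) z = 0 := fun j z hz =>
    wderBar_eq_zero (hev0 z hz)
  have hM : Continuous fun z => ((m z * Real.exp (φ' z / 2) : ℝ) : ℂ) := by
    simp only [ofReal_mul]
    exact continuous_mul_of_eq_zero_off hΩ hK hKΩ hcm.continuous hcm0 hcE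
  have hM0 : ∀ z, z ∉ K → ((m z * Real.exp (φ' z / 2) : ℝ) : ℂ) = 0 := fun z hz => by
    simp [hm0 z hz]
  have hP : ∀ j, Continuous fun z => wder n j (fun v => (m v : ℂ)) z *
      ((Real.exp (φ' z / 2) : ℝ) : ℂ) := fun j =>
    continuous_mul_of_eq_zero_off hΩ hK hKΩ (hcm.wder (m := 1) j (by norm_num)).continuous
      (hd0 j) hcE
  have hPb : ∀ j, Continuous fun z => wderBar n j (fun v => (m v : ℂ)) z *
      ((Real.exp (φ' z / 2) : ℝ) : ℂ) := fun j =>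
    continuous_mul_of_eq_zero_off hΩ hK hKΩ (hcm.wderBar (m := 1) j (by norm_num)).continuous
      (hdb0 j) hcE
  have hcs : ∀ {c : (Fin n → ℂ) → ℂ}, (∀ z, z ∉ K → c z = 0) → HasCompactSupport c := fun h =>
    hasCompactSupport_of_eq_zero_off hK h
  have hf : ∀ j, MemLp (f j) 2 := fun j => (ha j).continuous_mul hM (hcs hM0)
  have hN : ∀ {g : (Fin n → ℂ) → ℝ}, (∀ z ∈ Ω, ContDiffAt ℝ 1 g z) → ∀ j,
      MemLp (fun z => wder n j (fun v => (g v : ℂ)) z * f j z) 2 := by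
    intro g hg j
    have := (ha j).continuous_mul (continuous_mul_wder_of_eq_zero_off hΩ hK hKΩ hM hM0 hg j)
      (hcs fun z hz => by rw [hM0 z hz, zero_mul])
    refine this.congr_norm (by
      have e : (fun z => wder n j (fun v => (g v : ℂ)) z * f j z) = fun z =>
        ((m z * Real.exp (φ' z / 2) : ℝ) : ℂ) * wder n j (fun v => (g v : ℂ)) z * a j z := by
        ext z; simp only [f]; ring
      rw [e]; exact this.1) (Eventually.of_forall fun z => ?_)
    simp only [f]
    congr 1; ring
  have hPa : ∀ j, MemLp (fun z => wder n j (fun v => (m v : ℂ)) z *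
      ((Real.exp (φ' z / 2) : ℝ) : ℂ) * a j z) 2 := fun j =>
    (ha j).continuous_mul (hP j) (hcs fun z hz => by rw [hd0 j z hz, zero_mul])
  have hPba : ∀ j l, MemLp (fun z => wderBar n j (fun v => (m v : ℂ)) z *
      ((Real.exp (φ' z / 2) : ℝ) : ℂ) * a l z) 2 := fun j l =>
    (ha l).continuous_mul (hPb j) (hcs fun z hz => by rw [hdb0 j z hz, zero_mul])
  have hDm : MemLp (fun z => ((m z * Real.exp (φ' z) : ℝ) : ℂ) * starRingEnd ℂ (D z)) 2 := by
    have hc := continuous_mul_of_eq_zero_off hΩ hK hKΩ hcm.continuous hcm0 hcφ'.rexp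
    simp only [← ofReal_mul] at hc
    refine (hc.mul (continuous_conj.comp hD)).memLp_of_hasCompactSupport (hcs fun z hz => ?_)
    simp [hm0 z hz]
  have hk : MemLp k 2 := ((memLp_finsetSum _ fun j _ => hPa j).add
    (memLp_finsetSum _ fun j _ => hN hφ' j)).add hDm
  have hW : ∀ j l, MemLp (W j l) 2 := fun j l => (hPba j l).sub (hPba l j)
  have hf0 : ∀ j z, z ∉ K → f j z = 0 := fun j z hz => by simp only [f, hM0 z hz, zero_mul]
  have hk0 : ∀ z, z ∉ K → k z = 0 := fun z hz => by
    simp [k, hf0 _ z hz, hd0 _ z hz, hm0 z hz]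
  have hW0 : ∀ j l z, z ∉ K → W j l z = 0 := fun j l z hz => by
    simp [W, hdb0 _ z hz]
  have hy : ∀ η : (Fin n → ℂ) → ℂ, ContDiff ℝ ∞ η → HasCompactSupport η →
      ContDiff ℝ 2 (fun z => (m z : ℂ) * η z) ∧ HasCompactSupport (fun z => (m z : ℂ) * η z) ∧
      tsupport (fun z => (m z : ℂ) * η z) ⊆ Ω := fun η h1 h2 =>
    ⟨hcm.mul (h1.of_le (WithTop.coe_le_coe.2 (le_top (a := (2 : ℕ∞))))), h2.mul_left,
      (tsupport_subset_of_eq_zero_off hK.isClosed fun z hz => by simp [hm0 z hz]).trans hKΩ⟩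
  have hmd : Differentiable ℝ fun v => (m v : ℂ) := hcm.differentiable (by norm_num)
  have hmem : ∀ {η u : (Fin n → ℂ) → ℂ}, Continuous η → HasCompactSupport η → MemLp u 2 →
      Integrable fun z => u z * η z := fun h1 h2 hu =>
    hu.integrable_mul (h1.memLp_of_hasCompactSupport (p := 2) h2)
  have hφ1 : ∀ z ∈ Ω, ContDiffAt ℝ 1 φ z := fun z hz => (hφ z hz).of_le (by norm_num)
  refine ⟨integrable_leviForm_mul hΩ hK hKΩ hφ hcφ.neg.rexp hf hf0, ?_, ?_,
    integral_leviForm_le_of_weak hΩ hK hKΩ hφ hf hk hW hf0 hk0 hW0 ?_ ?_⟩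
  · refine integrable_norm_sq_mul_of_eq_zero hΩ hK hKΩ hcφ.neg.rexp
      (hk.sub (memLp_finsetSum _ fun j _ => hN hφ1 j)) fun z hz => ?_
    simp [hk0 z hz, hf0 _ z hz]
  · simp only [Finset.sum_mul]
    exact integrable_finsetSum _ fun j _ => integrable_finsetSum _ fun l _ =>
      integrable_norm_sq_mul_of_eq_zero hΩ hK hKΩ hcφ.neg.rexp (hW j l) (hW0 j l)
  · intro η hη hηc
    obtain ⟨y1, y2, y3⟩ := hy η hη hηc
    have hηd : Differentiable ℝ η := hη.differentiable (by norm_num)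
    have hηw : ∀ j, Continuous (wder n j η) := fun j =>
      (hη.wder (m := 0) j (mod_cast le_top)).continuous
    have i1 : ∀ j, Integrable fun z => f j z * wder n j η z := fun j =>
      hmem (hηw j) (hηc.wder j) (hf j)
    have i2 : ∀ j, Integrable fun z => (wder n j (fun v => (m v : ℂ)) z *
      ((Real.exp (φ' z / 2) : ℝ) : ℂ) * a j z) * η z := fun j => hmem hη.continuous hηc (hPa j)
    have i3 : ∀ j, Integrable fun z => (wder n j (fun v => (φ' v : ℂ)) z * f j z) * η z := fun j =>
      hmem hη.continuous hηc (hN hφ' j)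
    have i4 := hmem hη.continuous hηc hDm
    have i5 := hmem hη.continuous hηc hk
    have h := hadj _ (y1.of_le (by norm_num)) y2 y3
    have e1 : ∀ j z, ((Real.exp (φ' z / 2) : ℝ) : ℂ) * ((wder n j (fun z => (m z : ℂ) * η z) z +
        wder n j (fun v => (φ' v : ℂ)) z * ((m z : ℂ) * η z)) * a j z) =
        f j z * wder n j η z + (wder n j (fun v => (m v : ℂ)) z *
        ((Real.exp (φ' z / 2) : ℝ) : ℂ) * a j z) * η z +
        (wder n j (fun v => (φ' v : ℂ)) z * f j z) * η z := by
      intro j z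
      rw [wder_mul (hmd z) (hηd z)]
      simp only [f, ofReal_mul]
      ring
    have e2 : ∀ z, ((Real.exp (φ' z) : ℝ) : ℂ) * ((m z : ℂ) * η z) * starRingEnd ℂ (D z) =
        (((m z * Real.exp (φ' z) : ℝ) : ℂ) * starRingEnd ℂ (D z)) * η z := fun z => by
      rw [ofReal_mul]; ring
    simp only [e1, e2] at h
    have i6 : ∀ j, Integrable fun z => f j z * wder n j η z + (wder n j (fun v => (m v : ℂ)) z *
        ((Real.exp (φ' z / 2) : ℝ) : ℂ) * a j z) * η z +
        (wder n j (fun v => (φ' v : ℂ)) z * f j z) * η z :=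
      fun j => ((i1 j).add (i2 j)).add (i3 j)
    rw [← integral_finsetSum _ fun j _ => i6 j] at h
    rw [← sub_eq_zero, sub_neg_eq_add, ← integral_add (integrable_finsetSum _ fun j _ => i1 j) i5]
    rw [← sub_eq_zero, sub_neg_eq_add, ← integral_add
      (integrable_finsetSum _ fun j _ => i6 j) i4] at h
    rw [← h]
    congr 1
    ext z
    simp only [k, add_mul, Finset.sum_mul, Finset.sum_add_distrib]
    ring
  · intro j l η hη hηc
    obtain ⟨y1, y2, y3⟩ := hy η hη hηc
    have hηd : Differentiable ℝ η := hη.differentiable (by norm_num)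
    have hηw : ∀ j, Continuous (wderBar n j η) := fun j =>
      (hη.wderBar (m := 0) j (mod_cast le_top)).continuous
    have i1 : ∀ j l, Integrable fun z => f j z * wderBar n l η z := fun j l =>
      hmem (hηw l) (hηc.wderBar l) (hf j)
    have i5 := hmem hη.continuous hηc (hW j l)
    have h := hcl j l _ y1 y2 y3
    have i6 : Integrable fun z => f l z * wderBar n j η z - f j z * wderBar n l η z :=
      (i1 l j).sub (i1 j l)
    rw [← sub_eq_zero, sub_neg_eq_add, ← integral_add i6 i5, ← h]
    congr 1
    ext z
    rw [wderBar_mul (hmd z) (hηd z), wderBar_mul (hmd z) (hηd z)]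
    simp only [f, W, ofReal_mul]
    ring

end CutoffForm

/-! ### The energy estimate for the dual form -/

section Energy

variable {n : ℕ}

/-- A plurisubharmonic exhaustion function whose gradient grows at most exponentially. -/
structure IsExhaustion (Ω : Set (Fin n → ℂ)) (s : (Fin n → ℂ) → ℝ) (C : ℝ) : Prop where
  contDiffAt : ∀ z ∈ Ω, ContDiffAt ℝ 2 s z
  leviForm_nonneg : ∀ z ∈ Ω, ∀ X, 0 ≤ leviForm s z X
  norm_wder_le : ∀ z ∈ Ω, ∀ j, ‖wder n j (fun v => (s v : ℂ)) z‖ ≤ C * Real.exp (s z)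
  isCompact : ∀ τ, IsCompact {z | z ∈ Ω ∧ s z ≤ τ}

theorem two_mul_norm_sum_sq_add_le {P Q a : Fin n → ℂ} {q : ℝ} (hP : ∀ j, ‖P j‖ ≤ q)
    (hQ : ∀ j, ‖Q j‖ ≤ q) :
    2 * ‖∑ j, P j * a j‖ ^ 2 + (1 / 2) * ∑ j, ∑ l, ‖Q j * a l - Q l * a j‖ ^ 2 ≤
      4 * n * q ^ 2 * ∑ j, ‖a j‖ ^ 2 := by
  have h1 : ‖∑ j, P j * a j‖ ^ 2 ≤ n * q ^ 2 * ∑ j, ‖a j‖ ^ 2 := by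
    calc ‖∑ j, P j * a j‖ ^ 2 ≤ (∑ j, q * ‖a j‖) ^ 2 := by
          refine pow_le_pow_left₀ (norm_nonneg _) ((norm_sum_le _ _).trans
            (Finset.sum_le_sum fun j _ => ?_)) 2
          rw [norm_mul]
          exact mul_le_mul_of_nonneg_right (hP j) (norm_nonneg _)
      _ = q ^ 2 * (∑ j, ‖a j‖) ^ 2 := by rw [← Finset.mul_sum, mul_pow]
      _ ≤ q ^ 2 * (n * ∑ j, ‖a j‖ ^ 2) := by
          refine mul_le_mul_of_nonneg_left ?_ (sq_nonneg _)
          simpa using sq_sum_le_card_mul_sum_sq (s := Finset.univ) (f := fun j => ‖a j‖)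
      _ = _ := by ring
  have h2 : ∀ j l, ‖Q j * a l - Q l * a j‖ ^ 2 ≤ 2 * q ^ 2 * (‖a l‖ ^ 2 + ‖a j‖ ^ 2) := by
    intro j l
    have h3 : ‖Q j * a l - Q l * a j‖ ≤ q * ‖a l‖ + q * ‖a j‖ := by
      refine (norm_sub_le _ _).trans ?_
      rw [norm_mul, norm_mul]
      exact add_le_add (mul_le_mul_of_nonneg_right (hQ j) (norm_nonneg _))
        (mul_le_mul_of_nonneg_right (hQ l) (norm_nonneg _))
    refine (pow_le_pow_left₀ (norm_nonneg _) h3 2).trans ?_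
    nlinarith [sq_nonneg (q * ‖a l‖ - q * ‖a j‖)]
  have h4 : ∑ j, ∑ l, ‖Q j * a l - Q l * a j‖ ^ 2 ≤ 4 * n * q ^ 2 * ∑ j, ‖a j‖ ^ 2 := by
    refine (Finset.sum_le_sum fun j _ => Finset.sum_le_sum fun l _ => h2 j l).trans_eq ?_
    simp only [← Finset.mul_sum, Finset.sum_add_distrib, Finset.sum_const, Finset.card_univ,
      Fintype.card_fin, nsmul_eq_mul]
    ring
  linarith

theorem IsExhaustion.cutoff {Ω : Set (Fin n → ℂ)} {s : (Fin n → ℂ) → ℝ} {C : ℝ}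
    (hΩ : IsOpen Ω) (hs : IsExhaustion Ω s C) : ∃ B : ℝ, 0 ≤ B ∧ ∀ ν : ℝ,
      ∃ m : (Fin n → ℂ) → ℝ, ContDiff ℝ 2 m ∧ (∀ z, z ∉ {z | z ∈ Ω ∧ s z ≤ ν + 1} → m z = 0) ∧
      (∀ z ∈ Ω, s z ≤ ν → m z = 1) ∧
      (∀ z ∈ Ω, s z < ν → ∀ j, wder n j (fun v => (m v : ℂ)) z = 0) ∧
      (∀ z ∈ Ω, ∀ j, ‖wder n j (fun v => (m v : ℂ)) z‖ ≤ B * Real.exp (s z)) := by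
  classical
  obtain ⟨h, B, hh, h1, h0, hd, hB⟩ := exists_real_cutoff
  have hB0 : 0 ≤ B := (abs_nonneg _).trans (hB 0)
  refine ⟨B * |C|, by positivity, fun ν => ⟨Ω.indicator fun z => h (s z - ν), ?_, ?_, ?_, ?_⟩⟩
  · refine contDiff_of_eq_zero_off (hs.isCompact (ν + 1)).isClosed (fun z hz => hz.1)
      (fun z hz => ?_) fun z hz => ?_
    · refine ContDiffAt.congr_of_eventuallyEq (f := fun z => h (s z - ν)) ?_ ?_
      · exact (hh.contDiffAt.of_le (WithTop.coe_le_coe.2 (le_top (a := (2 : ℕ∞))))).comp z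
          ((hs.contDiffAt z hz).sub contDiffAt_const)
      · filter_upwards [hΩ.mem_nhds hz] with w hw using indicator_of_mem hw _
    · by_cases hz' : z ∈ Ω
      · rw [indicator_of_mem hz']
        exact h0 _ (by_contra fun hc => hz ⟨hz', by linarith⟩)
      · rw [indicator_of_notMem hz']
  · intro z hz
    by_cases hz' : z ∈ Ω
    · rw [indicator_of_mem hz']
      exact h0 _ (by_contra fun hc => hz ⟨hz', by linarith⟩)
    · rw [indicator_of_notMem hz']
  · intro z hz hz'
    rw [indicator_of_mem hz]
    exact h1 _ (by linarith)
  have hw : ∀ z ∈ Ω, ∀ j, wder n j (fun v => ((Ω.indicator (fun z => h (s z - ν)) v : ℝ) : ℂ)) z =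
      deriv h (s z - ν) * wder n j (fun v => (s v : ℂ)) z := by
    intro z hz j
    have hsd : DifferentiableAt ℝ s z := (hs.contDiffAt z hz).differentiableAt (by norm_num)
    have hder : HasDerivAt (fun τ => h (τ - ν)) (deriv h (s z - ν)) (s z) := by
      have h2 : HasDerivAt h (deriv h (s z - ν)) (s z - ν) :=
        (hh.differentiable (by simp) _).hasDerivAt
      exact h2.comp_sub_const (s z) ν
    have e : wder n j (fun v => ((Ω.indicator (fun z => h (s z - ν)) v : ℝ) : ℂ)) z =
        wder n j (fun v => ((h (s v - ν) : ℝ) : ℂ)) z := by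
      refine wder_congr ?_
      filter_upwards [hΩ.mem_nhds hz] with w hw
      rw [indicator_of_mem hw]
    have hsd2 : DifferentiableAt ℝ (fun v => h (s v - ν)) z :=
      (hder.comp_hasFDerivAt z hsd.hasFDerivAt).differentiableAt
    rw [e, wder_ofReal hsd2, wder_ofReal hsd, fderiv_comp_real hsd hder]
    simp
    ring
  refine ⟨fun z hz hz' j => ?_, fun z hz j => ?_⟩
  · rw [hw z hz, hd _ (by linarith), ofReal_zero, zero_mul]
  · rw [hw z hz, norm_mul, norm_real, mul_assoc]
    refine mul_le_mul (hB _) ((hs.norm_wder_le z hz j).trans ?_) (norm_nonneg _) hB0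
    exact mul_le_mul_of_nonneg_right (le_abs_self C) (Real.exp_pos _).le

theorem ContDiffAt.add_max_zero_pow {s ψ : (Fin n → ℂ) → ℝ} {z : Fin n → ℂ}
    (hs : ContDiffAt ℝ 2 s z) (hψ : ContDiffAt ℝ 2 ψ z) (t : ℝ) :
    ContDiffAt ℝ 2 (fun z => ψ z + max (s z - t) 0 ^ 4) z ∧
    ContDiffAt ℝ 1 (fun z => ψ z + max (s z - t) 0 ^ 4 - max (s z - t) 0 ^ 2) z ∧
    (∀ X, leviForm (fun z => ψ z + max (s z - t) 0 ^ 4) z X = leviForm ψ z X +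
      (4 * max (s z - t) 0 ^ 3 * leviForm s z X +
        12 * max (s z - t) 0 ^ 2 * ‖dPairing s z X‖ ^ 2)) ∧
    ∀ j, wder n j (fun v => ((ψ v + max (s v - t) 0 ^ 4 - max (s v - t) 0 ^ 2 : ℝ) : ℂ)) z =
      wder n j (fun v => ((ψ v + max (s v - t) 0 ^ 4 : ℝ) : ℂ)) z -
      ((2 * max (s z - t) 0 : ℝ) : ℂ) * wder n j (fun v => (s v : ℂ)) z := by
  have hst : ContDiffAt ℝ 2 (fun z => s z - t) z := hs.sub contDiffAt_const
  have c4 : ContDiffAt ℝ 2 (fun z => max (s z - t) 0 ^ 4) z :=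
    ContDiffAt.comp (g := fun τ => max τ 0 ^ 4) z
      ((contDiff_max_zero_pow 3).of_le (by norm_num)).contDiffAt hst
  have c2 : ContDiffAt ℝ 1 (fun z => max (s z - t) 0 ^ 2) z :=
    ContDiffAt.comp (g := fun τ => max τ 0 ^ 2) z
      ((contDiff_max_zero_pow 1).of_le (by norm_num)).contDiffAt (hst.of_le (by norm_num))
  have hd : ∀ (k : ℕ) (τ : ℝ), HasDerivAt (fun τ => max (τ - t) 0 ^ (k + 2))
      ((k + 2) * max (τ - t) 0 ^ (k + 1)) τ := fun k τ =>
    (hasDerivAt_max_zero_pow k (τ - t)).comp_sub_const τ t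
  refine ⟨hψ.add c4, ((hψ.add c4).of_le (by norm_num)).sub c2, fun X => ?_, fun j => ?_⟩
  · rw [leviForm_add hψ c4, leviForm_comp (θ := fun τ => max (τ - t) 0 ^ 4)
      (θ' := fun τ => 4 * max (τ - t) 0 ^ 3) (θ'' := 12 * max (s z - t) 0 ^ 2) hs
      (Eventually.of_forall fun τ => by have := hd 2 τ; norm_num at this; exact this) ?_]
    have := (hd 1 (s z)).const_mul 4
    norm_num [← mul_assoc] at this
    exact this
  · have hsd : DifferentiableAt ℝ s z := hs.differentiableAt (by norm_num)
    have hφd : DifferentiableAt ℝ (fun z => ψ z + max (s z - t) 0 ^ 4) z :=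
      (hψ.add c4).differentiableAt (by norm_num)
    have hcd : DifferentiableAt ℝ (fun z => max (s z - t) 0 ^ 2) z :=
      c2.differentiableAt (by norm_num)
    have h2 := fderiv_comp_real hsd (by simpa using hd 0 (s z))
    rw [wder_ofReal (hφd.fun_sub hcd), wder_ofReal hφd, wder_ofReal hsd, fderiv_fun_sub hφd hcd, h2]
    simp
    ring

end Energy

section EnergyEstimate

variable {n : ℕ}

theorem two_mul_sub_sq_le {x t ν : ℝ} (h : ν ≤ x + t) :
    2 * (x + t) - x ^ 2 ≤ 3 + 3 * t - ν := by
  nlinarith [sq_nonneg (2 * x - 3)]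

theorem integral_closed_dual_le_add {Ω S : Set (Fin n → ℂ)} (hΩ : IsOpen Ω)
    {s ψ : (Fin n → ℂ) → ℝ} {C t : ℝ} (hs : IsExhaustion Ω s C)
    (hψ : ∀ z ∈ Ω, ContDiffAt ℝ 2 ψ z) (hψ0 : ∀ z ∈ Ω, ∀ X, 0 ≤ leviForm ψ z X)
    (hS : MeasurableSet S) (hSΩ : S ⊆ Ω) (hSt : ∀ z ∈ S, s z ≤ t) {b : Fin n → ℝ}
    (hb : ∀ z ∈ S, ∀ X : Fin n → ℂ, ∑ j, b j * ‖X j‖ ^ 2 ≤ leviForm ψ z X)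
    {D : (Fin n → ℂ) → ℂ} (hD : Continuous D) (hDt : ∀ z, D z ≠ 0 → z ∈ Ω ∧ s z ≤ t)
    {a : Fin n → (Fin n → ℂ) → ℂ} (ha : ∀ k, MemLp (a k) 2)
    (hcl : ∀ j k η, ContDiff ℝ 2 η → HasCompactSupport η → tsupport η ⊆ Ω →
        ∫ z, Real.exp ((ψ z + max (s z - t) 0 ^ 4 - max (s z - t) 0 ^ 2) / 2) *
          (a k z * wderBar n j η z - a j z * wderBar n k η z) = 0)
    (hadj : ∀ y : (Fin n → ℂ) → ℂ, ContDiff ℝ 1 y → HasCompactSupport y → tsupport y ⊆ Ω →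
        ∑ k, ∫ z, Real.exp ((ψ z + max (s z - t) 0 ^ 4 - max (s z - t) 0 ^ 2) / 2) *
          ((wder n k y z + wder n k (fun v =>
            ((ψ v + max (s v - t) 0 ^ 4 - max (s v - t) 0 ^ 2 : ℝ) : ℂ)) z * y z) * a k z) =
          - ∫ z, Real.exp (ψ z + max (s z - t) 0 ^ 4 - max (s z - t) 0 ^ 2) * y z *
            starRingEnd ℂ (D z)) :
    ∃ B : ℝ, ∀ ν, t + 1 ≤ ν → ∫ z, S.indicator (fun z => ∑ j, b j * ‖a j z‖ ^ 2) z ≤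
      (∫ z, ‖D z‖ ^ 2 * Real.exp (ψ z)) + B * Real.exp (-ν) := by
  obtain ⟨B, hB0, hB⟩ := hs.cutoff hΩ
  have haq : ∀ j, Integrable fun z => ‖a j z‖ ^ 2 := fun j =>
    (memLp_two_iff_integrable_sq_norm (ha j).1).1 (ha j)
  have iA : Integrable fun z => ∑ j, ‖a j z‖ ^ 2 := integrable_finsetSum _ fun j _ => haq j
  refine ⟨4 * n * B ^ 2 * Real.exp (3 + 3 * t) * ∫ z, ∑ j, ‖a j z‖ ^ 2, fun ν hν => ?_⟩
  obtain ⟨m, hm, hm0, hm1, hmd0, hmd⟩ := hB ν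
  have hK := hs.isCompact (ν + 1)
  set φ : (Fin n → ℂ) → ℝ := fun z => ψ z + max (s z - t) 0 ^ 4 with hφdef
  set φ' : (Fin n → ℂ) → ℝ := fun z => ψ z + max (s z - t) 0 ^ 4 - max (s z - t) 0 ^ 2 with hφ'def
  have hall := fun z (hz : z ∈ Ω) => (hs.contDiffAt z hz).add_max_zero_pow (hψ z hz) t
  have hφ : ∀ z ∈ Ω, ContDiffAt ℝ 2 φ z := fun z hz => (hall z hz).1
  have hφ' : ∀ z ∈ Ω, ContDiffAt ℝ 1 φ' z := fun z hz => (hall z hz).2.1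
  have hψc : ContinuousOn (fun z => Real.exp (ψ z)) Ω := fun z hz =>
    (hψ z hz).continuousAt.rexp.continuousWithinAt
  have hmain := integral_leviForm_cutoff_le hΩ hK (fun z hz => hz.1) hφ hφ' hm hm0 hD ha hcl hadj
  dsimp only at hmain
  obtain ⟨iL, iQ, iW, hle⟩ := hmain
  have iD : Integrable fun z => ‖D z‖ ^ 2 * Real.exp (ψ z) := by
    have hD0 : ∀ z, z ∉ {z | z ∈ Ω ∧ s z ≤ t} → D z = 0 := fun z hz =>
      by_contra fun hc => hz (hDt z hc)
    exact integrable_norm_sq_mul_of_eq_zero hΩ (hs.isCompact t) (fun z hz => hz.1) hψc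
      (hD.memLp_of_hasCompactSupport (hasCompactSupport_of_eq_zero_off (hs.isCompact t) hD0)) hD0
  have iS : Integrable fun z => S.indicator (fun z => ∑ j, b j * ‖a j z‖ ^ 2) z :=
    (integrable_finsetSum _ fun j _ => (haq j).const_mul (b j)).indicator hS
  set ε := 4 * n * B ^ 2 * Real.exp (3 + 3 * t) * Real.exp (-ν)
  have key : ∀ z, S.indicator (fun z => ∑ j, b j * ‖a j z‖ ^ 2) z +
      ‖∑ j, wder n j (fun v => (m v : ℂ)) z * (Real.exp (φ' z / 2) : ℝ) * a j z +
      ∑ j, wder n j (fun v => (φ' v : ℂ)) z * (((m z * Real.exp (φ' z / 2) : ℝ) : ℂ) * a j z) +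
      ((m z * Real.exp (φ' z) : ℝ) : ℂ) * starRingEnd ℂ (D z) -
      ∑ j, wder n j (fun v => (φ v : ℂ)) z * (((m z * Real.exp (φ' z / 2) : ℝ) : ℂ) * a j z)‖ ^ 2 *
      Real.exp (-φ z) +
      (1 / 2) * ((∑ j, ∑ l, ‖wderBar n j (fun v => (m v : ℂ)) z * (Real.exp (φ' z / 2) : ℝ) * a l z -
      wderBar n l (fun v => (m v : ℂ)) z * (Real.exp (φ' z / 2) : ℝ) * a j z‖ ^ 2) *
        Real.exp (-φ z)) ≤
      leviForm φ z (fun j => ((m z * Real.exp (φ' z / 2) : ℝ) : ℂ) * a j z) * Real.exp (-φ z) +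
        ‖D z‖ ^ 2 * Real.exp (ψ z) + ε * ∑ j, ‖a j z‖ ^ 2 := by
    intro z
    have hA : 0 ≤ ∑ j, ‖a j z‖ ^ 2 := Finset.sum_nonneg fun j _ => sq_nonneg _
    by_cases hz : z ∈ Ω
    swap
    · have hzK : z ∉ {z | z ∈ Ω ∧ s z ≤ ν + 1} := fun h => hz h.1
      have hev : (fun v => (m v : ℂ)) =ᶠ[𝓝 z] fun _ => 0 := by
        filter_upwards [hK.isClosed.isOpen_compl.mem_nhds hzK] with w hw
        rw [hm0 w hw, ofReal_zero]
      have hD0 : D z = 0 := by_contra fun hc => hz (hDt z hc).1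
      rw [indicator_of_notMem fun h => hz (hSΩ h), hm0 z hzK, hD0]
      simp only [wder_eq_zero hev, wderBar_eq_zero hev]
      simp only [leviForm_ofReal_mul]
      simp
      positivity
    obtain ⟨-, -, hlev, hwd⟩ := hall z hz
    have hsd : DifferentiableAt ℝ s z := (hs.contDiffAt z hz).differentiableAt (by norm_num)
    have hwb : ∀ j, ‖wderBar n j (fun v => (m v : ℂ)) z‖ = ‖wder n j (fun v => (m v : ℂ)) z‖ := by
      intro j
      have := wder_conj j (fun v => (m v : ℂ)) z
      simp only [conj_ofReal] at this
      rw [this, RCLike.norm_conj]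
    set x := max (s z - t) 0 with hx
    have hx0 : 0 ≤ x := le_max_right _ _
    set E := Real.exp (φ' z / 2) with hE
    have hE2 : Real.exp (φ' z) = E ^ 2 := by
      rw [hE, ← Real.exp_nat_mul]; congr 1; push_cast; ring
    have hE0 : 0 < E := Real.exp_pos _
    have hφx : φ z = φ' z + x ^ 2 := by simp only [hφdef, hφ'def]; ring
    replace hwd : ∀ j, wder n j (fun v => (φ' v : ℂ)) z = wder n j (fun v => (φ v : ℂ)) z -
        ((2 * x : ℝ) : ℂ) * wder n j (fun v => (s v : ℂ)) z := hwd
    set p : ℂ := ∑ j, wder n j (fun v => (m v : ℂ)) z * (E : ℂ) * a j z with hp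
    have hdiff : p + ∑ j, wder n j (fun v => (φ' v : ℂ)) z * (((m z * E : ℝ) : ℂ) * a j z) +
        ((m z * Real.exp (φ' z) : ℝ) : ℂ) * starRingEnd ℂ (D z) -
        ∑ j, wder n j (fun v => (φ v : ℂ)) z * (((m z * E : ℝ) : ℂ) * a j z) =
        p - ((m z * E * (2 * x) : ℝ) : ℂ) * dPairing s z (fun j => a j z) +
        ((m z * Real.exp (φ' z) : ℝ) : ℂ) * starRingEnd ℂ (D z) := by
      rw [← sum_wder_ofReal_mul hsd, Finset.mul_sum]
      have : ∑ j, wder n j (fun v => (φ' v : ℂ)) z * (((m z * E : ℝ) : ℂ) * a j z) =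
          ∑ j, wder n j (fun v => (φ v : ℂ)) z * (((m z * E : ℝ) : ℂ) * a j z) -
          ∑ j, ((m z * E * (2 * x) : ℝ) : ℂ) * (wder n j (fun v => (s v : ℂ)) z * a j z) := by
        rw [← Finset.sum_sub_distrib]
        refine Finset.sum_congr rfl fun j _ => ?_
        rw [hwd j]
        push_cast
        ring
      rw [this]
      ring
    rw [hdiff]
    have hlev2 : leviForm φ z (fun j => ((m z * E : ℝ) : ℂ) * a j z) = (m z * E) ^ 2 *
        (leviForm ψ z (fun j => a j z) + (4 * x ^ 3 * leviForm s z (fun j => a j z) +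
        12 * x ^ 2 * ‖dPairing s z (fun j => a j z)‖ ^ 2)) := by
      rw [leviForm_ofReal_mul, hlev]
    rw [hlev2]
    have htail : 2 * ‖p‖ ^ 2 * Real.exp (-φ z) + (1 / 2) * ((∑ j, ∑ l,
        ‖wderBar n j (fun v => (m v : ℂ)) z * (E : ℂ) * a l z -
        wderBar n l (fun v => (m v : ℂ)) z * (E : ℂ) * a j z‖ ^ 2) * Real.exp (-φ z)) ≤
        ε * ∑ j, ‖a j z‖ ^ 2 := by
      rcases lt_or_ge (s z) ν with h | h
      · have h1 : ∀ j, wder n j (fun v => (m v : ℂ)) z = 0 := hmd0 z hz h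
        have h2 : ∀ j, wderBar n j (fun v => (m v : ℂ)) z = 0 := fun j => by
          rw [← norm_eq_zero, hwb, h1, norm_zero]
        simp only [hp, h1, h2]
        simp
        positivity
      · have hq : ∀ j, ‖wder n j (fun v => (m v : ℂ)) z * (E : ℂ)‖ ≤ B * Real.exp (s z) * E := by
          intro j
          rw [norm_mul, norm_real, Real.norm_of_nonneg hE0.le]
          exact mul_le_mul_of_nonneg_right (hmd z hz j) hE0.le
        have hq' : ∀ j, ‖wderBar n j (fun v => (m v : ℂ)) z * (E : ℂ)‖ ≤
            B * Real.exp (s z) * E := fun j => by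
          rw [norm_mul, hwb, ← norm_mul]; exact hq j
        have h1 := two_mul_norm_sum_sq_add_le (a := fun j => a j z) hq hq'
        have h2 : (B * Real.exp (s z) * E) ^ 2 * Real.exp (-φ z) ≤
            B ^ 2 * Real.exp (3 + 3 * t) * Real.exp (-ν) := by
          have hxe : x = s z - t := max_eq_left (by linarith)
          have e : (B * Real.exp (s z) * E) ^ 2 * Real.exp (-φ z) =
              B ^ 2 * Real.exp (2 * (x + t) - x ^ 2) := by
            have e1 : Real.exp (2 * (x + t) - x ^ 2) =
                Real.exp (s z) ^ 2 * (Real.exp (φ' z) * Real.exp (-φ z)) := by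
              rw [← Real.exp_nat_mul, ← Real.exp_add, ← Real.exp_add, hφx, hxe]
              congr 1; push_cast; ring
            rw [e1, hE2]; ring
          rw [e, mul_assoc, ← Real.exp_add]
          refine mul_le_mul_of_nonneg_left (Real.exp_le_exp.2 ?_) (sq_nonneg _)
          have := two_mul_sub_sq_le (x := x) (t := t) (ν := ν) (by rw [hxe]; linarith)
          linarith
        calc _ = (2 * ‖p‖ ^ 2 + (1 / 2) * (∑ j, ∑ l,
              ‖wderBar n j (fun v => (m v : ℂ)) z * (E : ℂ) * a l z -
              wderBar n l (fun v => (m v : ℂ)) z * (E : ℂ) * a j z‖ ^ 2)) * Real.exp (-φ z) := by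
              ring
          _ ≤ (4 * n * (B * Real.exp (s z) * E) ^ 2 * ∑ j, ‖a j z‖ ^ 2) * Real.exp (-φ z) :=
              mul_le_mul_of_nonneg_right h1 (Real.exp_pos _).le
          _ = 4 * n * (∑ j, ‖a j z‖ ^ 2) *
              ((B * Real.exp (s z) * E) ^ 2 * Real.exp (-φ z)) := by ring
          _ ≤ 4 * n * (∑ j, ‖a j z‖ ^ 2) * (B ^ 2 * Real.exp (3 + 3 * t) * Real.exp (-ν)) :=
              mul_le_mul_of_nonneg_left h2 (by positivity)
          _ = _ := by simp only [ε]; ring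
    have hbody : S.indicator (fun z => ∑ j, b j * ‖a j z‖ ^ 2) z +
        ‖p - ((m z * E * (2 * x) : ℝ) : ℂ) * dPairing s z (fun j => a j z) +
        ((m z * Real.exp (φ' z) : ℝ) : ℂ) * starRingEnd ℂ (D z)‖ ^ 2 * Real.exp (-φ z) ≤
        (m z * E) ^ 2 *
        (leviForm ψ z (fun j => a j z) + (4 * x ^ 3 * leviForm s z (fun j => a j z) +
        12 * x ^ 2 * ‖dPairing s z (fun j => a j z)‖ ^ 2)) * Real.exp (-φ z) +
        ‖D z‖ ^ 2 * Real.exp (ψ z) + 2 * ‖p‖ ^ 2 * Real.exp (-φ z) := by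
      rcases le_or_gt (s z) t with h | h
      · have hxe : x = 0 := max_eq_right (by linarith)
        have hp0 : p = 0 := by
          rw [hp]; exact Finset.sum_eq_zero fun j _ => by rw [hmd0 z hz (by linarith)]; ring
        have hψe : φ z = ψ z := by
          change ψ z + x ^ 4 = ψ z; rw [hxe]; ring
        have hψe' : φ' z = ψ z := by rw [← hψe, hφx, hxe]; ring
        rw [hm1 z hz (by linarith), hp0, hxe, hψe]
        have hE3 : E ^ 2 * Real.exp (-ψ z) = 1 := by
          rw [← hE2, hψe', ← Real.exp_add, add_neg_cancel, Real.exp_zero]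
        have h3 : ‖(0 : ℂ) - ((1 * E * (2 * 0) : ℝ) : ℂ) * dPairing s z (fun j => a j z) +
            ((1 * Real.exp (φ' z) : ℝ) : ℂ) * starRingEnd ℂ (D z)‖ ^ 2 * Real.exp (-ψ z) =
            ‖D z‖ ^ 2 * Real.exp (ψ z) := by
          have : ‖(0 : ℂ) - ((1 * E * (2 * 0) : ℝ) : ℂ) * dPairing s z (fun j => a j z) +
            ((1 * Real.exp (φ' z) : ℝ) : ℂ) * starRingEnd ℂ (D z)‖ = E ^ 2 * ‖D z‖ := by
            rw [hE2]
            simp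
          rw [this]
          calc (E ^ 2 * ‖D z‖) ^ 2 * Real.exp (-ψ z) =
              ‖D z‖ ^ 2 * E ^ 2 * (E ^ 2 * Real.exp (-ψ z)) := by ring
            _ = _ := by rw [hE3, mul_one, ← hE2, hψe']
        have h4 : S.indicator (fun z => ∑ j, b j * ‖a j z‖ ^ 2) z ≤
            leviForm ψ z (fun j => a j z) := by
          by_cases hzS : z ∈ S
          · rw [indicator_of_mem hzS]; exact hb z hzS _
          · rw [indicator_of_notMem hzS]; exact hψ0 z hz _
        rw [h3]
        calc _ ≤ leviForm ψ z (fun j => a j z) + ‖D z‖ ^ 2 * Real.exp (ψ z) := by linarith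
          _ = (E ^ 2 * Real.exp (-ψ z)) * leviForm ψ z (fun j => a j z) +
              ‖D z‖ ^ 2 * Real.exp (ψ z) := by rw [hE3, one_mul]
          _ = _ := by rw [norm_zero]; ring
      · have hD0 : D z = 0 := by_contra fun hc => by linarith [(hDt z hc).2]
        rw [indicator_of_notMem fun hc => by linarith [hSt z hc], hD0]
        have := norm_sub_sq_mul_le (m := m z) (E := E) hx0 (hψ0 z hz fun j => a j z)
          (hs.leviForm_nonneg z hz fun j => a j z) (Real.exp_pos (-φ z)).le p
          (dPairing s z fun j => a j z)
        simpa using this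
    linarith
  have hInt := integral_mono ((iS.add iQ).add (iW.const_mul (1 / 2)))
    ((iL.add iD).add (iA.const_mul ε)) key
  have e1 := integral_add (iS.add iQ) (iW.const_mul (1 / 2))
  have e2 := integral_add iS iQ
  have e3 := integral_add (iL.add iD) (iA.const_mul ε)
  have e4 := integral_add iL iD
  rw [integral_const_mul] at e1 e3
  simp only [Pi.add_apply] at e1 e2 e3 e4 hInt
  rw [e1, e2, e3, e4] at hInt
  have : ε * ∫ z, ∑ j, ‖a j z‖ ^ 2 = 4 * n * B ^ 2 * Real.exp (3 + 3 * t) *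
    (∫ z, ∑ j, ‖a j z‖ ^ 2) * Real.exp (-ν) := by simp only [ε]; ring
  linarith

end EnergyEstimate

section DualEstimate

variable {n : ℕ}

/-- The dual form of the weighted `L²` estimate for the `∂̄`-equation. -/
theorem norm_sum_integral_sq_le {Ω S : Set (Fin n → ℂ)} (hΩ : IsOpen Ω)
    {s ψ : (Fin n → ℂ) → ℝ} {C : ℝ} (hs : IsExhaustion Ω s C)
    (hψ : ∀ z ∈ Ω, ContDiffAt ℝ 2 ψ z) (hψ0 : ∀ z ∈ Ω, ∀ X, 0 ≤ leviForm ψ z X)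
    (hS : IsCompact S) (hSΩ : S ⊆ Ω) {b : Fin n → ℝ} (hb0 : ∀ j, 0 < b j)
    (hb : ∀ z ∈ S, ∀ X : Fin n → ℂ, ∑ j, b j * ‖X j‖ ^ 2 ≤ leviForm ψ z X)
    {v : Fin n → (Fin n → ℂ) → ℂ} (hv : ∀ k, Continuous (v k)) (hvS : ∀ k, tsupport (v k) ⊆ S)
    (hvcl : ∀ j k η, ContDiff ℝ 2 η → HasCompactSupport η → tsupport η ⊆ Ω →
      ∫ z, (v k z * wderBar n j η z - v j z * wderBar n k η z) = 0)
    {γ : Fin n → (Fin n → ℂ) → ℂ} (hγ : ∀ k, ContDiff ℝ 1 (γ k))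
    (hγc : ∀ k, HasCompactSupport (γ k)) (hγΩ : ∀ k, tsupport (γ k) ⊆ Ω) :
    ‖∑ k, ∫ z, v k z * γ k z‖ ^ 2 ≤
      (∫ z, ∑ k, (b k)⁻¹ * ‖v k z‖ ^ 2 * Real.exp (-ψ z)) *
        ∫ z, ‖∑ k, wderBar n k (γ k) z‖ ^ 2 * Real.exp (ψ z) := by
  obtain ⟨t, ht⟩ : ∃ t, ∀ z ∈ S ∪ ⋃ k, tsupport (γ k), s z ≤ t := by
    have hc : IsCompact (S ∪ ⋃ k, tsupport (γ k)) := hS.union (isCompact_iUnion hγc)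
    obtain ⟨t, ht⟩ := hc.bddAbove_image (f := s) fun z hz => by
      have : z ∈ Ω := (union_subset hSΩ (iUnion_subset hγΩ)) hz
      exact (hs.contDiffAt z this).continuousAt.continuousWithinAt
    exact ⟨t, fun z hz => ht (mem_image_of_mem s hz)⟩
  have hD : Continuous fun z => ∑ k, wderBar n k (γ k) z :=
    continuous_finsetSum _ fun k _ => ((hγ k).wderBar (m := 0) k (by norm_num)).continuous
  have hDt : ∀ z, ∑ k, wderBar n k (γ k) z ≠ 0 → z ∈ Ω ∧ s z ≤ t := by
    intro z hz
    obtain ⟨k, -, hk⟩ := Finset.exists_ne_zero_of_sum_ne_zero hz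
    have hk' : z ∈ tsupport (γ k) := by
      by_contra hc
      exact hk (wderBar_eq_zero (notMem_tsupport_iff_eventuallyEq.1 hc))
    exact ⟨hγΩ k hk', ht z (Or.inr (mem_iUnion.2 ⟨k, hk'⟩))⟩
  obtain ⟨a, ha, hcl, hdual, hadj⟩ := exists_closed_dual
    (φ := fun z => ψ z + max (s z - t) 0 ^ 4 - max (s z - t) 0 ^ 2)
    (fun z hz => ((hs.contDiffAt z hz).add_max_zero_pow (hψ z hz) t).2.1) hγ hγc hγΩ
  obtain ⟨B, hB⟩ := integral_closed_dual_le_add hΩ hs hψ hψ0 hS.isClosed.measurableSet hSΩ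
    (fun z hz => ht z (Or.inl hz)) hb hD hDt ha hcl hadj
  have hv0 : ∀ k z, z ∉ S → v k z = 0 := fun k z hz =>
    image_eq_zero_of_notMem_tsupport fun hc => hz (hvS k hc)
  have hvc : ∀ k, HasCompactSupport (v k) := fun k => hasCompactSupport_of_eq_zero_off hS (hv0 k)
  set Q := ∫ z, ‖∑ k, wderBar n k (γ k) z‖ ^ 2 * Real.exp (ψ z)
  have hT : ∫ z, S.indicator (fun z => ∑ j, b j * ‖a j z‖ ^ 2) z ≤ Q := by
    have hlim : Tendsto (fun ν : ℝ => Q + B * Real.exp (-ν)) atTop (𝓝 (Q + B * 0)) :=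
      tendsto_const_nhds.add
        ((Real.tendsto_exp_atBot.comp tendsto_neg_atTop_atBot).const_mul B)
    rw [mul_zero, add_zero] at hlim
    refine ge_of_tendsto hlim ?_
    filter_upwards [eventually_ge_atTop (t + 1)] with ν hν using hB ν hν
  have hψc : ContinuousOn (fun z => Real.exp (-ψ z)) Ω := fun z hz =>
    (hψ z hz).continuousAt.neg.rexp.continuousWithinAt
  have iv : ∀ k, Integrable fun z => (b k)⁻¹ * ‖v k z‖ ^ 2 * Real.exp (-ψ z) := fun k => by
    have := (integrable_norm_sq_mul_of_eq_zero hΩ hS hSΩ hψc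
      ((hv k).memLp_of_hasCompactSupport (hvc k)) (hv0 k)).const_mul (b k)⁻¹
    simpa only [mul_assoc] using this
  have ia : ∀ k, Integrable fun z => S.indicator (fun z => b k * ‖a k z‖ ^ 2) z := fun k =>
    (((memLp_two_iff_integrable_sq_norm (ha k).1).1 (ha k)).const_mul (b k)).indicator
      hS.isClosed.measurableSet
  set A := ∫ z, ∑ k, (b k)⁻¹ * ‖v k z‖ ^ 2 * Real.exp (-ψ z) with hA
  have hA0 : 0 ≤ A := integral_nonneg fun z => Finset.sum_nonneg fun k _ => by
    have := (hb0 k).le; positivity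
  have hQ0 : 0 ≤ Q := integral_nonneg fun z => by positivity
  rw [← hdual v hv hvc (fun k => (hvS k).trans hSΩ) hvcl]
  set N := ‖∑ k, ∫ z, v k z * starRingEnd ℂ (a k z) *
    Real.exp (-((ψ z + max (s z - t) 0 ^ 4 - max (s z - t) 0 ^ 2) / 2))‖ with hN
  have hpt : ∀ τ : ℝ, 0 ≤ τ → ∀ k z, 2 * τ * ‖v k z * starRingEnd ℂ (a k z) *
      Real.exp (-((ψ z + max (s z - t) 0 ^ 4 - max (s z - t) 0 ^ 2) / 2))‖ ≤
      τ ^ 2 * ((b k)⁻¹ * ‖v k z‖ ^ 2 * Real.exp (-ψ z)) +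
        S.indicator (fun z => b k * ‖a k z‖ ^ 2) z := by
    intro τ hτ k z
    by_cases hz : z ∈ S
    · have hx : max (s z - t) 0 = 0 := max_eq_right (by linarith [ht z (Or.inl hz)])
      rw [indicator_of_mem hz, hx, norm_mul, norm_mul, RCLike.norm_conj, norm_real,
        Real.norm_of_nonneg (Real.exp_pos _).le]
      have e1 : Real.exp (-((ψ z + 0 ^ 4 - 0 ^ 2) / 2)) = Real.exp (-(ψ z / 2)) := by
        congr 1; ring
      have e2 : Real.exp (-ψ z) = Real.exp (-(ψ z / 2)) ^ 2 := by
        rw [← Real.exp_nat_mul]; congr 1; push_cast; ring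
      rw [e1, e2]
      set e := Real.exp (-(ψ z / 2))
      have hbk := hb0 k
      have := mul_nonneg (inv_pos.2 hbk).le (sq_nonneg (τ * ‖v k z‖ * e - b k * ‖a k z‖))
      have e3 : (b k)⁻¹ * (τ * ‖v k z‖ * e - b k * ‖a k z‖) ^ 2 =
        τ ^ 2 * ((b k)⁻¹ * ‖v k z‖ ^ 2 * e ^ 2) + b k * ‖a k z‖ ^ 2 -
          2 * τ * (‖v k z‖ * ‖a k z‖ * e) := by
        field_simp
        ring
      linarith
    · rw [indicator_of_notMem hz, hv0 k z hz]
      simp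
  have hkey : ∀ τ : ℝ, 0 ≤ τ → 2 * τ * N ≤ τ ^ 2 * A + Q := by
    intro τ hτ
    have h1 : 2 * τ * N ≤ ∑ k, ∫ z, (τ ^ 2 * ((b k)⁻¹ * ‖v k z‖ ^ 2 * Real.exp (-ψ z)) +
        S.indicator (fun z => b k * ‖a k z‖ ^ 2) z) := by
      refine (mul_le_mul_of_nonneg_left (norm_sum_le _ _) (by positivity)).trans ?_
      rw [Finset.mul_sum]
      refine Finset.sum_le_sum fun k _ => ?_
      refine (mul_le_mul_of_nonneg_left (norm_integral_le_integral_norm _) (by positivity)).trans ?_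
      rw [← integral_const_mul]
      refine integral_mono_of_nonneg (Eventually.of_forall fun z => ?_)
        (((iv k).const_mul _).add (ia k)) (Eventually.of_forall fun z => hpt τ hτ k z)
      positivity
    have h2 : ∑ k, ∫ z, (τ ^ 2 * ((b k)⁻¹ * ‖v k z‖ ^ 2 * Real.exp (-ψ z)) +
        S.indicator (fun z => b k * ‖a k z‖ ^ 2) z) = τ ^ 2 * A +
        ∫ z, S.indicator (fun z => ∑ j, b j * ‖a j z‖ ^ 2) z := by
      have e1 : ∀ z, S.indicator (fun z => ∑ j, b j * ‖a j z‖ ^ 2) z =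
          ∑ j, S.indicator (fun z => b j * ‖a j z‖ ^ 2) z := fun z => by
        by_cases hz : z ∈ S
        · simp [indicator_of_mem hz]
        · simp [indicator_of_notMem hz]
      simp only [e1]
      rw [integral_finsetSum _ fun k _ => ia k, hA, integral_finsetSum _ fun k _ => iv k,
        Finset.mul_sum, ← Finset.sum_add_distrib]
      refine Finset.sum_congr rfl fun k _ => ?_
      rw [integral_add ((iv k).const_mul _) (ia k), integral_const_mul]
    linarith
  have hdisc := discrim_le_zero (a := A) (b := -(2 * N)) (c := Q) fun τ => by
    rcases le_total 0 τ with h | h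
    · nlinarith [hkey τ h]
    · have : 0 ≤ N := norm_nonneg _
      nlinarith [mul_nonneg this (neg_nonneg.2 h), mul_nonneg hA0 (sq_nonneg τ)]
  rw [discrim] at hdisc
  nlinarith

end DualEstimate

section Existence

variable {n : ℕ}

theorem exists_inner_eq_of_norm_le {G H : Type*} [AddCommGroup G] [Module ℂ G]
    [NormedAddCommGroup H] [InnerProductSpace ℂ H] [CompleteSpace H] (T : G →ₗ[ℂ] H)
    (L : G →ₗ[ℂ] ℂ) {A : ℝ} (hA : 0 ≤ A) (h : ∀ x, ‖L x‖ ≤ A * ‖T x‖) :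
    ∃ w : H, ‖w‖ ≤ A ∧ ∀ x, inner ℂ w (T x) = L x := by
  have hker : LinearMap.ker T ≤ LinearMap.ker L := fun x hx => by
    have := h x
    rw [LinearMap.mem_ker.1 hx, norm_zero, mul_zero] at this
    exact norm_le_zero_iff.1 this
  let f0 : LinearMap.range T →ₗ[ℂ] ℂ :=
    ((LinearMap.ker T).liftQ L hker).comp T.quotKerEquivRange.symm.toLinearMap
  have hf0 : ∀ x, f0 ⟨T x, LinearMap.mem_range_self T x⟩ = L x := fun x => by
    have : T.quotKerEquivRange.symm ⟨T x, LinearMap.mem_range_self T x⟩ =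
        (LinearMap.ker T).mkQ x := by
      rw [LinearEquiv.symm_apply_eq]
      rfl
    simp only [f0, LinearMap.comp_apply, LinearEquiv.coe_coe, this]
    rfl
  let f1 : LinearMap.range T →L[ℂ] ℂ := f0.mkContinuous A fun y => by
    obtain ⟨y, x, rfl⟩ := y
    rw [hf0]
    exact h x
  obtain ⟨g, hg, hgn⟩ := exists_extension_norm_eq _ f1
  refine ⟨(InnerProductSpace.toDual ℂ H).symm g, ?_, fun x => ?_⟩
  · rw [LinearIsometryEquiv.norm_map, hgn]
    exact LinearMap.mkContinuous_norm_le _ hA _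
  · rw [InnerProductSpace.toDual_symm_apply]
    exact (hg ⟨T x, LinearMap.mem_range_self T x⟩).trans (hf0 x)

theorem inner_toLp_right {α : Type*} [MeasurableSpace α] {μ : Measure α} (w : Lp ℂ 2 μ)
    {f : α → ℂ} (hf : MemLp f 2 μ) :
    inner ℂ w (hf.toLp f) = ∫ z, f z * starRingEnd ℂ (w z) ∂μ := by
  rw [L2.inner_def]
  refine integral_congr_ae ?_
  filter_upwards [hf.coeFn_toLp] with z h
  simp only [h, RCLike.inner_apply]

theorem norm_sq_eq_integral {α : Type*} [MeasurableSpace α] {μ : Measure α} (w : Lp ℂ 2 μ) :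
    ‖w‖ ^ 2 = ∫ z, ‖w z‖ ^ 2 ∂μ := by
  rw [← ofReal_inj (z := ‖w‖ ^ 2), ofReal_pow]
  refine (inner_self_eq_norm_sq_to_K (𝕜 := ℂ) w).symm.trans ?_
  rw [L2.inner_def, ← integral_complex_ofReal]
  refine integral_congr_ae (Eventually.of_forall fun z => ?_)
  simp only [ofReal_pow]
  exact inner_self_eq_norm_sq_to_K (𝕜 := ℂ) (w z)

theorem norm_sq_toLp {α : Type*} [MeasurableSpace α] {μ : Measure α} {f : α → ℂ}
    (hf : MemLp f 2 μ) : ‖hf.toLp f‖ ^ 2 = ∫ z, ‖f z‖ ^ 2 ∂μ := by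
  rw [norm_sq_eq_integral]
  refine integral_congr_ae ?_
  filter_upwards [hf.coeFn_toLp] with z h
  simp only [h]

/-- The forms of class `C¹` with compact support in `Ω`. -/
def compactForms (Ω : Set (Fin n → ℂ)) : Submodule ℂ (Fin n → (Fin n → ℂ) → ℂ) where
  carrier := {γ | ∀ k, ContDiff ℝ 1 (γ k) ∧ HasCompactSupport (γ k) ∧ tsupport (γ k) ⊆ Ω}
  add_mem' {x y} hx hy k := ⟨(hx k).1.add (hy k).1, (hx k).2.1.add (hy k).2.1,
    (tsupport_add _ _).trans (union_subset (hx k).2.2 (hy k).2.2)⟩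
  zero_mem' k := ⟨contDiff_const, HasCompactSupport.zero, by simp [tsupport, Function.support]⟩
  smul_mem' c x hx k := ⟨(hx k).1.const_smul c, (hx k).2.1.smul_left (f := fun _ => c),
    (closure_mono (Function.support_const_smul_subset c (x k))).trans (hx k).2.2⟩

theorem continuous_exp_mul_of_tsupport {Ω : Set (Fin n → ℂ)} (hΩ : IsOpen Ω)
    {ψ : (Fin n → ℂ) → ℝ} (hψ : ContinuousOn ψ Ω) {h : (Fin n → ℂ) → ℂ} (hc : Continuous h)
    (hcc : HasCompactSupport h) (hh : tsupport h ⊆ Ω) :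
    Continuous fun z => ((Real.exp (ψ z / 2) : ℝ) : ℂ) * h z := by
  have := continuous_mul_of_eq_zero_off hΩ hcc.isCompact hh hc
    (fun z hz => image_eq_zero_of_notMem_tsupport hz) (hψ.div_const 2).rexp
  simpa only [mul_comm] using this

/-- Hörmander's `L²` existence theorem for the `∂̄`-equation, for exact compactly supported
data. -/
theorem exists_weaklyHolomorphic_sub {Ω S : Set (Fin n → ℂ)} (hΩ : IsOpen Ω)
    {s ψ : (Fin n → ℂ) → ℝ} {C M : ℝ} (hs : IsExhaustion Ω s C)
    (hψ : ∀ z ∈ Ω, ContDiffAt ℝ 2 ψ z) (hψ0 : ∀ z ∈ Ω, ∀ X, 0 ≤ leviForm ψ z X)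
    (hψM : ∀ z ∈ Ω, ψ z ≤ M)
    (hS : IsCompact S) (hSΩ : S ⊆ Ω) {b : Fin n → ℝ} (hb0 : ∀ j, 0 < b j)
    (hb : ∀ z ∈ S, ∀ X : Fin n → ℂ, ∑ j, b j * ‖X j‖ ^ 2 ≤ leviForm ψ z X)
    {g : (Fin n → ℂ) → ℂ} (hg : ContDiff ℝ 2 g) (hgS : tsupport g ⊆ S) :
    ∃ f : (Fin n → ℂ) → ℂ, DifferentiableOn ℂ f Ω ∧
      IntegrableOn (fun z => ‖f z - g z‖ ^ 2) Ω ∧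
      IntegrableOn (fun z => ‖f z - g z‖ ^ 2 * Real.exp (-ψ z)) Ω ∧
      ∫ z in Ω, ‖f z - g z‖ ^ 2 * Real.exp (-ψ z) ≤
        ∫ z, ∑ k, (b k)⁻¹ * ‖wderBar n k g z‖ ^ 2 * Real.exp (-ψ z) := by
  have hψc : ContinuousOn ψ Ω := fun z hz => (hψ z hz).continuousAt.continuousWithinAt
  have hgc : HasCompactSupport g := hS.of_isClosed_subset (isClosed_tsupport g) hgS
  have hv : ∀ k, Continuous (wderBar n k g) := fun k =>
    (hg.wderBar (m := 1) k (by norm_num)).continuous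
  have hvS : ∀ k, tsupport (wderBar n k g) ⊆ S := fun k => by
    refine (closure_minimal ?_ (isClosed_tsupport g)).trans hgS
    intro z hz
    by_contra hc
    exact hz (wderBar_eq_zero (notMem_tsupport_iff_eventuallyEq.1 hc))
  have hvcl : ∀ j k η, ContDiff ℝ 2 η → HasCompactSupport η → tsupport η ⊆ Ω →
      ∫ z, (wderBar n k g z * wderBar n j η z - wderBar n j g z * wderBar n k η z) = 0 := by
    intro j k η hη hηc _
    have i1 : ∀ j k, Integrable fun z => wderBar n k g z * wderBar n j η z := fun j k =>
      ((hv k).mul (hη.wderBar (m := 1) j (by norm_num)).continuous).integrable_of_hasCompactSupport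
        (hηc.wderBar j).mul_left
    rw [integral_sub (i1 j k) (i1 k j)]
    have e1 : ∀ j k, ∫ z, wderBar n k g z * wderBar n j η z =
        - ∫ z, wderBar n j (wderBar n k g) z * η z := fun j k =>
      integral_mul_wderBar (hg.wderBar (m := 1) k (by norm_num)) (hη.of_le (by norm_num)) hηc j
    rw [e1, e1]
    simp only [wderBar_wderBar_comm hg.contDiffAt j k]
    ring
  set A0 := ∫ z, ∑ k, (b k)⁻¹ * ‖wderBar n k g z‖ ^ 2 * Real.exp (-ψ z)
  have hA0 : 0 ≤ A0 := integral_nonneg fun z => Finset.sum_nonneg fun k _ => by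
    have := (hb0 k).le; positivity
  set h : (Fin n → (Fin n → ℂ) → ℂ) → (Fin n → ℂ) → ℂ := fun γ z =>
    ((Real.exp (ψ z / 2) : ℝ) : ℂ) * ∑ k, wderBar n k (γ k) z with hh
  have hcG : ∀ γ ∈ compactForms Ω, Continuous (h γ) ∧ HasCompactSupport (h γ) := by
    intro γ hγ
    have e : h γ = fun z => ∑ k, ((Real.exp (ψ z / 2) : ℝ) : ℂ) * wderBar n k (γ k) z := by
      ext z; simp only [hh, Finset.mul_sum]
    have hK : IsCompact (⋃ k, tsupport (γ k)) := isCompact_iUnion fun k => (hγ k).2.1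
    refine ⟨?_, hasCompactSupport_of_eq_zero_off hK fun z hz => ?_⟩
    · rw [e]
      refine continuous_finsetSum _ fun k _ => continuous_exp_mul_of_tsupport hΩ hψc
        ((hγ k).1.wderBar (m := 0) k (by norm_num)).continuous ((hγ k).2.1.wderBar k) ?_
      refine (closure_minimal ?_ (isClosed_tsupport (γ k))).trans (hγ k).2.2
      intro z hz
      by_contra hc
      exact hz (wderBar_eq_zero (notMem_tsupport_iff_eventuallyEq.1 hc))
    · rw [mem_iUnion, not_exists] at hz
      simp only [hh]
      rw [Finset.sum_eq_zero fun k _ =>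
        wderBar_eq_zero (notMem_tsupport_iff_eventuallyEq.1 (hz k)), mul_zero]
  have hmem : ∀ γ : compactForms Ω, MemLp (h γ) 2 := fun γ =>
    (hcG γ γ.2).1.memLp_of_hasCompactSupport (hcG γ γ.2).2
  have hiv : ∀ γ ∈ compactForms Ω, ∀ k, Integrable fun z => wderBar n k g z * γ k z :=
    fun γ hγ k => ((hv k).mul (hγ k).1.continuous).integrable_of_hasCompactSupport
      (hγ k).2.1.mul_left
  let T : compactForms Ω →ₗ[ℂ] Lp ℂ 2 (volume : Measure (Fin n → ℂ)) :=
    { toFun := fun γ => (hmem γ).toLp (h γ)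
      map_add' := fun x y => by
        rw [← MemLp.toLp_add]
        refine MemLp.toLp_congr _ _ (Eventually.of_forall fun z => ?_)
        simp only [hh, Pi.add_apply, Submodule.coe_add, ← mul_add, ← Finset.sum_add_distrib]
        congr 1
        exact Finset.sum_congr rfl fun k _ => wderBar_add ((x.2 k).1.differentiable (by norm_num) z)
          ((y.2 k).1.differentiable (by norm_num) z)
      map_smul' := fun c x => by
        rw [RingHom.id_apply, ← MemLp.toLp_const_smul]
        refine MemLp.toLp_congr _ _ (Eventually.of_forall fun z => ?_)
        simp only [hh, Pi.smul_apply, Submodule.coe_smul, smul_eq_mul]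
        have : ∑ k, wderBar n k (c • x.1 k) z = c * ∑ k, wderBar n k (x.1 k) z := by
          rw [Finset.mul_sum]
          exact Finset.sum_congr rfl fun k _ =>
            wderBar_const_mul c ((x.2 k).1.differentiable (by norm_num) z)
        rw [this]
        ring }
  let L : compactForms Ω →ₗ[ℂ] ℂ :=
    { toFun := fun γ => ∑ k, ∫ z, wderBar n k g z * γ.1 k z
      map_add' := fun x y => by
        rw [← Finset.sum_add_distrib]
        refine Finset.sum_congr rfl fun k _ => ?_
        rw [← integral_add (hiv x x.2 k) (hiv y y.2 k)]
        simp only [Submodule.coe_add, Pi.add_apply, mul_add]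
      map_smul' := fun c x => by
        rw [RingHom.id_apply, smul_eq_mul, Finset.mul_sum]
        refine Finset.sum_congr rfl fun k _ => ?_
        rw [← integral_const_mul]
        simp only [Submodule.coe_smul, Pi.smul_apply, smul_eq_mul, mul_left_comm] }
  have hTn : ∀ γ : compactForms Ω, ‖T γ‖ ^ 2 =
      ∫ z, ‖∑ k, wderBar n k (γ.1 k) z‖ ^ 2 * Real.exp (ψ z) := fun γ => by
    change ‖(hmem γ).toLp (h γ)‖ ^ 2 = _
    rw [norm_sq_toLp]
    refine integral_congr_ae (Eventually.of_forall fun z => ?_)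
    simp only [hh]
    rw [norm_mul, norm_real, Real.norm_of_nonneg (Real.exp_pos _).le, mul_pow, ← Real.exp_nat_mul,
      mul_comm]
    congr 2
    push_cast
    ring
  obtain ⟨w, hw, hwT⟩ := exists_inner_eq_of_norm_le T L (Real.sqrt_nonneg A0) fun γ => by
    have := norm_sum_integral_sq_le hΩ hs hψ hψ0 hS hSΩ hb0 hb hv hvS hvcl
      (fun k => (γ.2 k).1) (fun k => (γ.2 k).2.1) (fun k => (γ.2 k).2.2)
    rw [← hTn γ] at this
    refine (sq_le_sq₀ (norm_nonneg _) (by positivity)).1 ?_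
    rw [mul_pow, Real.sq_sqrt hA0]
    exact this
  have hWm : MemLp (w : (Fin n → ℂ) → ℂ) 2 := Lp.memLp w
  have hWi : Integrable fun z => ‖w z‖ ^ 2 := (memLp_two_iff_integrable_sq_norm hWm.1).1 hWm
  have hWA : ∫ z, ‖w z‖ ^ 2 ≤ A0 := by
    rw [← norm_sq_eq_integral, ← Real.sq_sqrt hA0]
    exact pow_le_pow_left₀ (norm_nonneg _) hw 2
  set U : (Fin n → ℂ) → ℂ :=
    Ω.indicator fun z => -(starRingEnd ℂ (w z) * (Real.exp (ψ z / 2) : ℝ)) with hU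
  have hUn : ∀ z ∈ Ω, ‖U z‖ ^ 2 = ‖w z‖ ^ 2 * Real.exp (ψ z) := fun z hz => by
    rw [hU, indicator_of_mem hz, norm_neg, norm_mul, RCLike.norm_conj, norm_real,
      Real.norm_of_nonneg (Real.exp_pos _).le, mul_pow, ← Real.exp_nat_mul]
    congr 2
    push_cast
    ring
  have hU2 : MemLp U 2 := by
    refine MemLp.of_le_mul (c := Real.exp (M / 2)) hWm ?_ (Eventually.of_forall fun z => ?_)
    · refine (aestronglyMeasurable_indicator_iff hΩ.measurableSet).2 ?_
      refine ((continuous_conj.comp_aestronglyMeasurable hWm.1.restrict).mul ?_).neg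
      exact (continuous_ofReal.comp_continuousOn (hψc.div_const 2).rexp).aestronglyMeasurable
        hΩ.measurableSet
    · by_cases hz : z ∈ Ω
      · rw [hU, indicator_of_mem hz, norm_neg, norm_mul, RCLike.norm_conj, norm_real,
          Real.norm_of_nonneg (Real.exp_pos _).le, mul_comm]
        refine mul_le_mul_of_nonneg_right (Real.exp_le_exp.2 ?_) (norm_nonneg _)
        linarith [hψM z hz]
      · rw [hU, indicator_of_notMem hz, norm_zero]
        positivity
  have hg2 : MemLp g 2 := hg.continuous.memLp_of_hasCompactSupport hgc
  have hweak : WeaklyHolomorphic n Ω fun z => g z - U z := by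
    intro j η hη hηc hηΩ
    have hη1 : ContDiff ℝ 1 η := hη.of_le (by norm_num)
    have hηw : MemLp (wderBar n j η) 2 :=
      ((hη.wderBar (m := 1) j (by norm_num)).continuous).memLp_of_hasCompactSupport (hηc.wderBar j)
    have hγ : (Pi.single j η : Fin n → (Fin n → ℂ) → ℂ) ∈ compactForms Ω := by
      intro k
      rcases eq_or_ne k j with rfl | hk
      · simpa using ⟨hη1, hηc, hηΩ⟩
      · rw [Pi.single_eq_of_ne hk]
        exact (zero_mem (compactForms Ω) : (0 : Fin n → (Fin n → ℂ) → ℂ) ∈ compactForms Ω) k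
    have h1 := hwT ⟨_, hγ⟩
    have h2 : L ⟨_, hγ⟩ = ∫ z, wderBar n j g z * η z := by
      change ∑ k, ∫ z, wderBar n k g z * (Pi.single j η : Fin n → (Fin n → ℂ) → ℂ) k z = _
      rw [Finset.sum_eq_single j]
      · simp
      · intro k _ hk
        simp [Pi.single_eq_of_ne hk]
      · simp
    have h3 : inner ℂ w (T ⟨_, hγ⟩) = - ∫ z, U z * wderBar n j η z := by
      change inner ℂ w ((hmem ⟨_, hγ⟩).toLp _) = _
      rw [inner_toLp_right, ← integral_neg]
      refine integral_congr_ae (Eventually.of_forall fun z => ?_)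
      have h4 : ∑ k, wderBar n k ((Pi.single j η : Fin n → (Fin n → ℂ) → ℂ) k) z =
          wderBar n j η z := by
        rw [Finset.sum_eq_single j]
        · simp
        · intro k _ hk
          rw [Pi.single_eq_of_ne hk]
          exact wderBar_eq_zero (Eventually.of_forall fun _ => rfl)
        · simp
      simp only [hh, h4]
      by_cases hz : z ∈ Ω
      · rw [hU, indicator_of_mem hz]; ring
      · have : wderBar n j η z = 0 := wderBar_eq_zero
          (notMem_tsupport_iff_eventuallyEq.1 fun hc => hz (hηΩ hc))
        rw [this]; ring
    have h5 := integral_mul_wderBar (hg.of_le (by norm_num)) hη1 hηc j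
    have i1 : Integrable fun z => g z * wderBar n j η z := hg2.integrable_mul hηw
    have i2 : Integrable fun z => U z * wderBar n j η z := hU2.integrable_mul hηw
    simp only [sub_mul]
    rw [integral_sub i1 i2, h5, ← h2, ← h1, h3]
    ring
  obtain ⟨f, hf, hfe⟩ := hweak.exists_differentiableOn hΩ (hg2.sub hU2)
  have hfn : (fun z => ‖f z - g z‖ ^ 2) =ᵐ[volume.restrict Ω] fun z => ‖U z‖ ^ 2 := by
    filter_upwards [hfe] with z hz
    rw [hz, Pi.sub_apply, sub_sub_cancel_left, norm_neg]
  have hfn2 : (fun z => ‖f z - g z‖ ^ 2 * Real.exp (-ψ z)) =ᵐ[volume.restrict Ω]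
      fun z => ‖w z‖ ^ 2 := by
    filter_upwards [hfn, ae_restrict_mem hΩ.measurableSet] with z hz hz2
    rw [hz, hUn z hz2, mul_assoc, ← Real.exp_add, add_neg_cancel, Real.exp_zero, mul_one]
  refine ⟨f, hf, (((memLp_two_iff_integrable_sq_norm hU2.1).1 hU2).integrableOn).congr hfn.symm,
    hWi.integrableOn.congr hfn2.symm, ?_⟩
  rw [integral_congr_ae hfn2]
  exact (setIntegral_le_integral hWi (Eventually.of_forall fun z => sq_nonneg _)).trans hWA

end Existence

section WeightedSquare
variable {n : ℕ}

/-- The weighted square distance `∑ a_j |z_j - p_j|²`. -/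
noncomputable def wsq (a : Fin n → ℝ) (p z : Fin n → ℂ) : ℝ := ∑ j, a j * ‖z j - p j‖ ^ 2

theorem contDiff_wsq (a : Fin n → ℝ) (p : Fin n → ℂ) {k : WithTop ℕ∞} :
    ContDiff ℝ k (wsq a p) := by
  unfold wsq
  refine ContDiff.sum fun j _ => contDiff_const.mul (ContDiff.norm_sq ℂ ?_)
  exact ((contDiff_apply ℝ ℂ j)).sub contDiff_const

theorem hasFDerivAt_wsq (a : Fin n → ℝ) (p z : Fin n → ℂ) :
    HasFDerivAt (wsq a p) (∑ j, (2 * a j) • ((innerSL ℝ (z j - p j)).comp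
      (ContinuousLinearMap.proj (R := ℝ) (φ := fun _ : Fin n => ℂ) j))) z := by
  unfold wsq
  refine HasFDerivAt.fun_sum fun j _ => ?_
  have h : HasFDerivAt (fun z : Fin n → ℂ => z j - p j)
      (ContinuousLinearMap.proj (R := ℝ) (φ := fun _ : Fin n => ℂ) j) z :=
    (ContinuousLinearMap.proj (R := ℝ) (φ := fun _ : Fin n => ℂ) j).hasFDerivAt.sub_const _
  refine (h.norm_sq.const_mul (a j)).congr_fderiv ?_
  ext v
  simp only [smul_apply, smul_eq_mul, nsmul_eq_mul]
  push_cast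
  ring

theorem fderiv_wsq_apply (a : Fin n → ℝ) (p z X : Fin n → ℂ) :
    fderiv ℝ (wsq a p) z X = ∑ j, 2 * a j * inner ℝ (z j - p j) (X j) := by
  rw [(hasFDerivAt_wsq a p z).fderiv]
  simp only [sum_apply, smul_apply, ContinuousLinearMap.comp_apply,
    innerSL_apply_apply, ContinuousLinearMap.proj_apply, smul_eq_mul]

theorem fderiv_fderiv_wsq_apply (a : Fin n → ℝ) (p z X Y : Fin n → ℂ) :
    fderiv ℝ (fderiv ℝ (wsq a p)) z X Y = ∑ j, 2 * a j * inner ℝ (X j) (Y j) := by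
  have hd : DifferentiableAt ℝ (fderiv ℝ (wsq a p)) z :=
    ((contDiff_wsq a p (k := 2)).contDiffAt).differentiableAt_fderiv_of_two
  have h1 : HasFDerivAt (fun w => fderiv ℝ (wsq a p) w Y)
      ((ContinuousLinearMap.apply ℝ ℝ Y).comp (fderiv ℝ (fderiv ℝ (wsq a p)) z)) z :=
    (ContinuousLinearMap.apply ℝ ℝ Y).hasFDerivAt.comp z hd.hasFDerivAt
  have h2 : HasFDerivAt (fun w => fderiv ℝ (wsq a p) w Y)
      (∑ j, (2 * a j) • ((innerSL ℝ (Y j)).comp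
      (ContinuousLinearMap.proj (R := ℝ) (φ := fun _ : Fin n => ℂ) j))) z := by
    simp only [fderiv_wsq_apply]
    refine HasFDerivAt.fun_sum fun j _ => ?_
    have h : HasFDerivAt (fun z : Fin n → ℂ => z j - p j)
        (ContinuousLinearMap.proj (R := ℝ) (φ := fun _ : Fin n => ℂ) j) z :=
      (ContinuousLinearMap.proj (R := ℝ) (φ := fun _ : Fin n => ℂ) j).hasFDerivAt.sub_const _
    have h3 := ((innerSL ℝ (Y j)).hasFDerivAt.comp z h).const_mul (2 * a j)
    refine h3.congr_of_eventuallyEq (Eventually.of_forall fun w => ?_)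
    simp only [Function.comp_apply, innerSL_apply_apply]
    rw [real_inner_comm]
  have := congrArg (fun T => T X) (h1.unique h2)
  simpa [real_inner_comm] using this

theorem leviForm_wsq (a : Fin n → ℝ) (p z X : Fin n → ℂ) :
    leviForm (wsq a p) z X = ∑ j, a j * ‖X j‖ ^ 2 := by
  simp only [leviForm, fderiv_fderiv_wsq_apply, ← Finset.sum_add_distrib, Finset.mul_sum]
  refine Finset.sum_congr rfl fun j _ => ?_
  simp only [Pi.smul_apply, smul_eq_mul, real_inner_self_eq_norm_sq, norm_mul, norm_I, one_mul]
  ring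

theorem dPairing_wsq (a : Fin n → ℝ) (p z X : Fin n → ℂ) :
    dPairing (wsq a p) z X = ∑ j, (a j : ℂ) * (starRingEnd ℂ (z j - p j) * X j) := by
  simp only [dPairing, fderiv_wsq_apply, ofReal_sum, Finset.mul_sum, ← Finset.sum_sub_distrib]
  refine Finset.sum_congr rfl fun j _ => ?_
  simp only [Pi.smul_apply, smul_eq_mul, Complex.inner]
  apply Complex.ext <;> simp <;> ring

theorem wsq_nonneg {a : Fin n → ℝ} (ha : ∀ j, 0 ≤ a j) (p z : Fin n → ℂ) : 0 ≤ wsq a p z :=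
  Finset.sum_nonneg fun j _ => mul_nonneg (ha j) (sq_nonneg _)

end WeightedSquare

section LeviBounds
variable {n : ℕ}

theorem Continuous.eventually_norm_lt_add_one {E F : Type*} [TopologicalSpace E]
    [NormedAddCommGroup F] {f : E → F} (hf : Continuous f) (x : E) :
    ∀ᶠ z in 𝓝 x, ‖f z‖ < ‖f x‖ + 1 :=
  (hf.norm.tendsto x).eventually_lt_const (lt_add_one _)

theorem abs_leviForm_le (φ : (Fin n → ℂ) → ℝ) (z X : Fin n → ℂ) :
    |leviForm φ z X| ≤ ‖fderiv ℝ (fderiv ℝ φ) z‖ * ‖X‖ ^ 2 := by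
  have h1 := (fderiv ℝ (fderiv ℝ φ) z).le_opNorm₂ X X
  have h2 := (fderiv ℝ (fderiv ℝ φ) z).le_opNorm₂ (I • X) (I • X)
  rw [norm_smul, norm_I, one_mul] at h2
  rw [Real.norm_eq_abs, abs_le] at h1 h2
  unfold leviForm
  rw [abs_le]
  have h0 : 0 ≤ ‖fderiv ℝ (fderiv ℝ φ) z‖ * ‖X‖ ^ 2 := by positivity
  constructor <;> nlinarith

theorem abs_leviForm_sub_le (φ : (Fin n → ℂ) → ℝ) (z X Y : Fin n → ℂ) :
    |leviForm φ z X - leviForm φ z Y| ≤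
      ‖fderiv ℝ (fderiv ℝ φ) z‖ * (‖X - Y‖ * (‖X‖ + ‖Y‖)) := by
  set B := fderiv ℝ (fderiv ℝ φ) z with hB
  have h1 := B.le_opNorm₂ (X - Y) X
  have h2 := B.le_opNorm₂ Y (X - Y)
  have h3 := B.le_opNorm₂ (I • (X - Y)) (I • X)
  have h4 := B.le_opNorm₂ (I • Y) (I • (X - Y))
  simp only [norm_smul, norm_I, one_mul] at h3 h4
  rw [Real.norm_eq_abs, abs_le] at h1 h2 h3 h4
  have e : leviForm φ z X - leviForm φ z Y = (1 / 4) * (B (X - Y) X + B Y (X - Y) +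
      B (I • (X - Y)) (I • X) + B (I • Y) (I • (X - Y))) := by
    simp only [leviForm, ← hB, smul_sub, map_sub, sub_apply]
    ring
  rw [e, abs_le]
  have h0 : 0 ≤ ‖B‖ * (‖X - Y‖ * (‖X‖ + ‖Y‖)) := by positivity
  constructor <;> nlinarith

theorem abs_leviForm_sub_le_of_point (φ : (Fin n → ℂ) → ℝ) (z w X : Fin n → ℂ) :
    |leviForm φ z X - leviForm φ w X| ≤
      ‖fderiv ℝ (fderiv ℝ φ) z - fderiv ℝ (fderiv ℝ φ) w‖ * ‖X‖ ^ 2 := by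
  set B := fderiv ℝ (fderiv ℝ φ) z - fderiv ℝ (fderiv ℝ φ) w with hB
  have h1 := B.le_opNorm₂ X X
  have h2 := B.le_opNorm₂ (I • X) (I • X)
  rw [norm_smul, norm_I, one_mul] at h2
  rw [Real.norm_eq_abs, abs_le] at h1 h2
  have e : leviForm φ z X - leviForm φ w X = (1 / 4) * (B X X + B (I • X) (I • X)) := by
    simp only [leviForm, hB, sub_apply]
    ring
  rw [e, abs_le]
  have h0 : 0 ≤ ‖B‖ * ‖X‖ ^ 2 := by positivity
  constructor <;> nlinarith

theorem norm_dPairing_le (φ : (Fin n → ℂ) → ℝ) (z X : Fin n → ℂ) :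
    ‖dPairing φ z X‖ ≤ ‖fderiv ℝ φ z‖ * ‖X‖ := by
  have h1 := (fderiv ℝ φ z).le_opNorm X
  have h2 := (fderiv ℝ φ z).le_opNorm (I • X)
  rw [norm_smul, norm_I, one_mul] at h2
  unfold dPairing
  rw [norm_mul]
  have h3 := norm_sub_le (fderiv ℝ φ z X : ℂ) (I * (fderiv ℝ φ z (I • X) : ℂ))
  rw [norm_mul, norm_I, one_mul, norm_real, norm_real] at h3
  have : ‖(1 / 2 : ℂ)‖ = 1 / 2 := by norm_num
  rw [this]
  linarith

theorem norm_dPairing_sub_le (φ : (Fin n → ℂ) → ℝ) (z w X : Fin n → ℂ) :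
    ‖dPairing φ z X - dPairing φ w X‖ ≤ ‖fderiv ℝ φ z - fderiv ℝ φ w‖ * ‖X‖ := by
  have h1 := (fderiv ℝ φ z - fderiv ℝ φ w).le_opNorm X
  have h2 := (fderiv ℝ φ z - fderiv ℝ φ w).le_opNorm (I • X)
  rw [norm_smul, norm_I, one_mul] at h2
  have e : dPairing φ z X - dPairing φ w X = (1 / 2) *
      ((((fderiv ℝ φ z - fderiv ℝ φ w) X : ℝ) : ℂ) -
        I * (((fderiv ℝ φ z - fderiv ℝ φ w) (I • X) : ℝ) : ℂ)) := by
    simp only [dPairing, sub_apply, ofReal_sub]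
    ring
  have h3 := norm_sub_le (((fderiv ℝ φ z - fderiv ℝ φ w) X : ℝ) : ℂ)
    (I * (((fderiv ℝ φ z - fderiv ℝ φ w) (I • X) : ℝ) : ℂ))
  rw [norm_mul, norm_I, one_mul, norm_real, norm_real] at h3
  have : ‖(1 / 2 : ℂ)‖ = 1 / 2 := by norm_num
  rw [e, norm_mul, this]
  linarith

theorem dPairing_sub_smul {φ : (Fin n → ℂ) → ℝ} {z : Fin n → ℂ} (h : DifferentiableAt ℝ φ z)
    (X Y : Fin n → ℂ) (c : ℂ) :
    dPairing φ z (X - c • Y) = dPairing φ z X - c * dPairing φ z Y := by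
  simp only [← sum_wder_ofReal_mul h, Finset.mul_sum, ← Finset.sum_sub_distrib]
  refine Finset.sum_congr rfl fun j _ => ?_
  simp only [Pi.sub_apply, Pi.smul_apply, smul_eq_mul]
  ring

end LeviBounds

section Exhaustion
variable {n : ℕ} {Ω : Set (Fin n → ℂ)} {ρ : (Fin n → ℂ) → ℝ}

theorem LeviPSDAt.leviForm_nonneg {q : Fin n → ℂ} (h : LeviPSDAt n ρ q)
    (hρ : ContDiffAt ℝ 2 ρ q) {X : Fin n → ℂ} (hX : dPairing ρ q X = 0) :
    0 ≤ leviForm ρ q X := by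
  rw [← hermForm_cHess hρ]
  refine h X ?_
  rw [cTangent, LinearMap.mem_ker, cTangentMap, LinearMap.sum_apply, ← hX,
    ← sum_wder_ofReal_mul (hρ.differentiableAt (by simp))]
  rfl

/-- Near a boundary point, an interior point is at distance `O(|ρ|)` from the boundary. -/
theorem exists_mem_frontier_of_fderiv (hΩ : IsOpen Ω) (hρ : ContDiff ℝ 1 ρ) (hneg : ∀ z ∈ Ω, ρ z < 0)
    {N z : Fin n → ℂ} (hz : z ∈ Ω)
    (hN : ∀ t ∈ Icc (0 : ℝ) |ρ z|, 1 ≤ fderiv ℝ ρ (z + t • N) N) :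
    ∃ t ∈ Icc (0 : ℝ) |ρ z|, z + t • N ∈ frontier Ω := by
  have hder : ∀ t : ℝ, HasDerivAt (fun t : ℝ => ρ (z + t • N)) (fderiv ℝ ρ (z + t • N) N) t := by
    intro t
    have h1 : HasDerivAt (fun t : ℝ => z + t • N) N t := by
      simpa using ((hasDerivAt_id t).smul_const N).const_add z
    exact (hρ.differentiable (by simp) _).hasFDerivAt.comp_hasDerivAt t h1
  have h2 := (convex_Icc (0 : ℝ) |ρ z|).mul_sub_le_image_sub_of_le_deriv
    (f := fun t : ℝ => ρ (z + t • N)) (C := 1)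
    (fun t _ => (hder t).continuousAt.continuousWithinAt)
    (fun t _ => (hder t).differentiableAt.differentiableWithinAt)
    (fun t ht => by rw [(hder t).deriv]; exact hN t (interior_subset ht))
    0 ⟨le_rfl, abs_nonneg _⟩ |ρ z| ⟨abs_nonneg _, le_rfl⟩ (abs_nonneg _)
  simp only [zero_smul, add_zero, sub_zero, one_mul] at h2
  have hz' := hneg z hz
  rw [abs_of_neg hz'] at h2
  have hout : z + |ρ z| • N ∉ Ω := by
    intro hc
    have := hneg _ hc
    rw [abs_of_neg hz'] at this
    linarith
  have hcon : IsPreconnected ((fun t : ℝ => z + t • N) '' Icc (0 : ℝ) |ρ z|) :=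
    isPreconnected_Icc.image _ (by fun_prop)
  by_contra! hfr
  have hcl : ∀ t ∈ Icc (0 : ℝ) |ρ z|, z + t • N ∉ Ω → z + t • N ∈ (closure Ω)ᶜ :=
    fun t ht hn hc => hfr t ht (by rw [hΩ.frontier_eq]; exact ⟨hc, hn⟩)
  obtain ⟨q, -, hq1, hq2⟩ := hcon Ω (closure Ω)ᶜ hΩ isClosed_closure.isOpen_compl
    (by
      rintro _ ⟨t, ht, rfl⟩
      by_cases h : z + t • N ∈ Ω
      · exact Or.inl h
      · exact Or.inr (hcl t ht h))
    ⟨z, ⟨0, ⟨le_rfl, abs_nonneg _⟩, by simp⟩, hz⟩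
    ⟨_, ⟨|ρ z|, ⟨abs_nonneg _, le_rfl⟩, rfl⟩, hcl _ ⟨abs_nonneg _, le_rfl⟩ hout⟩
  exact hq2 (subset_closure hq1)

set_option maxHeartbeats 1000000 in
theorem exists_leviForm_lower_nhds_frontier (hΩ : IsOpen Ω) (hρ : ContDiff ℝ 3 ρ)
    (hneg : ∀ z ∈ Ω, ρ z < 0)
    (hzero : ∀ z ∈ frontier Ω, ρ z = 0) (hL : ∀ q ∈ frontier Ω, LeviPSDAt n ρ q)
    {q₀ : Fin n → ℂ} (hq₀ : q₀ ∈ frontier Ω) (hd : fderiv ℝ ρ q₀ ≠ 0) :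
    ∃ C : ℝ, 0 ≤ C ∧ ∀ᶠ z in 𝓝 q₀, z ∈ Ω → ∀ X,
      -C * (|ρ z| * ‖X‖ ^ 2 + ‖X‖ * ‖dPairing ρ z X‖) ≤ leviForm ρ z X := by
  have hρ1 : ContDiff ℝ 2 (fderiv ℝ ρ) := hρ.fderiv_right (by norm_num)
  have hρ2 : ContDiff ℝ 1 (fderiv ℝ (fderiv ℝ ρ)) := hρ1.fderiv_right (by norm_num)
  obtain ⟨L₁, t₁, ht₁, hL₁⟩ :=
    (hρ1.of_le (by norm_num)).contDiffAt.exists_lipschitzOnWith (x := q₀)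
  obtain ⟨L₂, t₂, ht₂, hL₂⟩ := hρ2.contDiffAt.exists_lipschitzOnWith (x := q₀)
  obtain ⟨v, hv⟩ : ∃ v, fderiv ℝ ρ q₀ v ≠ 0 := by
    by_contra! hc
    exact hd (ContinuousLinearMap.ext hc)
  obtain ⟨N, hN⟩ : ∃ N, fderiv ℝ ρ q₀ N = 2 :=
    ⟨(2 / fderiv ℝ ρ q₀ v) • v, by rw [map_smul, smul_eq_mul, div_mul_cancel₀ _ hv]⟩
  set B₁ := ‖fderiv ℝ ρ q₀‖ + 1 with hB₁
  set B₂ := ‖fderiv ℝ (fderiv ℝ ρ) q₀‖ + 1 with hB₂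
  have e1 : ∀ᶠ z in 𝓝 q₀, ‖fderiv ℝ ρ z‖ < B₁ :=
    hρ1.continuous.eventually_norm_lt_add_one q₀
  have e2 : ∀ᶠ z in 𝓝 q₀, ‖fderiv ℝ (fderiv ℝ ρ) z‖ < B₂ :=
    hρ2.continuous.eventually_norm_lt_add_one q₀
  have e3 : ∀ᶠ z in 𝓝 q₀, 1 < fderiv ℝ ρ z N := by
    have : Continuous fun z => fderiv ℝ ρ z N := hρ1.continuous.clm_apply continuous_const
    exact (this.tendsto q₀).eventually_const_lt (by rw [hN]; norm_num)
  obtain ⟨r, hr, hball⟩ := Metric.eventually_nhds_iff_ball.1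
    (((e1.and e2).and e3).and (Filter.inter_mem ht₁ ht₂))
  have e4 : ∀ᶠ z in 𝓝 q₀, |ρ z| * ‖N‖ < r / 2 := by
    have : Continuous fun z => |ρ z| * ‖N‖ := (hρ.continuous.abs).mul continuous_const
    exact (this.tendsto q₀).eventually_lt_const (by rw [hzero q₀ hq₀]; simpa using hr)
  set ν := ‖N‖ with hν
  set K := 2 * B₂ * ν * (2 + 2 * B₁ * ν) with hK
  have hB1 : 0 ≤ B₁ := by positivity
  have hB2 : 0 ≤ B₂ := by positivity
  have hν0 : 0 ≤ ν := norm_nonneg _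
  have hK0 : 0 ≤ K := by positivity
  refine ⟨K + K * L₁ * ν + L₂ * ν, by positivity, ?_⟩
  filter_upwards [e4, Metric.ball_mem_nhds q₀ (half_pos hr)] with z hz4 hzr hz X
  have hseg : ∀ t ∈ Icc (0 : ℝ) |ρ z|, z + t • N ∈ Metric.ball q₀ r := by
    intro t ht
    rw [Metric.mem_ball, dist_eq_norm] at hzr ⊢
    have h1 : ‖z + t • N - q₀‖ ≤ ‖z - q₀‖ + ‖t • N‖ := by
      rw [show z + t • N - q₀ = (z - q₀) + t • N by abel]
      exact norm_add_le _ _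
    rw [norm_smul, Real.norm_of_nonneg ht.1] at h1
    have h2 : t * ‖N‖ ≤ |ρ z| * ν := mul_le_mul_of_nonneg_right ht.2 hν0
    linarith
  obtain ⟨t, ht, hq⟩ := exists_mem_frontier_of_fderiv hΩ (hρ.of_le (by norm_num)) hneg hz
    fun t ht => (hball _ (hseg t ht)).1.2.le
  set q := z + t • N with hqdef
  obtain ⟨⟨⟨b1, b2⟩, b3⟩, hqt1, hqt2⟩ := hball q (hseg t ht)
  have hzb : z ∈ Metric.ball q₀ r := Metric.ball_subset_ball (by linarith) hzr
  obtain ⟨-, hzt1, hzt2⟩ := hball z hzb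
  set δ := |ρ z| with hδ
  have hδ0 : 0 ≤ δ := abs_nonneg _
  have hdist : ‖z - q‖ ≤ δ * ν := by
    rw [hqdef, sub_add_cancel_left, norm_neg, norm_smul, Real.norm_of_nonneg ht.1]
    exact mul_le_mul_of_nonneg_right ht.2 hν0
  have hl1 : ‖fderiv ℝ ρ z - fderiv ℝ ρ q‖ ≤ L₁ * (δ * ν) :=
    (hL₁.norm_sub_le hzt1 hqt1).trans (mul_le_mul_of_nonneg_left hdist L₁.2)
  have hl2 : ‖fderiv ℝ (fderiv ℝ ρ) z - fderiv ℝ (fderiv ℝ ρ) q‖ ≤ L₂ * (δ * ν) :=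
    (hL₂.norm_sub_le hzt2 hqt2).trans (mul_le_mul_of_nonneg_left hdist L₂.2)
  have hρq : ContDiffAt ℝ 2 ρ q := (hρ.of_le (by norm_num)).contDiffAt
  have hm : 1 / 2 ≤ ‖dPairing ρ q N‖ := by
    refine le_trans ?_ ((le_abs_self _).trans (abs_re_le_norm _))
    have : (dPairing ρ q N).re = (1 / 2) * fderiv ℝ ρ q N := by
      simp [dPairing]
    rw [this]
    linarith
  have hm0 : dPairing ρ q N ≠ 0 := by
    intro hc
    rw [hc, norm_zero] at hm
    norm_num at hm
  set c := dPairing ρ q X / dPairing ρ q N with hc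
  set x := ‖X‖ with hx
  set l := ‖dPairing ρ q X‖ with hl
  have hx0 : 0 ≤ x := norm_nonneg _
  have hl0 : 0 ≤ l := norm_nonneg _
  have hcn : ‖c‖ ≤ 2 * l := by
    rw [hc, norm_div, div_le_iff₀ (by linarith)]
    nlinarith
  have hT : 0 ≤ leviForm ρ q (X - c • N) := (hL q hq).leviForm_nonneg hρq (by
    rw [dPairing_sub_smul (hρq.differentiableAt (by simp)), hc, div_mul_cancel₀ _ hm0, sub_self])
  have hlx : l ≤ B₁ * x := (norm_dPairing_le ρ q X).trans (mul_le_mul_of_nonneg_right b1.le hx0)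
  have hcN : ‖c • N‖ ≤ 2 * l * ν := by
    rw [norm_smul]
    exact mul_le_mul_of_nonneg_right hcn hν0
  have h1 := abs_leviForm_sub_le ρ q X (X - c • N)
  rw [sub_sub_cancel] at h1
  have hXT : ‖X - c • N‖ ≤ x + 2 * l * ν := (norm_sub_le _ _).trans (by linarith)
  have h2 : ‖fderiv ℝ (fderiv ℝ ρ) q‖ * (‖c • N‖ * (x + ‖X - c • N‖)) ≤
      B₂ * ((2 * l * ν) * (x + (x + 2 * (B₁ * x) * ν))) := by
    have hXT2 : ‖X - c • N‖ ≤ x + 2 * (B₁ * x) * ν := hXT.trans (by gcongr)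
    gcongr
  have h3 : -(K * l * x) ≤ leviForm ρ q X := by
    have := (abs_le.1 (h1.trans h2)).1
    have e : B₂ * ((2 * l * ν) * (x + (x + 2 * (B₁ * x) * ν))) = K * l * x := by
      rw [hK]; ring
    linarith
  have h4 : l ≤ ‖dPairing ρ z X‖ + L₁ * (δ * ν) * x := by
    have h5 := (norm_dPairing_sub_le ρ z q X).trans (mul_le_mul_of_nonneg_right hl1 hx0)
    have h6 := norm_sub_norm_le (dPairing ρ q X) (dPairing ρ z X)
    rw [norm_sub_rev] at h6
    linarith
  have h7 := (abs_le.1 ((abs_leviForm_sub_le_of_point ρ z q X).trans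
    (mul_le_mul_of_nonneg_right hl2 (sq_nonneg x)))).1
  have h8 : K * l * x ≤ K * (‖dPairing ρ z X‖ + L₁ * (δ * ν) * x) * x := by gcongr
  have h9 : 0 ≤ (K * L₁ * ν + L₂ * ν) * (x * ‖dPairing ρ z X‖) := by positivity
  have h10 : 0 ≤ K * (δ * x ^ 2) := by positivity
  nlinarith

end Exhaustion

section DefiningFunction
variable {n : ℕ} {Ω : Set (Fin n → ℂ)} {ρ : (Fin n → ℂ) → ℝ}

theorem norm_sq_le_sum_norm_sq (X : Fin n → ℂ) : ‖X‖ ^ 2 ≤ ∑ j, ‖X j‖ ^ 2 := by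
  have h0 : 0 ≤ ∑ j, ‖X j‖ ^ 2 := Finset.sum_nonneg fun _ _ => sq_nonneg _
  have h : ‖X‖ ≤ √(∑ j, ‖X j‖ ^ 2) := (pi_norm_le_iff_of_nonneg (Real.sqrt_nonneg _)).2 fun j =>
    Real.le_sqrt_of_sq_le (Finset.single_le_sum (f := fun j => ‖X j‖ ^ 2)
      (fun _ _ => sq_nonneg _) (Finset.mem_univ j))
  exact (pow_le_pow_left₀ (norm_nonneg _) h 2).trans (Real.sq_sqrt h0).le

theorem norm_wder_ofReal_le {s : (Fin n → ℂ) → ℝ} {z : Fin n → ℂ} (h : DifferentiableAt ℝ s z)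
    (j : Fin n) : ‖wder n j (fun v => (s v : ℂ)) z‖ ≤ ‖fderiv ℝ s z‖ := by
  have h1 := norm_dPairing_le s z (Pi.single j 1)
  rw [← sum_wder_ofReal_mul h, Finset.sum_eq_single j, Pi.single_eq_same, mul_one,
    Pi.norm_single, norm_one, mul_one] at h1
  · exact h1
  · intro k _ hk
    rw [Pi.single_eq_of_ne hk, mul_zero]
  · simp

theorem IsDefining.exists_leviForm_lower (hΩ : IsOpen Ω) (hb : Bornology.IsBounded Ω)
    (hρ : IsDefining n Ω ρ) (hL : ∀ q ∈ frontier Ω, LeviPSDAt n ρ q) :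
    ∃ C : ℝ, 0 ≤ C ∧ ∀ z ∈ Ω, ∀ X,
      -C * (|ρ z| * ‖X‖ ^ 2 + ‖X‖ * ‖dPairing ρ z X‖) ≤ leviForm ρ z X := by
  have hρ3 : ContDiff ℝ 3 ρ := hρ.1.of_le (WithTop.coe_le_coe.2 (le_top (a := (3 : ℕ∞))))
  have hρ2 : ContDiff ℝ 1 (fderiv ℝ (fderiv ℝ ρ)) :=
    ((hρ3.fderiv_right (m := 2) (by norm_num)).fderiv_right (m := 1) (by norm_num))
  have key : ∃ C : ℝ, 0 ≤ C ∧ ∀ z ∈ closure Ω, z ∈ Ω → ∀ X,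
      -C * (|ρ z| * ‖X‖ ^ 2 + ‖X‖ * ‖dPairing ρ z X‖) ≤ leviForm ρ z X := by
    refine hb.isCompact_closure.induction_on (p := fun S => ∃ C : ℝ, 0 ≤ C ∧ ∀ z ∈ S, z ∈ Ω → ∀ X,
      -C * (|ρ z| * ‖X‖ ^ 2 + ‖X‖ * ‖dPairing ρ z X‖) ≤ leviForm ρ z X)
      ⟨0, le_rfl, fun z hz => absurd hz (notMem_empty z)⟩ ?_ ?_ ?_
    · rintro S T hST ⟨C, hC, h⟩
      exact ⟨C, hC, fun z hz => h z (hST hz)⟩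
    · rintro S T ⟨C, hC, h⟩ ⟨C', hC', h2⟩
      refine ⟨C + C', add_nonneg hC hC', fun z hz hzΩ X => ?_⟩
      have h0 : 0 ≤ |ρ z| * ‖X‖ ^ 2 + ‖X‖ * ‖dPairing ρ z X‖ := by positivity
      rcases hz with hz | hz
      · have := h z hz hzΩ X
        nlinarith
      · have := h2 z hz hzΩ X
        nlinarith
    · intro x hx
      by_cases hxΩ : x ∈ Ω
      · have hneg := hρ.2.1 x hxΩ
        have e1 : ∀ᶠ z in 𝓝 x, ρ z < ρ x / 2 :=
          (hρ3.continuous.tendsto x).eventually_lt_const (by linarith)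
        have e2 := hρ2.continuous.eventually_norm_lt_add_one x
        set B := ‖fderiv ℝ (fderiv ℝ ρ) x‖ + 1
        have hB : 0 ≤ B := by positivity
        refine ⟨_, mem_nhdsWithin_of_mem_nhds (e1.and e2), B * (2 / -ρ x),
          mul_nonneg hB (div_nonneg (by norm_num) (by linarith)), fun z hz _ X => ?_⟩
        have h1 := (abs_le.1 (abs_leviForm_le ρ z X)).1
        have h2 : ‖fderiv ℝ (fderiv ℝ ρ) z‖ * ‖X‖ ^ 2 ≤ B * ‖X‖ ^ 2 :=
          mul_le_mul_of_nonneg_right hz.2.le (sq_nonneg _)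
        have hz1 : ρ z < ρ x / 2 := hz.1
        have h3 : 1 ≤ 2 / -ρ x * |ρ z| := by
          rw [abs_of_neg (by linarith), div_mul_eq_mul_div, le_div_iff₀ (by linarith)]
          linarith
        have h4 : B * ‖X‖ ^ 2 * 1 ≤ B * ‖X‖ ^ 2 * (2 / -ρ x * |ρ z|) := by gcongr
        have h5 : 0 ≤ B * (2 / -ρ x) * (‖X‖ * ‖dPairing ρ z X‖) :=
          mul_nonneg (mul_nonneg hB (div_nonneg (by norm_num) (by linarith))) (by positivity)
        nlinarith
      · have hxf : x ∈ frontier Ω := by rw [hΩ.frontier_eq]; exact ⟨hx, hxΩ⟩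
        obtain ⟨C, hC, h⟩ := exists_leviForm_lower_nhds_frontier hΩ hρ3 hρ.2.1 hρ.2.2.1 hL hxf
          (hρ.2.2.2 x hxf)
        exact ⟨_, mem_nhdsWithin_of_mem_nhds h, C, hC, fun z hz => hz⟩
  obtain ⟨C, hC, h⟩ := key
  exact ⟨C, hC, fun z hz => h z (subset_closure hz) hz⟩

theorem IsDefining.exists_isExhaustion (hΩ : IsOpen Ω) (hb : Bornology.IsBounded Ω)
    (hρ : IsDefining n Ω ρ) (hL : ∀ q ∈ frontier Ω, LeviPSDAt n ρ q) :
    ∃ s C, IsExhaustion Ω s C := by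
  obtain ⟨C₀, hC₀, hlow⟩ := hρ.exists_leviForm_lower hΩ hb hL
  have hρ2 : ContDiff ℝ 2 ρ := hρ.1.of_le (WithTop.coe_le_coe.2 (le_top (a := (2 : ℕ∞))))
  have hcomp := hb.isCompact_closure
  set w := wsq (n := n) (fun _ => C₀ + C₀ ^ 2) 0 with hw
  have hwc : ContDiff ℝ 2 w := contDiff_wsq _ _
  have hw0 : ∀ z, 0 ≤ w z := fun z => wsq_nonneg (fun _ => by positivity) _ _
  obtain ⟨B₁, hB₁⟩ := hcomp.exists_bound_of_continuousOn (f := fderiv ℝ ρ)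
    (hρ2.continuous_fderiv (by simp)).continuousOn
  obtain ⟨B₂, hB₂⟩ := hcomp.exists_bound_of_continuousOn (f := fderiv ℝ w)
    (hwc.continuous_fderiv (by simp)).continuousOn
  obtain ⟨B₃, hB₃⟩ := hcomp.exists_bound_of_continuousOn (f := ρ) hρ2.continuous.continuousOn
  have hθ : ∀ t : ℝ, t < 0 → HasDerivAt (fun t : ℝ => -Real.log (-t)) (-t⁻¹) t := by
    intro t ht
    exact ((hasDerivAt_neg t).log (neg_ne_zero.2 ht.ne)).fun_neg.congr_deriv
      (by rw [neg_div_neg_eq, one_div])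
  have hcd : ∀ z ∈ Ω, ContDiffAt ℝ 2 (fun z => -Real.log (-ρ z)) z := fun z hz =>
    ((hρ2.contDiffAt.neg).log (neg_ne_zero.2 (hρ.2.1 z hz).ne)).neg
  refine ⟨fun z => -Real.log (-ρ z) + w z, B₁ + B₂ * B₃, ?_, ?_, ?_, ?_⟩
  · exact fun z hz => (hcd z hz).add hwc.contDiffAt
  · intro z hz X
    have hneg := hρ.2.1 z hz
    rw [leviForm_add (hcd z hz) hwc.contDiffAt, hw, leviForm_wsq,
      leviForm_comp (θ := fun t => -Real.log (-t)) (θ' := fun t => -t⁻¹)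
        (θ'' := ((ρ z) ^ 2)⁻¹) hρ2.contDiffAt
        ((eventually_lt_nhds hneg).mono hθ) ((hasDerivAt_inv hneg.ne).fun_neg.congr_deriv (neg_neg _)),
      ← Finset.mul_sum]
    have h1 := hlow z hz X
    have h2 := norm_sq_le_sum_norm_sq X
    rw [abs_of_neg hneg] at h1
    set l := ‖dPairing ρ z X‖
    set x := ‖X‖
    set d := -(ρ z)⁻¹ with hd
    have hd0 : 0 < d := by rw [hd]; exact neg_pos.2 (inv_lt_zero.2 hneg)
    have hdρ : d * -ρ z = 1 := by rw [hd, neg_mul_neg, inv_mul_cancel₀ hneg.ne]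
    have hd2 : ((ρ z) ^ 2)⁻¹ = d ^ 2 := by rw [hd, neg_sq, inv_pow]
    rw [hd2]
    have h3 := mul_le_mul_of_nonneg_left h1 hd0.le
    have h4 : d * (-C₀ * (-ρ z * x ^ 2 + x * l)) = -C₀ * (x ^ 2 + x * (d * l)) := by
      linear_combination (-C₀ * x ^ 2) * hdρ
    rw [h4] at h3
    have h5 : (C₀ + C₀ ^ 2) * x ^ 2 ≤ (C₀ + C₀ ^ 2) * ∑ j, ‖X j‖ ^ 2 := by gcongr
    nlinarith [sq_nonneg (d * l - C₀ * x), sq_nonneg (d * l), sq_nonneg (C₀ * x)]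
  · intro z hz j
    have hneg := hρ.2.1 z hz
    have hzc := subset_closure hz
    refine (norm_wder_ofReal_le (((hcd z hz).add hwc.contDiffAt).differentiableAt (by simp))
      j).trans ?_
    rw [fderiv_fun_add ((hcd z hz).differentiableAt (by simp)) (hwc.differentiable (by simp) z),
      fderiv_comp_real (hρ2.differentiable (by simp) z) (hθ _ hneg), Real.exp_add, Real.exp_neg,
      Real.exp_log (neg_pos.2 hneg)]
    have h1 := hB₁ z hzc
    have h2 := hB₂ z hzc
    have h3 := hB₃ z hzc
    rw [Real.norm_eq_abs, abs_of_neg hneg] at h3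
    have hd0 : 0 < (-ρ z)⁻¹ := inv_pos.2 (neg_pos.2 hneg)
    have h4 : ‖-(ρ z)⁻¹ • fderiv ℝ ρ z‖ ≤ (-ρ z)⁻¹ * B₁ := by
      rw [norm_smul, ← inv_neg, Real.norm_of_nonneg hd0.le]
      gcongr
    have hB2 : 0 ≤ B₂ := (norm_nonneg _).trans h2
    have hB1 : 0 ≤ B₁ := (norm_nonneg _).trans h1
    have h5 : 1 ≤ (-ρ z)⁻¹ * B₃ := by
      rw [← inv_mul_cancel₀ (neg_pos.2 hneg).ne']
      gcongr
    have h6 : B₂ * 1 ≤ B₂ * ((-ρ z)⁻¹ * B₃) := by gcongr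
    have h7 : 1 ≤ Real.exp (w z) := Real.one_le_exp (hw0 z)
    have hB3 : 0 ≤ B₃ := (neg_pos.2 hneg).le.trans h3
    have h8 : (B₁ + B₂ * B₃) * (-ρ z)⁻¹ * 1 ≤ (B₁ + B₂ * B₃) * (-ρ z)⁻¹ * Real.exp (w z) := by
      gcongr
    refine (norm_add_le _ _).trans ?_
    nlinarith
  · intro τ
    have he : {z | z ∈ Ω ∧ -Real.log (-ρ z) + w z ≤ τ} =
        closure Ω ∩ {z | Real.exp (w z - τ) ≤ -ρ z} := by
      ext z
      constructor
      · rintro ⟨hz, h⟩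
        refine ⟨subset_closure hz, ?_⟩
        rw [Set.mem_ofPred_eq, ← Real.le_log_iff_exp_le (neg_pos.2 (hρ.2.1 z hz))]
        linarith
      · rintro ⟨hz, h⟩
        have hpos : 0 < -ρ z := (Real.exp_pos _).trans_le h
        have hzΩ : z ∈ Ω := by
          by_contra hc
          have := hρ.2.2.1 z (by rw [hΩ.frontier_eq]; exact ⟨hz, hc⟩)
          linarith
        refine ⟨hzΩ, ?_⟩
        have := (Real.le_log_iff_exp_le hpos).2 h
        linarith
    rw [he]
    exact hcomp.inter_right (isClosed_le
      (Real.continuous_exp.comp (hwc.continuous.sub continuous_const)) hρ2.continuous.neg)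

end DefiningFunction

section CauchyEstimates
variable {n : ℕ}

theorem exists_norm_sq_le_integral_ball (n : ℕ) : ∃ C : ℝ, 0 < C ∧ ∀ F : (Fin n → ℂ) → ℂ,
    DifferentiableOn ℂ F (Metric.ball 0 1) →
    IntegrableOn (fun z => ‖F z‖ ^ 2) (Metric.ball 0 1) →
    ∀ z ∈ Metric.ball (0 : Fin n → ℂ) (1 / 2),
      ‖F z‖ ^ 2 ≤ C * ∫ w in Metric.ball 0 1, ‖F w‖ ^ 2 := by
  obtain ⟨ρ, hρ⟩ := exists_isMollifier (n := n) (r := 1 / 4) (by norm_num)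
  obtain ⟨R, hR⟩ := hρ.hasCompactSupport.exists_bound_of_continuous hρ.contDiff.continuous
  refine ⟨R + 1, by have := (norm_nonneg _).trans (hR 0); linarith, fun F hF hi z hz => ?_⟩
  have hsub : Metric.closedBall z (1 / 4) ⊆ Metric.ball 0 1 := by
    intro w hw
    rw [Metric.mem_closedBall] at hw
    rw [Metric.mem_ball] at hz ⊢
    have := dist_triangle w z 0
    linarith
  have h1 := hρ.integral_mul_eq Metric.isOpen_ball (hF.pow 2) hsub
  have h2 : ‖F z‖ ^ 2 = ‖(F ^ 2) z‖ := by simp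
  rw [h2, ← h1, ← integral_indicator Metric.isOpen_ball.measurableSet, ← integral_const_mul]
  refine (norm_integral_le_integral_norm _).trans (integral_mono_of_nonneg
    (Eventually.of_forall fun _ => norm_nonneg _)
    ((integrable_indicator_iff Metric.isOpen_ball.measurableSet).2 hi |>.const_mul _)
    (Eventually.of_forall fun w => ?_))
  simp only [Pi.pow_apply, norm_mul, norm_pow, norm_real]
  by_cases hw : w ∈ Metric.ball (0 : Fin n → ℂ) 1
  · rw [indicator_of_mem hw, mul_comm]
    have := hR (z - w)
    gcongr
    linarith
  · rw [indicator_of_notMem hw, mul_zero, hρ.eq_zero, norm_zero, mul_zero]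
    by_contra! hc
    exact hw (hsub (by rw [Metric.mem_closedBall, dist_comm, dist_eq_norm]; exact hc.le))

theorem norm_fderiv_apply_le {F : (Fin n → ℂ) → ℂ} {r B : ℝ} (hr : 0 < r)
    (hF : DifferentiableOn ℂ F (Metric.ball 0 r))
    (hB : ∀ z ∈ Metric.ball (0 : Fin n → ℂ) r, ‖F z‖ ≤ B) (X : Fin n → ℂ) :
    ‖fderiv ℂ F 0 X‖ ≤ 2 / r * B * ‖X‖ := by
  rcases eq_or_ne X 0 with rfl | hX
  · simp
  have hx : 0 < ‖X‖ := norm_pos_iff.2 hX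
  set R := r / (2 * ‖X‖) with hR
  have hR0 : 0 < R := by positivity
  have hmem : ∀ t ∈ Metric.closedBall (0 : ℂ) R, t • X ∈ Metric.ball (0 : Fin n → ℂ) r := by
    intro t ht
    rw [mem_closedBall_zero_iff] at ht
    rw [mem_ball_zero_iff, norm_smul]
    have : ‖t‖ * ‖X‖ ≤ R * ‖X‖ := by gcongr
    have e : R * ‖X‖ = r / 2 := by rw [hR]; field_simp
    linarith
  have hd : DifferentiableOn ℂ (fun t : ℂ => F (t • X)) (Metric.closedBall 0 R) :=
    hF.comp (by fun_prop) hmem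
  have h1 := norm_deriv_le_of_forall_mem_sphere_norm_le hR0
    (hd.diffContOnCl_ball subset_rfl) (C := B)
    fun t ht => hB _ (hmem t (Metric.sphere_subset_closedBall ht))
  have h2 : deriv (fun t : ℂ => F (t • X)) 0 = fderiv ℂ F 0 X := by
    have h3 : HasFDerivAt F (fderiv ℂ F 0) ((0 : ℂ) • X) := by
      rw [zero_smul]
      exact (hF.differentiableAt (Metric.ball_mem_nhds _ hr)).hasFDerivAt
    have h4 : HasDerivAt (fun t : ℂ => t • X) X 0 := by
      simpa using (hasDerivAt_id (0 : ℂ)).smul_const X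
    exact (h3.comp_hasDerivAt (0 : ℂ) h4).deriv
  rw [h2] at h1
  refine h1.trans (le_of_eq ?_)
  rw [hR]
  field_simp

end CauchyEstimates

section Scaling
variable {n : ℕ}

/-- The real linear map `ζ ↦ (β_j ζ_j)`. -/
noncomputable def scaleMap (β : Fin n → ℝ) : (Fin n → ℂ) →ₗ[ℝ] (Fin n → ℂ) :=
  LinearMap.pi fun j => β j • LinearMap.proj j

/-- The Jacobian determinant of `scaleMap β`. -/
noncomputable def scaleVol (β : Fin n → ℝ) : ℝ := |LinearMap.det (scaleMap β)|

theorem scaleMap_apply (β : Fin n → ℝ) (ζ : Fin n → ℂ) (j : Fin n) :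
    scaleMap β ζ j = (β j : ℂ) * ζ j := by
  simp [scaleMap]

theorem det_scaleMap_ne_zero {β : Fin n → ℝ} (hβ : ∀ j, 0 < β j) :
    LinearMap.det (scaleMap β) ≠ 0 := by
  intro hc
  obtain ⟨v, hv, h0⟩ := (LinearMap.bot_lt_ker_of_det_eq_zero hc).ne' |> fun h =>
    (Submodule.ne_bot_iff _).1 h
  refine h0 (funext fun j => ?_)
  have h1 := congrFun (LinearMap.mem_ker.1 hv) j
  rw [scaleMap_apply] at h1
  simpa [(hβ j).ne'] using h1

theorem scaleVol_pos {β : Fin n → ℝ} (hβ : ∀ j, 0 < β j) : 0 < scaleVol β :=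
  abs_pos.2 (det_scaleMap_ne_zero hβ)

theorem scaleVol_smul {ε : ℝ} (hε : 0 < ε) (β : Fin n → ℝ) :
    scaleVol (ε • β) = ε ^ (2 * n) * scaleVol β := by
  have h : scaleMap (ε • β) = ε • scaleMap β := by
    refine LinearMap.ext fun ζ => funext fun j => ?_
    rw [scaleMap_apply, LinearMap.smul_apply, Pi.smul_apply, Pi.smul_apply, scaleMap_apply]
    simp [mul_assoc]
  have hf : Module.finrank ℝ (Fin n → ℂ) = 2 * n := by
    rw [Module.finrank_pi_fintype]
    simp [Complex.finrank_real_complex, mul_comm]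
  rw [scaleVol, scaleVol, h, LinearMap.det_smul, hf, abs_mul, abs_of_pos (by positivity)]

/-- The scaling `ζ ↦ p + β ζ` is a measurable embedding multiplying volumes by `scaleVol β`. -/
theorem measurableEmbedding_scale {β : Fin n → ℝ} (hβ : ∀ j, 0 < β j) (p : Fin n → ℂ) :
    MeasurableEmbedding (fun ζ => p + scaleMap β ζ) := by
  have hc : Continuous (scaleMap β) := LinearMap.continuous_of_finiteDimensional _
  refine (hc.measurable.const_add p).measurableEmbedding fun ζ ξ h => ?_
  have h1 := add_left_cancel h
  refine funext fun j => ?_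
  have h2 := congrFun h1 j
  rw [scaleMap_apply, scaleMap_apply] at h2
  exact mul_left_cancel₀ (ofReal_ne_zero.2 (hβ j).ne') h2

theorem map_scale {β : Fin n → ℝ} (hβ : ∀ j, 0 < β j) (p : Fin n → ℂ) :
    Measure.map (fun ζ => p + scaleMap β ζ) volume =
      ENNReal.ofReal (scaleVol β)⁻¹ • (volume : Measure (Fin n → ℂ)) := by
  have hc : Continuous (scaleMap β) := LinearMap.continuous_of_finiteDimensional _
  have h1 := Measure.map_linearMap_addHaar_eq_smul_addHaar
    (volume : Measure (Fin n → ℂ)) (det_scaleMap_ne_zero hβ)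
  have h2 : (fun ζ => p + scaleMap β ζ) = (fun z => p + z) ∘ scaleMap β := rfl
  rw [h2, ← Measure.map_map (measurable_const_add p) hc.measurable, h1, Measure.map_smul,
    map_add_left_eq_self, abs_inv, scaleVol]

theorem integral_scale {E : Type*} [NormedAddCommGroup E] [NormedSpace ℝ E] {β : Fin n → ℝ}
    (hβ : ∀ j, 0 < β j) (p : Fin n → ℂ) (f : (Fin n → ℂ) → E) :
    ∫ ζ, f (p + scaleMap β ζ) = (scaleVol β)⁻¹ • ∫ z, f z := by
  rw [← (measurableEmbedding_scale hβ p).integral_map, map_scale hβ, integral_smul_measure,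
    ENNReal.toReal_ofReal (inv_nonneg.2 (scaleVol_pos hβ).le)]

theorem integrable_scale {E : Type*} [NormedAddCommGroup E] {β : Fin n → ℝ}
    (hβ : ∀ j, 0 < β j) (p : Fin n → ℂ) {f : (Fin n → ℂ) → E} (hf : Integrable f) :
    Integrable fun ζ => f (p + scaleMap β ζ) := by
  have h := (measurableEmbedding_scale hβ p).integrable_map_iff (g := f) (μ := volume)
  rw [map_scale hβ] at h
  exact h.1 (hf.smul_measure ENNReal.ofReal_ne_top)

theorem scale_mem_polydisc_iff {β : Fin n → ℝ} (hβ : ∀ j, 0 < β j) (p ζ : Fin n → ℂ) :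
    p + scaleMap β ζ ∈ polydisc n p β ↔ ζ ∈ Metric.ball (0 : Fin n → ℂ) 1 := by
  rw [mem_ball_zero_iff, pi_norm_lt_iff one_pos]
  refine forall_congr' fun j => ?_
  rw [Pi.add_apply, add_sub_cancel_left, scaleMap_apply, norm_mul, norm_real,
    Real.norm_of_nonneg (hβ j).le]
  exact mul_lt_iff_lt_one_right (hβ j)

theorem isOpen_polydisc (p : Fin n → ℂ) (β : Fin n → ℝ) : IsOpen (polydisc n p β) := by
  simp only [polydisc, ofPred_forall]
  exact isOpen_iInter_of_finite fun j => isOpen_lt (by fun_prop) continuous_const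

theorem mem_polydisc_self {β : Fin n → ℝ} (hβ : ∀ j, 0 < β j) (p : Fin n → ℂ) :
    p ∈ polydisc n p β := by
  intro j
  simpa using hβ j

/-- Interior estimates for holomorphic functions on a polydisc. -/
theorem exists_polydisc_estimate (n : ℕ) : ∃ C : ℝ, 0 < C ∧ ∀ (p : Fin n → ℂ) (β : Fin n → ℝ),
    (∀ j, 0 < β j) → ∀ u : (Fin n → ℂ) → ℂ, DifferentiableOn ℂ u (polydisc n p β) →
    IntegrableOn (fun z => ‖u z‖ ^ 2) (polydisc n p β) →
    ‖u p‖ ^ 2 ≤ C * (scaleVol β)⁻¹ * ∫ z in polydisc n p β, ‖u z‖ ^ 2 ∧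
    ∀ X : Fin n → ℂ, ‖fderiv ℂ u p X‖ ^ 2 ≤
      C * (scaleVol β)⁻¹ * (∑ j, ‖X j‖ ^ 2 / β j ^ 2) * ∫ z in polydisc n p β, ‖u z‖ ^ 2 := by
  obtain ⟨C, hC, h⟩ := exists_norm_sq_le_integral_ball n
  refine ⟨16 * C, by positivity, fun p β hβ u hu hi => ?_⟩
  have hL : ∀ ζ, HasFDerivAt (fun ζ : Fin n → ℂ => p + scaleMap β ζ) (ContinuousLinearMap.pi
      fun j => (β j : ℂ) • ContinuousLinearMap.proj (R := ℂ) (φ := fun _ : Fin n => ℂ) j) ζ := by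
    intro ζ
    have := (ContinuousLinearMap.pi fun j => (β j : ℂ) • ContinuousLinearMap.proj (R := ℂ)
      (φ := fun _ : Fin n => ℂ) j).hasFDerivAt (x := ζ) |>.const_add p
    refine this.congr_of_eventuallyEq (Eventually.of_forall fun ξ => ?_)
    funext j
    simp [scaleMap_apply]
  set F := fun ζ => u (p + scaleMap β ζ) with hF
  have hFd : DifferentiableOn ℂ F (Metric.ball 0 1) :=
    hu.comp (fun ζ _ => (hL ζ).differentiableAt.differentiableWithinAt)
      fun ζ hζ => (scale_mem_polydisc_iff hβ p ζ).2 hζ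
  have hm := (isOpen_polydisc p β).measurableSet
  have hind : ∀ ζ, (polydisc n p β).indicator (fun z => ‖u z‖ ^ 2) (p + scaleMap β ζ) =
      (Metric.ball 0 1).indicator (fun ζ => ‖F ζ‖ ^ 2) ζ := by
    intro ζ
    by_cases hζ : ζ ∈ Metric.ball (0 : Fin n → ℂ) 1
    · rw [indicator_of_mem hζ, indicator_of_mem ((scale_mem_polydisc_iff hβ p ζ).2 hζ)]
    · rw [indicator_of_notMem hζ,
        indicator_of_notMem fun h => hζ ((scale_mem_polydisc_iff hβ p ζ).1 h)]
  have hFi : IntegrableOn (fun ζ => ‖F ζ‖ ^ 2) (Metric.ball 0 1) := by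
    rw [← integrable_indicator_iff Metric.isOpen_ball.measurableSet]
    exact (integrable_scale hβ p ((integrable_indicator_iff hm).2 hi)).congr
      (Eventually.of_forall hind)
  have hInt : ∫ w in Metric.ball 0 1, ‖F w‖ ^ 2 =
      (scaleVol β)⁻¹ * ∫ z in polydisc n p β, ‖u z‖ ^ 2 := by
    rw [← integral_indicator Metric.isOpen_ball.measurableSet, ← integral_indicator hm,
      ← smul_eq_mul, ← integral_scale hβ p]
    simp only [hind]
  have h1 := h F hFd hFi
  set J := (scaleVol β)⁻¹ * ∫ z in polydisc n p β, ‖u z‖ ^ 2 with hJ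
  rw [hInt] at h1
  have hF0 : F 0 = u p := by simp [hF]
  have hJ0 : 0 ≤ J := mul_nonneg (inv_nonneg.2 (abs_nonneg _))
    (integral_nonneg fun _ => sq_nonneg _)
  constructor
  · have := h1 0 (by simp)
    rw [hF0] at this
    rw [mul_assoc, ← hJ]
    nlinarith
  · intro X
    set Y : Fin n → ℂ := fun j => X j / β j with hY
    have h2 : ∀ z ∈ Metric.ball (0 : Fin n → ℂ) (1 / 2), ‖F z‖ ≤ √(C * J) :=
      fun z hz => Real.le_sqrt_of_sq_le (h1 z hz)
    have h3 := norm_fderiv_apply_le (by norm_num)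
      (hFd.mono (Metric.ball_subset_ball (by norm_num))) h2 Y
    have h4 : fderiv ℂ F 0 Y = fderiv ℂ u p X := by
      have h5 : HasFDerivAt u (fderiv ℂ u p) (p + scaleMap β 0) := by
        rw [map_zero, add_zero]
        exact (hu.differentiableAt
          ((isOpen_polydisc p β).mem_nhds (mem_polydisc_self hβ p))).hasFDerivAt
      have h7 : HasFDerivAt F _ 0 := h5.comp (0 : Fin n → ℂ) (hL 0)
      rw [h7.fderiv]
      simp only [ContinuousLinearMap.comp_apply]
      congr 1
      funext j
      have := ofReal_ne_zero.2 (hβ j).ne'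
      simp only [ContinuousLinearMap.coe_pi', smul_apply, ContinuousLinearMap.proj_apply, hY,
        smul_eq_mul]
      field_simp
    have h6 : ‖Y‖ ^ 2 ≤ ∑ j, ‖X j‖ ^ 2 / β j ^ 2 := by
      refine (norm_sq_le_sum_norm_sq Y).trans (le_of_eq (Finset.sum_congr rfl fun j _ => ?_))
      rw [hY, norm_div, norm_real, div_pow, Real.norm_eq_abs, sq_abs]
    rw [← h4]
    calc ‖fderiv ℂ F 0 Y‖ ^ 2 ≤ (2 / (1 / 2) * √(C * J) * ‖Y‖) ^ 2 := by gcongr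
      _ = 16 * (C * J) * ‖Y‖ ^ 2 := by
        rw [mul_pow, mul_pow, Real.sq_sqrt (by positivity)]
        norm_num
      _ ≤ 16 * (C * J) * ∑ j, ‖X j‖ ^ 2 / β j ^ 2 := by gcongr
      _ = _ := by rw [hJ]; ring

end Scaling

section LogWeight

/-- A smooth cutoff on the line: `1` for `τ ≤ 1/2`, `0` for `τ ≥ 3/4`. -/
noncomputable def lineCutoff (τ : ℝ) : ℝ := Real.smoothTransition (3 - 4 * τ)

theorem contDiff_lineCutoff {k : ℕ∞} : ContDiff ℝ k lineCutoff :=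
  Real.smoothTransition.contDiff.comp (contDiff_const.sub (contDiff_const.mul contDiff_id))

theorem lineCutoff_of_le {τ : ℝ} (h : τ ≤ 1 / 2) : lineCutoff τ = 1 :=
  Real.smoothTransition.one_of_one_le (by linarith)

theorem lineCutoff_of_ge {τ : ℝ} (h : 3 / 4 ≤ τ) : lineCutoff τ = 0 :=
  Real.smoothTransition.zero_of_nonpos (by linarith)

theorem lineCutoff_nonneg (τ : ℝ) : 0 ≤ lineCutoff τ := Real.smoothTransition.nonneg _

theorem lineCutoff_le_one (τ : ℝ) : lineCutoff τ ≤ 1 := Real.smoothTransition.le_one _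

theorem contDiff_deriv_lineCutoff {k : ℕ} : ContDiff ℝ k (deriv lineCutoff) :=
  ((contDiff_succ_iff_deriv (n := (k : WithTop ℕ∞))).1
    (contDiff_lineCutoff (k := ((k + 1 : ℕ) : ℕ∞)))).2.2

theorem hasDerivAt_lineCutoff (τ : ℝ) : HasDerivAt lineCutoff (deriv lineCutoff τ) τ :=
  ((contDiff_lineCutoff (k := 1)).differentiable (by simp) τ).hasDerivAt

theorem hasDerivAt_deriv_lineCutoff (τ : ℝ) :
    HasDerivAt (deriv lineCutoff) (deriv (deriv lineCutoff) τ) τ :=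
  ((contDiff_deriv_lineCutoff (k := 1)).differentiable (by simp) τ).hasDerivAt

theorem deriv_lineCutoff_of_le {τ : ℝ} (h : τ < 1 / 2) : deriv lineCutoff τ = 0 := by
  have : lineCutoff =ᶠ[𝓝 τ] fun _ => 1 := by
    filter_upwards [Iio_mem_nhds h] with t ht using lineCutoff_of_le (le_of_lt ht)
  rw [this.deriv_eq, deriv_const]

theorem deriv_lineCutoff_of_ge {τ : ℝ} (h : 3 / 4 < τ) : deriv lineCutoff τ = 0 := by
  have : lineCutoff =ᶠ[𝓝 τ] fun _ => 0 := by
    filter_upwards [Ioi_mem_nhds h] with t ht using lineCutoff_of_ge (le_of_lt ht)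
  rw [this.deriv_eq, deriv_const]

theorem deriv_deriv_lineCutoff_of_le {τ : ℝ} (h : τ < 1 / 2) :
    deriv (deriv lineCutoff) τ = 0 := by
  have : deriv lineCutoff =ᶠ[𝓝 τ] fun _ => 0 := by
    filter_upwards [Iio_mem_nhds h] with t ht using deriv_lineCutoff_of_le ht
  rw [this.deriv_eq, deriv_const]

theorem deriv_deriv_lineCutoff_of_ge {τ : ℝ} (h : 3 / 4 < τ) :
    deriv (deriv lineCutoff) τ = 0 := by
  have : deriv lineCutoff =ᶠ[𝓝 τ] fun _ => 0 := by
    filter_upwards [Ioi_mem_nhds h] with t ht using deriv_lineCutoff_of_ge ht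
  rw [this.deriv_eq, deriv_const]

theorem exists_bound_deriv_lineCutoff : ∃ B : ℝ, 1 ≤ B ∧ ∀ τ, |deriv lineCutoff τ| ≤ B ∧
    |deriv (deriv lineCutoff) τ| ≤ B := by
  have hc : Continuous (deriv lineCutoff) := (contDiff_deriv_lineCutoff (k := 0)).continuous
  have hc2 : Continuous (deriv (deriv lineCutoff)) :=
    (contDiff_deriv_lineCutoff (k := 1)).continuous_deriv (by simp)
  obtain ⟨B1, h1⟩ := (isCompact_Icc (a := (1 / 2 : ℝ)) (b := 3 / 4)).exists_bound_of_continuousOn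
    hc.continuousOn
  obtain ⟨B2, h2⟩ := (isCompact_Icc (a := (1 / 2 : ℝ)) (b := 3 / 4)).exists_bound_of_continuousOn
    hc2.continuousOn
  refine ⟨max 1 (max B1 B2), le_max_left _ _, fun τ => ?_⟩
  rcases lt_or_ge τ (1 / 2) with h | h
  · rw [deriv_lineCutoff_of_le h, deriv_deriv_lineCutoff_of_le h]
    simp
  rcases lt_or_ge (3 / 4) τ with h' | h'
  · rw [deriv_lineCutoff_of_ge h', deriv_deriv_lineCutoff_of_ge h']
    simp
  exact ⟨(h1 τ ⟨h, h'⟩).trans (by simp), (h2 τ ⟨h, h'⟩).trans (by simp)⟩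

/-- The truncated regularized logarithm. -/
noncomputable def logWeight (δ τ : ℝ) : ℝ := lineCutoff τ * Real.log (τ + δ)

/-- The first derivative of `logWeight δ`. -/
noncomputable def logWeightDeriv (δ τ : ℝ) : ℝ :=
  deriv lineCutoff τ * Real.log (τ + δ) + lineCutoff τ * (τ + δ)⁻¹

/-- The second derivative of `logWeight δ`. -/
noncomputable def logWeightDeriv2 (δ τ : ℝ) : ℝ :=
  deriv (deriv lineCutoff) τ * Real.log (τ + δ) + deriv lineCutoff τ * (τ + δ)⁻¹ +
    (deriv lineCutoff τ * (τ + δ)⁻¹ + lineCutoff τ * -((τ + δ) ^ 2)⁻¹)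

theorem hasDerivAt_logWeight {δ τ : ℝ} (h : 0 < τ + δ) :
    HasDerivAt (logWeight δ) (logWeightDeriv δ τ) τ := by
  have hl : HasDerivAt (fun t => Real.log (t + δ)) (τ + δ)⁻¹ τ := by
    have := ((hasDerivAt_id τ).add_const δ).log h.ne'
    simpa using this
  exact (hasDerivAt_lineCutoff τ).fun_mul hl

theorem hasDerivAt_logWeightDeriv {δ τ : ℝ} (h : 0 < τ + δ) :
    HasDerivAt (logWeightDeriv δ) (logWeightDeriv2 δ τ) τ := by
  have hl : HasDerivAt (fun t => Real.log (t + δ)) (τ + δ)⁻¹ τ := by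
    have := ((hasDerivAt_id τ).add_const δ).log h.ne'
    simpa using this
  have hi : HasDerivAt (fun t => (t + δ)⁻¹) (-((τ + δ) ^ 2)⁻¹) τ := by
    have := ((hasDerivAt_id τ).add_const δ).fun_inv h.ne'
    simpa [neg_div] using this
  exact ((hasDerivAt_deriv_lineCutoff τ).fun_mul hl).fun_add
    ((hasDerivAt_lineCutoff τ).fun_mul hi)

theorem logWeightDeriv_of_ge {δ τ : ℝ} (h : 3 / 4 < τ) :
    logWeightDeriv δ τ = 0 ∧ logWeightDeriv2 δ τ = 0 := by
  simp [logWeightDeriv, logWeightDeriv2, deriv_lineCutoff_of_ge h, lineCutoff_of_ge h.le,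
    deriv_deriv_lineCutoff_of_ge h]

theorem abs_log_le_one {x : ℝ} (h : 1 / 2 ≤ x) (h' : x ≤ 1) : |Real.log x| ≤ 1 := by
  rw [abs_of_nonpos (Real.log_nonpos (by linarith) h')]
  have h1 := Real.one_sub_inv_le_log_of_pos (x := x) (by linarith)
  have h2 : x⁻¹ ≤ 2 := by
    rw [inv_le_comm₀ (by linarith) (by norm_num)]
    linarith
  linarith

theorem logWeightDeriv_lower {B : ℝ} (hB1 : 1 ≤ B) (hB : ∀ τ, |deriv lineCutoff τ| ≤ B ∧
    |deriv (deriv lineCutoff) τ| ≤ B) {δ τ : ℝ} (hδ : 0 < δ) (hδ' : δ ≤ 1 / 4) (hτ : 0 ≤ τ) :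
    -(10 * B) ≤ logWeightDeriv δ τ ∧ -(10 * B) ≤ logWeightDeriv δ τ + τ * logWeightDeriv2 δ τ := by
  rcases lt_or_ge (3 / 4) τ with h' | h'
  · rw [(logWeightDeriv_of_ge h').1, (logWeightDeriv_of_ge h').2]
    constructor <;> linarith
  have hp : 0 < τ + δ := by linarith
  rcases lt_or_ge τ (1 / 2) with h | h
  · simp only [logWeightDeriv, logWeightDeriv2, deriv_lineCutoff_of_le h,
      lineCutoff_of_le h.le, deriv_deriv_lineCutoff_of_le h]
    have h1 : 0 < (τ + δ)⁻¹ := inv_pos.2 hp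
    have h2 : (τ + δ)⁻¹ + τ * -((τ + δ) ^ 2)⁻¹ = δ * ((τ + δ) ^ 2)⁻¹ := by
      field_simp
      ring
    have h3 : 0 ≤ δ * ((τ + δ) ^ 2)⁻¹ := by positivity
    constructor
    · linarith
    · linarith
  · have hl := abs_log_le_one (x := τ + δ) (by linarith) (by linarith)
    have hi : 0 < (τ + δ)⁻¹ := inv_pos.2 hp
    have hi2 : (τ + δ)⁻¹ ≤ 2 := by
      rw [inv_le_comm₀ hp (by norm_num)]
      linarith
    have hq : ((τ + δ) ^ 2)⁻¹ ≤ 4 := by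
      rw [← inv_pow]
      nlinarith
    have hq0 : 0 < ((τ + δ) ^ 2)⁻¹ := by positivity
    have hx0 := lineCutoff_nonneg τ
    have hx1 := lineCutoff_le_one τ
    have e1 : |deriv lineCutoff τ * Real.log (τ + δ)| ≤ B := by
      rw [abs_mul]
      nlinarith [abs_nonneg (deriv lineCutoff τ), abs_nonneg (Real.log (τ + δ)), (hB τ).1]
    have e2 : |deriv (deriv lineCutoff) τ * Real.log (τ + δ)| ≤ B := by
      rw [abs_mul]
      nlinarith [abs_nonneg (deriv (deriv lineCutoff) τ), abs_nonneg (Real.log (τ + δ)), (hB τ).2]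
    have e3 : |deriv lineCutoff τ * (τ + δ)⁻¹| ≤ 2 * B := by
      rw [abs_mul, abs_of_pos hi]
      nlinarith [abs_nonneg (deriv lineCutoff τ), (hB τ).1]
    have e4 : 0 ≤ lineCutoff τ * (τ + δ)⁻¹ := by positivity
    have e5 : lineCutoff τ * ((τ + δ) ^ 2)⁻¹ ≤ 4 := by nlinarith
    have f1 : -B ≤ logWeightDeriv δ τ := by
      unfold logWeightDeriv
      linarith [(abs_le.1 e1).1]
    have f2 : -(9 * B) ≤ logWeightDeriv2 δ τ := by
      unfold logWeightDeriv2
      linarith [(abs_le.1 e2).1, (abs_le.1 e3).1]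
    constructor
    · linarith
    · nlinarith

theorem logWeight_nonpos {δ τ : ℝ} (hδ : 0 < δ) (hδ' : δ ≤ 1 / 4) (hτ : 0 ≤ τ) :
    logWeight δ τ ≤ 0 := by
  unfold logWeight
  rcases lt_or_ge (3 / 4) τ with h | h
  · rw [lineCutoff_of_ge h.le, zero_mul]
  · exact mul_nonpos_of_nonneg_of_nonpos (lineCutoff_nonneg τ)
      (Real.log_nonpos (by linarith) (by linarith))

theorem neg_one_le_logWeight {δ τ : ℝ} (hδ : 0 < δ) (hδ' : δ ≤ 1 / 4) (hτ : 1 / 2 ≤ τ) :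
    -1 ≤ logWeight δ τ := by
  unfold logWeight
  rcases lt_or_ge (3 / 4) τ with h | h
  · rw [lineCutoff_of_ge h.le, zero_mul]
    norm_num
  · have hl := (abs_le.1 (abs_log_le_one (x := τ + δ) (by linarith) (by linarith)))
    nlinarith [lineCutoff_nonneg τ, lineCutoff_le_one τ]

end LogWeight

section WeightOnPolydisc
variable {n : ℕ}

theorem norm_dPairing_wsq_sq_le {a : Fin n → ℝ} (ha : ∀ j, 0 ≤ a j) (p z X : Fin n → ℂ) :
    ‖dPairing (wsq a p) z X‖ ^ 2 ≤ wsq a p z * ∑ j, a j * ‖X j‖ ^ 2 := by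
  rw [dPairing_wsq]
  have h1 : ‖∑ j, (a j : ℂ) * (starRingEnd ℂ (z j - p j) * X j)‖ ≤
      ∑ j, (√(a j) * ‖z j - p j‖) * (√(a j) * ‖X j‖) := by
    refine (norm_sum_le _ _).trans (le_of_eq (Finset.sum_congr rfl fun j _ => ?_))
    rw [norm_mul, norm_mul, norm_real, Real.norm_of_nonneg (ha j), RCLike.norm_conj]
    nth_rewrite 1 [← Real.mul_self_sqrt (ha j)]
    ring
  refine (pow_le_pow_left₀ (norm_nonneg _) h1 2).trans
    ((Finset.sum_mul_sq_le_sq_mul_sq _ _ _).trans (le_of_eq ?_))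
  simp only [mul_pow, Real.sq_sqrt (ha _), wsq]

theorem contDiffAt_logWeight_wsq {a : Fin n → ℝ} (ha : ∀ j, 0 ≤ a j) (p z : Fin n → ℂ) {δ : ℝ}
    (hδ : 0 < δ) : ContDiffAt ℝ 2 (fun w => logWeight δ (wsq a p w)) z := by
  have h0 : wsq a p z + δ ≠ 0 := by linarith [wsq_nonneg ha p z]
  exact ((contDiff_lineCutoff (k := 2)).contDiffAt.comp z (contDiff_wsq a p).contDiffAt).mul
    (((contDiff_wsq a p).contDiffAt.add contDiffAt_const).log h0)

theorem leviForm_logWeight_wsq {a : Fin n → ℝ} (ha : ∀ j, 0 ≤ a j) (p z X : Fin n → ℂ) {δ : ℝ}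
    (hδ : 0 < δ) : leviForm (fun w => logWeight δ (wsq a p w)) z X =
      logWeightDeriv δ (wsq a p z) * (∑ j, a j * ‖X j‖ ^ 2) +
      logWeightDeriv2 δ (wsq a p z) * ‖dPairing (wsq a p) z X‖ ^ 2 := by
  have h0 : 0 < wsq a p z + δ := by linarith [wsq_nonneg ha p z]
  have hev : ∀ᶠ t in 𝓝 (wsq a p z), HasDerivAt (logWeight δ) (logWeightDeriv δ t) t := by
    filter_upwards [Ioi_mem_nhds (show -δ < wsq a p z by linarith)] with t ht
    exact hasDerivAt_logWeight (by linarith [mem_Ioi.1 ht])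
  rw [leviForm_comp (contDiff_wsq a p).contDiffAt hev (hasDerivAt_logWeightDeriv h0) X,
    leviForm_wsq]

theorem leviForm_logWeight_wsq_lower {B : ℝ} (hB1 : 1 ≤ B) (hB : ∀ τ, |deriv lineCutoff τ| ≤ B ∧
    |deriv (deriv lineCutoff) τ| ≤ B) {a : Fin n → ℝ} (ha : ∀ j, 0 ≤ a j) (p z X : Fin n → ℂ)
    {δ : ℝ} (hδ : 0 < δ) (hδ' : δ ≤ 1 / 4) :
    -(10 * B) * ∑ j, a j * ‖X j‖ ^ 2 ≤ leviForm (fun w => logWeight δ (wsq a p w)) z X := by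
  rw [leviForm_logWeight_wsq ha p z X hδ]
  have hq := wsq_nonneg ha p z
  obtain ⟨h1, h2⟩ := logWeightDeriv_lower hB1 hB hδ hδ' hq
  have h3 := norm_dPairing_wsq_sq_le ha p z X
  have hQ : 0 ≤ ∑ j, a j * ‖X j‖ ^ 2 :=
    Finset.sum_nonneg fun j _ => mul_nonneg (ha j) (sq_nonneg _)
  set Q := ∑ j, a j * ‖X j‖ ^ 2
  set d := ‖dPairing (wsq a p) z X‖ ^ 2 with hd
  have hd0 : 0 ≤ d := sq_nonneg _
  rcases le_or_gt 0 (logWeightDeriv2 δ (wsq a p z)) with h | h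
  · nlinarith [mul_nonneg h hd0, mul_le_mul_of_nonneg_right h1 hQ]
  · nlinarith [mul_le_mul_of_nonpos_left h3 h.le, mul_le_mul_of_nonneg_right h2 hQ]

theorem leviForm_logWeight_wsq_of_ge {a : Fin n → ℝ} (ha : ∀ j, 0 ≤ a j) {p z : Fin n → ℂ}
    (hz : 3 / 4 < wsq a p z) (X : Fin n → ℂ) {δ : ℝ} (hδ : 0 < δ) :
    leviForm (fun w => logWeight δ (wsq a p w)) z X = 0 := by
  rw [leviForm_logWeight_wsq ha p z X hδ, (logWeightDeriv_of_ge hz).1, (logWeightDeriv_of_ge hz).2]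
  ring

theorem mem_polydisc_of_wsq_lt_one {β : Fin n → ℝ} (hβ : ∀ j, 0 < β j) {p z : Fin n → ℂ}
    (h : wsq (fun j => (β j ^ 2)⁻¹) p z < 1) : z ∈ polydisc n p β := by
  intro j
  have h1 : (β j ^ 2)⁻¹ * ‖z j - p j‖ ^ 2 ≤ wsq (fun j => (β j ^ 2)⁻¹) p z :=
    Finset.single_le_sum (f := fun j => (β j ^ 2)⁻¹ * ‖z j - p j‖ ^ 2)
      (fun i _ => mul_nonneg (inv_nonneg.2 (sq_nonneg _)) (sq_nonneg _)) (Finset.mem_univ j)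
  have h2 : ‖z j - p j‖ ^ 2 < β j ^ 2 := by
    have := h1.trans_lt h
    rwa [inv_mul_lt_iff₀ (by have := hβ j; positivity), mul_one] at this
  exact lt_of_pow_lt_pow_left₀ 2 (hβ j).le h2

theorem isCompact_wsq_le {β : Fin n → ℝ} (hβ : ∀ j, 0 < β j) (p : Fin n → ℂ) {r : ℝ}
    (hr : r < 1) : IsCompact {z | wsq (fun j => (β j ^ 2)⁻¹) p z ≤ r} := by
  refine (isCompact_univ_pi fun j => isCompact_closedBall (p j) (β j)).of_isClosed_subset
    (isClosed_le (contDiff_wsq (k := 0) _ p).continuous continuous_const) fun z hz j _ => ?_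
  rw [mem_closedBall_iff_norm]
  exact (mem_polydisc_of_wsq_lt_one hβ (lt_of_le_of_lt hz hr) j).le

theorem wsq_le_of_mem_polydisc {β : Fin n → ℝ} (hβ : ∀ j, 0 < β j) {p z : Fin n → ℂ} {t : ℝ}
    (hz : z ∈ polydisc n p (t • β)) : wsq (fun j => (β j ^ 2)⁻¹) p z ≤ n * t ^ 2 := by
  unfold wsq
  refine (Finset.sum_le_card_nsmul _ _ (t ^ 2) fun j _ => ?_).trans (by simp)
  have h1 := (hz j).le
  rw [Pi.smul_apply, smul_eq_mul] at h1
  have h2 := pow_le_pow_left₀ (norm_nonneg _) h1 2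
  have := hβ j
  rw [inv_mul_le_iff₀ (by positivity)]
  linarith [mul_pow t (β j) 2]

/-- The volume of an ellipsoid in terms of the Jacobian of the scaling. -/
theorem volume_wsq_le {β : Fin n → ℝ} (hβ : ∀ j, 0 < β j) (p : Fin n → ℂ) {r : ℝ} (hr : r < 1) :
    volume.real {z | wsq (fun j => (β j ^ 2)⁻¹) p z ≤ r} ≤
      scaleVol β * volume.real (Metric.closedBall (0 : Fin n → ℂ) 1) := by
  set S := {z | wsq (fun j => (β j ^ 2)⁻¹) p z ≤ r} with hS
  have hm : MeasurableSet S := (isCompact_wsq_le hβ p hr).measurableSet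
  have hV := scaleVol_pos hβ
  have h1 := integral_scale hβ p (S.indicator fun _ => (1 : ℝ))
  rw [integral_indicator hm, setIntegral_const, smul_eq_mul, smul_eq_mul, mul_one] at h1
  have h2 : volume.real S = scaleVol β * ∫ ζ, S.indicator (fun _ => (1 : ℝ)) (p + scaleMap β ζ) := by
    rw [h1]
    field_simp
  rw [h2]
  have h3 : volume.real (Metric.closedBall (0 : Fin n → ℂ) 1) =
      ∫ ζ, (Metric.closedBall (0 : Fin n → ℂ) 1).indicator (fun _ => (1 : ℝ)) ζ := by
    rw [integral_indicator Metric.isClosed_closedBall.measurableSet, setIntegral_const,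
      smul_eq_mul, mul_one]
  rw [h3]
  refine mul_le_mul_of_nonneg_left (integral_mono_of_nonneg
    (Eventually.of_forall fun ζ => indicator_nonneg (fun _ _ => zero_le_one) _) ?_
    (Eventually.of_forall fun ζ => ?_)) hV.le
  · exact (integrable_indicator_iff Metric.isClosed_closedBall.measurableSet).2
      (integrableOn_const (isCompact_closedBall _ _).measure_lt_top.ne)
  · by_cases h : p + scaleMap β ζ ∈ S
    · have h4 := mem_polydisc_of_wsq_lt_one hβ (lt_of_le_of_lt h hr)
      rw [scale_mem_polydisc_iff hβ] at h4
      simp only [indicator_of_mem h, indicator_of_mem (Metric.ball_subset_closedBall h4), le_refl]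
    · simp only [indicator_of_notMem h]
      exact indicator_nonneg (fun _ _ => zero_le_one) _

end WeightOnPolydisc

section PeakFunctions
variable {n : ℕ}

/-- The affine function `c₀ + ∑ c_j (z_j - p_j) / β_j`. -/
noncomputable def affineFun (β : Fin n → ℝ) (p : Fin n → ℂ) (c0 : ℂ) (c : Fin n → ℂ)
    (z : Fin n → ℂ) : ℂ :=
  c0 + ∑ j, c j * ((z j - p j) / β j)

theorem hasFDerivAt_affineFun (β : Fin n → ℝ) (p : Fin n → ℂ) (c0 : ℂ) (c z : Fin n → ℂ) :
    HasFDerivAt (affineFun β p c0 c) (∑ j, (c j / β j) •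
      ContinuousLinearMap.proj (R := ℂ) (φ := fun _ : Fin n => ℂ) j) z := by
  unfold affineFun
  refine HasFDerivAt.const_add _ (HasFDerivAt.fun_sum fun j _ => ?_)
  have h : HasFDerivAt (fun z : Fin n → ℂ => z j - p j)
      (ContinuousLinearMap.proj (R := ℂ) (φ := fun _ : Fin n => ℂ) j) z :=
    (ContinuousLinearMap.proj (R := ℂ) (φ := fun _ : Fin n => ℂ) j).hasFDerivAt.sub_const _
  refine (h.const_mul (c j / β j)).congr_of_eventuallyEq (Eventually.of_forall fun w => ?_)
  simp only
  ring

theorem fderiv_affineFun_apply (β : Fin n → ℝ) (p : Fin n → ℂ) (c0 : ℂ) (c z X : Fin n → ℂ) :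
    fderiv ℂ (affineFun β p c0 c) z X = ∑ j, c j * X j / β j := by
  rw [(hasFDerivAt_affineFun β p c0 c z).fderiv, sum_apply]
  refine Finset.sum_congr rfl fun j _ => ?_
  rw [smul_apply, ContinuousLinearMap.proj_apply, smul_eq_mul]
  ring

theorem differentiable_affineFun (β : Fin n → ℝ) (p : Fin n → ℂ) (c0 : ℂ) (c : Fin n → ℂ) :
    Differentiable ℂ (affineFun β p c0 c) :=
  fun z => (hasFDerivAt_affineFun β p c0 c z).differentiableAt

theorem contDiff_affineFun (β : Fin n → ℝ) (p : Fin n → ℂ) (c0 : ℂ) (c : Fin n → ℂ)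
    {k : WithTop ℕ∞} : ContDiff ℝ k (affineFun β p c0 c) := by
  unfold affineFun
  refine contDiff_const.add (ContDiff.sum fun j _ => contDiff_const.mul ?_)
  exact ((contDiff_apply ℝ ℂ j).sub contDiff_const).div_const _

theorem norm_affineFun_sq_le {β : Fin n → ℝ} {c0 : ℂ} {c : Fin n → ℂ}
    (hc0 : ‖c0‖ ≤ 1) (hc : ∑ j, ‖c j‖ ^ 2 ≤ 1) {p z : Fin n → ℂ}
    (hz : wsq (fun j => (β j ^ 2)⁻¹) p z ≤ 1) : ‖affineFun β p c0 c z‖ ^ 2 ≤ 4 := by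
  have h1 : ‖∑ j, c j * ((z j - p j) / β j)‖ ^ 2 ≤ 1 := by
    have h2 : ‖∑ j, c j * ((z j - p j) / β j)‖ ≤ ∑ j, ‖c j‖ * ‖(z j - p j) / β j‖ :=
      (norm_sum_le _ _).trans (le_of_eq (Finset.sum_congr rfl fun j _ => norm_mul _ _))
    refine (pow_le_pow_left₀ (norm_nonneg _) h2 2).trans
      ((Finset.sum_mul_sq_le_sq_mul_sq _ _ _).trans ?_)
    have h3 : ∑ j, ‖(z j - p j) / β j‖ ^ 2 = wsq (fun j => (β j ^ 2)⁻¹) p z := by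
      unfold wsq
      refine Finset.sum_congr rfl fun j _ => ?_
      rw [norm_div, norm_real, div_pow, Real.norm_eq_abs, sq_abs]
      ring
    rw [h3]
    have h4 : 0 ≤ ∑ j, ‖c j‖ ^ 2 := Finset.sum_nonneg fun _ _ => sq_nonneg _
    have h5 : 0 ≤ wsq (fun j => (β j ^ 2)⁻¹) p z :=
      wsq_nonneg (fun j => inv_nonneg.2 (sq_nonneg _)) p z
    nlinarith
  have h2 : ‖∑ j, c j * ((z j - p j) / β j)‖ ≤ 1 := by
    nlinarith [norm_nonneg (∑ j, c j * ((z j - p j) / β j))]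
  have h3 : ‖affineFun β p c0 c z‖ ≤ 2 := (norm_add_le _ _).trans (by linarith)
  nlinarith [norm_nonneg (affineFun β p c0 c z)]

theorem wderBar_conj_wder_ofReal {φ : (Fin n → ℂ) → ℝ} (z : Fin n → ℂ) (j : Fin n) :
    ‖wderBar n j (fun v => (φ v : ℂ)) z‖ = ‖wder n j (fun v => (φ v : ℂ)) z‖ := by
  have h := wder_conj j (fun v => (φ v : ℂ)) z
  simp only [conj_ofReal] at h
  rw [h, RCLike.norm_conj]

theorem norm_wderBar_cutoff_wsq (a : Fin n → ℝ) (p z : Fin n → ℂ) (k : Fin n) :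
    ‖wderBar n k (fun w => (lineCutoff (wsq a p w) : ℂ)) z‖ =
      |deriv lineCutoff (wsq a p z)| * (|a k| * ‖z k - p k‖) := by
  have hd : DifferentiableAt ℝ (wsq a p) z :=
    (contDiff_wsq a p (k := 1)).differentiable (by simp) z
  have hd2 : DifferentiableAt ℝ (fun w => lineCutoff (wsq a p w)) z :=
    ((hasDerivAt_lineCutoff _).differentiableAt).comp z hd
  rw [wderBar_conj_wder_ofReal, wder_ofReal hd2,
    fderiv_comp_real hd (hasDerivAt_lineCutoff (wsq a p z))]
  have h1 : wder n k (fun v => (wsq a p v : ℂ)) z = (a k : ℂ) * starRingEnd ℂ (z k - p k) := by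
    have := sum_wder_ofReal_mul hd (Pi.single k 1)
    rw [dPairing_wsq] at this
    simpa [Pi.single_apply] using this
  rw [wder_ofReal hd] at h1
  have h2 : (1 / 2 : ℂ) * (((deriv lineCutoff (wsq a p z) • fderiv ℝ (wsq a p) z)
      (Pi.single k 1) : ℝ) - I * ((deriv lineCutoff (wsq a p z) • fderiv ℝ (wsq a p) z)
      (Pi.single k I) : ℝ)) =
      ((deriv lineCutoff (wsq a p z) : ℝ) : ℂ) * ((a k : ℂ) * starRingEnd ℂ (z k - p k)) := by
    rw [← h1]
    simp only [smul_apply, smul_eq_mul, ofReal_mul]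
    ring
  rw [h2, norm_mul, norm_mul, norm_real, norm_real, RCLike.norm_conj, Real.norm_eq_abs,
    Real.norm_eq_abs]

/-- An affine function truncated to an ellipsoid. -/
noncomputable def truncAffine (β : Fin n → ℝ) (p : Fin n → ℂ) (c0 : ℂ) (c : Fin n → ℂ)
    (w : Fin n → ℂ) : ℂ :=
  (lineCutoff (wsq (fun j => (β j ^ 2)⁻¹) p w) : ℂ) * affineFun β p c0 c w

theorem contDiff_truncAffine (β : Fin n → ℝ) (p : Fin n → ℂ) (c0 : ℂ) (c : Fin n → ℂ) :
    ContDiff ℝ 2 (truncAffine β p c0 c) := by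
  have h1 : ContDiff ℝ 2 fun w => lineCutoff (wsq (fun j => (β j ^ 2)⁻¹) p w) :=
    (contDiff_lineCutoff (k := 2)).comp (contDiff_wsq _ p)
  exact (ofRealCLM.contDiff.comp h1).mul (contDiff_affineFun β p c0 c)

theorem truncAffine_of_le {β : Fin n → ℝ} {p : Fin n → ℂ} {c0 : ℂ} {c z : Fin n → ℂ}
    (hz : wsq (fun j => (β j ^ 2)⁻¹) p z ≤ 1 / 2) :
    truncAffine β p c0 c z = affineFun β p c0 c z := by
  rw [truncAffine, lineCutoff_of_le hz, ofReal_one, one_mul]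

theorem tsupport_truncAffine_subset (β : Fin n → ℝ) (p : Fin n → ℂ) (c0 : ℂ) (c : Fin n → ℂ) :
    tsupport (truncAffine β p c0 c) ⊆ {z | wsq (fun j => (β j ^ 2)⁻¹) p z ≤ 3 / 4} := by
  refine closure_minimal (fun z hz => ?_)
    (isClosed_le (contDiff_wsq (k := 0) _ p).continuous continuous_const)
  by_contra hc
  refine hz ?_
  rw [truncAffine, lineCutoff_of_ge (not_le.1 hc).le, ofReal_zero, zero_mul]

theorem norm_truncAffine_sq_le {β : Fin n → ℝ} {c0 : ℂ} {c : Fin n → ℂ}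
    (hc0 : ‖c0‖ ≤ 1) (hc : ∑ j, ‖c j‖ ^ 2 ≤ 1) (p z : Fin n → ℂ) :
    ‖truncAffine β p c0 c z‖ ^ 2 ≤
      {z | wsq (fun j => (β j ^ 2)⁻¹) p z ≤ 3 / 4}.indicator (fun _ => (4 : ℝ)) z := by
  by_cases hz : z ∈ {z | wsq (fun j => (β j ^ 2)⁻¹) p z ≤ 3 / 4}
  · rw [indicator_of_mem hz]
    have h1 := norm_affineFun_sq_le (β := β) hc0 hc (p := p) (z := z)
      (le_trans hz (by norm_num))
    rw [truncAffine, norm_mul, norm_real, mul_pow, Real.norm_eq_abs, sq_abs]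
    have h2 : lineCutoff (wsq (fun j => (β j ^ 2)⁻¹) p z) ^ 2 ≤ 1 :=
      pow_le_one₀ (lineCutoff_nonneg _) (lineCutoff_le_one _)
    nlinarith [sq_nonneg ‖affineFun β p c0 c z‖]
  · have : truncAffine β p c0 c z = 0 := by
      by_contra h0
      exact hz (tsupport_truncAffine_subset β p c0 c (subset_tsupport _ h0))
    rw [indicator_of_notMem hz, this]
    simp

/-- The antiholomorphic derivative of a truncated affine function. -/
theorem sum_norm_wderBar_cutoff_sq_le {B : ℝ} (hB : ∀ τ, |deriv lineCutoff τ| ≤ B)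
    {β : Fin n → ℝ} (hβ : ∀ j, 0 < β j) {c0 : ℂ} {c : Fin n → ℂ}
    (hc0 : ‖c0‖ ≤ 1) (hc : ∑ j, ‖c j‖ ^ 2 ≤ 1) (p z : Fin n → ℂ) :
    (∑ k, ((β k ^ 2)⁻¹)⁻¹ * ‖wderBar n k (truncAffine β p c0 c) z‖ ^ 2 ≤
        4 * B ^ 2) ∧
    (wsq (fun j => (β j ^ 2)⁻¹) p z < 1 / 2 ∨ 3 / 4 < wsq (fun j => (β j ^ 2)⁻¹) p z →
      ∑ k, ((β k ^ 2)⁻¹)⁻¹ * ‖wderBar n k (truncAffine β p c0 c) z‖ ^ 2 = 0) := by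
  unfold truncAffine
  set a : Fin n → ℝ := fun j => (β j ^ 2)⁻¹ with ha
  have ha0 : ∀ j, 0 < a j := fun j => inv_pos.2 (pow_pos (hβ j) 2)
  have hq := wsq_nonneg (fun j => (ha0 j).le) p z
  have hd : DifferentiableAt ℝ (fun w => (lineCutoff (wsq a p w) : ℂ)) z := by
    have h1 : ContDiff ℝ 1 fun w => lineCutoff (wsq a p w) :=
      (contDiff_lineCutoff (k := 1)).comp (contDiff_wsq a p)
    exact (ofRealCLM.contDiff.comp h1).differentiable (by simp) z
  have hk : ∀ k, ‖wderBar n k (fun w => (lineCutoff (wsq a p w) : ℂ) * affineFun β p c0 c w) z‖ =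
      |deriv lineCutoff (wsq a p z)| * (a k * ‖z k - p k‖) * ‖affineFun β p c0 c z‖ := by
    intro k
    rw [wderBar_mul hd (((contDiff_affineFun β p c0 c (k := 1)).differentiable (by simp)) z),
      wderBar_eq_zero_of_differentiableAt (differentiable_affineFun β p c0 c z), mul_zero,
      add_zero, norm_mul, norm_wderBar_cutoff_wsq, abs_of_pos (ha0 k)]
  have hs : ∑ k, (a k)⁻¹ * ‖wderBar n k (fun w =>
      (lineCutoff (wsq a p w) : ℂ) * affineFun β p c0 c w) z‖ ^ 2 =
      |deriv lineCutoff (wsq a p z)| ^ 2 * wsq a p z * ‖affineFun β p c0 c z‖ ^ 2 := by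
    generalize |deriv lineCutoff (wsq a p z)| = D at hk ⊢
    rw [wsq, Finset.mul_sum, Finset.sum_mul]
    refine Finset.sum_congr rfl fun k _ => ?_
    rw [hk]
    have := (ha0 k).ne'
    field_simp
  have hz : wsq a p z < 1 / 2 ∨ 3 / 4 < wsq a p z → deriv lineCutoff (wsq a p z) = 0 :=
    fun h => h.elim deriv_lineCutoff_of_le deriv_lineCutoff_of_ge
  rw [hs]
  refine ⟨?_, fun h => by rw [hz h]; simp⟩
  rcases lt_or_ge (3 / 4) (wsq a p z) with h | h
  · rw [hz (Or.inr h)]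
    simp
    positivity
  · have h1 := norm_affineFun_sq_le (β := β) hc0 hc (p := p) (z := z)
      (show wsq a p z ≤ 1 by linarith)
    have h2 : |deriv lineCutoff (wsq a p z)| ^ 2 ≤ B ^ 2 :=
      pow_le_pow_left₀ (abs_nonneg _) (hB _) 2
    calc |deriv lineCutoff (wsq a p z)| ^ 2 * wsq a p z * ‖affineFun β p c0 c z‖ ^ 2
        ≤ B ^ 2 * 1 * 4 := by gcongr; linarith
      _ = 4 * B ^ 2 := by ring

end PeakFunctions

section PeakExistence
variable {n : ℕ}

/-- A bounded plurisubharmonic function on an exhausted domain `Ω` whose complex Hessian is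
comparable from below with the polydisc `P(p, β) ⊆ Ω`. -/
structure IsCatlinWeight (M Ct : ℝ) (Ω : Set (Fin n → ℂ)) (p : Fin n → ℂ) (β : Fin n → ℝ)
    (φ : (Fin n → ℂ) → ℝ) : Prop where
  isOpen : IsOpen Ω
  exhaustion : ∃ s C, IsExhaustion Ω s C
  pos : ∀ j, 0 < β j
  contDiffAt : ∀ z ∈ Ω, ContDiffAt ℝ 2 φ z
  abs_le : ∀ z ∈ Ω, |φ z| ≤ M
  leviForm_nonneg : ∀ z ∈ Ω, ∀ X, 0 ≤ leviForm φ z X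
  subset : polydisc n p β ⊆ Ω
  le_leviForm : ∀ z ∈ polydisc n p β, ∀ X : Fin n → ℂ,
    Ct * ∑ j, ‖X j‖ ^ 2 / β j ^ 2 ≤ leviForm φ z X

/-- The plurisubharmonic weight with an approximate logarithmic pole at `p`. -/
noncomputable def poleWeight (A m δ : ℝ) (φ : (Fin n → ℂ) → ℝ) (β : Fin n → ℝ) (p z : Fin n → ℂ) :
    ℝ := A * φ z + m * logWeight δ (wsq (fun j => (β j ^ 2)⁻¹) p z)

theorem leviForm_const_mul {φ : (Fin n → ℂ) → ℝ} {z : Fin n → ℂ} (h : ContDiffAt ℝ 2 φ z)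
    (A : ℝ) (X : Fin n → ℂ) : leviForm (fun x => A * φ x) z X = A * leviForm φ z X := by
  have h1 : ∀ t : ℝ, HasDerivAt (fun t => A * t) A t := fun t => by
    simpa using (hasDerivAt_id t).const_mul A
  rw [leviForm_comp (θ := fun t => A * t) (θ' := fun _ => A) (θ'' := 0) h
    (Eventually.of_forall h1) (hasDerivAt_const _ _)]
  ring

variable {M Ct : ℝ} {Ω : Set (Fin n → ℂ)} {p : Fin n → ℂ} {β : Fin n → ℝ}
  {φ : (Fin n → ℂ) → ℝ}

theorem IsCatlinWeight.contDiffAt_poleWeight (h : IsCatlinWeight M Ct Ω p β φ) (A m : ℝ) {δ : ℝ}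
    (hδ : 0 < δ) {z : Fin n → ℂ} (hz : z ∈ Ω) : ContDiffAt ℝ 2 (poleWeight A m δ φ β p) z :=
  (contDiffAt_const.mul (h.contDiffAt z hz)).add (contDiffAt_const.mul
    (contDiffAt_logWeight_wsq (fun j => inv_nonneg.2 (sq_nonneg (β j))) p z hδ))

theorem IsCatlinWeight.leviForm_poleWeight (h : IsCatlinWeight M Ct Ω p β φ) (A m : ℝ) {δ : ℝ}
    (hδ : 0 < δ) {z : Fin n → ℂ} (hz : z ∈ Ω) (X : Fin n → ℂ) :
    leviForm (poleWeight A m δ φ β p) z X = A * leviForm φ z X +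
      m * leviForm (fun w => logWeight δ (wsq (fun j => (β j ^ 2)⁻¹) p w)) z X := by
  have h1 := contDiffAt_logWeight_wsq (fun j => inv_nonneg.2 (sq_nonneg (β j))) p z hδ
  unfold poleWeight
  rw [leviForm_add (contDiffAt_const.mul (h.contDiffAt z hz)) (contDiffAt_const.mul h1),
    leviForm_const_mul (h.contDiffAt z hz), leviForm_const_mul h1]

theorem IsCatlinWeight.le_leviForm_poleWeight (h : IsCatlinWeight M Ct Ω p β φ) (hCt : 0 < Ct)
    {B m δ : ℝ} (hm : 0 ≤ m) (hB1 : 1 ≤ B) (hB : ∀ τ, |deriv lineCutoff τ| ≤ B ∧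
    |deriv (deriv lineCutoff) τ| ≤ B) (hδ : 0 < δ) (hδ' : δ ≤ 1 / 4) {z : Fin n → ℂ}
    (hz : wsq (fun j => (β j ^ 2)⁻¹) p z < 1) (X : Fin n → ℂ) :
    ∑ j, (β j ^ 2)⁻¹ * ‖X j‖ ^ 2 ≤
      leviForm (poleWeight ((10 * m * B + 1) / Ct) m δ φ β p) z X := by
  have hzP := mem_polydisc_of_wsq_lt_one h.pos hz
  rw [h.leviForm_poleWeight _ m hδ (h.subset hzP) X]
  have h1 := h.le_leviForm z hzP X
  have h2 := leviForm_logWeight_wsq_lower hB1 hB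
    (fun j => inv_nonneg.2 (sq_nonneg (β j))) p z X hδ hδ'
  have e : ∑ j, ‖X j‖ ^ 2 / β j ^ 2 = ∑ j, (β j ^ 2)⁻¹ * ‖X j‖ ^ 2 :=
    Finset.sum_congr rfl fun j _ => by rw [div_eq_inv_mul]
  rw [e] at h1
  set Q := ∑ j, (β j ^ 2)⁻¹ * ‖X j‖ ^ 2
  have h3 : (10 * m * B + 1) / Ct * (Ct * Q) ≤ (10 * m * B + 1) / Ct * leviForm φ z X :=
    mul_le_mul_of_nonneg_left h1 (by positivity)
  have h4 : (10 * m * B + 1) / Ct * (Ct * Q) = (10 * m * B + 1) * Q := by field_simp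
  nlinarith [mul_le_mul_of_nonneg_left h2 hm]

theorem IsCatlinWeight.leviForm_poleWeight_nonneg (h : IsCatlinWeight M Ct Ω p β φ) (hCt : 0 < Ct)
    {B m δ : ℝ} (hm : 0 ≤ m) (hB1 : 1 ≤ B) (hB : ∀ τ, |deriv lineCutoff τ| ≤ B ∧
    |deriv (deriv lineCutoff) τ| ≤ B) (hδ : 0 < δ) (hδ' : δ ≤ 1 / 4) {z : Fin n → ℂ}
    (hz : z ∈ Ω) (X : Fin n → ℂ) :
    0 ≤ leviForm (poleWeight ((10 * m * B + 1) / Ct) m δ φ β p) z X := by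
  rcases lt_or_ge (wsq (fun j => (β j ^ 2)⁻¹) p z) 1 with h1 | h1
  · exact (Finset.sum_nonneg fun j _ => by positivity).trans
      (h.le_leviForm_poleWeight hCt hm hB1 hB hδ hδ' h1 X)
  · rw [h.leviForm_poleWeight _ m hδ hz X, leviForm_logWeight_wsq_of_ge
      (fun j => inv_nonneg.2 (sq_nonneg (β j))) (by linarith) X hδ, mul_zero, add_zero]
    exact mul_nonneg (by positivity) (h.leviForm_nonneg z hz X)

theorem IsCatlinWeight.poleWeight_le (h : IsCatlinWeight M Ct Ω p β φ) {A m δ : ℝ} (hA : 0 ≤ A)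
    (hm : 0 ≤ m) (hδ : 0 < δ) (hδ' : δ ≤ 1 / 4) {z : Fin n → ℂ} (hz : z ∈ Ω) :
    poleWeight A m δ φ β p z ≤ A * M := by
  have h1 := logWeight_nonpos hδ hδ' (wsq_nonneg (fun j => inv_nonneg.2 (sq_nonneg (β j))) p z)
  have h2 := (_root_.abs_le.1 (h.abs_le z hz)).2
  unfold poleWeight
  nlinarith [mul_le_mul_of_nonneg_left h2 hA, mul_nonpos_of_nonneg_of_nonpos hm h1]

theorem IsCatlinWeight.le_poleWeight (h : IsCatlinWeight M Ct Ω p β φ) {A m δ : ℝ} (hA : 0 ≤ A)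
    (hm : 0 ≤ m) (hδ : 0 < δ) (hδ' : δ ≤ 1 / 4) {z : Fin n → ℂ} (hz : z ∈ Ω)
    (hz2 : 1 / 2 ≤ wsq (fun j => (β j ^ 2)⁻¹) p z) :
    -(A * M + m) ≤ poleWeight A m δ φ β p z := by
  have h1 := neg_one_le_logWeight hδ hδ' hz2
  have h2 := (_root_.abs_le.1 (h.abs_le z hz)).1
  unfold poleWeight
  nlinarith [mul_le_mul_of_nonneg_left h2 hA, mul_le_mul_of_nonneg_left h1 hm]

theorem integral_norm_truncAffine_sq {β : Fin n → ℝ} (hβ : ∀ j, 0 < β j) {c0 : ℂ} {c : Fin n → ℂ}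
    (hc0 : ‖c0‖ ≤ 1) (hc : ∑ j, ‖c j‖ ^ 2 ≤ 1) (p : Fin n → ℂ) :
    Integrable (fun z => ‖truncAffine β p c0 c z‖ ^ 2) ∧ ∫ z, ‖truncAffine β p c0 c z‖ ^ 2 ≤
      4 * (scaleVol β * volume.real (Metric.closedBall (0 : Fin n → ℂ) 1)) := by
  have hSc := isCompact_wsq_le hβ p (r := 3 / 4) (by norm_num)
  have hgc : HasCompactSupport (truncAffine β p c0 c) :=
    hSc.of_isClosed_subset (isClosed_tsupport _) (tsupport_truncAffine_subset β p c0 c)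
  have hgi : Integrable fun z => ‖truncAffine β p c0 c z‖ ^ 2 :=
    ((contDiff_truncAffine β p c0 c).continuous.norm.pow 2).integrable_of_hasCompactSupport
      (hgc.mono fun z hz h0 => hz (by simp [h0]))
  refine ⟨hgi, (integral_mono hgi ((integrable_indicator_iff hSc.measurableSet).2
    (integrableOn_const hSc.measure_lt_top.ne)) (norm_truncAffine_sq_le hc0 hc p)).trans ?_⟩
  rw [integral_indicator hSc.measurableSet, setIntegral_const, smul_eq_mul, mul_comm]
  have := volume_wsq_le hβ p (r := 3 / 4) (by norm_num)
  gcongr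

theorem IsCatlinWeight.integral_wderBar_truncAffine_le (h : IsCatlinWeight M Ct Ω p β φ)
    {A B m δ : ℝ} (hA : 0 ≤ A) (hm : 0 ≤ m) (hB : ∀ τ, |deriv lineCutoff τ| ≤ B)
    (hδ : 0 < δ) (hδ' : δ ≤ 1 / 4) {c0 : ℂ} {c : Fin n → ℂ}
    (hc0 : ‖c0‖ ≤ 1) (hc : ∑ j, ‖c j‖ ^ 2 ≤ 1) :
    ∫ z, ∑ k, ((β k ^ 2)⁻¹)⁻¹ * ‖wderBar n k (truncAffine β p c0 c) z‖ ^ 2 *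
        Real.exp (-poleWeight A m δ φ β p z) ≤ 4 * B ^ 2 * Real.exp (A * M + m) *
          (scaleVol β * volume.real (Metric.closedBall (0 : Fin n → ℂ) 1)) := by
  have hSc := isCompact_wsq_le h.pos p (r := 3 / 4) (by norm_num)
  have h1 : ∀ z, ∑ k, ((β k ^ 2)⁻¹)⁻¹ * ‖wderBar n k (truncAffine β p c0 c) z‖ ^ 2 *
      Real.exp (-poleWeight A m δ φ β p z) ≤
      {z | wsq (fun j => (β j ^ 2)⁻¹) p z ≤ 3 / 4}.indicator
        (fun _ => 4 * B ^ 2 * Real.exp (A * M + m)) z := by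
    intro z
    rw [← Finset.sum_mul]
    obtain ⟨e1, e2⟩ := sum_norm_wderBar_cutoff_sq_le hB h.pos hc0 hc p z
    by_cases hz : wsq (fun j => (β j ^ 2)⁻¹) p z < 1 / 2 ∨ 3 / 4 < wsq (fun j => (β j ^ 2)⁻¹) p z
    · rw [e2 hz, zero_mul]
      exact indicator_nonneg (fun _ _ => by positivity) z
    · push Not at hz
      have hzS : z ∈ {z | wsq (fun j => (β j ^ 2)⁻¹) p z ≤ 3 / 4} := hz.2
      rw [indicator_of_mem hzS]
      have e4 := h.le_poleWeight hA hm hδ hδ' (h.subset (mem_polydisc_of_wsq_lt_one h.pos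
        (lt_of_le_of_lt hz.2 (by norm_num)))) hz.1
      exact mul_le_mul e1 (Real.exp_le_exp.2 (by linarith)) (Real.exp_pos _).le (by positivity)
  refine (integral_mono_of_nonneg (Eventually.of_forall fun z => Finset.sum_nonneg fun k _ =>
    mul_nonneg (mul_nonneg (inv_nonneg.2 (inv_nonneg.2 (sq_nonneg _))) (sq_nonneg _))
    (Real.exp_pos _).le) ((integrable_indicator_iff hSc.measurableSet).2
    (integrableOn_const hSc.measure_lt_top.ne)) (Eventually.of_forall h1)).trans ?_
  rw [integral_indicator hSc.measurableSet, setIntegral_const, smul_eq_mul, mul_comm]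
  have := volume_wsq_le h.pos p (r := 3 / 4) (by norm_num)
  gcongr

/-- Solution of the `∂̄`-problem with the weight `poleWeight` for a truncated affine function. -/
theorem IsCatlinWeight.exists_holomorphic_sub (h : IsCatlinWeight M Ct Ω p β φ) (hCt : 0 < Ct)
    {B m δ : ℝ} (hm : 0 ≤ m) (hB1 : 1 ≤ B) (hB : ∀ τ, |deriv lineCutoff τ| ≤ B ∧
    |deriv (deriv lineCutoff) τ| ≤ B) (hδ : 0 < δ) (hδ' : δ ≤ 1 / 4) {c0 : ℂ} {c : Fin n → ℂ}
    (hc0 : ‖c0‖ ≤ 1) (hc : ∑ j, ‖c j‖ ^ 2 ≤ 1) :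
    ∃ f : (Fin n → ℂ) → ℂ, DifferentiableOn ℂ f Ω ∧
      IntegrableOn (fun z => ‖f z - truncAffine β p c0 c z‖ ^ 2) Ω ∧
      IntegrableOn (fun z => ‖f z - truncAffine β p c0 c z‖ ^ 2 *
        Real.exp (-poleWeight ((10 * m * B + 1) / Ct) m δ φ β p z)) Ω ∧
      ∫ z in Ω, ‖f z - truncAffine β p c0 c z‖ ^ 2 *
        Real.exp (-poleWeight ((10 * m * B + 1) / Ct) m δ φ β p z) ≤
        4 * B ^ 2 * Real.exp ((10 * m * B + 1) / Ct * M + m) *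
          (scaleVol β * volume.real (Metric.closedBall (0 : Fin n → ℂ) 1)) := by
  have hA0 : 0 ≤ (10 * m * B + 1) / Ct := by positivity
  have hSc := isCompact_wsq_le h.pos p (r := 3 / 4) (by norm_num)
  have hSΩ : {z | wsq (fun j => (β j ^ 2)⁻¹) p z ≤ 3 / 4} ⊆ Ω := fun z hz => h.subset
    (mem_polydisc_of_wsq_lt_one h.pos (lt_of_le_of_lt hz (by norm_num)))
  obtain ⟨s, C, hs⟩ := h.exhaustion
  obtain ⟨f, hf, hi1, hi2, hi3⟩ := exists_weaklyHolomorphic_sub h.isOpen hs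
    (fun z hz => h.contDiffAt_poleWeight _ m hδ hz)
    (fun z hz X => h.leviForm_poleWeight_nonneg hCt hm hB1 hB hδ hδ' hz X)
    (fun z hz => h.poleWeight_le hA0 hm hδ hδ' hz) hSc hSΩ
    (fun j => inv_pos.2 (pow_pos (h.pos j) 2))
    (fun z hz X => h.le_leviForm_poleWeight hCt hm hB1 hB hδ hδ'
      (lt_of_le_of_lt hz (by norm_num)) X)
    (contDiff_truncAffine β p c0 c) (tsupport_truncAffine_subset β p c0 c)
  exact ⟨f, hf, hi1, hi2, hi3.trans
    (h.integral_wderBar_truncAffine_le hA0 hm (fun τ => (hB τ).1) hδ hδ' hc0 hc)⟩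

end PeakExistence

section PeakEstimates
variable {n : ℕ} {M Ct : ℝ} {Ω : Set (Fin n → ℂ)} {p : Fin n → ℂ} {β : Fin n → ℝ}
  {φ : (Fin n → ℂ) → ℝ}

theorem IsCatlinWeight.one_le_exp_neg_poleWeight (h : IsCatlinWeight M Ct Ω p β φ) {A t : ℝ}
    {m : ℕ} (hA : 0 ≤ A) (ht : 0 < t) (ht2 : n * t ^ 2 ≤ 1 / 2) {z : Fin n → ℂ} (hzΩ : z ∈ Ω)
    (hz : wsq (fun j => (β j ^ 2)⁻¹) p z ≤ n * t ^ 2) :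
    1 ≤ Real.exp (A * M) * ((n + 1) * t ^ 2) ^ m *
      Real.exp (-poleWeight A m (t ^ 2) φ β p z) := by
  have hx : 0 < (n + 1) * t ^ 2 := by positivity
  have hq := wsq_nonneg (fun j => inv_nonneg.2 (sq_nonneg (β j))) p z
  have h1 : logWeight (t ^ 2) (wsq (fun j => (β j ^ 2)⁻¹) p z) ≤ Real.log ((n + 1) * t ^ 2) := by
    rw [logWeight, lineCutoff_of_le (hz.trans ht2), one_mul]
    exact Real.log_le_log (by positivity) (by linarith)
  have h2 : ((n + 1) * t ^ 2) ^ m = Real.exp (m * Real.log ((n + 1) * t ^ 2)) := by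
    rw [mul_comm (m : ℝ), Real.exp_mul, Real.exp_log hx, Real.rpow_natCast]
  rw [h2, ← Real.exp_add, ← Real.exp_add, Real.one_le_exp_iff]
  have h3 := (_root_.abs_le.1 (h.abs_le z hzΩ)).2
  unfold poleWeight
  nlinarith [mul_le_mul_of_nonneg_left h3 hA,
    mul_le_mul_of_nonneg_left h1 (Nat.cast_nonneg (α := ℝ) m)]

theorem polydisc_smul_subset (hβ : ∀ j, 0 < β j) {t : ℝ} (ht : t ≤ 1) :
    polydisc n p (t • β) ⊆ polydisc n p β := fun z hz j =>
  (hz j).trans_le (by rw [Pi.smul_apply, smul_eq_mul]; exact mul_le_of_le_one_left (hβ j).le ht)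

theorem sum_div_smul_sq {t : ℝ} (X : Fin n → ℂ) :
    ∑ j, ‖X j‖ ^ 2 / (t • β) j ^ 2 = (t ^ 2)⁻¹ * ∑ j, ‖X j‖ ^ 2 / β j ^ 2 := by
  rw [Finset.mul_sum]
  refine Finset.sum_congr rfl fun j _ => ?_
  rw [Pi.smul_apply, smul_eq_mul, mul_pow, div_eq_mul_inv, div_eq_mul_inv, mul_inv]
  ring

theorem setIntegral_le_mul_of_one_le {S T : Set (Fin n → ℂ)} (hS : MeasurableSet S)
    (hST : S ⊆ T) {w e : (Fin n → ℂ) → ℝ} (hw : IntegrableOn w S)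
    (hwe : IntegrableOn (fun z => w z * e z) T) (hw0 : ∀ z, 0 ≤ w z) (he0 : ∀ z, 0 ≤ e z)
    {E R : ℝ} (hE : 0 ≤ E) (h1 : ∀ z ∈ S, 1 ≤ E * e z) (hR : ∫ z in T, w z * e z ≤ R) :
    ∫ z in S, w z ≤ E * R := by
  calc ∫ z in S, w z ≤ ∫ z in S, E * (w z * e z) := by
        refine setIntegral_mono_on hw ((hwe.mono_set hST).const_mul E) hS fun z hz => ?_
        nlinarith [hw0 z, h1 z hz]
    _ = E * ∫ z in S, w z * e z := integral_const_mul _ _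
    _ ≤ E * R := mul_le_mul_of_nonneg_left ((setIntegral_mono_set hwe
        (Eventually.of_forall fun z => mul_nonneg (hw0 z) (he0 z)) hST.eventuallyLE).trans hR) hE

theorem inBergman_of_sub {f g : (Fin n → ℂ) → ℂ} (hΩ : IsOpen Ω) (hf : DifferentiableOn ℂ f Ω)
    (hfg : IntegrableOn (fun z => ‖f z - g z‖ ^ 2) Ω) (hg : Integrable fun z => ‖g z‖ ^ 2) :
    InBergman n Ω f ∧
      l2sq n Ω f ≤ 2 * (∫ z in Ω, ‖f z - g z‖ ^ 2) + 2 * ∫ z, ‖g z‖ ^ 2 := by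
  have hdom : IntegrableOn (fun z => 2 * ‖f z - g z‖ ^ 2 + 2 * ‖g z‖ ^ 2) Ω :=
    (hfg.const_mul 2).add (hg.integrableOn.const_mul 2)
  have hle : ∀ z, ‖f z‖ ^ 2 ≤ 2 * ‖f z - g z‖ ^ 2 + 2 * ‖g z‖ ^ 2 := by
    intro z
    have h2 : ‖f z‖ ≤ ‖f z - g z‖ + ‖g z‖ := by simpa using norm_add_le (f z - g z) (g z)
    nlinarith [norm_nonneg (f z), sq_nonneg (‖f z - g z‖ - ‖g z‖)]
  have hf2 : IntegrableOn (fun z => ‖f z‖ ^ 2) Ω := by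
    refine hdom.mono' ((hf.continuousOn.norm.pow 2).aestronglyMeasurable hΩ.measurableSet)
      (Eventually.of_forall fun z => ?_)
    rw [Real.norm_of_nonneg (sq_nonneg _)]
    exact hle z
  refine ⟨⟨hf, hf2⟩, ?_⟩
  calc l2sq n Ω f ≤ ∫ z in Ω, (2 * ‖f z - g z‖ ^ 2 + 2 * ‖g z‖ ^ 2) :=
        integral_mono hf2 hdom hle
    _ = 2 * (∫ z in Ω, ‖f z - g z‖ ^ 2) + 2 * ∫ z in Ω, ‖g z‖ ^ 2 := by
        rw [integral_add (hfg.const_mul 2) (hg.integrableOn.const_mul 2),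
          integral_const_mul, integral_const_mul]
    _ ≤ _ := by
        have := setIntegral_le_integral (s := Ω) hg (Eventually.of_forall fun _ => sq_nonneg _)
        linarith

theorem exists_small_scale {K : ℝ} (hK : 0 ≤ K) {η : ℝ} (hη : 0 < η) (n : ℕ) :
    ∃ t : ℝ, 0 < t ∧ t ≤ 1 / 2 ∧ n * t ^ 2 ≤ 1 / 2 ∧ K * t ^ 2 ≤ η := by
  have hn : (0 : ℝ) ≤ n := Nat.cast_nonneg n
  have h0 : 0 < min (1 / (2 * (n + 1) : ℝ)) (η / (K + 1)) := lt_min (by positivity) (by positivity)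
  have h1 : min (1 / (2 * (n + 1) : ℝ)) (η / (K + 1)) * (2 * (n + 1)) ≤ 1 := by
    rw [← le_div_iff₀ (by positivity)]
    exact min_le_left _ _
  have h2 : min (1 / (2 * (n + 1) : ℝ)) (η / (K + 1)) * (K + 1) ≤ η := by
    rw [← le_div_iff₀ (by positivity)]
    exact min_le_right _ _
  generalize min (1 / (2 * (n + 1) : ℝ)) (η / (K + 1)) = t at h0 h1 h2
  have h3 : t ≤ 1 / 2 := by nlinarith
  have h4 : t ^ 2 ≤ t := by nlinarith
  exact ⟨t, h0, h3, by nlinarith, by nlinarith⟩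

theorem jet_constant_eq {t V : ℝ} (ht : t ≠ 0) (hV : V ≠ 0) (C0 E D κ N : ℝ) :
    C0 * (t ^ (2 * n) * V)⁻¹ * (E * (N * t ^ 2) ^ (n + 2) * (D * (V * κ))) =
      C0 * E * D * κ * N ^ (n + 2) * t ^ 4 := by
  have h1 : (N * t ^ 2) ^ (n + 2) = N ^ (n + 2) * (t ^ (2 * n) * t ^ 4) := by
    rw [mul_pow, ← pow_mul, ← pow_add]
    congr 2
  have h2 : t ^ (2 * n) ≠ 0 := pow_ne_zero _ ht
  rw [h1]
  generalize t ^ (2 * n) = a at h2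
  generalize N ^ (n + 2) = b
  field_simp

/-- The first jet at `p` of a holomorphic function on a small polydisc close to an affine one. -/
theorem jet_sub_affineFun_le {C0 : ℝ} (hC0 : 0 < C0)
    (hest : ∀ (p : Fin n → ℂ) (β : Fin n → ℝ), (∀ j, 0 < β j) →
      ∀ u : (Fin n → ℂ) → ℂ, DifferentiableOn ℂ u (polydisc n p β) →
      IntegrableOn (fun z => ‖u z‖ ^ 2) (polydisc n p β) →
      ‖u p‖ ^ 2 ≤ C0 * (scaleVol β)⁻¹ * (∫ z in polydisc n p β, ‖u z‖ ^ 2) ∧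
      ∀ X : Fin n → ℂ, ‖fderiv ℂ u p X‖ ^ 2 ≤
        C0 * (scaleVol β)⁻¹ * (∑ j, ‖X j‖ ^ 2 / β j ^ 2) * ∫ z in polydisc n p β, ‖u z‖ ^ 2)
    (hβ : ∀ j, 0 < β j) {t : ℝ} (ht : 0 < t) (ht1 : t ≤ 1 / 2) {f : (Fin n → ℂ) → ℂ}
    (hf : DifferentiableOn ℂ f (polydisc n p (t • β))) {c0 : ℂ} {c : Fin n → ℂ}
    (hfi : IntegrableOn (fun z => ‖f z - affineFun β p c0 c z‖ ^ 2) (polydisc n p (t • β)))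
    {R K : ℝ} (hR : ∫ z in polydisc n p (t • β), ‖f z - affineFun β p c0 c z‖ ^ 2 ≤ R)
    (hK0 : 0 ≤ K) (hK : C0 * (t ^ (2 * n) * scaleVol β)⁻¹ * R = K * t ^ 4) :
    ‖f p - c0‖ ^ 2 ≤ K * t ^ 2 ∧ ∀ X : Fin n → ℂ,
      ‖fderiv ℂ f p X - ∑ j, c j * X j / β j‖ ^ 2 ≤ K * t ^ 2 * ∑ j, ‖X j‖ ^ 2 / β j ^ 2 := by
  have htβ : ∀ j, 0 < (t • β) j := fun j => mul_pos ht (hβ j)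
  have hV := scaleVol_pos hβ
  obtain ⟨h1, h2⟩ := hest p (t • β) htβ _
    (hf.sub (differentiable_affineFun β p c0 c).differentiableOn) hfi
  have hle : C0 * (t ^ (2 * n) * scaleVol β)⁻¹ *
      ∫ z in polydisc n p (t • β), ‖f z - affineFun β p c0 c z‖ ^ 2 ≤ K * t ^ 4 := by
    rw [← hK]
    exact mul_le_mul_of_nonneg_left hR (by positivity)
  constructor
  · have hp0 : affineFun β p c0 c p = c0 := by simp [affineFun]
    rw [scaleVol_smul ht] at h1
    simp only [Pi.sub_apply, hp0] at h1
    have h3 : K * t ^ 4 ≤ K * t ^ 2 :=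
      mul_le_mul_of_nonneg_left (pow_le_pow_of_le_one ht.le (by linarith) (by norm_num)) hK0
    exact (h1.trans hle).trans h3
  · intro X
    have h3 := h2 X
    have hfp : DifferentiableAt ℂ f p :=
      hf.differentiableAt ((isOpen_polydisc p (t • β)).mem_nhds (mem_polydisc_self htβ p))
    rw [fderiv_sub hfp (differentiable_affineFun β p c0 c p), sub_apply,
      fderiv_affineFun_apply, scaleVol_smul ht, sum_div_smul_sq] at h3
    refine h3.trans ?_
    have hQ : 0 ≤ ∑ j, ‖X j‖ ^ 2 / β j ^ 2 := Finset.sum_nonneg fun j _ => by positivity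
    generalize ∑ j, ‖X j‖ ^ 2 / β j ^ 2 = Q at hQ ⊢
    simp only [Pi.sub_apply]
    calc _ = (C0 * (t ^ (2 * n) * scaleVol β)⁻¹ *
          ∫ z in polydisc n p (t • β), ‖f z - affineFun β p c0 c z‖ ^ 2) * ((t ^ 2)⁻¹ * Q) := by ring
      _ ≤ (K * t ^ 4) * ((t ^ 2)⁻¹ * Q) := mul_le_mul_of_nonneg_right hle (by positivity)
      _ = K * t ^ 2 * Q := by field_simp

/-- Holomorphic functions with approximately prescribed first jet at `p` and controlled norm. -/
theorem exists_peak_function (n : ℕ) (M : ℝ) {Ct η : ℝ} (hCt : 0 < Ct) (hη : 0 < η) :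
    ∃ C : ℝ, 0 < C ∧ ∀ (Ω : Set (Fin n → ℂ)) (p : Fin n → ℂ) (β : Fin n → ℝ)
      (φ : (Fin n → ℂ) → ℝ), IsCatlinWeight M Ct Ω p β φ →
      ∀ (c0 : ℂ) (c : Fin n → ℂ), ‖c0‖ ≤ 1 → ∑ j, ‖c j‖ ^ 2 ≤ 1 →
      ∃ f, InBergman n Ω f ∧ l2sq n Ω f ≤ C * scaleVol β ∧ ‖f p - c0‖ ^ 2 ≤ η ∧
        ∀ X : Fin n → ℂ, ‖fderiv ℂ f p X - ∑ j, c j * X j / β j‖ ^ 2 ≤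
          η * ∑ j, ‖X j‖ ^ 2 / β j ^ 2 := by
  obtain ⟨B, hB1, hB⟩ := exists_bound_deriv_lineCutoff
  obtain ⟨C0, hC0, hest⟩ := exists_polydisc_estimate n
  obtain ⟨A, hA⟩ : ∃ A, A = (10 * ((n + 2 : ℕ) : ℝ) * B + 1) / Ct := ⟨_, rfl⟩
  have hA0 : 0 ≤ A := by rw [hA]; positivity
  obtain ⟨κ, hκ⟩ : ∃ κ, κ = volume.real (Metric.closedBall (0 : Fin n → ℂ) 1) := ⟨_, rfl⟩
  have hκ0 : 0 ≤ κ := by rw [hκ]; exact measureReal_nonneg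
  obtain ⟨D, hD⟩ : ∃ D, D = 4 * B ^ 2 * Real.exp (A * M + (n + 2 : ℕ)) := ⟨_, rfl⟩
  have hD0 : 0 ≤ D := by rw [hD]; positivity
  obtain ⟨E, hE⟩ : ∃ E, E = Real.exp (A * M) := ⟨_, rfl⟩
  have hE0 : 0 < E := by rw [hE]; exact Real.exp_pos _
  have hK0 : 0 ≤ C0 * E * D * κ * ((n : ℝ) + 1) ^ (n + 2) := by positivity
  obtain ⟨t, ht0, ht1, htn, htK⟩ := exists_small_scale hK0 hη n
  have hδ : 0 < t ^ 2 := by positivity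
  have hδ' : t ^ 2 ≤ 1 / 4 := by nlinarith
  refine ⟨2 * (E * D * κ) + 8 * κ + 1, by positivity, fun Ω p β φ h c0 c hc0 hc => ?_⟩
  obtain ⟨f, hf, hi1, hi2, hi3⟩ := h.exists_holomorphic_sub hCt (Nat.cast_nonneg (n + 2)) hB1 hB
    hδ hδ' hc0 hc
  rw [← hA] at hi2 hi3
  rw [← hκ, ← hD] at hi3
  have hV := scaleVol_pos h.pos
  obtain ⟨hgi, hg2⟩ := integral_norm_truncAffine_sq h.pos hc0 hc p
  rw [← hκ] at hg2
  have hΩm := h.isOpen.measurableSet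
  have hfg := setIntegral_le_mul_of_one_le hΩm subset_rfl hi1 hi2 (fun _ => sq_nonneg _)
    (fun _ => (Real.exp_pos _).le) hE0.le (fun z hz => by
      rw [hE, ← Real.exp_add, Real.one_le_exp_iff]
      linarith [h.poleWeight_le hA0 (Nat.cast_nonneg (n + 2)) hδ hδ' hz]) hi3
  obtain ⟨hfB, hfl⟩ := inBergman_of_sub h.isOpen hf hi1 hgi
  refine ⟨f, hfB, ?_, ?_⟩
  · nlinarith
  have hPP : polydisc n p (t • β) ⊆ Ω :=
    (polydisc_smul_subset h.pos (by linarith)).trans h.subset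
  have hPm := (isOpen_polydisc p (t • β)).measurableSet
  have hgP : EqOn (fun z => ‖f z - truncAffine β p c0 c z‖ ^ 2)
      (fun z => ‖f z - affineFun β p c0 c z‖ ^ 2) (polydisc n p (t • β)) := fun z hz => by
    simp only [truncAffine_of_le ((wsq_le_of_mem_polydisc h.pos hz).trans htn)]
  have hInt := setIntegral_le_mul_of_one_le hPm hPP (hi1.mono_set hPP) hi2
    (fun _ => sq_nonneg _) (fun _ => (Real.exp_pos _).le)
    (E := E * ((n + 1) * t ^ 2) ^ (n + 2)) (by positivity) (fun z hz => by
      rw [hE]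
      exact h.one_le_exp_neg_poleWeight hA0 ht0 htn (hPP hz)
        (wsq_le_of_mem_polydisc h.pos hz)) hi3
  rw [setIntegral_congr_fun hPm hgP] at hInt
  obtain ⟨h1, h2⟩ := jet_sub_affineFun_le hC0 hest h.pos ht0 ht1 (hf.mono hPP)
    ((hi1.mono_set hPP).congr_fun hgP hPm) hInt hK0 (jet_constant_eq ht0.ne' hV.ne' _ _ _ _ _)
  exact ⟨h1.trans htK, fun X => (h2 X).trans (mul_le_mul_of_nonneg_right htK
    (Finset.sum_nonneg fun j _ => by positivity))⟩

end PeakEstimates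

section BergmanFunctions
variable {n : ℕ} {Ω : Set (Fin n → ℂ)} {f g : (Fin n → ℂ) → ℂ}

theorem InBergman.const_mul (c : ℂ) (hf : InBergman n Ω f) :
    InBergman n Ω (fun z => c * f z) ∧ l2sq n Ω (fun z => c * f z) = ‖c‖ ^ 2 * l2sq n Ω f := by
  have h : (fun z => ‖c * f z‖ ^ 2) = fun z => ‖c‖ ^ 2 * ‖f z‖ ^ 2 := by
    funext z
    rw [norm_mul, mul_pow]
  refine ⟨⟨hf.1.const_mul c, ?_⟩, ?_⟩
  · rw [h]
    exact hf.2.const_mul _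
  · unfold l2sq
    rw [h, integral_const_mul]

theorem InBergman.sub (hΩ : IsOpen Ω) (hf : InBergman n Ω f) (hg : InBergman n Ω g) :
    InBergman n Ω (fun z => f z - g z) ∧
      l2sq n Ω (fun z => f z - g z) ≤ 2 * l2sq n Ω f + 2 * l2sq n Ω g := by
  have hdom : IntegrableOn (fun z => 2 * ‖f z‖ ^ 2 + 2 * ‖g z‖ ^ 2) Ω :=
    (hf.2.const_mul 2).add (hg.2.const_mul 2)
  have hle : ∀ z, ‖f z - g z‖ ^ 2 ≤ 2 * ‖f z‖ ^ 2 + 2 * ‖g z‖ ^ 2 := by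
    intro z
    have h2 := norm_sub_le (f z) (g z)
    nlinarith [norm_nonneg (f z - g z), sq_nonneg (‖f z‖ - ‖g z‖)]
  have hd : DifferentiableOn ℂ (fun z => f z - g z) Ω := hf.1.sub hg.1
  have hfg : IntegrableOn (fun z => ‖f z - g z‖ ^ 2) Ω := by
    refine hdom.mono' ((hd.continuousOn.norm.pow 2).aestronglyMeasurable hΩ.measurableSet)
      (Eventually.of_forall fun z => ?_)
    rw [Real.norm_of_nonneg (sq_nonneg _)]
    exact hle z
  refine ⟨⟨hd, hfg⟩, ?_⟩
  calc l2sq n Ω (fun z => f z - g z) ≤ ∫ z in Ω, (2 * ‖f z‖ ^ 2 + 2 * ‖g z‖ ^ 2) :=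
        integral_mono hfg hdom hle
    _ = _ := by
        rw [integral_add (hf.2.const_mul 2) (hg.2.const_mul 2), integral_const_mul,
          integral_const_mul]
        rfl

theorem exists_unit_dual {β : Fin n → ℝ} (X : Fin n → ℂ) (hQ : 0 < ∑ j, ‖X j‖ ^ 2 / β j ^ 2) :
    ∃ c : Fin n → ℂ, ∑ j, ‖c j‖ ^ 2 ≤ 1 ∧
      ∑ j, c j * X j / β j = (√(∑ j, ‖X j‖ ^ 2 / β j ^ 2) : ℝ) := by
  obtain ⟨s, hs⟩ : ∃ s, s = √(∑ j, ‖X j‖ ^ 2 / β j ^ 2) := ⟨_, rfl⟩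
  have hs2 : s ^ 2 = ∑ j, ‖X j‖ ^ 2 / β j ^ 2 := by rw [hs, Real.sq_sqrt hQ.le]
  have hs0 : s ≠ 0 := by
    intro h
    rw [h] at hs2
    norm_num at hs2
    linarith
  rw [← hs]
  refine ⟨fun j => (starRingEnd ℂ) (X j) / (β j * s), ?_, ?_⟩
  · have h : ∀ j, ‖(starRingEnd ℂ) (X j) / (β j * s : ℂ)‖ ^ 2 = ‖X j‖ ^ 2 / β j ^ 2 / s ^ 2 := by
      intro j
      rw [norm_div, RCLike.norm_conj, norm_mul, Complex.norm_real, Complex.norm_real, div_pow,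
        mul_pow, Real.norm_eq_abs, Real.norm_eq_abs, sq_abs, sq_abs, div_div]
    simp_rw [h]
    rw [← Finset.sum_div, ← hs2, div_self (pow_ne_zero 2 hs0)]
  · have h : ∀ j, (starRingEnd ℂ) (X j) / (β j * s : ℂ) * X j / β j =
        ((‖X j‖ ^ 2 / β j ^ 2 / s : ℝ) : ℂ) := by
      intro j
      have h1 := Complex.conj_mul' (X j)
      push_cast
      rw [← h1]
      ring
    simp_rw [h]
    rw [← Complex.ofReal_sum, ← Finset.sum_div, ← hs2, pow_two, mul_div_assoc, div_self hs0,
      mul_one]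

/-- Competitors for the two extremal problems that define the Bergman kernel and metric. -/
theorem exists_extremal_competitors (n : ℕ) (M : ℝ) {Ct : ℝ} (hCt : 0 < Ct) :
    ∃ C : ℝ, 0 < C ∧ ∀ (Ω : Set (Fin n → ℂ)) (p : Fin n → ℂ) (β : Fin n → ℝ)
      (φ : (Fin n → ℂ) → ℝ), IsCatlinWeight M Ct Ω p β φ →
      (∃ f, InBergman n Ω f ∧ l2sq n Ω f ≤ C * scaleVol β ∧ f p = 1) ∧
      ∀ X : Fin n → ℂ, ∃ f, InBergman n Ω f ∧ l2sq n Ω f ≤ C * scaleVol β ∧ f p = 0 ∧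
        ∑ j, ‖X j‖ ^ 2 / β j ^ 2 ≤ 4 * ‖fderiv ℂ f p X‖ ^ 2 := by
  obtain ⟨C, hC, h⟩ := exists_peak_function n M hCt (show (0 : ℝ) < 1 / 16 by norm_num)
  refine ⟨4 * C, by positivity, fun Ω p β φ hw => ?_⟩
  have hV := scaleVol_pos hw.pos
  have hpΩ : p ∈ Ω := hw.subset (mem_polydisc_self hw.pos p)
  have hd : ∀ {f}, InBergman n Ω f → DifferentiableAt ℂ f p := fun hf =>
    hf.1.differentiableAt (hw.isOpen.mem_nhds hpΩ)
  obtain ⟨f0, hf0, hl0, hp0, hX0⟩ := h Ω p β φ hw 1 0 (by simp) (by simp)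
  have hr : ‖f0 p - 1‖ ≤ 1 / 4 := by nlinarith [norm_nonneg (f0 p - 1)]
  have hr2 : 1 / 2 ≤ ‖f0 p‖ := by
    have := norm_sub_norm_le (1 : ℂ) (f0 p)
    rw [norm_one, norm_sub_rev] at this
    linarith
  have hne : f0 p ≠ 0 := by
    intro h0
    rw [h0, norm_zero] at hr2
    linarith
  have hi : ‖(f0 p)⁻¹‖ ≤ 2 := by
    rw [norm_inv]
    exact inv_le_of_inv_le₀ (by norm_num) (by linarith)
  have hi2 : ‖(f0 p)⁻¹‖ ^ 2 ≤ 4 := by nlinarith [norm_nonneg (f0 p)⁻¹]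
  obtain ⟨hb, hl⟩ := hf0.const_mul (f0 p)⁻¹
  have hl2 : l2sq n Ω (fun z => (f0 p)⁻¹ * f0 z) ≤ 4 * C * scaleVol β := by
    rw [hl]
    have : 0 ≤ l2sq n Ω f0 := integral_nonneg fun _ => sq_nonneg _
    nlinarith
  refine ⟨⟨_, hb, hl2, inv_mul_cancel₀ hne⟩, fun X => ?_⟩
  have hQ0 : 0 ≤ ∑ j, ‖X j‖ ^ 2 / β j ^ 2 := Finset.sum_nonneg fun j _ => by positivity
  rcases hQ0.eq_or_lt with hQ | hQ
  · refine ⟨fun z => 0 * f0 z, (hf0.const_mul 0).1, ?_, by simp, ?_⟩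
    · rw [(hf0.const_mul 0).2]
      simp only [norm_zero]
      nlinarith [mul_pos hC hV]
    · rw [← hQ]
      positivity
  obtain ⟨c, hc1, hc2⟩ := exists_unit_dual X hQ
  obtain ⟨f, hf, hlf, hpf, hXf⟩ := h Ω p β φ hw 0 c (by simp) hc1
  have hX := hXf X
  have hX0 := hX0 X
  rw [hc2] at hX
  simp only [Pi.zero_apply, zero_mul, zero_div, Finset.sum_const_zero, sub_zero] at hX0
  rw [sub_zero] at hpf
  obtain ⟨hb1, hl1⟩ := hf0.const_mul (f p * (f0 p)⁻¹)
  obtain ⟨hb2, hl3⟩ := hf.sub hw.isOpen hb1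
  have ha : ‖f p‖ ≤ 1 / 4 := by nlinarith [norm_nonneg (f p)]
  have hco : ‖f p * (f0 p)⁻¹‖ ≤ 1 / 2 := by
    rw [norm_mul]
    nlinarith [norm_nonneg (f p), norm_nonneg (f0 p)⁻¹]
  refine ⟨_, hb2, ?_, by simp [hne], ?_⟩
  · have : 0 ≤ l2sq n Ω f0 := integral_nonneg fun _ => sq_nonneg _
    have h4 : ‖f p * (f0 p)⁻¹‖ ^ 2 ≤ 1 := by nlinarith [norm_nonneg (f p * (f0 p)⁻¹)]
    rw [hl1] at hl3
    nlinarith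
  · rw [fderiv_fun_sub (hd hf) (hd hb1), fderiv_const_mul (hd hf0), sub_apply, smul_apply,
      smul_eq_mul]
    obtain ⟨s, hs⟩ : ∃ s, s = √(∑ j, ‖X j‖ ^ 2 / β j ^ 2) := ⟨_, rfl⟩
    have hs2 : s ^ 2 = ∑ j, ‖X j‖ ^ 2 / β j ^ 2 := by rw [hs, Real.sq_sqrt hQ0]
    have hs0 : 0 ≤ s := by rw [hs]; exact Real.sqrt_nonneg _
    rw [← hs] at hX
    rw [← hs2] at hX hX0 ⊢
    have e1 : ‖fderiv ℂ f p X - s‖ ≤ 1 / 4 * s := by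
      refine le_of_sq_le_sq ?_ (by positivity)
      nlinarith
    have e2 : ‖fderiv ℂ f0 p X‖ ≤ 1 / 4 * s := by
      refine le_of_sq_le_sq ?_ (by positivity)
      nlinarith
    have e3 : ‖f p * (f0 p)⁻¹ * fderiv ℂ f0 p X‖ ≤ 1 / 8 * s := by
      rw [norm_mul]
      nlinarith [norm_nonneg (f p * (f0 p)⁻¹), norm_nonneg (fderiv ℂ f0 p X)]
    have e4 : s ≤ ‖fderiv ℂ f p X - f p * (f0 p)⁻¹ * fderiv ℂ f0 p X‖ +
        ‖fderiv ℂ f p X - s‖ + ‖f p * (f0 p)⁻¹ * fderiv ℂ f0 p X‖ := by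
      have e5 : (s : ℂ) = (fderiv ℂ f p X - f p * (f0 p)⁻¹ * fderiv ℂ f0 p X) -
        (fderiv ℂ f p X - s) + f p * (f0 p)⁻¹ * fderiv ℂ f0 p X := by ring
      have e6 : ‖(s : ℂ)‖ = s := by rw [Complex.norm_real, Real.norm_of_nonneg hs0]
      calc s = ‖(s : ℂ)‖ := e6.symm
        _ ≤ _ := by
          conv_lhs => rw [e5]
          exact (norm_add_le _ _).trans (add_le_add_left (norm_sub_le _ _) _)
    have e8 : s ≤ 2 * ‖fderiv ℂ f p X - f p * (f0 p)⁻¹ * fderiv ℂ f0 p X‖ := by linarith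
    refine (pow_le_pow_left₀ hs0 e8 2).trans_eq ?_
    ring

end BergmanFunctions

section HilbertLevi
variable {n : ℕ} {H : Type*} [NormedAddCommGroup H] [InnerProductSpace ℂ H] [NormedSpace ℝ H]
  {Ψ : (Fin n → ℂ) → H} {p : Fin n → ℂ}

theorem hasFDerivAt_norm_sq_apply {z : Fin n → ℂ} (h : DifferentiableAt ℝ Ψ z) :
    DifferentiableAt ℝ (fun z => ‖Ψ z‖ ^ 2) z ∧ ∀ v,
      fderiv ℝ (fun z => ‖Ψ z‖ ^ 2) z v = 2 * (inner ℂ (Ψ z) (fderiv ℝ Ψ z v)).re := by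
  have h0 : (fun z => ‖Ψ z‖ ^ 2) = fun z => reCLM (inner ℂ (Ψ z) (Ψ z)) := by
    funext z
    exact (inner_self_eq_norm_sq (𝕜 := ℂ) (Ψ z)).symm
  have h1 := reCLM.hasFDerivAt.comp z (h.hasFDerivAt.inner ℂ h.hasFDerivAt)
  rw [h0]
  refine ⟨h1.differentiableAt, fun v => ?_⟩
  rw [show fderiv ℝ (fun z => reCLM (inner ℂ (Ψ z) (Ψ z))) z = _ from h1.fderiv]
  simp only [ContinuousLinearMap.comp_apply, ContinuousLinearMap.prod_apply, fderivInnerCLM_apply,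
    reCLM_apply, add_re]
  rw [← inner_conj_symm (fderiv ℝ Ψ z v), conj_re]
  ring

theorem fderiv_fderiv_norm_sq_apply (h : ContDiffAt ℝ 2 Ψ p) (v : Fin n → ℂ) :
    fderiv ℝ (fderiv ℝ (fun z => ‖Ψ z‖ ^ 2)) p v v =
      2 * (‖fderiv ℝ Ψ p v‖ ^ 2 + (inner ℂ (Ψ p) (fderiv ℝ (fderiv ℝ Ψ) p v v)).re) := by
  have hK : ContDiffAt ℝ 2 (fun z => ‖Ψ z‖ ^ 2) p := h.norm_sq ℂ
  have hd : ∀ᶠ z in 𝓝 p, DifferentiableAt ℝ Ψ z := by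
    filter_upwards [h.eventually (by simp)] with z hz
    exact hz.differentiableAt (by norm_num)
  have hΨ : DifferentiableAt ℝ (fderiv ℝ Ψ) p :=
    (h.fderiv_right (m := 1) (by norm_num)).differentiableAt (by norm_num)
  have hK2 : DifferentiableAt ℝ (fderiv ℝ (fun z => ‖Ψ z‖ ^ 2)) p :=
    (hK.fderiv_right (m := 1) (by norm_num)).differentiableAt (by norm_num)
  have e1 : fderiv ℝ (fderiv ℝ (fun z => ‖Ψ z‖ ^ 2)) p v v =
      fderiv ℝ (fun z => fderiv ℝ (fun z => ‖Ψ z‖ ^ 2) z v) p v := by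
    rw [fderiv_clm_apply hK2 (differentiableAt_const v)]
    simp
  have e2 : (fun z => fderiv ℝ (fun z => ‖Ψ z‖ ^ 2) z v) =ᶠ[𝓝 p]
      fun z => (2 : ℝ) * reCLM (inner ℂ (Ψ z) (fderiv ℝ Ψ z v)) := by
    filter_upwards [hd] with z hz
    exact (hasFDerivAt_norm_sq_apply hz).2 v
  have hv : HasFDerivAt (fun z => fderiv ℝ Ψ z v)
      ((ContinuousLinearMap.apply ℝ H v).comp (fderiv ℝ (fderiv ℝ Ψ) p)) p :=
    (ContinuousLinearMap.apply ℝ H v).hasFDerivAt.comp p hΨ.hasFDerivAt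
  have h1 := (reCLM.hasFDerivAt.comp p (hd.self_of_nhds.hasFDerivAt.inner ℂ hv)).const_mul (2 : ℝ)
  rw [e1, e2.fderiv_eq]
  rw [show fderiv ℝ (fun z => (2 : ℝ) * reCLM (inner ℂ (Ψ z) (fderiv ℝ Ψ z v))) p = _ from
    h1.fderiv]
  simp only [smul_apply, ContinuousLinearMap.comp_apply, ContinuousLinearMap.prod_apply,
    fderivInnerCLM_apply, reCLM_apply, add_re, ContinuousLinearMap.apply_apply, smul_eq_mul]
  rw [add_comm, ← inner_self_eq_norm_sq (𝕜 := ℂ) (fderiv ℝ Ψ p v)]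
  rfl

theorem norm_sq_dPairing_norm_sq (h : DifferentiableAt ℝ Ψ p)
    (ha : ∀ v, fderiv ℝ Ψ p (I • v) = -(I • fderiv ℝ Ψ p v)) (X : Fin n → ℂ) :
    ‖dPairing (fun z => ‖Ψ z‖ ^ 2) p X‖ ^ 2 = ‖inner ℂ (Ψ p) (fderiv ℝ Ψ p X)‖ ^ 2 := by
  obtain ⟨-, h1⟩ := hasFDerivAt_norm_sq_apply h
  rw [normSq_dPairing, h1, h1, ha, inner_neg_right, inner_smul_right, neg_re,
    ← Complex.normSq_eq_norm_sq, Complex.normSq_apply, mul_re, I_re, I_im]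
  ring

variable [IsScalarTower ℝ ℂ H]

theorem leviForm_norm_sq (h : ContDiffAt ℝ 2 Ψ p)
    (ha : ∀ᶠ z in 𝓝 p, ∀ v, fderiv ℝ Ψ z (I • v) = -(I • fderiv ℝ Ψ z v)) (X : Fin n → ℂ) :
    leviForm (fun z => ‖Ψ z‖ ^ 2) p X = ‖fderiv ℝ Ψ p X‖ ^ 2 := by
  have hs := h.isSymmSndFDerivAt (by simp)
  have hΨ : DifferentiableAt ℝ (fderiv ℝ Ψ) p :=
    (h.fderiv_right (m := 1) (by norm_num)).differentiableAt (by norm_num)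
  have hI : ∀ v w, fderiv ℝ (fderiv ℝ Ψ) p w (I • v) = -(I • fderiv ℝ (fderiv ℝ Ψ) p w v) := by
    intro v w
    have hap : ∀ v, HasFDerivAt (fun z => fderiv ℝ Ψ z v)
        ((ContinuousLinearMap.apply ℝ H v).comp (fderiv ℝ (fderiv ℝ Ψ) p)) p := fun v =>
      (ContinuousLinearMap.apply ℝ H v).hasFDerivAt.comp p hΨ.hasFDerivAt
    have e1 : (fun z => fderiv ℝ Ψ z (I • v)) =ᶠ[𝓝 p] fun z => -(I • fderiv ℝ Ψ z v) :=
      ha.mono fun z hz => hz v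
    have e2 := e1.fderiv_eq.symm.trans (hap (I • v)).fderiv
    have e3 := e2.symm.trans ((hap v).const_smul I).neg.fderiv
    exact DFunLike.congr_fun e3 w
  have hII : fderiv ℝ (fderiv ℝ Ψ) p (I • X) (I • X) = -fderiv ℝ (fderiv ℝ Ψ) p X X := by
    rw [hI, hs (I • X) X, hI, smul_neg, smul_smul, I_mul_I, neg_smul, one_smul, neg_neg]
  unfold leviForm
  rw [fderiv_fderiv_norm_sq_apply h, fderiv_fderiv_norm_sq_apply h, hII, ha.self_of_nhds X,
    norm_neg, norm_smul, norm_I, one_mul, inner_neg_right, neg_re]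
  ring

theorem leviForm_log_norm_sq (h : ContDiffAt ℝ 2 Ψ p)
    (ha : ∀ᶠ z in 𝓝 p, ∀ v, fderiv ℝ Ψ z (I • v) = -(I • fderiv ℝ Ψ z v)) (h0 : Ψ p ≠ 0)
    (X : Fin n → ℂ) :
    leviForm (fun z => Real.log (‖Ψ z‖ ^ 2)) p X = ‖fderiv ℝ Ψ p X‖ ^ 2 / ‖Ψ p‖ ^ 2 -
      ‖inner ℂ (Ψ p) (fderiv ℝ Ψ p X)‖ ^ 2 / (‖Ψ p‖ ^ 2) ^ 2 := by
  have hK : ContDiffAt ℝ 2 (fun z => ‖Ψ z‖ ^ 2) p := h.norm_sq ℂ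
  have hne : ‖Ψ p‖ ^ 2 ≠ 0 := pow_ne_zero 2 (norm_ne_zero_iff.2 h0)
  have h1 : ∀ᶠ t in 𝓝 (‖Ψ p‖ ^ 2), HasDerivAt Real.log t⁻¹ t :=
    (eventually_ne_nhds hne).mono fun t ht => Real.hasDerivAt_log ht
  rw [leviForm_comp hK h1 (hasDerivAt_inv hne), leviForm_norm_sq h ha,
    norm_sq_dPairing_norm_sq (h.differentiableAt (by norm_num)) ha.self_of_nhds]
  ring

end HilbertLevi

section HilbertExtremal
variable {H : Type*} [NormedAddCommGroup H] [InnerProductSpace ℂ H]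

theorem norm_inner_sq_le_of_orthogonal {e D f : H} (he : e ≠ 0) (hf : inner ℂ e f = 0) :
    ‖inner ℂ D f‖ ^ 2 ≤ ‖e‖ ^ 2 * ‖f‖ ^ 2 *
      (‖D‖ ^ 2 / ‖e‖ ^ 2 - ‖inner ℂ e D‖ ^ 2 / (‖e‖ ^ 2) ^ 2) := by
  have hne : ‖e‖ ≠ 0 := norm_ne_zero_iff.2 he
  obtain ⟨a, ha⟩ : ∃ a : ℂ, a = inner ℂ e D / (‖e‖ ^ 2 : ℝ) := ⟨_, rfl⟩
  have h1 : inner ℂ (D - a • e) f = inner ℂ D f := by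
    rw [inner_sub_left, inner_smul_left, hf, mul_zero, sub_zero]
  have h2 : ‖D - a • e‖ ^ 2 = ‖D‖ ^ 2 - ‖inner ℂ e D‖ ^ 2 / ‖e‖ ^ 2 := by
    have h3 : inner ℂ D (a • e) = ((‖inner ℂ e D‖ ^ 2 / ‖e‖ ^ 2 : ℝ) : ℂ) := by
      rw [inner_smul_right, ha, ← inner_conj_symm D e]
      have := Complex.mul_conj' (inner ℂ e D)
      push_cast
      rw [← this]
      ring
    have h4 : ‖a • e‖ ^ 2 = ‖inner ℂ e D‖ ^ 2 / ‖e‖ ^ 2 := by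
      rw [norm_smul, ha, norm_div, Complex.norm_real, Real.norm_of_nonneg (sq_nonneg _)]
      field_simp
    rw [@norm_sub_sq ℂ, h3, h4]
    simp only [RCLike.re_to_complex, ofReal_re]
    ring
  rw [← h1]
  calc ‖inner ℂ (D - a • e) f‖ ^ 2 ≤ (‖D - a • e‖ * ‖f‖) ^ 2 :=
        pow_le_pow_left₀ (norm_nonneg _) (norm_inner_le_norm _ _) 2
    _ = _ := by
        rw [mul_pow, h2]
        field_simp

theorem norm_sq_le_of_mem_closure {S : Submodule ℂ H} {D : H} (hD : D ∈ S.topologicalClosure)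
    {R : ℝ} (hR : 0 ≤ R) (h : ∀ f ∈ S, ‖inner ℂ D f‖ ^ 2 ≤ R * ‖f‖ ^ 2) : ‖D‖ ^ 2 ≤ R := by
  have hcl : IsClosed {f : H | ‖inner ℂ D f‖ ^ 2 ≤ R * ‖f‖ ^ 2} :=
    isClosed_le ((continuous_const.inner continuous_id).norm.pow 2)
      (continuous_const.mul (continuous_norm.pow 2))
  have h1 : ‖inner ℂ D D‖ ^ 2 ≤ R * ‖D‖ ^ 2 := closure_minimal h hcl hD
  rcases eq_or_ne D 0 with h0 | h0
  · rwa [h0, norm_zero, zero_pow two_ne_zero]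
  · have h2 : 0 < ‖D‖ ^ 2 := pow_pos (norm_pos_iff.2 h0) 2
    rw [inner_self_eq_norm_sq_to_K, norm_pow, RCLike.norm_ofReal, abs_norm, pow_two] at h1
    exact le_of_mul_le_mul_right h1 h2

end HilbertExtremal

section TranslateLp
variable {n : ℕ} {μ : Measure (Fin n → ℂ)} [IsFiniteMeasure μ] {u : (Fin n → ℂ) → ℂ}

theorem memLp_translate (μ : Measure (Fin n → ℂ)) [IsFiniteMeasure μ] (hu : ContDiff ℝ ∞ u)
    (hc : HasCompactSupport u) (z : Fin n → ℂ) : MemLp (fun w => u (z - w)) 2 μ := by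
  obtain ⟨C, hC⟩ := hc.exists_bound_of_continuous hu.continuous
  exact MemLp.of_bound (hu.continuous.comp (continuous_const.sub continuous_id)).aestronglyMeasurable
    C (Eventually.of_forall fun w => hC _)

/-- The function `w ↦ u (z - w)`, as an element of `L²(μ)`. -/
noncomputable def translateLp (μ : Measure (Fin n → ℂ)) [IsFiniteMeasure μ] (hu : ContDiff ℝ ∞ u)
    (hc : HasCompactSupport u) (z : Fin n → ℂ) : Lp ℂ 2 μ :=
  (memLp_translate μ hu hc z).toLp

theorem contDiff_fderiv_apply (hu : ContDiff ℝ ∞ u) (v : Fin n → ℂ) :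
    ContDiff ℝ ∞ fun x => fderiv ℝ u x v :=
  (hu.fderiv_right (m := ∞) le_rfl).clm_apply contDiff_const

theorem hasCompactSupport_fderiv_apply (hc : HasCompactSupport u) (v : Fin n → ℂ) :
    HasCompactSupport fun x => fderiv ℝ u x v :=
  (hc.fderiv ℝ).mono fun z hz h0 => hz (by simp [h0])

/-- The derivative of `translateLp`. -/
noncomputable def translateLpDeriv (μ : Measure (Fin n → ℂ)) [IsFiniteMeasure μ]
    (hu : ContDiff ℝ ∞ u) (hc : HasCompactSupport u) (z : Fin n → ℂ) :
    (Fin n → ℂ) →L[ℝ] Lp ℂ 2 μ :=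
  LinearMap.toContinuousLinearMap
    { toFun := fun v => translateLp μ (contDiff_fderiv_apply hu v)
        (hasCompactSupport_fderiv_apply hc v) z
      map_add' := fun v w => by
        unfold translateLp
        rw [← MemLp.toLp_add]
        exact MemLp.toLp_congr _ _ (Eventually.of_forall fun x => by simp)
      map_smul' := fun c v => by
        unfold translateLp
        rw [RingHom.id_apply, ← MemLp.toLp_const_smul]
        exact MemLp.toLp_congr _ _ (Eventually.of_forall fun x => by simp) }

theorem exists_taylor_bound (hu : ContDiff ℝ ∞ u) (hc : HasCompactSupport u) :
    ∃ C : ℝ, 0 ≤ C ∧ ∀ x v, ‖u (x + v) - u x - fderiv ℝ u x v‖ ≤ C * ‖v‖ ^ 2 := by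
  obtain ⟨L, hL⟩ := ContDiff.lipschitzWith_of_hasCompactSupport (hc.fderiv ℝ)
    (hu.fderiv_right (m := ∞) le_rfl) (by simp)
  refine ⟨L, L.2, fun x v => ?_⟩
  have h := Convex.norm_image_sub_le_of_norm_hasFDerivWithin_le' (𝕜 := ℝ)
    (s := Metric.closedBall x ‖v‖) (f := u) (f' := fderiv ℝ u) (φ := fderiv ℝ u x)
    (C := L * ‖v‖) (x := x) (y := x + v)
    (fun y _ => ((hu.differentiable (by simp)) y).hasFDerivAt.hasFDerivWithinAt)
    (fun y hy => (hL.norm_sub_le y x).trans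
      (mul_le_mul_of_nonneg_left (mem_closedBall_iff_norm.1 hy) L.2))
    (convex_closedBall x ‖v‖) (Metric.mem_closedBall_self (norm_nonneg v)) (by simp)
  rw [add_sub_cancel_left] at h
  exact h.trans_eq (by ring)

theorem hasFDerivAt_translateLp (hu : ContDiff ℝ ∞ u) (hc : HasCompactSupport u) (z : Fin n → ℂ) :
    HasFDerivAt (translateLp μ hu hc) (translateLpDeriv μ hu hc z) z := by
  obtain ⟨C, hC, h⟩ := exists_taylor_bound hu hc
  rw [hasFDerivAt_iff_isLittleO_nhds_zero]
  refine (Asymptotics.IsBigO.of_bound ((measureUnivNNReal μ : ℝ) ^ (2 : ENNReal).toReal⁻¹ * C)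
    (Eventually.of_forall fun v => ?_)).trans_isLittleO
    (Asymptotics.isLittleO_norm_pow_id one_lt_two)
  rw [norm_pow, norm_norm, mul_assoc]
  refine Lp.norm_le_of_ae_bound (by positivity) ?_
  change ∀ᵐ x ∂μ, ‖(translateLp μ hu hc (z + v) - translateLp μ hu hc z -
    translateLp μ (contDiff_fderiv_apply hu v) (hasCompactSupport_fderiv_apply hc v) z :
      Lp ℂ 2 μ) x‖ ≤ C * ‖v‖ ^ 2
  unfold translateLp
  rw [← MemLp.toLp_sub, ← MemLp.toLp_sub]
  filter_upwards [MemLp.coeFn_toLp (((memLp_translate μ hu hc (z + v)).sub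
    (memLp_translate μ hu hc z)).sub (memLp_translate μ (contDiff_fderiv_apply hu v)
      (hasCompactSupport_fderiv_apply hc v) z))] with x hx
  rw [hx]
  have := h (z - x) v
  rwa [sub_add_eq_add_sub] at this

theorem contDiff_translateLp (hu : ContDiff ℝ ∞ u) (hc : HasCompactSupport u) (k : ℕ) :
    ContDiff ℝ k (translateLp μ hu hc) := by
  induction k generalizing u with
  | zero =>
    refine contDiff_zero.2 (continuous_iff_continuousAt.2 fun z => ?_)
    exact (hasFDerivAt_translateLp hu hc z).continuousAt
  | succ k ih =>
    refine contDiff_succ_iff_hasFDerivAt.2 ⟨translateLpDeriv μ hu hc, ?_,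
      hasFDerivAt_translateLp hu hc⟩
    exact contDiff_clm_apply_iff.2 fun v => ih (contDiff_fderiv_apply hu v)
      (hasCompactSupport_fderiv_apply hc v)

end TranslateLp

section BergmanRepresenter
variable {n : ℕ} {Ω : Set (Fin n → ℂ)} {p : Fin n → ℂ} {f g : (Fin n → ℂ) → ℂ}

theorem InBergman.memLp (hΩ : IsOpen Ω) (hf : InBergman n Ω f) : MemLp f 2 (volume.restrict Ω) :=
  (memLp_two_iff_integrable_sq_norm
    (hf.1.continuousOn.aestronglyMeasurable hΩ.measurableSet)).2 hf.2

theorem InBergman.add (hΩ : IsOpen Ω) (hf : InBergman n Ω f) (hg : InBergman n Ω g) :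
    InBergman n Ω (fun z => f z + g z) := by
  have h := (hf.sub hΩ (hg.const_mul (-1)).1).1
  simpa using h

/-- The Bergman space, as a subspace of `L²(Ω)`. -/
noncomputable def bergmanSubmodule (hΩ : IsOpen Ω) : Submodule ℂ (Lp ℂ 2 (volume.restrict Ω)) where
  carrier := {F | ∃ f, ∃ hf : InBergman n Ω f, F = (hf.memLp hΩ).toLp}
  zero_mem' := by
    refine ⟨fun _ => 0, ⟨differentiableOn_const _, by simp⟩, ?_⟩
    exact (MemLp.toLp_zero _).symm
  add_mem' := by
    rintro _ _ ⟨f, hf, rfl⟩ ⟨g, hg, rfl⟩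
    exact ⟨_, hf.add hΩ hg, (MemLp.toLp_add _ _).symm⟩
  smul_mem' := by
    rintro c _ ⟨f, hf, rfl⟩
    exact ⟨_, (hf.const_mul c).1, (MemLp.toLp_const_smul c _).symm⟩

theorem InBergman.norm_toLp_sq (hΩ : IsOpen Ω) (hf : InBergman n Ω f) :
    ‖(hf.memLp hΩ).toLp‖ ^ 2 = l2sq n Ω f := norm_sq_toLp _

theorem InBergman.inner_translateLp [IsFiniteMeasure (volume.restrict Ω)] (hΩ : IsOpen Ω)
    (hf : InBergman n Ω f) {ρ : (Fin n → ℂ) → ℝ} {r : ℝ} (h : IsMollifier r ρ)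
    (hu : ContDiff ℝ ∞ fun w => (ρ w : ℂ)) (hc : HasCompactSupport fun w => (ρ w : ℂ))
    {z : Fin n → ℂ} (hz : Metric.closedBall z r ⊆ Ω) :
    inner ℂ (translateLp (volume.restrict Ω) hu hc z) ((hf.memLp hΩ).toLp) = f z := by
  have h0 : ∀ w ∉ Ω, f w * (ρ (z - w) : ℂ) = 0 := fun w hw => by
    rw [h.eq_zero (z - w), ofReal_zero, mul_zero]
    by_contra h2
    refine hw (hz ?_)
    rw [Metric.mem_closedBall, dist_comm, dist_eq_norm]
    exact (not_le.1 h2).le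
  rw [inner_toLp_right, ← h.integral_mul_eq hΩ hf.1 hz,
    ← setIntegral_eq_integral_of_forall_compl_eq_zero h0]
  refine integral_congr_ae ?_
  filter_upwards [(memLp_translate (volume.restrict Ω) hu hc z).coeFn_toLp] with w hw
  rw [translateLp, hw, conj_ofReal]

/-- A smooth family of `L²` functions in the closure of the Bergman space that represents
evaluation near `p`. -/
structure IsRepresenter (hΩ : IsOpen Ω) (p : Fin n → ℂ)
    (Ψ : (Fin n → ℂ) → Lp ℂ 2 (volume.restrict Ω)) : Prop where
  contDiff : ContDiff ℝ 2 Ψ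
  mem : ∀ z, Ψ z ∈ (bergmanSubmodule hΩ).topologicalClosure
  fderiv_mem : ∀ z v, fderiv ℝ Ψ z v ∈ (bergmanSubmodule hΩ).topologicalClosure
  inner_eq : ∀ᶠ z in 𝓝 p, z ∈ Ω ∧ ∀ (f : (Fin n → ℂ) → ℂ) (hf : InBergman n Ω f),
    inner ℂ (Ψ z) ((hf.memLp hΩ).toLp) = f z

theorem exists_isRepresenter (hΩ : IsOpen Ω) (hb : Bornology.IsBounded Ω) (hp : p ∈ Ω) :
    ∃ Ψ, IsRepresenter hΩ p Ψ := by
  have : IsFiniteMeasure (volume.restrict Ω) := ⟨by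
    rw [Measure.restrict_apply_univ]
    exact hb.measure_lt_top⟩
  obtain ⟨r, hr, hrΩ⟩ := Metric.isOpen_iff.1 hΩ p hp
  obtain ⟨ρ, hρ⟩ := exists_isMollifier (n := n) (r := r / 2) (by positivity)
  have hu : ContDiff ℝ ∞ fun w => (ρ w : ℂ) := ofRealCLM.contDiff.comp hρ.contDiff
  have hc : HasCompactSupport fun w => (ρ w : ℂ) :=
    hasCompactSupport_of_eq_zero_of_le_norm (r := r / 2) fun z hz => by simp [hρ.eq_zero z hz]
  have hΦ := contDiff_translateLp (μ := volume.restrict Ω) hu hc 2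
  have : CompleteSpace (bergmanSubmodule hΩ).topologicalClosure :=
    (Submodule.isClosed_topologicalClosure _).completeSpace_coe
  let P := (bergmanSubmodule hΩ).topologicalClosure.starProjection
  have hmem : ∀ F, P F ∈ (bergmanSubmodule hΩ).topologicalClosure := fun F => by
    simp [P]
  refine ⟨fun z => P (translateLp (volume.restrict Ω) hu hc z), ?_, fun z => hmem _,
    fun z v => ?_, ?_⟩
  · exact (P.restrictScalars ℝ).contDiff.comp hΦ
  · have h1 := (P.restrictScalars ℝ).hasFDerivAt.comp z
      (hasFDerivAt_translateLp (μ := volume.restrict Ω) hu hc z)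
    rw [show fderiv ℝ (fun z => P (translateLp (volume.restrict Ω) hu hc z)) z = _ from h1.fderiv]
    exact hmem _
  · filter_upwards [Metric.ball_mem_nhds p (half_pos hr)] with z hz
    have hzr : Metric.closedBall z (r / 2) ⊆ Ω := fun w hw => hrΩ (by
      rw [Metric.mem_ball] at hz ⊢
      rw [Metric.mem_closedBall] at hw
      linarith [dist_triangle w z p])
    refine ⟨hzr (Metric.mem_closedBall_self (by positivity)), fun f hf => ?_⟩
    have hfm : (hf.memLp hΩ).toLp ∈ (bergmanSubmodule hΩ).topologicalClosure :=
      Submodule.le_topologicalClosure _ ⟨f, hf, rfl⟩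
    rw [Submodule.inner_starProjection_left_eq_right, Submodule.starProjection_eq_self_iff.2 hfm,
      hf.inner_translateLp hΩ hρ hu hc hzr]

variable {Ψ : (Fin n → ℂ) → Lp ℂ 2 (volume.restrict Ω)} {hΩ : IsOpen Ω}

theorem IsRepresenter.inner_fderiv (h : IsRepresenter hΩ p Ψ) :
    ∀ᶠ z in 𝓝 p, ∀ (f : (Fin n → ℂ) → ℂ) (hf : InBergman n Ω f) (v : Fin n → ℂ),
      inner ℂ (fderiv ℝ Ψ z v) ((hf.memLp hΩ).toLp) = fderiv ℂ f z v := by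
  filter_upwards [h.inner_eq.eventually_nhds] with z hz f hf v
  have h1 : (fun z => inner ℂ (Ψ z) ((hf.memLp hΩ).toLp)) =ᶠ[𝓝 z] f :=
    hz.mono fun w hw => hw.2 f hf
  have hfz : DifferentiableAt ℂ f z := hf.1.differentiableAt (hΩ.mem_nhds hz.self_of_nhds.1)
  have h2 := fderiv_inner_apply (𝕜 := ℂ) ((h.contDiff.differentiable (by norm_num)) z)
    (differentiableAt_const (𝕜 := ℝ) ((hf.memLp hΩ).toLp)) v
  rw [h1.fderiv_eq, hfz.fderiv_restrictScalars ℝ] at h2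
  simpa using h2.symm

theorem IsRepresenter.fderiv_I_smul (h : IsRepresenter hΩ p Ψ) :
    ∀ᶠ z in 𝓝 p, ∀ v, fderiv ℝ Ψ z (I • v) = -(I • fderiv ℝ Ψ z v) := by
  filter_upwards [h.inner_fderiv] with z hz v
  have h1 : ‖fderiv ℝ Ψ z (I • v) + I • fderiv ℝ Ψ z v‖ ^ 2 ≤ 0 := by
    refine norm_sq_le_of_mem_closure (Submodule.add_mem _ (h.fderiv_mem z _)
      (Submodule.smul_mem _ _ (h.fderiv_mem z _))) le_rfl ?_
    rintro _ ⟨f, hf, rfl⟩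
    rw [inner_add_left, inner_smul_left, hz f hf, hz f hf, map_smul, conj_I, smul_eq_mul]
    simp
  have h2 : ‖fderiv ℝ Ψ z (I • v) + I • fderiv ℝ Ψ z v‖ = 0 :=
    pow_eq_zero_iff two_ne_zero |>.1 (le_antisymm h1 (sq_nonneg _))
  exact eq_neg_of_add_eq_zero_left (norm_eq_zero.1 h2)

theorem bergmanKernel_eq_of_inner (hΩ : IsOpen Ω) {e : Lp ℂ 2 (volume.restrict Ω)}
    (he : e ∈ (bergmanSubmodule hΩ).topologicalClosure) {z : Fin n → ℂ}
    (h : ∀ (f : (Fin n → ℂ) → ℂ) (hf : InBergman n Ω f),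
      inner ℂ e ((hf.memLp hΩ).toLp) = f z) : bergmanKernel n Ω z = ‖e‖ ^ 2 := by
  have hle : ∀ (f : (Fin n → ℂ) → ℂ), InBergman n Ω f → ‖f z‖ ^ 2 ≤ ‖e‖ ^ 2 * l2sq n Ω f := by
    intro f hf
    rw [← h f hf, ← hf.norm_toLp_sq hΩ, ← mul_pow]
    exact pow_le_pow_left₀ (norm_nonneg _) (norm_inner_le_norm _ _) 2
  have hub : ∀ r ∈ {r : ℝ | ∃ f, InBergman n Ω f ∧ l2sq n Ω f ≤ 1 ∧ r = ‖f z‖ ^ 2},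
      r ≤ ‖e‖ ^ 2 := by
    rintro _ ⟨f, hf, hf1, rfl⟩
    exact (hle f hf).trans (mul_le_of_le_one_right (sq_nonneg _) hf1)
  have h0 : InBergman n Ω (fun _ => 0) := ⟨differentiableOn_const _, by simp⟩
  have hmem0 : (0 : ℝ) ∈ {r : ℝ | ∃ f, InBergman n Ω f ∧ l2sq n Ω f ≤ 1 ∧ r = ‖f z‖ ^ 2} :=
    ⟨_, h0, by simp [l2sq], by simp⟩
  have hnn : 0 ≤ bergmanKernel n Ω z := le_csSup ⟨_, hub⟩ hmem0
  refine le_antisymm (csSup_le ⟨0, hmem0⟩ hub) (norm_sq_le_of_mem_closure he hnn ?_)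
  rintro _ ⟨f, hf, rfl⟩
  rw [h f hf, hf.norm_toLp_sq hΩ]
  have hl0 : 0 ≤ l2sq n Ω f := integral_nonneg fun _ => sq_nonneg _
  rcases hl0.eq_or_lt with hl | hl
  · have := hle f hf
    rwa [← hl, mul_zero] at this ⊢
  · obtain ⟨c, hc⟩ : ∃ c : ℂ, c = ((√(l2sq n Ω f))⁻¹ : ℝ) := ⟨_, rfl⟩
    have hc2 : ‖c‖ ^ 2 = (l2sq n Ω f)⁻¹ := by
      rw [hc, Complex.norm_real, Real.norm_eq_abs, sq_abs, inv_pow, Real.sq_sqrt hl0]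
    obtain ⟨hb, hbl⟩ := hf.const_mul c
    have h3 : ‖c * f z‖ ^ 2 ≤ bergmanKernel n Ω z := le_csSup ⟨_, hub⟩
      ⟨_, hb, by rw [hbl, hc2, inv_mul_cancel₀ hl.ne'], rfl⟩
    rwa [norm_mul, mul_pow, hc2, inv_mul_le_iff₀ hl, mul_comm] at h3

/-- The extremal characterization of the Bergman metric, in the form of two inequalities. -/
theorem bergMetric_extremal (hΩ : IsOpen Ω) (hb : Bornology.IsBounded Ω) (hp : p ∈ Ω)
    (X : Fin n → ℂ) {a b R : ℝ} (hR0 : 0 ≤ R) (hb0 : 0 ≤ b)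
    (ha : ∃ f, InBergman n Ω f ∧ l2sq n Ω f ≤ a ∧ f p = 1)
    (hbK : ∀ f, InBergman n Ω f → ‖f p‖ ^ 2 ≤ b * l2sq n Ω f)
    (hR : ∀ f, InBergman n Ω f → ‖fderiv ℂ f p X‖ ^ 2 ≤ R * l2sq n Ω f) :
    0 ≤ bergMetric n Ω p X ∧ bergMetric n Ω p X ≤ R * a ∧ ∀ f, InBergman n Ω f → f p = 0 →
      ‖fderiv ℂ f p X‖ ^ 2 ≤ b * l2sq n Ω f * bergMetric n Ω p X := by
  obtain ⟨Ψ, h⟩ := exists_isRepresenter hΩ hb hp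
  have hin := h.inner_eq.self_of_nhds.2
  have hin' := h.inner_fderiv.self_of_nhds
  have hK : (fun w => Real.log (bergmanKernel n Ω w)) =ᶠ[𝓝 p]
      fun w => Real.log (‖Ψ w‖ ^ 2) := by
    filter_upwards [h.inner_eq] with z hz
    rw [bergmanKernel_eq_of_inner hΩ (h.mem z) hz.2]
  have hl0 : ∀ f, 0 ≤ l2sq n Ω f := fun f => integral_nonneg fun _ => sq_nonneg _
  have hka : 1 ≤ ‖Ψ p‖ ^ 2 * a := by
    obtain ⟨f, hf, hfa, hf1⟩ := ha
    have h1 : ‖inner ℂ (Ψ p) ((hf.memLp hΩ).toLp)‖ ^ 2 ≤ ‖Ψ p‖ ^ 2 * l2sq n Ω f := by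
      rw [← hf.norm_toLp_sq hΩ, ← mul_pow]
      exact pow_le_pow_left₀ (norm_nonneg _) (norm_inner_le_norm _ _) 2
    rw [hin f hf, hf1, norm_one, one_pow] at h1
    exact h1.trans (mul_le_mul_of_nonneg_left hfa (sq_nonneg _))
  have hne : Ψ p ≠ 0 := by
    intro h0
    rw [h0, norm_zero] at hka
    norm_num at hka
  have hk0 : 0 < ‖Ψ p‖ ^ 2 := pow_pos (norm_pos_iff.2 hne) 2
  have hkb : ‖Ψ p‖ ^ 2 ≤ b := by
    refine norm_sq_le_of_mem_closure (h.mem p) hb0 ?_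
    rintro _ ⟨f, hf, rfl⟩
    rw [hin f hf, hf.norm_toLp_sq hΩ]
    exact hbK f hf
  have hD : ‖fderiv ℝ Ψ p X‖ ^ 2 ≤ R := by
    refine norm_sq_le_of_mem_closure (h.fderiv_mem p X) hR0 ?_
    rintro _ ⟨f, hf, rfl⟩
    rw [hin' f hf, hf.norm_toLp_sq hΩ]
    exact hR f hf
  have hg : bergMetric n Ω p X = ‖fderiv ℝ Ψ p X‖ ^ 2 / ‖Ψ p‖ ^ 2 -
      ‖inner ℂ (Ψ p) (fderiv ℝ Ψ p X)‖ ^ 2 / (‖Ψ p‖ ^ 2) ^ 2 := by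
    have hc : ContDiffAt ℝ 2 (fun w => Real.log (‖Ψ w‖ ^ 2)) p :=
      (h.contDiff.contDiffAt.norm_sq ℂ).log hk0.ne'
    change hermForm n (cHess n (fun w => Real.log (bergmanKernel n Ω w)) p) X X = _
    rw [hermForm_cHess (hc.congr_of_eventuallyEq hK), leviForm_congr hK,
      leviForm_log_norm_sq h.contDiff.contDiffAt h.fderiv_I_smul hne]
  have hg0 : 0 ≤ bergMetric n Ω p X := by
    rw [hg, sub_nonneg, div_le_div_iff₀ (by positivity) hk0]
    have h2 : ‖inner ℂ (Ψ p) (fderiv ℝ Ψ p X)‖ ^ 2 ≤ ‖Ψ p‖ ^ 2 * ‖fderiv ℝ Ψ p X‖ ^ 2 := by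
      rw [← mul_pow]
      exact pow_le_pow_left₀ (norm_nonneg _) (norm_inner_le_norm _ _) 2
    nlinarith
  refine ⟨hg0, ?_, ?_⟩
  · rw [hg]
    have h1 : 0 ≤ ‖inner ℂ (Ψ p) (fderiv ℝ Ψ p X)‖ ^ 2 / (‖Ψ p‖ ^ 2) ^ 2 := by positivity
    have h2 : ‖fderiv ℝ Ψ p X‖ ^ 2 / ‖Ψ p‖ ^ 2 ≤ R * a := by
      rw [div_le_iff₀ hk0]
      nlinarith
    linarith
  · intro f hf hf0
    have h1 := norm_inner_sq_le_of_orthogonal (D := fderiv ℝ Ψ p X) hne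
      ((hin f hf).trans hf0)
    rw [← hg, hin' f hf, hf.norm_toLp_sq hΩ] at h1
    exact h1.trans (mul_le_mul_of_nonneg_right (mul_le_mul_of_nonneg_right hkb (hl0 f)) hg0)

end BergmanRepresenter

/-- **(Catlin)** Given positive constants `M`, `C̃`, `C_α`, there is `C > 0` (depending
only on these constants) such that for every bounded pseudoconvex domain `Ω ⊂ ℂⁿ` with
smooth boundary, every `p ∈ Ω`, every polyradius `β` with `P(p,β) ⊆ Ω`, and every
`φ ∈ C³(Ω̄)` which is bounded by `M`, plurisubharmonic on `Ω`, has complex Hessian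
`≥ C̃ Σ_j |X_j|²/β_j²` on `P(p,β)`, and has mixed derivatives of order `≤ 3` bounded by
`C_α ∏_j β_j^{−α_j}` on `P(p,β)`, one has
`C⁻¹ Σ_j |X_j|²/β_j² ≤ g_Ω(p;X) ≤ C Σ_j |X_j|²/β_j²` for all `X ∈ ℂⁿ`. -/
theorem catlin_bergman_metric_estimate
    (n : ℕ) (M Ct : ℝ) (Cα : (Fin n → ℕ) → ℝ)
    (hM : 0 < M) (hCt : 0 < Ct) (hCα : ∀ α, 0 < Cα α) :
    ∃ C > (0:ℝ), ∀ Ω : Set (Fin n → ℂ), IsOpen Ω → Bornology.IsBounded Ω →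
      IsPreconnected Ω → ∀ ρ : (Fin n → ℂ) → ℝ, IsDefining n Ω ρ →
      (∀ q ∈ frontier Ω, LeviPSDAt n ρ q) →
      ∀ p ∈ Ω, ∀ β : Fin n → ℝ, (∀ j, 0 < β j) →
      ∀ φ : (Fin n → ℂ) → ℝ, ContDiffOn ℝ 3 φ (closure Ω) →
      (∀ z ∈ Ω, |φ z| ≤ M) →
      PSHOnC2 n φ Ω →
      polydisc n p β ⊆ Ω →
      (∀ z ∈ polydisc n p β, ∀ X : Fin n → ℂ,
        Ct * ∑ j, ‖X j‖ ^ 2 / (β j) ^ 2 ≤ hermForm n (cHess n φ z) X X) →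
      MixedDerivBound n φ (polydisc n p β) 3 (fun α => Cα α * ∏ j, ((β j)⁻¹) ^ (α j)) →
      ∀ X : Fin n → ℂ,
        C⁻¹ * ∑ j, ‖X j‖ ^ 2 / (β j) ^ 2 ≤ bergMetric n Ω p X ∧
          bergMetric n Ω p X ≤ C * ∑ j, ‖X j‖ ^ 2 / (β j) ^ 2 := by
  obtain ⟨C₁, hC₁, hcomp⟩ := exists_extremal_competitors n M hCt
  obtain ⟨C₂, hC₂, hpoly⟩ := exists_polydisc_estimate n
  refine ⟨4 * C₁ * C₂, by positivity, ?_⟩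
  intro Ω hΩ hb _ ρ hρ hL p hp β hβ φ hφ hφM hψ hsub hlow _ X
  have hφ2 : ∀ z ∈ Ω, ContDiffAt ℝ 2 φ z := fun z hz =>
    ((hφ z (subset_closure hz)).contDiffAt
      (mem_of_superset (hΩ.mem_nhds hz) subset_closure)).of_le (by norm_num)
  have hw : IsCatlinWeight M Ct Ω p β φ :=
    { isOpen := hΩ
      exhaustion := IsDefining.exists_isExhaustion hΩ hb hρ hL
      pos := hβ
      contDiffAt := hφ2
      abs_le := hφM
      leviForm_nonneg := fun z hz X => hermForm_cHess (hφ2 z hz) X ▸ hψ z hz X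
      subset := hsub
      le_leviForm := fun z hz X =>
        hermForm_cHess (hφ2 z (hsub hz)) X ▸ hlow z hz X }
  obtain ⟨hval, hder⟩ := hcomp Ω p β φ hw
  have hV := scaleVol_pos hβ
  have hmono : ∀ f, InBergman n Ω f → ∫ z in polydisc n p β, ‖f z‖ ^ 2 ≤ l2sq n Ω f :=
    fun f hf => setIntegral_mono_set hf.2 (ae_of_all _ fun _ => sq_nonneg _)
      (Eventually.of_forall hsub)
  have hest := fun f (hf : InBergman n Ω f) =>
    hpoly p β hβ f (hf.1.mono hsub) (hf.2.mono_set hsub)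
  have hQ : 0 ≤ ∑ j, ‖X j‖ ^ 2 / β j ^ 2 := Finset.sum_nonneg fun j _ => by positivity
  set Q := ∑ j, ‖X j‖ ^ 2 / β j ^ 2
  obtain ⟨hg0, hupper, hlower⟩ := bergMetric_extremal hΩ hb hp X
    (a := C₁ * scaleVol β) (b := C₂ * (scaleVol β)⁻¹) (R := C₂ * (scaleVol β)⁻¹ * Q)
    (by positivity) (by positivity) hval
    (fun f hf => (hest f hf).1.trans (mul_le_mul_of_nonneg_left (hmono f hf) (by positivity)))
    (fun f hf => ((hest f hf).2 X).trans
      (mul_le_mul_of_nonneg_left (hmono f hf) (by positivity)))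
  constructor
  · obtain ⟨f, hf, hfa, hf0, hfX⟩ := hder X
    have h1 : C₂ * (scaleVol β)⁻¹ * l2sq n Ω f ≤ C₁ * C₂ :=
      (mul_le_mul_of_nonneg_left hfa (by positivity)).trans_eq (by field_simp)
    rw [inv_mul_le_iff₀ (by positivity)]
    linarith [hlower f hf hf0, mul_le_mul_of_nonneg_right h1 hg0]
  · have h2 : C₂ * (scaleVol β)⁻¹ * Q * (C₁ * scaleVol β) = C₁ * C₂ * Q := by field_simp
    have h3 : 0 ≤ C₁ * C₂ * Q := by positivity
    linarith
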